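/- Let g : ℝ → ℝ be completely monotonic on (0,∞), meaning g is infinitely differentiable on (0,∞) and (−1)^k · g^{(k)}(x) ≥ 0 for every integer k ≥ 0 and every x > 0. Let C be a subset of Euclidean space ℝ⁸ such that C ∩ B̄_R is finite for every R > 0 (where B̄_R is the closed ball of radius R about the origin) and such that C has density 1, i.e. #(C ∩ B̄_R) / vol(B̄_R) → 1 as R → ∞. Then, computing in the extended nonnegative reals [0,∞], the lower energy of C for the potential r ↦ g(r²) is at least the corresponding lattice sum for E8: liminf_{R→∞} (1 / #(C ∩ B̄_R)) · Σ_{x,y ∈ C ∩ B̄_R, x ≠ y} g(|x−y|²) ≥ Σ_{x ∈ E8, x ≠ 0} g(|x|²). -/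

import Mathlib

open MeasureTheory Filter
open scoped ENNReal Classical

noncomputable section

/-- The `E₈` root lattice, realized as the set of `x ∈ ℝ⁸` whose coordinates are either all
integers or all half-integers, and whose coordinate sum is an even integer. -/
def E8 : Set (EuclideanSpace ℝ (Fin 8)) :=
  {x | ((∀ i, ∃ n : ℤ, x i = n) ∨ (∀ i, ∃ n : ℤ, x i = n + 1 / 2)) ∧
    ∃ m : ℤ, (∑ i, x i) = 2 * m}

namespace UO

/-- Eight-dimensional Euclidean space. -/
abbrev V8 := EuclideanSpace ℝ (Fin 8)

/-! ### Part 1: the linear programming bound -/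

section PosDef

variable {f F : V8 → ℝ}

lemma pd_fubini (hF : Integrable F) (hf : ∀ x, f x = ∫ ξ, F ξ * Real.cos (2 * Real.pi * inner ℝ x ξ))
    (μ ν : Measure V8) [IsFiniteMeasure μ] [IsFiniteMeasure ν] :
    (∫ x, ∫ y, f (x - y) ∂ν ∂μ) = ∫ ξ, F ξ *
      ((∫ x, Real.cos (2 * Real.pi * inner ℝ x ξ) ∂μ) * (∫ x, Real.cos (2 * Real.pi * inner ℝ x ξ) ∂ν)
       + (∫ x, Real.sin (2 * Real.pi * inner ℝ x ξ) ∂μ) * (∫ x, Real.sin (2 * Real.pi * inner ℝ x ξ) ∂ν)) := by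
  have hnt : Integrable (fun p : (V8 × V8) × V8 =>
      F p.2 * Real.cos (2 * Real.pi * inner ℝ (p.1.1 - p.1.2) p.2)) ((μ.prod ν).prod volume) := by
    have h1 : Integrable (fun p : (V8 × V8) × V8 => F p.2) ((μ.prod ν).prod volume) := by
      simpa using hF.comp_snd (μ.prod ν)
    refine h1.mul_bdd (c := 1) ?_ ?_
    · refine Continuous.aestronglyMeasurable ?_
      fun_prop
    · refine Eventually.of_forall fun p => ?_
      simpa using Real.abs_cos_le_one _
  have e1 : (∫ x, ∫ y, f (x - y) ∂ν ∂μ) = ∫ p : V8 × V8, f (p.1 - p.2) ∂(μ.prod ν) := by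
    rw [integral_prod]
    simp_rw [hf]
    exact hnt.integral_prod_left
  rw [e1]
  simp_rw [hf]
  rw [integral_integral_swap (f := fun (p : V8 × V8) (ξ : V8) =>
    F ξ * Real.cos (2 * Real.pi * inner ℝ (p.1 - p.2) ξ)) hnt]
  congr 1
  ext ξ
  rw [integral_const_mul]
  congr 1
  rw [← integral_prod_mul, ← integral_prod_mul, ← integral_add]
  · congr 1
    ext p
    rw [inner_sub_left, mul_sub, Real.cos_sub]
  all_goals
    refine Integrable.of_bound (C := 1) (Continuous.aestronglyMeasurable (by fun_prop)) ?_
    refine Eventually.of_forall fun p => ?_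
    rw [norm_mul]
    refine mul_le_one₀ ?_ (norm_nonneg _) ?_ <;> simp [Real.abs_cos_le_one, Real.abs_sin_le_one]

lemma pd_nonneg (hF : Integrable F) (hF0 : ∀ ξ, 0 ≤ F ξ)
    (hf : ∀ x, f x = ∫ ξ, F ξ * Real.cos (2 * Real.pi * inner ℝ x ξ))
    (μ ν : Measure V8) [IsFiniteMeasure μ] [IsFiniteMeasure ν] :
    2 * (∫ x, ∫ y, f (x - y) ∂ν ∂μ) - (∫ x, ∫ y, f (x - y) ∂ν ∂ν) ≤ ∫ x, ∫ y, f (x - y) ∂μ ∂μ := by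
  have hb : ∀ (m m' : Measure V8) [IsFiniteMeasure m] [IsFiniteMeasure m'], Integrable (fun ξ : V8 => F ξ *
      ((∫ x, Real.cos (2 * Real.pi * inner ℝ x ξ) ∂m) * (∫ x, Real.cos (2 * Real.pi * inner ℝ x ξ) ∂m')
       + (∫ x, Real.sin (2 * Real.pi * inner ℝ x ξ) ∂m) * (∫ x, Real.sin (2 * Real.pi * inner ℝ x ξ) ∂m'))) := by
    intro m m' _ _
    have key : ∀ ξ : V8, ((∫ x, Real.cos (2 * Real.pi * inner ℝ x ξ) ∂m) * (∫ x, Real.cos (2 * Real.pi * inner ℝ x ξ) ∂m')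
       + (∫ x, Real.sin (2 * Real.pi * inner ℝ x ξ) ∂m) * (∫ x, Real.sin (2 * Real.pi * inner ℝ x ξ) ∂m'))
       = ∫ p : V8 × V8, Real.cos (2 * Real.pi * inner ℝ (p.1 - p.2) ξ) ∂(m.prod m') := by
      intro ξ
      rw [← integral_prod_mul, ← integral_prod_mul, ← integral_add]
      · congr 1
        ext p
        rw [inner_sub_left, mul_sub, Real.cos_sub]
      all_goals
        refine Integrable.of_bound (C := 1) (Continuous.aestronglyMeasurable (by fun_prop)) ?_
        refine Eventually.of_forall fun p => ?_
        rw [norm_mul]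
        refine mul_le_one₀ ?_ (norm_nonneg _) ?_ <;> simp [Real.abs_cos_le_one, Real.abs_sin_le_one]
    simp_rw [key]
    refine hF.mul_bdd (c := (m.prod m').real Set.univ) ?_ ?_
    · refine Continuous.aestronglyMeasurable ?_
      refine continuous_of_dominated (bound := fun _ => 1) ?_ ?_ ?_ ?_
      · intro ξ; exact Continuous.aestronglyMeasurable (by fun_prop)
      · intro ξ; exact Eventually.of_forall fun p => by simpa using Real.abs_cos_le_one _
      · exact integrable_const _
      · exact Eventually.of_forall fun p => by fun_prop
    · refine Eventually.of_forall fun ξ => ?_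
      refine (norm_integral_le_of_norm_le_const (C := 1) (Eventually.of_forall fun p => by simpa using Real.abs_cos_le_one _)).trans ?_
      simp
  rw [pd_fubini hF hf, pd_fubini hF hf, pd_fubini hF hf, ← integral_const_mul, ← integral_sub ((hb _ _).const_mul 2) (hb _ _)]
  refine integral_mono (((hb _ _).const_mul 2).sub (hb _ _)) (hb _ _) ?_
  intro ξ
  have h := hF0 ξ
  simp only
  set A := ∫ x, Real.cos (2 * Real.pi * inner ℝ x ξ) ∂μ
  set B := ∫ x, Real.cos (2 * Real.pi * inner ℝ x ξ) ∂ν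
  set A' := ∫ x, Real.sin (2 * Real.pi * inner ℝ x ξ) ∂μ
  set B' := ∫ x, Real.sin (2 * Real.pi * inner ℝ x ξ) ∂ν
  have : 0 ≤ F ξ * ((A - B)^2 + (A' - B')^2) := by positivity
  nlinarith

end PosDef

lemma pd_finset {f F : V8 → ℝ} (hF : Integrable F) (hF0 : ∀ ξ, 0 ≤ F ξ)
    (hf : ∀ x, f x = ∫ ξ, F ξ * Real.cos (2 * Real.pi * inner ℝ x ξ))
    (s : Finset V8) (B : Set V8) (hB : volume B ≠ ⊤) :
    2 * (∑ x ∈ s, ∫ y in B, f (x - y)) - (∫ x in B, ∫ y in B, f (x - y))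
      ≤ ∑ x ∈ s, ∑ y ∈ s, f (x - y) := by
  have : IsFiniteMeasure (volume.restrict B) := ⟨by simpa using hB.lt_top⟩
  have h := pd_nonneg hF hF0 hf (∑ x ∈ s, Measure.dirac x) (volume.restrict B)
  have hd : ∀ g : V8 → ℝ, (∫ x, g x ∂(∑ x ∈ s, Measure.dirac x)) = ∑ x ∈ s, g x := by
    intro g
    rw [integral_finsetSum_measure]
    · simp
    · intro i _
      exact integrable_dirac (by simp)
  simpa only [hd] using h

lemma conv_ball {f : V8 → ℝ} (hf : Integrable f) (B : Set V8) (hB : MeasurableSet B) (x : V8) :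
    |(∫ y in B, f (x - y)) - ∫ y, f y| ≤ ∫ y, |f y| := by
  have h1 : Integrable (fun y => f (x - y)) := hf.comp_sub_left x
  rw [← integral_sub_left_eq_self f volume x, ← integral_sub_left_eq_self (fun y => |f y|) volume x,
    ← integral_add_compl hB h1, sub_add_cancel_left, abs_neg]
  refine (abs_integral_le_integral_abs).trans ?_
  exact setIntegral_le_integral h1.abs (Eventually.of_forall fun _ => abs_nonneg _)

lemma conv_ball_near {f : V8 → ℝ} (hf : Integrable f) {R ρ : ℝ} {x : V8} (hx : ‖x‖ ≤ R - ρ) :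
    |(∫ y in Metric.closedBall 0 R, f (x - y)) - ∫ y, f y| ≤ ∫ y in (Metric.closedBall 0 ρ)ᶜ, |f y| := by
  have h1 : Integrable (fun y => f (x - y)) := hf.comp_sub_left x
  have hB : MeasurableSet (Metric.closedBall (0 : V8) R) := measurableSet_closedBall
  have hB' : MeasurableSet (Metric.closedBall (0 : V8) ρ) := measurableSet_closedBall
  rw [← integral_sub_left_eq_self f volume x,
    ← integral_add_compl hB h1, sub_add_cancel_left, abs_neg]
  refine (abs_integral_le_integral_abs).trans ?_
  rw [← integral_indicator hB.compl, ← integral_indicator hB'.compl,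
    ← integral_sub_left_eq_self ((Metric.closedBall (0 : V8) ρ)ᶜ.indicator (fun a => |f a|)) volume x]
  refine integral_mono ?_ ?_ ?_
  · exact h1.abs.indicator hB.compl
  · exact (hf.abs.indicator hB'.compl).comp_sub_left x
  · intro y
    simp only [Set.indicator_apply, Set.mem_compl_iff, mem_closedBall_zero_iff, not_le]
    by_cases hy : R < ‖y‖
    · have : ρ < ‖x - y‖ := by
        have := norm_sub_norm_le y x
        rw [norm_sub_rev] at this
        linarith
      simp [hy, this]
    · simp only [hy, if_false]
      split_ifs <;> positivity

lemma tail_small {f : V8 → ℝ} (hf : Integrable f) {ε : ℝ} (hε : 0 < ε) :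
    ∃ ρ : ℝ, 0 < ρ ∧ ∫ y in (Metric.closedBall 0 ρ)ᶜ, |f y| < ε := by
  have h : Tendsto (fun n : ℕ => ∫ y in (Metric.closedBall (0 : V8) (n : ℝ))ᶜ, |f y|) atTop
      (nhds (∫ y in ⋂ n : ℕ, (Metric.closedBall (0 : V8) (n : ℝ))ᶜ, |f y|)) := by
    refine tendsto_setIntegral_of_antitone (fun n => measurableSet_closedBall.compl) ?_ ⟨0, hf.abs.integrableOn⟩
    intro m n hmn
    exact Set.compl_subset_compl.mpr (Metric.closedBall_subset_closedBall (by exact_mod_cast hmn))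
  have h0 : (⋂ n : ℕ, (Metric.closedBall (0 : V8) (n : ℝ))ᶜ) = ∅ := by
    ext x
    simp only [Set.mem_iInter, Set.mem_compl_iff, mem_closedBall_zero_iff, Set.mem_empty_iff_false, iff_false, not_forall,
      not_not]
    exact exists_nat_ge ‖x‖
  rw [h0, setIntegral_empty] at h
  obtain ⟨n, hn, hn'⟩ := ((h.eventually (gt_mem_nhds hε)).and (eventually_gt_atTop 0)).exists
  exact ⟨n, by exact_mod_cast hn', hn⟩

lemma pd_bound {f F : V8 → ℝ} (hF : Integrable F) (hF0 : ∀ ξ, 0 ≤ F ξ)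
    (hf : ∀ x, f x = ∫ ξ, F ξ * Real.cos (2 * Real.pi * inner ℝ x ξ)) (x : V8) : |f x| ≤ ∫ ξ, F ξ := by
  rw [hf, ← Real.norm_eq_abs]
  refine norm_integral_le_of_norm_le hF (Eventually.of_forall fun ξ => ?_)
  rw [norm_mul, Real.norm_eq_abs, Real.norm_eq_abs, abs_of_nonneg (hF0 ξ)]
  exact mul_le_of_le_one_right (hF0 ξ) (Real.abs_cos_le_one _)

lemma pd_cont {f F : V8 → ℝ} (hF : Integrable F) (hF0 : ∀ ξ, 0 ≤ F ξ)
    (hf : ∀ x, f x = ∫ ξ, F ξ * Real.cos (2 * Real.pi * inner ℝ x ξ)) : Continuous f := by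
  have : f = fun x => ∫ ξ, F ξ * Real.cos (2 * Real.pi * inner ℝ x ξ) := funext hf
  rw [this]
  refine continuous_of_dominated (bound := F) ?_ ?_ hF ?_
  · intro x
    exact hF.aestronglyMeasurable.mul (Continuous.aestronglyMeasurable (by fun_prop))
  · intro x
    refine Eventually.of_forall fun ξ => ?_
    rw [norm_mul, Real.norm_eq_abs, Real.norm_eq_abs, abs_of_nonneg (hF0 ξ)]
    exact mul_le_of_le_one_right (hF0 ξ) (Real.abs_cos_le_one _)
  · exact Eventually.of_forall fun ξ => by fun_prop

/-- Volume of the ball of radius `R`. -/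
def volB (R : ℝ) : ℝ := (volume (Metric.closedBall (0 : V8) R)).toReal

/-- Lower energy. -/
def lowE (C : Set V8) (φ : ℝ → ℝ≥0∞) : ℝ≥0∞ :=
  liminf (fun R : ℝ =>
          (Nat.card ↥(C ∩ Metric.closedBall 0 R) : ℝ≥0∞)⁻¹ *
            ∑' q : ↥(C ∩ Metric.closedBall 0 R) × ↥(C ∩ Metric.closedBall 0 R),
              if (q.1 : V8) ≠ (q.2 : V8) then
                φ (‖(q.1 : V8) - (q.2 : V8)‖ ^ 2)
              else 0) atTop

lemma volB_eq {R : ℝ} (hR : 0 ≤ R) : volB R = R ^ 8 * volB 1 := by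
  unfold volB
  rw [Measure.addHaar_closedBall _ _ hR, Measure.addHaar_closedBall _ _ zero_le_one]
  simp [ENNReal.toReal_ofReal, hR]

lemma volB_one_pos : 0 < volB 1 := by
  unfold volB
  refine ENNReal.toReal_pos ?_ ?_
  · exact (Metric.measure_closedBall_pos _ _ one_pos).ne'
  · exact measure_closedBall_lt_top.ne

lemma lp_finite {f F : V8 → ℝ} (hfi : Integrable f) (hF : Integrable F) (hF0 : ∀ ξ, 0 ≤ F ξ)
    (hf : ∀ x, f x = ∫ ξ, F ξ * Real.cos (2 * Real.pi * inner ℝ x ξ))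
    (s : Finset V8) {R ρ ε : ℝ} (hρ : 0 ≤ ρ) (hε : ∫ y in (Metric.closedBall 0 ρ)ᶜ, |f y| ≤ ε) (hR : ρ ≤ R) :
    2 * (s.card * ((∫ y, f y) - ε) - (∫ y, |f y|) * (s.card - (s.filter (fun x => ‖x‖ ≤ R - ρ)).card))
     - (volB R * ((∫ y, f y) + ε) + (∫ y, |f y|) * (volB R - volB (R - ρ)))
      ≤ ∑ x ∈ s, ∑ y ∈ s, f (x - y) := by
  refine le_trans ?_ (pd_finset hF hF0 hf s (Metric.closedBall 0 R) measure_closedBall_lt_top.ne)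
  set I := ∫ y, f y with hI
  set M := ∫ y, |f y| with hM
  have hM0 : 0 ≤ M := integral_nonneg fun _ => abs_nonneg _
  have hε0 : 0 ≤ ε := le_trans (setIntegral_nonneg measurableSet_closedBall.compl fun _ _ => abs_nonneg _) hε
  have hD : ∀ x : V8, |(∫ y in Metric.closedBall 0 R, f (x - y)) - I| ≤ ε + M * (1 - if ‖x‖ ≤ R - ρ then 1 else 0) := by
    intro x
    split_ifs with h
    · simpa using (conv_ball_near hfi h).trans hε
    · have := conv_ball hfi (Metric.closedBall 0 R) measurableSet_closedBall x
      simp only [sub_zero, mul_one]; linarith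
  have h1 : s.card * (I - ε) - M * (s.card - (s.filter (fun x => ‖x‖ ≤ R - ρ)).card)
      ≤ ∑ x ∈ s, ∫ y in Metric.closedBall 0 R, f (x - y) := by
    have : ∑ x ∈ s, (I - (ε + M * (1 - if ‖x‖ ≤ R - ρ then 1 else 0))) ≤
        ∑ x ∈ s, ∫ y in Metric.closedBall 0 R, f (x - y) := by
      refine Finset.sum_le_sum fun x _ => ?_
      have := abs_le.mp (hD x)
      linarith [this.1]
    refine le_trans (le_of_eq ?_) this
    rw [Finset.card_filter]
    push_cast
    simp only [Finset.sum_sub_distrib, Finset.sum_add_distrib, Finset.sum_const, nsmul_eq_mul, ← Finset.mul_sum]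
    ring
  have hvf : ∀ r : ℝ, volume (Metric.closedBall (0 : V8) r) ≠ ⊤ := fun r => measure_closedBall_lt_top.ne
  have h2 : (∫ x in Metric.closedBall 0 R, ∫ y in Metric.closedBall 0 R, f (x - y)) ≤
      volB R * (I + ε) + M * (volB R - volB (R - ρ)) := by
    have hi : IntegrableOn (fun x => (I + ε + M) - (Metric.closedBall (0:V8) (R - ρ)).indicator (fun _ => M) x)
        (Metric.closedBall 0 R) := by
      refine Integrable.sub (integrableOn_const (hvf R)) ?_
      exact (integrableOn_const (hvf R)).indicator measurableSet_closedBall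
    have hi2 : IntegrableOn (fun x : V8 => ∫ y in Metric.closedBall 0 R, f (x - y)) (Metric.closedBall 0 R) := by
      have : IsFiniteMeasure (volume.restrict (Metric.closedBall (0:V8) R)) := ⟨by simpa using (hvf R).lt_top⟩
      have hc := pd_cont hF hF0 hf
      have : Integrable (fun p : V8 × V8 => f (p.1 - p.2))
        ((volume.restrict (Metric.closedBall (0:V8) R)).prod (volume.restrict (Metric.closedBall (0:V8) R))) := by
        refine Integrable.of_bound (C := ∫ ξ, F ξ) (Continuous.aestronglyMeasurable (by fun_prop)) ?_
        exact Eventually.of_forall fun p => pd_bound hF hF0 hf _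
      exact this.integral_prod_left
    refine (setIntegral_mono_on hi2 hi measurableSet_closedBall (fun x _ => ?_)).trans (le_of_eq ?_)
    · have := (abs_le.mp (hD x)).2
      simp only [Set.indicator_apply, mem_closedBall_zero_iff]
      split_ifs at this ⊢ <;> linarith
    · have i1 : Integrable (fun _ : V8 => I + ε + M) (volume.restrict (Metric.closedBall 0 R)) :=
        integrableOn_const (hvf R)
      have i2 : Integrable (fun _ : V8 => M) (volume.restrict (Metric.closedBall 0 R)) :=
        integrableOn_const (hvf R)
      rw [integral_sub i1 (i2.indicator measurableSet_closedBall),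
        setIntegral_const, setIntegral_indicator measurableSet_closedBall, setIntegral_const,
        Set.inter_eq_right.mpr (Metric.closedBall_subset_closedBall (by linarith))]
      simp only [volB, Measure.real, smul_eq_mul]
      ring
  linarith

theorem lp_bound {f F : V8 → ℝ} (hfi : Integrable f) (hF : Integrable F) (hF0 : ∀ ξ, 0 ≤ F ξ)
    (hf : ∀ x, f x = ∫ ξ, F ξ * Real.cos (2 * Real.pi * inner ℝ x ξ))
    {G : ℝ → ℝ} (hG : ∀ r, 0 < r → 0 ≤ G r) (hfG : ∀ x, x ≠ 0 → f x ≤ G (‖x‖ ^ 2))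
    (C : Set V8)
    (hC_fin : ∀ R : ℝ, 0 < R → (C ∩ Metric.closedBall 0 R).Finite)
    (hC_dens : Tendsto (fun R : ℝ =>
        (Nat.card ↥(C ∩ Metric.closedBall 0 R) : ℝ) / volB R) atTop (nhds 1)) :
    ENNReal.ofReal ((∫ x, f x) - f 0) ≤ lowE C (fun r => ENNReal.ofReal (G r)) := by
  set I := ∫ y, f y with hI
  set M := ∫ y, |f y| with hM
  set N : ℝ → ℝ := fun R => (Nat.card ↥(C ∩ Metric.closedBall 0 R) : ℝ) with hN
  -- asymptotics
  have hv : ∀ ρ : ℝ, Tendsto (fun R => volB (R - ρ) / volB R) atTop (nhds 1) := by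
    intro ρ
    have h1 : Tendsto (fun R : ℝ => (1 - ρ / R) ^ 8) atTop (nhds ((1 - 0) ^ 8)) :=
      (tendsto_const_nhds.sub (tendsto_const_nhds.div_atTop tendsto_id)).pow 8
    norm_num at h1
    refine h1.congr' ?_
    filter_upwards [eventually_gt_atTop 0, eventually_ge_atTop ρ] with R h0 h1
    rw [volB_eq h0.le, volB_eq (sub_nonneg.mpr h1), mul_div_mul_right _ _ volB_one_pos.ne', ← div_pow]
    congr 1
    field_simp
  have hVpos : ∀ R, 0 < R → 0 < volB R := fun R hR => by
    rw [volB_eq hR.le]; exact mul_pos (by positivity) volB_one_pos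
  have hVN : Tendsto (fun R => volB R / N R) atTop (nhds 1) := by
    have := hC_dens.inv₀ one_ne_zero
    rw [inv_one] at this
    refine this.congr fun R => ?_
    rw [inv_div]
  have hNpos : ∀ᶠ R in atTop, 0 < N R := by
    filter_upwards [hC_dens.eventually (lt_mem_nhds (show (0:ℝ) < 1 by norm_num)), eventually_gt_atTop 0] with R h1 h0
    exact (div_pos_iff_of_pos_right (hVpos R h0)).mp h1
  have hNN : ∀ ρ : ℝ, Tendsto (fun R => N (R - ρ) / N R) atTop (nhds 1) := by
    intro ρ
    have h1 : Tendsto (fun R => N (R - ρ) / volB (R - ρ)) atTop (nhds 1) :=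
      hC_dens.comp (tendsto_atTop_add_const_right _ (-ρ) tendsto_id)
    have := (h1.mul (hv ρ)).mul hVN
    norm_num at this
    refine this.congr' ?_
    filter_upwards [hNpos, eventually_gt_atTop 0, eventually_gt_atTop ρ] with R h1 h0 h2
    have := hVpos R h0
    have := hVpos (R - ρ) (by linarith)
    field_simp
  have key : ∀ η : ℝ, 0 < η → ENNReal.ofReal (I - f 0 - η) ≤ lowE C (fun r => ENNReal.ofReal (G r)) := by
    intro η hη
    obtain ⟨ρ, hρ, hρε⟩ := tail_small hfi (show 0 < η / 4 by positivity)
    have hlim : Tendsto (fun R => 2 * ((I - η / 4) - M * (1 - N (R - ρ) / N R)) -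
        (volB R / N R) * ((I + η / 4) + M * (1 - volB (R - ρ) / volB R)) - f 0) atTop
        (nhds (2 * ((I - η / 4) - M * (1 - 1)) - 1 * ((I + η / 4) + M * (1 - 1)) - f 0)) := by
      refine Tendsto.sub (Tendsto.sub ?_ ?_) tendsto_const_nhds
      · exact (tendsto_const_nhds.sub ((tendsto_const_nhds.sub (hNN ρ)).const_mul M)).const_mul 2
      · exact hVN.mul (tendsto_const_nhds.add ((tendsto_const_nhds.sub (hv ρ)).const_mul M))
    have hev := hlim.eventually (lt_mem_nhds (show I - f 0 - η <
      2 * ((I - η / 4) - M * (1 - 1)) - 1 * ((I + η / 4) + M * (1 - 1)) - f 0 by linarith))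
    refine le_liminf_of_le (by isBoundedDefault) ?_
    filter_upwards [hev, hNpos, eventually_gt_atTop 0, eventually_gt_atTop ρ] with R h1 hNR h0 h2
    let _ : Fintype ↥(C ∩ Metric.closedBall 0 R) := (hC_fin R h0).fintype
    set s : Finset V8 := (C ∩ Metric.closedBall 0 R).toFinset with hs
    have hcard : (s.card : ℝ) = N R := by
      simp [hN, hs, Nat.card_eq_fintype_card, Set.toFinset_card]
    have hcard2 : ((s.filter (fun x => ‖x‖ ≤ R - ρ)).card : ℝ) = N (R - ρ) := by
      simp only [hN]
      congr 1
      rw [← Set.ncard_coe_finset]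
      simp only [Nat.card_coe_set_eq]
      congr 1
      ext x
      simp only [hs, Finset.coe_filter, Set.mem_toFinset, Set.mem_inter_iff, mem_closedBall_zero_iff, Set.mem_setOf_eq]
      constructor
      · rintro ⟨⟨h3, h4⟩, h5⟩; exact ⟨h3, h5⟩
      · rintro ⟨h3, h5⟩; exact ⟨⟨h3, by linarith⟩, h5⟩
    have hfin := lp_finite hfi hF hF0 hf s hρ.le hρε.le h2.le
    rw [hcard, hcard2] at hfin
    have hsum : I - f 0 - η ≤ (N R)⁻¹ * ∑ x ∈ s, ∑ y ∈ s, (if x ≠ y then G (‖x - y‖ ^ 2) else 0) := by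
      have hle : ∑ x ∈ s, ∑ y ∈ s, f (x - y) - N R * f 0 ≤ ∑ x ∈ s, ∑ y ∈ s, (if x ≠ y then G (‖x - y‖ ^ 2) else 0) := by
        have : ∑ x ∈ s, ∑ y ∈ s, f (x - y) ≤ ∑ x ∈ s, ∑ y ∈ s, ((if x ≠ y then G (‖x - y‖ ^ 2) else 0)
            + if x = y then f 0 else 0) := by
          refine Finset.sum_le_sum fun x _ => Finset.sum_le_sum fun y _ => ?_
          by_cases h : x = y
          · simp [h]
          · simpa [h] using hfG (x - y) (sub_ne_zero.mpr h)
        simp only [Finset.sum_add_distrib] at this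
        have h3 : ∑ x ∈ s, ∑ y ∈ s, (if x = y then f 0 else 0) = N R * f 0 := by
          rw [← hcard]
          rw [Finset.sum_congr rfl (g := fun _ => f 0)]
          · simp
          · intro x hx; simp [hx]
        linarith
      refine h1.le.trans ?_
      rw [le_inv_mul_iff₀ hNR]
      refine le_trans ?_ hle
      have e : N R * (2 * ((I - η / 4) - M * (1 - N (R - ρ) / N R)) -
        (volB R / N R) * ((I + η / 4) + M * (1 - volB (R - ρ) / volB R)) - f 0) = 
        (2 * (N R * (I - η / 4) - M * (N R - N (R - ρ))) -
          (volB R * (I + η / 4) + M * (volB R - volB (R - ρ)))) - N R * f 0 := by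
        have := hVpos R h0
        field_simp
      linarith
    have hcast : (Nat.card ↥(C ∩ Metric.closedBall 0 R) : ℝ≥0∞)⁻¹ = ENNReal.ofReal ((N R)⁻¹) := by
      rw [ENNReal.ofReal_inv_of_pos hNR]
      simp [hN]
    rw [hcast, tsum_fintype, Fintype.sum_prod_type]
    have hnn : ∀ x y : V8, 0 ≤ (if x ≠ y then G (‖x - y‖ ^ 2) else 0) := by
      intro x y
      split_ifs with h
      · exact hG _ (by have := norm_pos_iff.mpr (sub_ne_zero.mpr h); positivity)
      · exact le_rfl
    have e2 : (∑ x : ↥(C ∩ Metric.closedBall 0 R), ∑ y : ↥(C ∩ Metric.closedBall 0 R),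
        (if (x : V8) ≠ (y : V8) then ENNReal.ofReal (G (‖(x : V8) - (y : V8)‖ ^ 2)) else 0)) =
        ENNReal.ofReal (∑ x ∈ s, ∑ y ∈ s, (if x ≠ y then G (‖x - y‖ ^ 2) else 0)) := by
      rw [ENNReal.ofReal_sum_of_nonneg (fun x _ => Finset.sum_nonneg fun y _ => hnn x y)]
      rw [hs, ← Finset.sum_set_coe]
      refine Finset.sum_congr rfl fun x _ => ?_
      rw [ENNReal.ofReal_sum_of_nonneg (fun y _ => hnn x y)]
      rw [← Finset.sum_set_coe]
      refine Finset.sum_congr rfl fun y _ => ?_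
      split_ifs <;> simp
    rw [e2, ← ENNReal.ofReal_mul (by positivity)]
    exact ENNReal.ofReal_le_ofReal hsum
  have hl : Tendsto (fun η : ℝ => ENNReal.ofReal (I - f 0 - η)) (nhdsWithin 0 (Set.Ioi 0)) (nhds (ENNReal.ofReal (I - f 0 - 0))) := by
    refine (ENNReal.continuous_ofReal.tendsto _).comp ?_
    exact (Continuous.tendsto (by fun_prop) 0).mono_left nhdsWithin_le_nhds
  rw [sub_zero] at hl
  exact le_of_tendsto hl (eventually_nhdsWithin_of_forall fun η hη => key η hη)

end UO

namespace UO

/-! ### Part 2: reduction to Gaussians (Bernstein) -/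

section Taylor

variable {g : ℝ → ℝ}

/-- complete monotonicity with ordinary iterated derivatives -/
def CM (g : ℝ → ℝ) : Prop := (∀ x : ℝ, 0 < x → ContDiffAt ℝ (⊤ : ℕ∞) g x) ∧
  ∀ (k : ℕ) (x : ℝ), 0 < x → 0 ≤ (-1 : ℝ) ^ k * iteratedDeriv k g x

lemma CM.of_within (hg_smooth : ContDiffOn ℝ (⊤ : ℕ∞) g (Set.Ioi 0))
    (hg_cm : ∀ (k : ℕ) (x : ℝ), 0 < x →
      0 ≤ (-1 : ℝ) ^ k * iteratedDerivWithin k g (Set.Ioi 0) x) : CM g := by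
  refine ⟨fun x hx => hg_smooth.contDiffAt (Ioi_mem_nhds hx), fun k x hx => ?_⟩
  have := hg_cm k x hx
  rwa [iteratedDerivWithin_of_isOpen isOpen_Ioi hx] at this

lemma CM.hasDerivAt (hg : CM g) (k : ℕ) {x : ℝ} (hx : 0 < x) :
    HasDerivAt (iteratedDeriv k g) (iteratedDeriv (k + 1) g x) x := by
  rw [iteratedDeriv_succ]
  refine DifferentiableAt.hasDerivAt ?_
  have h := ContDiffWithinAt.differentiableWithinAt_iteratedDerivWithin (m := k) (s := Set.univ)
    ((hg.1 x hx).contDiffWithinAt) (by exact_mod_cast (WithTop.coe_lt_top k)) (by simpa using uniqueDiffOn_univ)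
  rwa [iteratedDerivWithin_univ, differentiableWithinAt_univ] at h

lemma CM.antitone (hg : CM g) (k : ℕ) :
    AntitoneOn (fun x => (-1 : ℝ) ^ k * iteratedDeriv k g x) (Set.Ioi 0) := by
  refine antitoneOn_of_deriv_nonpos (convex_Ioi 0) ?_ ?_ ?_
  · intro x hx
    exact ((hg.hasDerivAt k hx).const_mul _).continuousAt.continuousWithinAt
  · intro x hx
    rw [interior_Ioi] at hx
    exact ((hg.hasDerivAt k hx).const_mul _).differentiableAt.differentiableWithinAt
  · intro x hx
    rw [interior_Ioi] at hx
    rw [((hg.hasDerivAt k hx).const_mul _).deriv]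
    have := hg.2 (k + 1) x hx
    rw [pow_succ] at this
    linarith

lemma CM.taylor (hg : CM g) {a x : ℝ} (hx : 0 < x) (hxa : x ≤ a) (n : ℕ) :
    g x = ∑ k ∈ Finset.range (n + 1), ((-1) ^ k * iteratedDeriv k g a) * (a - x) ^ k / k.factorial +
      (a - x) ^ (n + 1) * ((n.factorial : ℝ)⁻¹ * ∫ t in (0 : ℝ)..1, (1 - t) ^ n *
        ((-1) ^ (n + 1) * iteratedDeriv (n + 1) g (a - t * (a - x)))) := by
  have hpos : ∀ t ∈ Set.Icc (0 : ℝ) 1, 0 < a - t * (a - x) := by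
    intro t ht
    nlinarith [ht.1, ht.2]
  have h := map_add_eq_sum_add_integral_iteratedFDeriv (f := g) (x := a) (y := x - a) (n := n) (by
    intro t ht
    have h1 := hpos t ht
    have : a + t • (x - a) = a - t * (a - x) := by simp; ring
    rw [this]
    exact (hg.1 _ h1).of_le (by exact_mod_cast le_top))
  simp only [iteratedFDeriv_apply_eq_iteratedDeriv_mul_prod, Finset.prod_const, Finset.card_univ, Fintype.card_fin,
    smul_eq_mul] at h
  rw [add_sub_cancel] at h
  rw [h]
  congr 1
  · refine Finset.sum_congr rfl fun k _ => ?_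
    have : x - a = (-1) * (a - x) := by ring
    rw [this, mul_pow]
    field_simp
  · rw [← mul_assoc, mul_comm ((a - x) ^ (n + 1)), mul_assoc]
    congr 1
    rw [← intervalIntegral.integral_const_mul]
    refine intervalIntegral.integral_congr (E := ℝ) fun t _ => ?_
    have : x - a = (-1) * (a - x) := by ring
    have h2 : a + t * (x - a) = a - t * (a - x) := by ring
    simp only [h2]
    rw [this, mul_pow]
    ring

lemma CM.hasSum (hg : CM g) {a x : ℝ} (hx : 0 < x) (hxa : x ≤ a) :
    HasSum (fun k : ℕ => ((-1) ^ k * iteratedDeriv k g a) * (a - x) ^ k / k.factorial) (g x) := by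
  have ha : 0 < a := hx.trans_le hxa
  have hnn : ∀ (y : ℝ), y ≤ a → ∀ k : ℕ, 0 ≤ ((-1) ^ k * iteratedDeriv k g a) * (a - y) ^ k / k.factorial := by
    intro y hy k
    have := hg.2 k a ha
    have : 0 ≤ (a - y) ^ k := pow_nonneg (by linarith) k
    positivity
  set I : ℕ → ℝ → ℝ := fun n y => ((n.factorial : ℝ)⁻¹ * ∫ t in (0 : ℝ)..1, (1 - t) ^ n *
        ((-1) ^ (n + 1) * iteratedDeriv (n + 1) g (a - t * (a - y)))) with hI
  have hpos : ∀ y, 0 < y → y ≤ a → ∀ t ∈ Set.Icc (0 : ℝ) 1, 0 < a - t * (a - y) := by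
    intro y hy hya t ht
    nlinarith [ht.1, ht.2]
  have hI0 : ∀ n y, 0 < y → y ≤ a → 0 ≤ I n y := by
    intro n y hy hya
    refine mul_nonneg (by positivity) (intervalIntegral.integral_nonneg zero_le_one fun t ht => ?_)
    exact mul_nonneg (pow_nonneg (by linarith [ht.2]) n) (hg.2 _ _ (hpos y hy hya t ht))
  have hImono : ∀ n, I n x ≤ I n (x / 2) := by
    intro n
    refine mul_le_mul_of_nonneg_left ?_ (by positivity)
    have hnt : ∀ y, 0 < y → y ≤ a → IntervalIntegrable (fun t => (1 - t) ^ n *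
        ((-1) ^ (n + 1) * iteratedDeriv (n + 1) g (a - t * (a - y)))) volume 0 1 := by
      intro y hy hya
      refine ContinuousOn.intervalIntegrable ?_
      rw [Set.uIcc_of_le zero_le_one]
      refine ContinuousOn.mul (by fun_prop) (ContinuousOn.mul (by fun_prop) ?_)
      intro t ht
      have := (hg.hasDerivAt (n + 1) (hpos y hy hya t ht)).continuousAt
      exact (ContinuousAt.comp (f := fun t => a - t * (a - y)) this (by fun_prop)).continuousWithinAt
    refine intervalIntegral.integral_mono_on zero_le_one (hnt x hx hxa) (hnt (x / 2) (by positivity) (by linarith)) ?_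
    intro t ht
    refine mul_le_mul_of_nonneg_left ?_ (pow_nonneg (by linarith [ht.2]) n)
    refine hg.antitone (n + 1) (hpos (x / 2) (by positivity) (by linarith) t ht) (hpos x hx hxa t ht) ?_
    nlinarith [ht.1]
  rw [hasSum_iff_tendsto_nat_of_nonneg (hnn x hxa)]
  rw [← tendsto_add_atTop_iff_nat 1]
  have hR : ∀ n, (a - x) ^ (n + 1) * I n x ≤ ((a - x) / (a - x / 2)) ^ (n + 1) * g (x / 2) := by
    intro n
    have h1 := hg.taylor (a := a) (x := x / 2) (by positivity) (by linarith) n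
    have h2 : 0 ≤ ∑ k ∈ Finset.range (n + 1), ((-1) ^ k * iteratedDeriv k g a) * (a - x / 2) ^ k / k.factorial :=
      Finset.sum_nonneg fun k _ => hnn _ (by linarith) k
    have h3 : 0 < a - x / 2 := by linarith
    have h4 : (a - x / 2) ^ (n + 1) * I n (x / 2) ≤ g (x / 2) := by
      rw [h1]; simp only [hI]; linarith
    rw [div_pow, div_mul_eq_mul_div, le_div_iff₀ (by positivity)]
    have h5 : 0 ≤ (a - x) ^ (n + 1) := pow_nonneg (by linarith) _
    calc (a - x) ^ (n + 1) * I n x * (a - x / 2) ^ (n + 1)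
        = (a - x) ^ (n + 1) * ((a - x / 2) ^ (n + 1) * I n x) := by ring
      _ ≤ (a - x) ^ (n + 1) * ((a - x / 2) ^ (n + 1) * I n (x / 2)) := by
          refine mul_le_mul_of_nonneg_left (mul_le_mul_of_nonneg_left (hImono n) (by positivity)) h5
      _ ≤ _ := mul_le_mul_of_nonneg_left h4 h5
  have hlim : Tendsto (fun n : ℕ => (a - x) ^ (n + 1) * I n x) atTop (nhds 0) := by
    refine squeeze_zero (fun n => mul_nonneg (pow_nonneg (by linarith) _) (hI0 n x hx hxa)) hR ?_
    have h1 : Tendsto (fun n : ℕ => ((a - x) / (a - x / 2)) ^ (n + 1)) atTop (nhds 0) := by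
      refine (tendsto_pow_atTop_nhds_zero_of_lt_one ?_ ?_).comp (tendsto_add_atTop_nat 1)
      · exact div_nonneg (by linarith) (by linarith)
      · rw [div_lt_one (by linarith)]; linarith
    simpa using h1.mul_const (g (x / 2))
  have := tendsto_const_nhds (x := g x) |>.sub hlim
  rw [sub_zero] at this
  refine this.congr fun n => ?_
  rw [hg.taylor hx hxa n]
  ring

end Taylor

section Measures

open unitInterval

lemma continuous_rpow_I {x : ℝ} (hx : 0 < x) : Continuous (fun u : I => (u : ℝ) ^ x) :=
  Continuous.rpow_const (by fun_prop) (fun _ => Or.inr hx.le)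

/-- Bernstein's theorem (for the shifted function, on the compactified parameter space). -/
lemma CM.exists_measure {g : ℝ → ℝ} (hg : CM g) {ε : ℝ} (hε : 0 < ε) :
    ∃ μ : FiniteMeasure I, ∀ x : ℝ, 0 < x → g (ε + x) = ∫ u : I, (u : ℝ) ^ x ∂(μ : Measure I) := by
  have hgε : 0 ≤ g ε := by simpa using hg.2 0 ε hε
  set c : ℕ → ℕ → ℝ := fun n k => ((-1) ^ k * iteratedDeriv k g (ε + n)) * n ^ k / k.factorial with hc
  have hc0 : ∀ n k, 0 ≤ c n k := by
    intro n k
    have := hg.2 k (ε + n) (by positivity)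
    simp only [hc]
    positivity
  have hsum : ∀ n : ℕ, 0 < n → ∀ x : ℝ, 0 ≤ x → HasSum (fun k => c n k * Real.exp (-(k * x / n)))
      (g (ε + n * (1 - Real.exp (-(x / n))))) := by
    intro n hn x hx
    have hn' : (0 : ℝ) < n := by exact_mod_cast hn
    have h1 : Real.exp (-(x / n)) ≤ 1 := Real.exp_le_one_iff.mpr (by have : 0 ≤ x / n := by positivity
                                                                     linarith)
    have h2 := Real.exp_pos (-(x / n))
    have := hg.hasSum (a := ε + n) (x := ε + n * (1 - Real.exp (-(x / n)))) (by nlinarith) (by nlinarith)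
    refine (this.congr_fun ?_)
    intro k
    have e : (ε + n - (ε + n * (1 - Real.exp (-(x / n))))) = n * Real.exp (-(x / n)) := by ring
    rw [e, mul_pow, ← Real.exp_nat_mul]
    simp only [hc]
    have : (k : ℝ) * -(x / n) = -(k * x / n) := by ring
    rw [this]
    ring
  have hmem : ∀ n k : ℕ, Real.exp (-((k : ℝ) / n)) ∈ I := fun n k =>
    ⟨(Real.exp_pos _).le, Real.exp_le_one_iff.mpr (by have : (0:ℝ) ≤ k / n := by positivity
                                                      linarith)⟩
  set m : ℕ → Measure I := fun n => Measure.sum (fun k => ENNReal.ofReal (c n k) • Measure.dirac ⟨_, hmem n k⟩) with hm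
  have hmass : ∀ n : ℕ, 0 < n → m n Set.univ = ENNReal.ofReal (g ε) := by
    intro n hn
    simp only [hm]
    rw [Measure.sum_apply _ MeasurableSet.univ]
    simp only [Measure.smul_apply, measure_univ, smul_eq_mul, mul_one]
    have := hsum n hn 0 le_rfl
    simp at this
    rw [← ENNReal.ofReal_tsum_of_nonneg (hc0 n) this.summable, this.tsum_eq]
  have hfin : ∀ n : ℕ, IsFiniteMeasure (m (n + 1)) := fun n => ⟨by rw [hmass _ n.succ_pos]; exact ENNReal.ofReal_lt_top⟩
  set M : ℕ → FiniteMeasure I := fun n => ⟨m (n + 1), hfin n⟩ with hM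
  have hnt : ∀ n x, 0 < x → ∫ u : I, (u : ℝ) ^ x ∂(M n : Measure I) =
      g (ε + (n + 1 : ℕ) * (1 - Real.exp (-(x / (n + 1 : ℕ))))) := by
    intro n x hx
    have := hsum (n + 1) n.succ_pos x hx.le
    rw [← this.tsum_eq]
    have hi : Integrable (fun u : I => (u : ℝ) ^ x) (m (n + 1)) := by
      have := hfin n
      refine Integrable.of_bound (C := 1) (continuous_rpow_I hx).aestronglyMeasurable ?_
      refine Eventually.of_forall fun u => ?_
      rw [Real.norm_eq_abs, abs_of_nonneg (Real.rpow_nonneg u.2.1 _)]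
      exact Real.rpow_le_one u.2.1 u.2.2 hx.le
    change ∫ u : I, (u : ℝ) ^ x ∂(m (n + 1)) = _
    simp only [hm] at hi ⊢
    rw [integral_sum_measure hi]
    refine tsum_congr fun k => ?_
    rw [integral_smul_measure, integral_dirac, ENNReal.toReal_ofReal (hc0 _ _), smul_eq_mul, ← Real.exp_mul]
    congr 2
    ring
  have hcomp := isCompact_setOfPred_finiteMeasure_eq_of_compactSpace I (g ε).toNNReal
  have hMmem : ∀ n, M n ∈ {μ : FiniteMeasure I | μ.mass = (g ε).toNNReal} := by
    intro n
    change (m (n + 1) Set.univ).toNNReal = _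
    rw [hmass _ n.succ_pos]
    simp [ENNReal.ofReal]
  obtain ⟨μ, -, hμ⟩ := hcomp.ultrafilter_le_nhds (Ultrafilter.map M (hyperfilter ℕ)) (by
    rw [le_principal_iff]
    exact Filter.mem_map.mpr (Filter.Eventually.of_forall (f := (hyperfilter ℕ : Filter ℕ)) hMmem))
  refine ⟨μ, fun x hx => ?_⟩
  have hT : Tendsto M (hyperfilter ℕ : Filter ℕ) (nhds μ) := hμ
  rw [FiniteMeasure.tendsto_iff_forall_integral_tendsto] at hT
  have h1 := hT (BoundedContinuousFunction.mkOfCompact ⟨_, continuous_rpow_I hx⟩)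
  simp only [BoundedContinuousFunction.mkOfCompact_apply, ContinuousMap.coe_mk] at h1
  simp_rw [hnt _ x hx] at h1
  have h2 : Tendsto (fun n : ℕ => g (ε + (n + 1 : ℕ) * (1 - Real.exp (-(x / (n + 1 : ℕ)))))) atTop (nhds (g (ε + x))) := by
    have hcont : ContinuousAt g (ε + x) := (hg.1 _ (by positivity)).continuousAt
    refine hcont.tendsto.comp (tendsto_const_nhds.add ?_)
    -- n (1 - exp (-x/n)) → x
    have hd : HasDerivAt (fun t : ℝ => 1 - Real.exp (-(x * t))) x 0 := by
      have : HasDerivAt (fun t : ℝ => -(x * t)) (-x) 0 := by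
        have h0 := ((hasDerivAt_id (0 : ℝ)).const_mul (-x))
        simp only [id, mul_one, neg_mul] at h0
        exact h0
      simpa using this.exp.const_sub 1
    have hd2 := hd.tendsto_slope
    have hseq : Tendsto (fun n : ℕ => (1 / ((n : ℝ) + 1))) atTop (nhdsWithin 0 {0}ᶜ) := by
      refine tendsto_nhdsWithin_iff.mpr ⟨tendsto_one_div_add_atTop_nhds_zero_nat, Eventually.of_forall fun n => ?_⟩
      have : (1 / ((n : ℝ) + 1)) ≠ 0 := by positivity
      simpa using this
    refine (hd2.comp hseq).congr fun n => ?_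
    have : ((n : ℝ) + 1) ≠ 0 := by positivity
    simp only [Function.comp, slope, vsub_eq_sub, smul_eq_mul, sub_zero, mul_zero, neg_zero, Real.exp_zero, sub_self]
    push_cast
    field_simp
  exact (tendsto_nhds_unique h1 (h2.mono_left (Nat.hyperfilter_le_atTop))).symm

end Measures

lemma lowE_mono {C : Set V8} {φ ψ : ℝ → ℝ≥0∞} (h : ∀ r, 0 < r → φ r ≤ ψ r) : lowE C φ ≤ lowE C ψ := by
  unfold lowE
  refine liminf_le_liminf (Eventually.of_forall fun R => ?_)
  refine mul_le_mul_right (ENNReal.tsum_le_tsum fun q => ?_) _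
  split_ifs with hq
  · exact h _ (by have := norm_pos_iff.mpr (sub_ne_zero.mpr hq); positivity)
  · exact le_rfl

lemma gauss_limit {C : Set V8} {S : Set V8} {c : ℝ} {c₁ : ℝ} (hc : c < c₁)
    (h : ∀ c', c < c' → c' < c₁ → ∑' x : S, ENNReal.ofReal (Real.exp (-c' * ‖(x : V8)‖ ^ 2)) ≤
      lowE C (fun r => ENNReal.ofReal (Real.exp (-c' * r)))) :
    ∑' x : S, ENNReal.ofReal (Real.exp (-c * ‖(x : V8)‖ ^ 2)) ≤
      lowE C (fun r => ENNReal.ofReal (Real.exp (-c * r))) := by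
  rw [ENNReal.tsum_eq_iSup_sum]
  refine iSup_le fun s => ?_
  have hl : Tendsto (fun c' : ℝ => ∑ x ∈ s, ENNReal.ofReal (Real.exp (-c' * ‖(x : V8)‖ ^ 2)))
      (nhdsWithin c (Set.Ioi c)) (nhds (∑ x ∈ s, ENNReal.ofReal (Real.exp (-c * ‖(x : V8)‖ ^ 2)))) := by
    refine tendsto_finsetSum _ fun x _ => ?_
    refine (ENNReal.continuous_ofReal.tendsto _).comp ?_
    exact (Continuous.tendsto (by fun_prop) c).mono_left nhdsWithin_le_nhds
  refine le_of_tendsto hl ?_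
  filter_upwards [Ioo_mem_nhdsGT hc] with c' hc'
  refine (ENNReal.sum_le_tsum s).trans ((h c' hc'.1 hc'.2).trans (lowE_mono fun r hr => ?_))
  refine ENNReal.ofReal_le_ofReal (Real.exp_le_exp.mpr ?_)
  nlinarith [hc'.1]

lemma lowE_lintegral {Ω : Type*} [MeasurableSpace Ω] (μ : Measure Ω) {C : Set V8}
    (hC_fin : ∀ R : ℝ, 0 < R → (C ∩ Metric.closedBall 0 R).Finite) {φ : Ω → ℝ → ℝ≥0∞}
    (hφ : ∀ r, 0 < r → Measurable (fun u => φ u r)) :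
    ∫⁻ u, lowE C (φ u) ∂μ ≤ lowE C (fun r => ∫⁻ u, φ u r ∂μ) := by
  set A : (ℝ → ℝ≥0∞) → ℝ → ℝ≥0∞ := fun ψ R => (Nat.card ↥(C ∩ Metric.closedBall 0 R) : ℝ≥0∞)⁻¹ *
            ∑' q : ↥(C ∩ Metric.closedBall 0 R) × ↥(C ∩ Metric.closedBall 0 R),
              if (q.1 : V8) ≠ (q.2 : V8) then
                ψ (‖(q.1 : V8) - (q.2 : V8)‖ ^ 2)
              else 0 with hA
  have hlow : ∀ ψ, lowE C ψ = liminf (A ψ) atTop := fun ψ => rfl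
  have hmeas0 : ∀ (x y : V8), Measurable (fun u => if x ≠ y then φ u (‖x - y‖ ^ 2) else 0) := by
    intro x y
    by_cases h : x = y
    · simp [h]
    · simp only [ne_eq, h, not_false_eq_true, if_true]
      exact hφ _ (by have := norm_pos_iff.mpr (sub_ne_zero.mpr h); positivity)
  have hmeas : ∀ R, 0 < R → Measurable (fun u => A (φ u) R) := by
    intro R hR
    have := (hC_fin R hR).fintype
    simp only [hA]
    refine Measurable.const_mul ?_ _
    simp_rw [tsum_fintype]
    exact Finset.measurable_fun_sum _ fun q _ => hmeas0 _ _
  have hAint : ∀ R, 0 < R → ∫⁻ u, A (φ u) R ∂μ = A (fun r => ∫⁻ u, φ u r ∂μ) R := by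
    intro R hR
    have := (hC_fin R hR).fintype
    simp only [hA]
    simp_rw [tsum_fintype]
    rw [lintegral_const_mul _ (Finset.measurable_fun_sum _ fun q _ => hmeas0 _ _)]
    congr 1
    rw [lintegral_finsetSum _ (fun q _ => hmeas0 _ _)]
    refine Finset.sum_congr rfl fun q _ => ?_
    split_ifs <;> simp
  simp_rw [hlow]
  refine le_of_forall_gt_imp_ge_of_dense fun b hb => ?_
  have hfr : ∃ᶠ R in atTop, A (fun r => ∫⁻ u, φ u r ∂μ) R < b := frequently_lt_of_liminf_lt (by isBoundedDefault) hb
  have hfr2 := hfr.and_eventually (eventually_gt_atTop (0 : ℝ))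
  obtain ⟨R, hR, hRb⟩ := exists_seq_forall_of_frequently hfr2
  calc ∫⁻ u, liminf (A (φ u)) atTop ∂μ ≤ ∫⁻ u, liminf (fun n => A (φ u) (R n)) atTop ∂μ := by
        refine lintegral_mono fun u => ?_
        rw [show liminf (fun n => A (φ u) (R n)) atTop = liminf (A (φ u)) (map R atTop) from rfl]
        exact liminf_le_liminf_of_le hR
    _ ≤ liminf (fun n => ∫⁻ u, A (φ u) (R n) ∂μ) atTop := lintegral_liminf_le fun n => hmeas _ (hRb n).2
    _ ≤ b := by
        refine liminf_le_of_le (by isBoundedDefault) fun c hc => ?_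
        obtain ⟨n, hn⟩ := hc.exists
        rw [hAint _ (hRb n).2] at hn
        exact hn.trans (hRb n).1.le

theorem bernstein_reduction {g : ℝ → ℝ} (hg : CM g) {C : Set V8} {S : Set V8} (hS : (0 : V8) ∉ S)
    (hC_fin : ∀ R : ℝ, 0 < R → (C ∩ Metric.closedBall 0 R).Finite)
    (h : ∀ c, 0 < c → c ≠ Real.pi → ∑' x : S, ENNReal.ofReal (Real.exp (-c * ‖(x : V8)‖ ^ 2)) ≤
      lowE C (fun r => ENNReal.ofReal (Real.exp (-c * r)))) :
    ∑' x : S, ENNReal.ofReal (g (‖(x : V8)‖ ^ 2)) ≤ lowE C (fun r => ENNReal.ofReal (g r)) := by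
  have h' : ∀ c, 0 ≤ c → ∑' x : S, ENNReal.ofReal (Real.exp (-c * ‖(x : V8)‖ ^ 2)) ≤
      lowE C (fun r => ENNReal.ofReal (Real.exp (-c * r))) := by
    intro c hc
    by_cases hcπ : c < Real.pi
    · exact gauss_limit hcπ fun c' h1 h2 => h c' (by linarith) h2.ne
    · refine gauss_limit (lt_add_one c) fun c' h1 h2 => h c' (by linarith) ?_
      exact (lt_of_le_of_lt (not_lt.mp hcπ) h1).ne'
  have hxpos : ∀ x : S, 0 < ‖(x : V8)‖ ^ 2 := by
    intro x
    have : (x : V8) ≠ 0 := fun h0 => hS (h0 ▸ x.2)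
    have := norm_pos_iff.mpr this
    positivity
  have key : ∀ ε, 0 < ε → ∀ s : Finset S, ∑ x ∈ s, ENNReal.ofReal (g (ε + ‖(x : V8)‖ ^ 2)) ≤
      lowE C (fun r => ENNReal.ofReal (g r)) := by
    intro ε hε s
    obtain ⟨μ, hμ⟩ := hg.exists_measure hε
    have hmeas : ∀ r : ℝ, 0 < r → Measurable (fun u : unitInterval => ENNReal.ofReal ((u : ℝ) ^ r)) := by
      intro r hr
      exact ((ENNReal.continuous_ofReal).comp (continuous_rpow_I hr)).measurable
    have hgi : ∀ r : ℝ, 0 < r → ENNReal.ofReal (g (ε + r)) =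
        ∫⁻ u : unitInterval, ENNReal.ofReal ((u : ℝ) ^ r) ∂(μ : Measure unitInterval) := by
      intro r hr
      rw [hμ r hr, ofReal_integral_eq_lintegral_ofReal]
      · refine Integrable.of_bound (C := 1) (continuous_rpow_I hr).aestronglyMeasurable ?_
        refine Eventually.of_forall fun u => ?_
        rw [Real.norm_eq_abs, abs_of_nonneg (Real.rpow_nonneg u.2.1 _)]
        exact Real.rpow_le_one u.2.1 u.2.2 hr.le
      · exact Eventually.of_forall fun u => Real.rpow_nonneg u.2.1 _
    have e1 : ∑ x ∈ s, ENNReal.ofReal (g (ε + ‖(x : V8)‖ ^ 2)) =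
        ∫⁻ u : unitInterval, ∑ x ∈ s, ENNReal.ofReal ((u : ℝ) ^ (‖(x : V8)‖ ^ 2)) ∂(μ : Measure unitInterval) := by
      rw [lintegral_finsetSum _ (fun x _ => hmeas _ (hxpos x))]
      exact Finset.sum_congr rfl fun x _ => hgi _ (hxpos x)
    rw [e1]
    refine le_trans (lintegral_mono (g := fun u : unitInterval => lowE C (fun r => ENNReal.ofReal ((u : ℝ) ^ r))) ?_) ?_
    · intro u
      simp only
      by_cases hu : (u : ℝ) = 0
      · refine le_trans (le_of_eq ?_) (zero_le)
        refine Finset.sum_eq_zero fun x _ => ?_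
        rw [hu, Real.zero_rpow (hxpos x).ne']
        simp
      · have hu0 : 0 < (u : ℝ) := lt_of_le_of_ne u.2.1 (Ne.symm hu)
        have e : ∀ r : ℝ, (u : ℝ) ^ r = Real.exp (-(-Real.log u) * r) := by
          intro r
          rw [neg_neg, Real.rpow_def_of_pos hu0]
        simp_rw [e]
        refine (ENNReal.sum_le_tsum s).trans (h' _ ?_)
        exact neg_nonneg.mpr (Real.log_nonpos u.2.1 u.2.2)
    · refine (lowE_lintegral _ hC_fin hmeas).trans (lowE_mono fun r hr => ?_)
      rw [← hgi r hr]
      refine ENNReal.ofReal_le_ofReal ?_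
      have := hg.antitone 0 (Set.mem_Ioi.mpr hr) (Set.mem_Ioi.mpr (by positivity : 0 < ε + r)) (by linarith)
      simpa using this
  rw [ENNReal.tsum_eq_iSup_sum]
  refine iSup_le fun s => ?_
  have hl : Tendsto (fun ε : ℝ => ∑ x ∈ s, ENNReal.ofReal (g (ε + ‖(x : V8)‖ ^ 2)))
      (nhdsWithin 0 (Set.Ioi 0)) (nhds (∑ x ∈ s, ENNReal.ofReal (g (0 + ‖(x : V8)‖ ^ 2)))) := by
    refine tendsto_finsetSum _ fun x _ => ?_
    refine (ENNReal.continuous_ofReal.tendsto _).comp ?_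
    have hcont : ContinuousAt g (0 + ‖(x : V8)‖ ^ 2) := (hg.1 _ (by simpa using hxpos x)).continuousAt
    exact (ContinuousAt.comp (f := fun ε : ℝ => ε + ‖(x : V8)‖ ^ 2) hcont (by fun_prop)).tendsto.mono_left nhdsWithin_le_nhds
  simp only [zero_add] at hl
  exact le_of_tendsto hl (eventually_nhdsWithin_of_forall fun ε hε => key ε hε s)

end UO

namespace UO

open UpperHalfPlane MatrixGroups ModularForm in
/-- Build a cusp form of level one from a function on `ℂ`. -/
def mkCusp (f : ℂ → ℂ) (k : ℕ) (hf : ∀ z : ℂ, 0 < z.im → DifferentiableAt ℂ f z)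
    (hT : ∀ z : ℂ, 0 < z.im → f (z + 1) = f z)
    (hS : ∀ z : ℂ, 0 < z.im → f (-1 / z) = z ^ k * f z)
    (h0 : Tendsto f (comap Complex.im atTop) (nhds 0)) : CuspForm 𝒮ℒ k := by
  have hS' : (fun z : ℍ => f z) ∣[(k : ℤ)] ModularGroup.S = fun z : ℍ => f z := by
    ext z
    rw [SlashInvariantForm.slash_S_apply]
    have h1 := hS z z.2
    have hz : (z : ℂ) ≠ 0 := z.ne_zero
    have h2 : f (-(z : ℂ)⁻¹) = f (-1 / z) := by congr 1; field_simp
    simp only [inv_neg]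
    rw [h2, h1, zpow_neg, zpow_natCast]
    field_simp
  have hT' : (fun z : ℍ => f z) ∣[(k : ℤ)] ModularGroup.T = fun z : ℍ => f z := by
    ext z
    rw [ModularForm.SL_slash_apply, modular_T_smul]
    have h1 := hT z z.2
    have h2 : denom (ModularGroup.T : GL (Fin 2) ℝ) z = 1 := by
      rw [ModularGroup.denom_apply]; simp [ModularGroup.T]
    rw [h2]
    simp
    rw [add_comm, h1]
  have hz : UpperHalfPlane.IsZeroAtImInfty (fun z : ℍ => f z) := by
    exact h0.comp (tendsto_coe_atImInfty)
  exact
  { toFun := fun z : ℍ => f z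
    slash_action_eq' := by
      intro A hA
      obtain ⟨A, rfl⟩ := hA
      exact SlashInvariantForm.slash_action_generators_SL2Z hS' hT' A
    holo' := by
      rw [UpperHalfPlane.mdifferentiable_iff]
      refine DifferentiableOn.congr (f := f) (fun z hz ↦ (hf z hz).differentiableWithinAt) fun z hz ↦ ?_
      simp [ofComplex_apply_of_im_pos hz]
    zero_at_cusps' := by
      intro c hc
      rw [Subgroup.IsArithmetic.isCusp_iff_isCusp_SL2Z] at hc
      rw [OnePoint.isZeroAt_iff_forall_SL2Z hc]
      intro γ _
      rw [SlashInvariantForm.slash_action_generators_SL2Z hS' hT']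
      exact hz }

theorem levelOne_zero {f : ℂ → ℂ} (k : ℕ) (hk : k < 12)
    (hf : ∀ z : ℂ, 0 < z.im → DifferentiableAt ℂ f z)
    (hT : ∀ z : ℂ, 0 < z.im → f (z + 1) = f z)
    (hS : ∀ z : ℂ, 0 < z.im → f (-1 / z) = z ^ k * f z)
    (h0 : Tendsto f (comap Complex.im atTop) (nhds 0)) : ∀ z : ℂ, 0 < z.im → f z = 0 := by
  intro z hz
  have h := CuspForm.rank_eq_zero_of_weight_lt_twelve (k := (k : ℤ)) (by exact_mod_cast hk)
  rw [rank_zero_iff_forall_zero] at h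
  have h2 := h (mkCusp f k hf hT hS h0)
  have h3 := congrArg (fun F => F.toFun ⟨z, hz⟩) h2
  exact h3

/-- The modular discriminant as a function on `ℂ` (meaningful on the upper half plane). -/
def disc (z : ℂ) : ℂ := ModularForm.eta z ^ 24

theorem levelOne_disc {f : ℂ → ℂ}
    (hf : ∀ z : ℂ, 0 < z.im → DifferentiableAt ℂ f z)
    (hT : ∀ z : ℂ, 0 < z.im → f (z + 1) = f z)
    (hS : ∀ z : ℂ, 0 < z.im → f (-1 / z) = z ^ 12 * f z)
    (h0 : Tendsto f (comap Complex.im atTop) (nhds 0)) :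
    ∃ c : ℂ, ∀ z : ℂ, 0 < z.im → f z = c * disc z := by
  obtain ⟨c, hc⟩ := CuspForm.exists_smul_discriminant_of_weight_eq_twelve (mkCusp f 12 hf hT hS h0)
  refine ⟨c, fun z hz => ?_⟩
  have h3 := congrArg (fun F => F.toFun ⟨z, hz⟩) hc
  exact h3.symm

end UO

namespace UO
open Complex

/-- the filter `Im z → ∞` on `ℂ` -/
abbrev iInfty : Filter ℂ := comap Complex.im atTop

def th2 (z : ℂ) : ℂ := cexp (Real.pi * I * z / 4) * jacobiTheta₂ (z / 2) z
def th3 (z : ℂ) : ℂ := jacobiTheta z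
def th4 (z : ℂ) : ℂ := jacobiTheta (z + 1)
def tA (z : ℂ) : ℂ := th2 z ^ 4
def tB (z : ℂ) : ℂ := th3 z ^ 4
def tC (z : ℂ) : ℂ := th4 z ^ 4

lemma im_S_pos {z : ℂ} (hz : 0 < z.im) : 0 < (-1 / z).im := by
  have h : z ≠ 0 := by rintro rfl; simp at hz
  rw [neg_div, one_div, Complex.neg_im, Complex.inv_im]
  have := Complex.normSq_pos.mpr h
  rw [neg_div, neg_neg]; positivity

lemma ne_zero_of_im {z : ℂ} (hz : 0 < z.im) : z ≠ 0 := by rintro rfl; simp at hz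

lemma th3_T (z : ℂ) : th3 (z + 1) = th4 z := rfl
lemma th4_T (z : ℂ) : th4 (z + 1) = th3 z := by
  unfold th4 th3
  rw [show z + 1 + 1 = 2 + z by ring, jacobiTheta_two_add]

lemma exp_pi_even (n : ℤ) : cexp (Real.pi * I * ((n : ℂ) + n ^ 2)) = 1 := by
  have h : Even (n + n ^ 2) := by
    have := Int.even_mul_succ_self n
    have h2 : n + n ^ 2 = n * (n + 1) := by ring
    rwa [h2]
  obtain ⟨k, hk⟩ := h
  have : (Real.pi * I * ((n : ℂ) + n ^ 2)) = k * (2 * Real.pi * I) := by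
    have h2 : ((n : ℂ) + n ^ 2) = k + k := by exact_mod_cast hk
    rw [h2]; ring
  rw [this, Complex.exp_int_mul_two_pi_mul_I]

lemma th2_aux_T (z : ℂ) : jacobiTheta₂ ((z + 1) / 2) (z + 1) = jacobiTheta₂ (z / 2) z := by
  unfold jacobiTheta₂
  refine tsum_congr fun n => ?_
  unfold jacobiTheta₂_term
  rw [show 2 * (Real.pi : ℂ) * I * n * ((z + 1) / 2) + Real.pi * I * n ^ 2 * (z + 1)
    = (2 * (Real.pi : ℂ) * I * n * (z / 2) + Real.pi * I * n ^ 2 * z)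
      + Real.pi * I * ((n : ℂ) + n ^ 2) by ring, Complex.exp_add, exp_pi_even, mul_one]

lemma tA_T (z : ℂ) : tA (z + 1) = - tA z := by
  unfold tA th2
  rw [th2_aux_T, mul_pow, mul_pow, ← Complex.exp_nat_mul, ← Complex.exp_nat_mul]
  have : ((4 : ℕ) : ℂ) * (Real.pi * I * (z + 1) / 4) = ((4 : ℕ) : ℂ) * (Real.pi * I * z / 4) + Real.pi * I := by
    push_cast; ring
  rw [this, Complex.exp_add, Complex.exp_pi_mul_I]; ring

lemma tB_T (z : ℂ) : tB (z + 1) = tC z := rfl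
lemma tC_T (z : ℂ) : tC (z + 1) = tB z := by unfold tC tB; rw [th4_T]

lemma th4_eq (z : ℂ) : th4 z = jacobiTheta₂ (-1 / 2) z := by
  unfold th4 jacobiTheta jacobiTheta₂
  refine tsum_congr fun n => ?_
  unfold jacobiTheta₂_term
  rw [show (Real.pi : ℂ) * I * n ^ 2 * (z + 1)
    = (2 * (Real.pi : ℂ) * I * n * (-1 / 2) + Real.pi * I * n ^ 2 * z)
      + Real.pi * I * ((n : ℂ) + n ^ 2) by ring, Complex.exp_add, exp_pi_even, mul_one]

lemma cpow_half_four {z : ℂ} (hz : 0 < z.im) : ((-I * z) ^ (1 / 2 : ℂ)) ^ 4 = - z ^ 2 := by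
  have h2 : ((-I * z) ^ (1 / 2 : ℂ)) ^ 2 = -I * z := by
    rw [one_div]; exact Complex.cpow_nat_inv_pow _ two_ne_zero
  calc ((-I * z) ^ (1 / 2 : ℂ)) ^ 4 = (((-I * z) ^ (1 / 2 : ℂ)) ^ 2) ^ 2 := by ring
    _ = - z ^ 2 := by rw [h2]; ring_nf; simp

lemma cpow_half_ne {z : ℂ} (hz : 0 < z.im) : ((-I * z) ^ (1 / 2 : ℂ)) ≠ 0 := by
  intro h
  have := cpow_half_four hz
  rw [h] at this
  have h3 := ne_zero_of_im hz
  have : z ^ 2 = 0 := by simpa using this.symm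
  exact h3 (by simpa using this)

lemma tB_S {z : ℂ} (hz : 0 < z.im) : tB (-1 / z) = - z ^ 2 * tB z := by
  unfold tB th3
  have h := jacobiTheta₂_functional_equation 0 z
  rw [← jacobiTheta_eq_jacobiTheta₂, zero_div, ← jacobiTheta_eq_jacobiTheta₂] at h
  have h1 := cpow_half_ne hz
  have : jacobiTheta (-1 / z) = ((-I * z) ^ (1 / 2 : ℂ)) * jacobiTheta z := by
    generalize (-I * z) ^ (1 / 2 : ℂ) = w at h h1 ⊢
    rw [h]; simp; rw [mul_inv_cancel_left₀ h1]
  rw [this, mul_pow, cpow_half_four hz]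

lemma tA_S {z : ℂ} (hz : 0 < z.im) : tA (-1 / z) = - z ^ 2 * tC z := by
  unfold tA tC
  rw [th4_eq]
  have h := jacobiTheta₂_functional_equation (-1 / 2) z
  have h1 := cpow_half_ne hz
  have h0 := ne_zero_of_im hz
  have : th2 (-1 / z) = ((-I * z) ^ (1 / 2 : ℂ)) * jacobiTheta₂ (-1 / 2) z := by
    rw [h]; unfold th2
    have e1 : (-1 / z / 2) = -1 / 2 / z := by field_simp
    have e2 : (Real.pi : ℂ) * I * (-1 / z) / 4 = -Real.pi * I * (-1 / 2) ^ 2 / z := by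
      field_simp; ring
    rw [e1, e2]; field_simp
  rw [this, mul_pow, cpow_half_four hz]

lemma tC_S {z : ℂ} (hz : 0 < z.im) : tC (-1 / z) = - z ^ 2 * tA z := by
  have h := tA_S (im_S_pos hz)
  have h0 := ne_zero_of_im hz
  rw [show -1 / (-1 / z) = z by field_simp] at h
  rw [h]; field_simp

lemma tendsto_im_add_one : Tendsto (fun z : ℂ => z + 1) iInfty iInfty := by
  rw [tendsto_comap_iff]
  have : (Complex.im ∘ fun z : ℂ => z + 1) = Complex.im := by ext; simp
  rw [this]; exact tendsto_comap

lemma tendsto_exp_iInfty {a : ℝ} (ha : 0 < a) :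
    Tendsto (fun z : ℂ => Real.exp (-a * z.im)) iInfty (nhds 0) := by
  have h : Tendsto (fun y : ℝ => Real.exp (-a * y)) atTop (nhds 0) := by
    apply Real.tendsto_exp_atBot.comp
    exact tendsto_id.const_mul_atTop_of_neg (by linarith)
  exact h.comp tendsto_comap

lemma th3_lim : Tendsto th3 iInfty (nhds 1) := by
  have h := isBigO_at_im_infty_jacobiTheta_sub_one.trans_tendsto (tendsto_exp_iInfty Real.pi_pos)
  have := h.add_const 1
  have h2 : th3 = fun x => jacobiTheta x := rfl
  rw [h2]
  simpa using this

lemma tB_lim : Tendsto tB iInfty (nhds 1) := by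
  have h2 : tB = fun x => th3 x ^ 4 := rfl
  rw [h2]
  simpa using th3_lim.pow 4
lemma tC_lim : Tendsto tC iInfty (nhds 1) := tB_lim.comp tendsto_im_add_one

/-- `∑ exp(π i z n (n+1))`, equal to `th2` up to the exponential factor. -/
lemma th2_hasSum {z : ℂ} (hz : 0 < z.im) :
    HasSum (fun n : ℕ => 2 * cexp (Real.pi * I * z * (n * (n + 1)))) (jacobiTheta₂ (z / 2) z) := by
  have h := (hasSum_jacobiTheta₂_term (z / 2) hz).nat_add_neg_add_one
  convert h using 2 with n
  unfold jacobiTheta₂_term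
  rw [two_mul]; congr 2 <;> push_cast <;> ring

lemma norm_exp_piI (z : ℂ) (x : ℝ) : ‖cexp (Real.pi * I * z * x)‖ = Real.exp (-Real.pi * z.im) ^ x := by
  rw [Complex.norm_exp, ← Real.exp_mul]
  congr 1
  rw [show (Real.pi : ℂ) * I * z * x = ((Real.pi * x : ℝ) : ℂ) * (z * I) by push_cast; ring,
    Complex.re_ofReal_mul, Complex.mul_I_re]; ring

lemma th2_sub_le {z : ℂ} (hz : 0 < z.im) : ‖jacobiTheta₂ (z / 2) z - 2‖ ≤
    2 * (Real.exp (-Real.pi * z.im) / (1 - Real.exp (-Real.pi * z.im))) := by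
  have h := (hasSum_nat_add_iff' 1).mpr (th2_hasSum hz)
  simp only [Finset.sum_range_one, Nat.cast_zero, zero_mul, mul_zero, Complex.exp_zero, mul_one] at h
  set r := Real.exp (-Real.pi * z.im) with hr
  have hr0 : 0 < r := Real.exp_pos _
  have hr1 : r < 1 := Real.exp_lt_one_iff.mpr (by nlinarith [Real.pi_pos])
  have hg : HasSum (fun n : ℕ => 2 * r ^ (n + 1)) (2 * (r / (1 - r))) := by
    apply HasSum.mul_left
    simp_rw [pow_succ', div_eq_mul_inv]
    exact (hasSum_geometric_of_lt_one hr0.le hr1).mul_left r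
  rw [← h.tsum_eq]
  refine tsum_of_norm_bounded hg fun n => ?_
  rw [norm_mul, Complex.norm_two]
  gcongr
  have := norm_exp_piI z (((n + 1 : ℕ) : ℝ) * (((n + 1 : ℕ) : ℝ) + 1))
  push_cast at this ⊢
  rw [this, ← Real.rpow_natCast]
  apply Real.rpow_le_rpow_of_exponent_ge hr0 hr1.le
  push_cast; nlinarith

lemma tA_lim : Tendsto tA iInfty (nhds 0) := by
  have h1 : Tendsto (fun z : ℂ => jacobiTheta₂ (z / 2) z - 2) iInfty (nhds 0) := by
    have h := tendsto_exp_iInfty Real.pi_pos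
    have h2 : Tendsto (fun z : ℂ => 2 * (Real.exp (-Real.pi * z.im) / (1 - Real.exp (-Real.pi * z.im))))
        iInfty (nhds 0) := by
      have := (h.div (h.const_sub 1) (by norm_num)).const_mul 2
      simpa using this
    refine squeeze_zero_norm' ?_ h2
    have : ∀ᶠ z : ℂ in iInfty, 0 < z.im := tendsto_comap.eventually (eventually_gt_atTop 0)
    filter_upwards [this] with z hz using th2_sub_le hz
  have h3 : Tendsto (fun z : ℂ => cexp (Real.pi * I * z / 4)) iInfty (nhds 0) := by
    rw [tendsto_zero_iff_norm_tendsto_zero]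
    have h := tendsto_exp_iInfty (a := Real.pi / 4) (by positivity)
    refine h.congr fun z => ?_
    rw [Complex.norm_exp]; congr 1
    rw [show (Real.pi : ℂ) * I * z / 4 = ((Real.pi / 4 : ℝ) : ℂ) * (z * I) by push_cast; ring,
      Complex.re_ofReal_mul, Complex.mul_I_re]; ring
  have h4 := h3.mul (h1.add_const 2)
  have h5 := h4.pow 4
  have h6 : tA = fun x => (cexp (Real.pi * I * x / 4) * jacobiTheta₂ (x / 2) x) ^ 4 := rfl
  rw [h6]
  simpa using h5

lemma tA_diff {z : ℂ} (hz : 0 < z.im) : DifferentiableAt ℂ tA z := by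
  have h := (hasFDerivAt_jacobiTheta₂ (z / 2) hz).differentiableAt
  have h2 : DifferentiableAt ℂ (fun w : ℂ => ((w / 2, w) : ℂ × ℂ)) z := by fun_prop
  have h3 : DifferentiableAt ℂ (fun w : ℂ => jacobiTheta₂ (w / 2) w) z :=
    DifferentiableAt.comp (g := fun p : ℂ × ℂ => jacobiTheta₂ p.1 p.2) (f := fun w : ℂ => ((w / 2, w) : ℂ × ℂ)) z h h2
  unfold tA th2
  fun_prop
lemma tB_diff {z : ℂ} (hz : 0 < z.im) : DifferentiableAt ℂ tB z := by
  unfold tB th3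
  exact (differentiableAt_jacobiTheta hz).pow 4
lemma tC_diff {z : ℂ} (hz : 0 < z.im) : DifferentiableAt ℂ tC z := by
  have h : DifferentiableAt ℂ tB (z + 1) := tB_diff (by simpa using hz)
  exact DifferentiableAt.comp (g := tB) z h (by fun_prop)

/-- Jacobi's identity. -/
theorem jacobi_id {z : ℂ} (hz : 0 < z.im) : tB z = tA z + tC z := by
  have h := levelOne_zero (f := fun z => (tA z + tC z - tB z) ^ 2) 4 (by norm_num)
    (fun z hz => (((tA_diff hz).add (tC_diff hz)).sub (tB_diff hz)).pow 2)
    (fun z hz => by simp only [tA_T, tB_T, tC_T]; ring)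
    (fun z hz => by simp only [tA_S hz, tB_S hz, tC_S hz]; ring)
    (by simpa using ((tA_lim.add tC_lim).sub tB_lim).pow 2) z hz
  have h2 : tA z + tC z - tB z = 0 := by simpa using h
  linear_combination -h2

end UO

namespace UO
open Complex

lemma isOpen_im_pos : IsOpen {z : ℂ | 0 < z.im} := isOpen_lt continuous_const Complex.continuous_im

lemma ev_im_pos {z : ℂ} (hz : 0 < z.im) : ∀ᶠ w in nhds z, 0 < w.im := isOpen_im_pos.mem_nhds hz

/-- Cauchy estimate: derivatives tend to zero at `i∞`. -/
lemma deriv_lim {f : ℂ → ℂ} {l : ℂ} (hf : ∀ z : ℂ, 0 < z.im → DifferentiableAt ℂ f z)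
    (h : Tendsto f iInfty (nhds l)) : Tendsto (deriv f) iInfty (nhds 0) := by
  rw [Metric.tendsto_nhds] at h ⊢
  intro ε hε
  have h1 := h (ε / 2) (by positivity)
  rw [eventually_comap] at h1 ⊢
  rw [eventually_atTop] at h1 ⊢
  obtain ⟨M, hM⟩ := h1
  refine ⟨max M 0 + 2, fun y hy z hzy => ?_⟩
  have hb : ∀ w ∈ Metric.closedBall z 1, 0 < w.im ∧ M ≤ w.im := by
    intro w hw
    have : |(w - z).im| ≤ 1 := (Complex.abs_im_le_norm _).trans (by simpa [dist_eq_norm] using hw)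
    rw [Complex.sub_im, abs_le] at this
    have h1 := le_max_left M 0
    have h2 := le_max_right M 0
    constructor <;> linarith
  have hd : DiffContOnCl ℂ (fun w => f w - l) (Metric.ball z 1) := by
    apply DifferentiableOn.diffContOnCl
    intro w hw
    have hw' : w ∈ Metric.closedBall z 1 := Metric.closure_ball_subset_closedBall hw
    exact ((hf w (hb w hw').1).sub_const l).differentiableWithinAt
  have h2 := Complex.norm_deriv_le_of_forall_mem_sphere_norm_le (C := ε / 2) one_pos hd (by
    intro w hw
    have hw' := hb w (Metric.sphere_subset_closedBall hw)
    have := hM w.im hw'.2 w rfl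
    rw [dist_eq_norm] at this
    exact this.le)
  rw [deriv_sub_const] at h2
  rw [dist_zero_right]
  linarith

lemma ev_iInfty : ∀ᶠ z : ℂ in iInfty, 0 < z.im := tendsto_comap.eventually (eventually_gt_atTop 0)

instance : (iInfty).NeBot := by
  rw [comap_neBot_iff_frequently]
  apply Frequently.of_forall
  intro y
  exact ⟨y * I, by simp⟩

/-- the product `abc` -/
def tP (z : ℂ) : ℂ := tA z * tB z * tC z

lemma th2_lim : Tendsto (fun z : ℂ => jacobiTheta₂ (z / 2) z) iInfty (nhds 2) := by
  have h1 : Tendsto (fun z : ℂ => jacobiTheta₂ (z / 2) z - 2) iInfty (nhds 0) := by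
    have h := tendsto_exp_iInfty Real.pi_pos
    have h2 : Tendsto (fun z : ℂ => 2 * (Real.exp (-Real.pi * z.im) / (1 - Real.exp (-Real.pi * z.im))))
        iInfty (nhds 0) := by
      have := (h.div (h.const_sub 1) (by norm_num)).const_mul 2
      simpa using this
    refine squeeze_zero_norm' ?_ h2
    filter_upwards [ev_iInfty] with z hz using th2_sub_le hz
  have := h1.add_const 2
  simpa using this

/-- `tA = exp(π i z) * tA0` -/
def tA0 (z : ℂ) : ℂ := jacobiTheta₂ (z / 2) z ^ 4

lemma tA_eq (z : ℂ) : tA z = cexp (Real.pi * I * z) * tA0 z := by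
  unfold tA tA0 th2
  rw [mul_pow, ← Complex.exp_nat_mul]; congr 2; push_cast; ring

lemma tA0_lim : Tendsto tA0 iInfty (nhds 16) := by
  have := th2_lim.pow 4
  norm_num at this
  exact this

lemma tA0_diff {z : ℂ} (hz : 0 < z.im) : DifferentiableAt ℂ tA0 z := by
  have h : tA0 = fun z => cexp (-(Real.pi * I * z)) * tA z := by
    ext z; rw [tA_eq, ← mul_assoc, ← Complex.exp_add]; simp
  rw [h]
  have := tA_diff hz
  fun_prop

lemma tP_diff {z : ℂ} (hz : 0 < z.im) : DifferentiableAt ℂ tP z :=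
  ((tA_diff hz).mul (tB_diff hz)).mul (tC_diff hz)

lemma tP_sq_disc : ∃ k : ℂ, k ≠ 0 ∧ ∀ z : ℂ, 0 < z.im → tP z ^ 2 = k * disc z := by
  obtain ⟨k, hk⟩ := levelOne_disc (f := fun z => tP z ^ 2) (fun z hz => (tP_diff hz).pow 2)
    (fun z hz => by simp only [tP, tA_T, tB_T, tC_T]; ring)
    (fun z hz => by simp only [tP, tA_S hz, tB_S hz, tC_S hz]; ring)
    (by
      have h := ((tA_lim.mul tB_lim).mul tC_lim).pow 2
      norm_num at h; exact h)
  refine ⟨k, ?_, hk⟩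
  rintro rfl
  have h1 : Tendsto (fun z => tA0 z * tB z * tC z) iInfty (nhds (16 * 1 * 1)) :=
    (tA0_lim.mul tB_lim).mul tC_lim
  have h2 := h1.eventually_ne (b₂ := 0) (by norm_num)
  obtain ⟨z, hz, hz2⟩ := (ev_iInfty.and h2).exists
  have h3 := hk z hz
  simp only [zero_mul, tP, tA_eq] at h3
  apply hz2
  have h4 : cexp (Real.pi * I * z) ≠ 0 := Complex.exp_ne_zero _
  have h5 : cexp (Real.pi * I * z) * (tA0 z * tB z * tC z) = 0 := by
    rw [← sq_eq_zero_iff, ← h3]; ring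
  simpa [h4] using h5

lemma tP_ne {z : ℂ} (hz : 0 < z.im) : tP z ≠ 0 := by
  obtain ⟨k, hk, h⟩ := tP_sq_disc
  intro h0
  have h1 := h z hz
  rw [h0] at h1
  have : disc z ≠ 0 := pow_ne_zero _ (ModularForm.eta_ne_zero hz)
  have : k * disc z ≠ 0 := mul_ne_zero hk this
  apply this; rw [← h1]; norm_num

lemma tA_ne {z : ℂ} (hz : 0 < z.im) : tA z ≠ 0 := fun h => tP_ne hz (by simp [tP, h])
lemma tB_ne {z : ℂ} (hz : 0 < z.im) : tB z ≠ 0 := fun h => tP_ne hz (by simp [tP, h])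
lemma tC_ne {z : ℂ} (hz : 0 < z.im) : tC z ≠ 0 := fun h => tP_ne hz (by simp [tP, h])

lemma logDeriv_T {f g : ℂ → ℂ} {c : ℂ} (hc : c ≠ 0) (h : ∀ z : ℂ, f (z + 1) = c * g z) (z : ℂ) :
    logDeriv f (z + 1) = logDeriv g z := by
  have h1 : deriv f (z + 1) = c * deriv g z := by
    rw [← deriv_comp_add_const]
    have : (fun x => f (x + 1)) = fun x => c * g x := funext h
    rw [this, deriv_const_mul_field]
  rw [logDeriv_apply, logDeriv_apply, h1, h, mul_div_mul_left _ _ hc]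

lemma deriv_S {f : ℂ → ℂ} {z : ℂ} (hz : 0 < z.im) (hf : DifferentiableAt ℂ f (-1 / z)) :
    HasDerivAt (fun w => f (-1 / w)) (deriv f (-1 / z) / z ^ 2) z := by
  have h0 := ne_zero_of_im hz
  have h1 : HasDerivAt (fun w : ℂ => -1 / w) (1 / z ^ 2) z := by
    have := (hasDerivAt_const z (-1 : ℂ)).fun_div (hasDerivAt_id z) h0
    refine this.congr_deriv ?_
    simp
  exact (hf.hasDerivAt.comp z h1).congr_deriv (by ring)

lemma logDeriv_S {f g : ℂ → ℂ} (hf : ∀ z : ℂ, 0 < z.im → DifferentiableAt ℂ f z)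
    (hg : ∀ z : ℂ, 0 < z.im → DifferentiableAt ℂ g z) (hg0 : ∀ z : ℂ, 0 < z.im → g z ≠ 0)
    (h : ∀ z : ℂ, 0 < z.im → f (-1 / z) = - z ^ 2 * g z) {z : ℂ} (hz : 0 < z.im) :
    logDeriv f (-1 / z) = z ^ 2 * logDeriv g z + 2 * z := by
  have h0 := ne_zero_of_im hz
  have h1 := deriv_S hz (hf _ (im_S_pos hz))
  have h2 : HasDerivAt (fun w => - w ^ 2 * g w) (-(2 * z) * g z + - z ^ 2 * deriv g z) z := by
    have h3 : HasDerivAt (fun w : ℂ => - w ^ 2) (-(2 * z)) z := by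
      exact (hasDerivAt_pow 2 z).fun_neg.congr_deriv (by simp)
    exact h3.mul (hg z hz).hasDerivAt
  have h4 : (fun w => f (-1 / w)) =ᶠ[nhds z] (fun w => - w ^ 2 * g w) := by
    filter_upwards [ev_im_pos hz] with w hw using h w hw
  have h5 := h1.unique (h2.congr_of_eventuallyEq h4)
  have h6 := hg0 z hz
  rw [logDeriv_apply, logDeriv_apply, h z hz]
  field_simp at h5 ⊢
  linear_combination -h5

lemma logDeriv_diff {f : ℂ → ℂ} (hf : ∀ z : ℂ, 0 < z.im → DifferentiableAt ℂ f z)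
    (hf0 : ∀ z : ℂ, 0 < z.im → f z ≠ 0) {z : ℂ} (hz : 0 < z.im) : DifferentiableAt ℂ (logDeriv f) z := by
  have h1 : DifferentiableOn ℂ f {z | 0 < z.im} := fun w hw => (hf w hw).differentiableWithinAt
  have h2 := (h1.deriv isOpen_im_pos).differentiableAt (isOpen_im_pos.mem_nhds hz)
  exact h2.div (hf z hz) (hf0 z hz)

lemma ldA_lim : Tendsto (logDeriv tA) iInfty (nhds (Real.pi * I)) := by
  have h1 : Tendsto (fun z => Real.pi * I + deriv tA0 z / tA0 z) iInfty (nhds (Real.pi * I + 0 / 16)) :=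
    ((deriv_lim (fun z hz => tA0_diff hz) tA0_lim).div tA0_lim (by norm_num)).const_add _
  rw [zero_div, add_zero] at h1
  refine h1.congr' ?_
  filter_upwards [ev_iInfty] with z hz
  have h2 : tA = fun z => cexp (Real.pi * I * z) * tA0 z := funext tA_eq
  have h3 : tA0 z ≠ 0 := by
    have := tA_ne hz
    rw [tA_eq] at this
    exact right_ne_zero_of_mul this
  rw [h2, logDeriv_mul (f := fun z => cexp (Real.pi * I * z)) z (Complex.exp_ne_zero _) h3 (by fun_prop) (tA0_diff hz), logDeriv_apply, logDeriv_apply]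
  congr 1
  have : HasDerivAt (fun z => cexp (Real.pi * I * z)) (cexp (Real.pi * I * z) * (Real.pi * I)) z := by
    have := ((hasDerivAt_id z).const_mul (Real.pi * I)).cexp
    simpa using this
  rw [this.deriv, mul_div_cancel_left₀ _ (Complex.exp_ne_zero _)]

lemma ldB_lim : Tendsto (logDeriv tB) iInfty (nhds 0) := by
  have h := (deriv_lim (fun z hz => tB_diff hz) tB_lim).div tB_lim (by norm_num)
  rw [zero_div] at h; exact h
lemma ldC_lim : Tendsto (logDeriv tC) iInfty (nhds 0) := by
  have h := (deriv_lim (fun z hz => tC_diff hz) tC_lim).div tC_lim (by norm_num)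
  rw [zero_div] at h; exact h

lemma ldA_T (z : ℂ) : logDeriv tA (z + 1) = logDeriv tA z :=
  logDeriv_T (c := -1) (by norm_num) (fun z => by rw [tA_T]; ring) z
lemma ldB_T (z : ℂ) : logDeriv tB (z + 1) = logDeriv tC z :=
  logDeriv_T (c := 1) (by norm_num) (fun z => by rw [tB_T]; ring) z
lemma ldC_T (z : ℂ) : logDeriv tC (z + 1) = logDeriv tB z :=
  logDeriv_T (c := 1) (by norm_num) (fun z => by rw [tC_T]; ring) z
lemma ldA_S {z : ℂ} (hz : 0 < z.im) : logDeriv tA (-1 / z) = z ^ 2 * logDeriv tC z + 2 * z :=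
  logDeriv_S (fun _ h => tA_diff h) (fun _ h => tC_diff h) (fun _ h => tC_ne h) (fun _ h => tA_S h) hz
lemma ldB_S {z : ℂ} (hz : 0 < z.im) : logDeriv tB (-1 / z) = z ^ 2 * logDeriv tB z + 2 * z :=
  logDeriv_S (fun _ h => tB_diff h) (fun _ h => tB_diff h) (fun _ h => tB_ne h) (fun _ h => tB_S h) hz
lemma ldC_S {z : ℂ} (hz : 0 < z.im) : logDeriv tC (-1 / z) = z ^ 2 * logDeriv tA z + 2 * z :=
  logDeriv_S (fun _ h => tC_diff h) (fun _ h => tA_diff h) (fun _ h => tA_ne h) (fun _ h => tC_S h) hz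
lemma ldA_diff {z : ℂ} (hz : 0 < z.im) : DifferentiableAt ℂ (logDeriv tA) z :=
  logDeriv_diff (fun _ h => tA_diff h) (fun _ h => tA_ne h) hz
lemma ldB_diff {z : ℂ} (hz : 0 < z.im) : DifferentiableAt ℂ (logDeriv tB) z :=
  logDeriv_diff (fun _ h => tB_diff h) (fun _ h => tB_ne h) hz
lemma ldC_diff {z : ℂ} (hz : 0 < z.im) : DifferentiableAt ℂ (logDeriv tC) z :=
  logDeriv_diff (fun _ h => tC_diff h) (fun _ h => tC_ne h) hz

def auxU (z : ℂ) : ℂ := logDeriv tA z - logDeriv tB z - Real.pi * I * tC z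
def auxV (z : ℂ) : ℂ := logDeriv tC z - logDeriv tB z + Real.pi * I * tA z

lemma auxU_diff {z : ℂ} (hz : 0 < z.im) : DifferentiableAt ℂ auxU z :=
  ((ldA_diff hz).sub (ldB_diff hz)).sub ((tC_diff hz).const_mul _)
lemma auxV_diff {z : ℂ} (hz : 0 < z.im) : DifferentiableAt ℂ auxV z :=
  ((ldC_diff hz).sub (ldB_diff hz)).add ((tA_diff hz).const_mul _)
lemma auxU_lim : Tendsto auxU iInfty (nhds 0) := by
  have h := (ldA_lim.sub ldB_lim).sub (tC_lim.const_mul (Real.pi * I))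
  rw [show (Real.pi * I - 0 - Real.pi * I * 1 : ℂ) = 0 by ring] at h; exact h
lemma auxV_lim : Tendsto auxV iInfty (nhds 0) := by
  have h := (ldC_lim.sub ldB_lim).add (tA_lim.const_mul (Real.pi * I))
  rw [show (0 - 0 + Real.pi * I * 0 : ℂ) = 0 by ring] at h; exact h
lemma auxU_T {z : ℂ} (hz : 0 < z.im) : auxU (z + 1) = auxU z - auxV z := by
  unfold auxU auxV
  rw [ldA_T, ldB_T, tC_T, jacobi_id hz]; ring
lemma auxV_T {z : ℂ} : auxV (z + 1) = - auxV z := by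
  unfold auxV
  rw [ldC_T, ldB_T, tA_T]; ring
lemma auxU_S {z : ℂ} (hz : 0 < z.im) : auxU (-1 / z) = z ^ 2 * auxV z := by
  unfold auxU auxV
  rw [ldA_S hz, ldB_S hz, tC_S hz]; ring
lemma auxV_S {z : ℂ} (hz : 0 < z.im) : auxV (-1 / z) = z ^ 2 * auxU z := by
  unfold auxU auxV
  rw [ldC_S hz, ldB_S hz, tA_S hz]; ring

lemma auxUV_zero {z : ℂ} (hz : 0 < z.im) : auxU z = 0 ∧ auxV z = 0 := by
  have h1 := levelOne_zero (f := fun z => auxU z ^ 2 - auxU z * auxV z + auxV z ^ 2) 4 (by norm_num)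
    (fun z hz => (((auxU_diff hz).pow 2).sub ((auxU_diff hz).mul (auxV_diff hz))).add ((auxV_diff hz).pow 2))
    (fun z hz => by simp only [auxU_T hz, auxV_T]; ring)
    (fun z hz => by simp only [auxU_S hz, auxV_S hz]; ring)
    (by simpa using ((auxU_lim.pow 2).sub (auxU_lim.mul auxV_lim)).add (auxV_lim.pow 2)) z hz
  have h2 := levelOne_zero (f := fun z => (auxU z + auxV z) * (2 * auxU z - auxV z) * (2 * auxV z - auxU z))
    6 (by norm_num)
    (fun z hz => (((auxU_diff hz).add (auxV_diff hz)).mul (((auxU_diff hz).const_mul 2).sub (auxV_diff hz))).mul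
      (((auxV_diff hz).const_mul 2).sub (auxU_diff hz)))
    (fun z hz => by simp only [auxU_T hz, auxV_T]; ring)
    (fun z hz => by simp only [auxU_S hz, auxV_S hz]; ring)
    (by simpa using ((auxU_lim.add auxV_lim).mul ((auxU_lim.const_mul 2).sub auxV_lim)).mul ((auxV_lim.const_mul 2).sub auxU_lim)) z hz
  simp only [mul_eq_zero] at h1 h2
  generalize auxU z = u at *
  generalize auxV z = v at *
  rcases h2 with (h2 | h2) | h2
  · have hu : u = -v := by linear_combination h2
    subst hu
    have : v ^ 2 = 0 := by linear_combination h1 / 3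
    have : v = 0 := by simpa using this
    simp [this]
  · have hv : v = 2 * u := by linear_combination -h2
    subst hv
    have : u ^ 2 = 0 := by linear_combination h1 / 3
    have : u = 0 := by simpa using this
    simp [this]
  · have hu : u = 2 * v := by linear_combination -h2
    subst hu
    have : v ^ 2 = 0 := by linear_combination h1 / 3
    have : v = 0 := by simpa using this
    simp [this]

/-- Eisenstein series of weight two (through the logarithmic derivative of `abc`). -/
def mP (z : ℂ) : ℂ := (logDeriv tA z + logDeriv tB z + logDeriv tC z) / (Real.pi * I)
def mQ (z : ℂ) : ℂ := tA z ^ 2 + tA z * tC z + tC z ^ 2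
def mR (z : ℂ) : ℂ := (2 * tA z + tC z) * (tA z + 2 * tC z) * (tC z - tA z) / 2
def mD (z : ℂ) : ℂ := tP z ^ 2 / 256

lemma piI_ne : (Real.pi * I : ℂ) ≠ 0 := by simp [Real.pi_ne_zero]

lemma tA_deriv {z : ℂ} (hz : 0 < z.im) :
    HasDerivAt tA (Real.pi * I / 3 * tA z * (mP z + tA z + 2 * tC z)) z := by
  obtain ⟨hu, hv⟩ := auxUV_zero hz
  have h := (tA_diff hz).hasDerivAt
  refine h.congr_deriv ?_
  have h1 : deriv tA z = tA z * logDeriv tA z := by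
    rw [logDeriv_apply, mul_div_cancel₀ _ (tA_ne hz)]
  rw [h1]; unfold mP auxU auxV at *
  have := piI_ne
  field_simp
  linear_combination tA z * (2 * hu - hv)
lemma tC_deriv {z : ℂ} (hz : 0 < z.im) :
    HasDerivAt tC (Real.pi * I / 3 * tC z * (mP z - 2 * tA z - tC z)) z := by
  obtain ⟨hu, hv⟩ := auxUV_zero hz
  have h := (tC_diff hz).hasDerivAt
  refine h.congr_deriv ?_
  have h1 : deriv tC z = tC z * logDeriv tC z := by
    rw [logDeriv_apply, mul_div_cancel₀ _ (tC_ne hz)]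
  rw [h1]; unfold mP auxU auxV at *
  have := piI_ne
  field_simp
  linear_combination tC z * (-hu + 2 * hv)

lemma mP_T (z : ℂ) : mP (z + 1) = mP z := by
  unfold mP; rw [ldA_T, ldB_T, ldC_T]; ring
lemma mP_S {z : ℂ} (hz : 0 < z.im) : mP (-1 / z) = z ^ 2 * mP z + 6 * z / (Real.pi * I) := by
  unfold mP; rw [ldA_S hz, ldB_S hz, ldC_S hz]
  have := piI_ne
  field_simp; ring
lemma mP_lim : Tendsto mP iInfty (nhds 1) := by
  have h := ((ldA_lim.add ldB_lim).add ldC_lim).div_const (Real.pi * I)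
  rw [add_zero, add_zero, div_self piI_ne] at h; exact h
lemma mP_diff {z : ℂ} (hz : 0 < z.im) : DifferentiableAt ℂ mP z :=
  (((ldA_diff hz).add (ldB_diff hz)).add (ldC_diff hz)).div_const _

lemma mQ_T {z : ℂ} (hz : 0 < z.im) : mQ (z + 1) = mQ z := by
  unfold mQ; rw [tA_T, tC_T, jacobi_id hz]; ring
lemma mQ_S {z : ℂ} (hz : 0 < z.im) : mQ (-1 / z) = z ^ 4 * mQ z := by
  unfold mQ; rw [tA_S hz, tC_S hz]; ring
lemma mR_T {z : ℂ} (hz : 0 < z.im) : mR (z + 1) = mR z := by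
  unfold mR; rw [tA_T, tC_T, jacobi_id hz]; ring
lemma mR_S {z : ℂ} (hz : 0 < z.im) : mR (-1 / z) = z ^ 6 * mR z := by
  unfold mR; rw [tA_S hz, tC_S hz]; ring
lemma mD_T {z : ℂ} : mD (z + 1) = mD z := by
  unfold mD tP; rw [tA_T, tB_T, tC_T]; ring
lemma mD_S {z : ℂ} (hz : 0 < z.im) : mD (-1 / z) = z ^ 12 * mD z := by
  unfold mD tP; rw [tA_S hz, tC_S hz, tB_S hz]; ring
lemma mQ_lim : Tendsto mQ iInfty (nhds 1) := by
  have h := ((tA_lim.pow 2).add (tA_lim.mul tC_lim)).add (tC_lim.pow 2)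
  norm_num at h; exact h
lemma mR_lim : Tendsto mR iInfty (nhds 1) := by
  have h := (((tA_lim.const_mul 2).add tC_lim).mul (tA_lim.add (tC_lim.const_mul 2))).mul (tC_lim.sub tA_lim) |>.div_const 2
  norm_num at h; exact h
lemma mD_lim : Tendsto mD iInfty (nhds 0) := by
  have h := (((tA_lim.mul tB_lim).mul tC_lim).pow 2).div_const 256
  norm_num at h; exact h
lemma mQ_diff {z : ℂ} (hz : 0 < z.im) : DifferentiableAt ℂ mQ z := by
  have := tA_diff hz; have := tC_diff hz
  unfold mQ; fun_prop
lemma mR_diff {z : ℂ} (hz : 0 < z.im) : DifferentiableAt ℂ mR z := by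
  have := tA_diff hz; have := tC_diff hz
  unfold mR; fun_prop
lemma mD_diff {z : ℂ} (hz : 0 < z.im) : DifferentiableAt ℂ mD z := by
  have := tP_diff hz
  unfold mD; fun_prop
lemma mD_ne {z : ℂ} (hz : 0 < z.im) : mD z ≠ 0 := by
  have := tP_ne hz
  unfold mD; exact div_ne_zero (pow_ne_zero _ this) (by norm_num)
lemma mD_eq {z : ℂ} (hz : 0 < z.im) : mQ z ^ 3 - mR z ^ 2 = 1728 * mD z := by
  unfold mQ mR mD tP; rw [jacobi_id hz]; ring

lemma mQ_deriv {z : ℂ} (hz : 0 < z.im) :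
    HasDerivAt mQ (2 * Real.pi * I / 3 * (mP z * mQ z - mR z)) z := by
  have ha := tA_deriv hz
  have hc := tC_deriv hz
  have := ((ha.pow 2).add (ha.mul hc)).add (hc.pow 2)
  refine this.congr_deriv ?_
  simp only [mQ, mR]
  push_cast; ring
lemma mR_deriv {z : ℂ} (hz : 0 < z.im) :
    HasDerivAt mR (Real.pi * I * (mP z * mR z - mQ z ^ 2)) z := by
  have ha := tA_deriv hz
  have hc := tC_deriv hz
  have := ((((ha.const_mul 2).add hc).mul (ha.add (hc.const_mul 2))).mul (hc.sub ha)).div_const 2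
  refine this.congr_deriv ?_
  simp only [mQ, mR]
  simp; ring
lemma mP_deriv {z : ℂ} (hz : 0 < z.im) :
    HasDerivAt mP (Real.pi * I / 6 * (mP z ^ 2 - mQ z)) z := by
  have h2 : ∀ z : ℂ, 0 < z.im → DifferentiableAt ℂ (deriv mP) z := by
    intro z hz
    have h1 : DifferentiableOn ℂ mP {z | 0 < z.im} := fun w hw => (mP_diff hw).differentiableWithinAt
    exact (h1.deriv isOpen_im_pos).differentiableAt (isOpen_im_pos.mem_nhds hz)
  have h1 := levelOne_zero (f := fun z => deriv mP z - Real.pi * I / 6 * (mP z ^ 2 - mQ z)) 4 (by norm_num)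
    (fun z hz => (h2 z hz).sub ((((mP_diff hz).pow 2).sub (mQ_diff hz)).const_mul _))
    (fun z hz => by
      simp only [mP_T, mQ_T hz]
      rw [← deriv_comp_add_const]
      simp only [mP_T])
    (fun z hz => by
      have e1 := deriv_S hz (mP_diff (im_S_pos hz))
      have e2 : HasDerivAt (fun z => z ^ 2 * mP z + 6 * z / (Real.pi * I))
          (2 * z * mP z + z ^ 2 * deriv mP z + 6 / (Real.pi * I)) z := by
        have i1 := (hasDerivAt_pow 2 z).mul (mP_diff hz).hasDerivAt
        have i2 := ((hasDerivAt_id z).const_mul 6).div_const (Real.pi * I)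
        exact (i1.add i2).congr_deriv (by simp)
      have e3 : (fun w => mP (-1 / w)) =ᶠ[nhds z] (fun z => z ^ 2 * mP z + 6 * z / (Real.pi * I)) := by
        filter_upwards [ev_im_pos hz] with w hw using mP_S hw
      have e4 := e1.unique (e2.congr_of_eventuallyEq e3)
      have h0 := ne_zero_of_im hz
      have e5 : deriv mP (-1 / z) = z ^ 2 * (2 * z * mP z + z ^ 2 * deriv mP z + 6 / (Real.pi * I)) := by
        rw [← e4]; field_simp
      rw [e5, mP_S hz, mQ_S hz]
      have hpi : (Real.pi : ℂ) ≠ 0 := by simp [Real.pi_ne_zero]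
      field_simp
      ring)
    (by
      have := (deriv_lim (fun z hz => mP_diff hz) mP_lim).sub (((mP_lim.pow 2).sub mQ_lim).const_mul (Real.pi * I / 6))
      simpa using this) z hz
  have h3 := (mP_diff hz).hasDerivAt
  have h4 : deriv mP z = Real.pi * I / 6 * (mP z ^ 2 - mQ z) := by
    linear_combination h1
  rwa [h4] at h3

end UO

namespace UO
open Complex

lemma hasSum_congr' {ι E : Type*} [AddCommMonoid E] [TopologicalSpace E] {f g : ι → E} {a : E}
    (h : ∀ i, f i = g i) : HasSum f a ↔ HasSum g a := by rw [funext h]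

lemma hasSum_pi_prod {f : ℤ → ℂ} {s : ℂ} (hf : HasSum f s) (n : ℕ) :
    HasSum (fun x : Fin n → ℤ => ∏ i, f (x i)) (s ^ n) ∧ Summable (fun x : Fin n → ℤ => ‖∏ i, f (x i)‖) := by
  induction n with
  | zero =>
    constructor
    · simp
    · exact Summable.of_finite
  | succ n ih =>
    have h1 : HasSum (fun x : Fin (n + 1) → ℤ => ∏ i, f (x i)) (s ^ (n + 1)) := by
      rw [← (Fin.consEquiv (fun _ : Fin (n + 1) => ℤ)).hasSum_iff, pow_succ']
      have h2 := summable_mul_of_summable_norm (f := f) (g := fun x : Fin n → ℤ => ∏ i, f (x i)) hf.summable.norm ih.2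
      have := hf.mul ih.1 h2
      refine (hasSum_congr' fun x => ?_).mpr (this)
      simp [Fin.consEquiv, Fin.prod_univ_succ]
    exact ⟨h1, h1.summable.norm⟩

lemma hs3 {z : ℂ} (hz : 0 < z.im) : HasSum (fun n : ℤ => cexp (Real.pi * I * z * (n : ℂ) ^ 2)) (th3 z) := by
  have := hasSum_jacobiTheta₂_term 0 hz
  rw [← jacobiTheta_eq_jacobiTheta₂] at this
  refine (hasSum_congr' fun n => ?_).mpr (this)
  unfold jacobiTheta₂_term; congr 1; ring
lemma neg_one_zpow_exp (n : ℤ) : cexp (Real.pi * I * (n : ℂ) ^ 2) = (-1) ^ n := by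
  have h := exp_pi_even n
  rw [mul_add, Complex.exp_add, mul_comm (Real.pi * I : ℂ) (n : ℂ), Complex.exp_int_mul, Complex.exp_pi_mul_I] at h
  have h2 : ((-1 : ℂ) ^ n) * (-1) ^ n = 1 := by rw [← mul_zpow]; simp
  have h3 : ((-1 : ℂ) ^ n) ≠ 0 := zpow_ne_zero _ (by norm_num)
  exact mul_left_cancel₀ h3 (h.trans h2.symm)
lemma hs4 {z : ℂ} (hz : 0 < z.im) : HasSum (fun n : ℤ => (-1) ^ n * cexp (Real.pi * I * z * (n : ℂ) ^ 2)) (th4 z) := by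
  have := hs3 (z := z + 1) (by simpa using hz)
  refine (hasSum_congr' fun n => ?_).mpr (this)
  rw [← neg_one_zpow_exp, ← Complex.exp_add]; congr 1; ring
lemma hs2 {z : ℂ} (hz : 0 < z.im) : HasSum (fun n : ℤ => cexp (Real.pi * I * z * ((n : ℂ) + 1 / 2) ^ 2)) (th2 z) := by
  have := (hasSum_jacobiTheta₂_term (z / 2) hz).mul_left (cexp (Real.pi * I * z / 4))
  refine (hasSum_congr' fun n => ?_).mpr (this)
  unfold jacobiTheta₂_term
  rw [← Complex.exp_add]; congr 1; ring
lemma hs2' {z : ℂ} (hz : 0 < z.im) :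
    HasSum (fun n : ℤ => (-1) ^ n * cexp (Real.pi * I * z * ((n : ℂ) + 1 / 2) ^ 2)) 0 := by
  have h1 : Summable (fun n : ℤ => (-1) ^ n * cexp (Real.pi * I * z * ((n : ℂ) + 1 / 2) ^ 2)) := by
    apply Summable.of_norm
    refine (hs2 hz).summable.norm.congr fun n => ?_
    simp
  obtain ⟨s, hs⟩ := h1
  have h2 := ((Equiv.subLeft (-1 : ℤ)).hasSum_iff).mpr hs
  have h3 : HasSum (fun n : ℤ => (-1) ^ n * cexp (Real.pi * I * z * ((n : ℂ) + 1 / 2) ^ 2)) (-s) := by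
    refine (hasSum_congr' fun n => ?_).mpr (h2.neg)
    simp only [Function.comp, Equiv.subLeft_apply]
    rw [zpow_sub₀ (by norm_num)]
    push_cast
    rw [show ((-1 - n + 1 / 2 : ℂ)) ^ 2 = (n + 1 / 2) ^ 2 by ring]
    have h4 : ((-1 : ℂ) ^ n) * (-1) ^ n = 1 := by rw [← mul_zpow]; simp
    have h3 : ((-1 : ℂ) ^ n) ≠ 0 := zpow_ne_zero _ (by norm_num)
    field_simp
    linear_combination h4
  have h4 := hs.unique h3
  have : s = 0 := by linear_combination h4 / 2
  rwa [this] at hs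

/-- half-sum over even coordinate sum -/
lemma hasSum_even {v : ℤ → ℝ} {s t : ℂ} (h1 : HasSum (fun n => ((v n : ℝ) : ℂ)) s)
    (h2 : HasSum (fun n => (-1) ^ n * ((v n : ℝ) : ℂ)) t) :
    HasSum (fun x : Fin 8 → ℤ => if Even (∑ i, x i) then ∏ i, v (x i) else 0) (((s ^ 8 + t ^ 8) / 2).re) := by
  have h := (((hasSum_pi_prod h1 8).1.add (hasSum_pi_prod h2 8).1).div_const 2)
  have h3 := Complex.hasSum_re h
  refine (hasSum_congr' fun x => ?_).mpr (h3)
  have e : ∏ i, ((-1 : ℂ) ^ (x i) * ((v (x i) : ℝ) : ℂ)) = (-1) ^ (∑ i, x i) * ∏ i, ((v (x i) : ℝ) : ℂ) := by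
    rw [Finset.prod_mul_distrib]
    congr 1
    simp only [Fin.prod_univ_eight, Fin.sum_univ_eight]
    simp only [zpow_add₀ (show (-1 : ℂ) ≠ 0 by norm_num)]
  rw [e, ← Complex.ofReal_prod]
  split_ifs with hx
  · rw [hx.neg_one_zpow, one_mul, ← Complex.ofReal_add]
    have : ((∏ i, v (x i) + ∏ i, v (x i) : ℝ) : ℂ) / 2 = ((∏ i, v (x i) : ℝ) : ℂ) := by push_cast; ring
    rw [this, Complex.ofReal_re]
  · rw [(Int.not_even_iff_odd.mp hx).neg_one_zpow]
    simp

def vI (y : ℝ) (n : ℤ) : ℝ := Real.exp (-(Real.pi * y) * (n : ℝ) ^ 2)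
def vH (y : ℝ) (n : ℤ) : ℝ := Real.exp (-(Real.pi * y) * ((n : ℝ) + 1 / 2) ^ 2)

lemma im_yI {y : ℝ} (hy : 0 < y) : 0 < ((y : ℂ) * I).im := by simpa using hy

lemma hasSum_int {y : ℝ} (hy : 0 < y) :
    HasSum (fun x : Fin 8 → ℤ => if Even (∑ i, x i) then ∏ i, vI y (x i) else 0)
      (((th3 (y * I) ^ 8 + th4 (y * I) ^ 8) / 2).re) := by
  have e : ∀ n : ℤ, ((vI y n : ℝ) : ℂ) = cexp (Real.pi * I * (y * I) * (n : ℂ) ^ 2) := by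
    intro n; unfold vI; push_cast; congr 1
    linear_combination (-(Real.pi : ℂ) * y * n ^ 2) * Complex.I_sq
  apply hasSum_even
  · simp only [e]; exact hs3 (im_yI hy)
  · simp only [e]; exact hs4 (im_yI hy)
lemma hasSum_half {y : ℝ} (hy : 0 < y) :
    HasSum (fun x : Fin 8 → ℤ => if Even (∑ i, x i) then ∏ i, vH y (x i) else 0)
      (((th2 (y * I) ^ 8 + 0 ^ 8) / 2).re) := by
  have e : ∀ n : ℤ, ((vH y n : ℝ) : ℂ) = cexp (Real.pi * I * (y * I) * ((n : ℂ) + 1 / 2) ^ 2) := by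
    intro n; unfold vH; push_cast; congr 1
    linear_combination (-(Real.pi : ℂ) * y * ((n : ℂ) + 1 / 2) ^ 2) * Complex.I_sq
  apply hasSum_even
  · simp only [e]; exact hs2 (im_yI hy)
  · simp only [e]; exact hs2' (im_yI hy)

def embI (x : Fin 8 → ℤ) : V8 := WithLp.toLp 2 (fun i => (x i : ℝ))
def embH (x : Fin 8 → ℤ) : V8 := WithLp.toLp 2 (fun i => (x i : ℝ) + 1 / 2)

lemma exp_embI (y : ℝ) (x : Fin 8 → ℤ) : Real.exp (-(Real.pi * y) * ‖embI x‖ ^ 2) = ∏ i, vI y (x i) := by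
  unfold vI
  rw [← Real.exp_sum, EuclideanSpace.norm_sq_eq, ← Finset.mul_sum]
  simp [embI]
lemma exp_embH (y : ℝ) (x : Fin 8 → ℤ) : Real.exp (-(Real.pi * y) * ‖embH x‖ ^ 2) = ∏ i, vH y (x i) := by
  unfold vH
  rw [← Real.exp_sum, EuclideanSpace.norm_sq_eq, ← Finset.mul_sum]
  simp [embH]

theorem E8_sum_le {y : ℝ} (hy : 0 < y) :
    ∑' x : ↥(E8 \ {0}), ENNReal.ofReal (Real.exp (-(Real.pi * y) * ‖(x : V8)‖ ^ 2))
      ≤ ENNReal.ofReal ((mQ (y * I)).re - 1) := by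
  let SI : Set (Fin 8 → ℤ) := {x | Even (∑ i, x i) ∧ x ≠ 0}
  let SH : Set (Fin 8 → ℤ) := {x | Even (∑ i, x i)}
  have hI : HasSum (fun x : Fin 8 → ℤ => SI.indicator (fun x => ∏ i, vI y (x i)) x)
      ((((th3 (y * I) ^ 8 + th4 (y * I) ^ 8) / 2).re) - 1) := by
    have h1 := (hasSum_int hy).sub (hasSum_ite_eq (0 : Fin 8 → ℤ) (1 : ℝ))
    refine (hasSum_congr' fun x => ?_).mpr (h1)
    by_cases hx : x = 0
    · subst hx
      simp [SI, vI]
    · by_cases h2 : Even (∑ i, x i) <;> simp [SI, hx, h2, Set.indicator]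
  have hH : HasSum (fun x : Fin 8 → ℤ => SH.indicator (fun x => ∏ i, vH y (x i)) x)
      (((th2 (y * I) ^ 8 + 0 ^ 8) / 2).re) := by
    refine (hasSum_congr' fun x => ?_).mpr (hasSum_half hy)
    by_cases h2 : Even (∑ i, x i) <;> simp [SH, h2, Set.indicator]
  have hI' := hasSum_subtype_iff_indicator.mpr hI
  have hH' := hasSum_subtype_iff_indicator.mpr hH
  have key : E8 \ {0} ⊆ (Set.image embI SI) ∪ (Set.image embH SH) := by
    rintro x ⟨⟨h1, m, hm⟩, h0⟩
    rcases h1 with h1 | h1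
    · left
      choose n hn using h1
      refine ⟨n, ⟨?_, ?_⟩, ?_⟩
      · refine ⟨m, ?_⟩
        simp only [hn] at hm
        have : ((∑ i, n i : ℤ) : ℝ) = ((m + m : ℤ) : ℝ) := by push_cast; rw [hm]; ring
        exact_mod_cast this
      · rintro rfl
        apply h0
        ext i; simp [hn]
      · ext i; simp [embI, hn]
    · right
      choose n hn using h1
      refine ⟨n, ?_, ?_⟩
      · refine ⟨m - 2, ?_⟩
        simp only [hn] at hm
        have : ((∑ i, n i : ℤ) : ℝ) = (((m - 2) + (m - 2) : ℤ) : ℝ) := by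
          push_cast
          rw [Finset.sum_add_distrib] at hm
          simp at hm
          linarith
        exact_mod_cast this
      · ext i; simp [embH, hn]
  let F : V8 → ℝ≥0∞ := fun x => ENNReal.ofReal (Real.exp (-(Real.pi * y) * ‖x‖ ^ 2))
  calc ∑' x : ↥(E8 \ {0}), F x ≤ ∑' x : ↥((Set.image embI SI) ∪ (Set.image embH SH)), F x := ENNReal.tsum_mono_subtype F key
    _ ≤ ∑' x : ↥(Set.image embI SI), F x + ∑' x : ↥(Set.image embH SH), F x := ENNReal.tsum_union_le F _ _
    _ ≤ ∑' x : SI, F (embI x) + ∑' x : SH, F (embH x) := by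
        gcongr
        · exact ENNReal.tsum_le_tsum_comp_of_surjective (f := fun x : SI => (⟨embI x, x, x.2, rfl⟩ : ↥(Set.image embI SI)))
            (by rintro ⟨_, x, hx, rfl⟩; exact ⟨⟨x, hx⟩, rfl⟩) (fun x : ↥(Set.image embI SI) => F x)
        · exact ENNReal.tsum_le_tsum_comp_of_surjective (f := fun x : SH => (⟨embH x, x, x.2, rfl⟩ : ↥(Set.image embH SH)))
            (by rintro ⟨_, x, hx, rfl⟩; exact ⟨⟨x, hx⟩, rfl⟩) (fun x : ↥(Set.image embH SH) => F x)
    _ = ENNReal.ofReal ((((th3 (y * I) ^ 8 + th4 (y * I) ^ 8) / 2).re) - 1) +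
          ENNReal.ofReal (((th2 (y * I) ^ 8 + 0 ^ 8) / 2).re) := by
        rw [← hI'.tsum_eq, ← hH'.tsum_eq, ENNReal.ofReal_tsum_of_nonneg _ hI'.summable,
          ENNReal.ofReal_tsum_of_nonneg _ hH'.summable]
        · simp only [F, exp_embI, exp_embH, Function.comp]
        · intro x; exact Finset.prod_nonneg fun i _ => (Real.exp_pos _).le
        · intro x; exact Finset.prod_nonneg fun i _ => (Real.exp_pos _).le
    _ = ENNReal.ofReal ((mQ (y * I)).re - 1) := by
        rw [← ENNReal.ofReal_add]
        · congr 1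
          have e : mQ (y * I) = (th3 (y * I) ^ 8 + th4 (y * I) ^ 8) / 2 + (th2 (y * I) ^ 8 + 0 ^ 8) / 2 := by
            have := jacobi_id (im_yI hy)
            have e2 : (th3 (y * I) ^ 8 + th4 (y * I) ^ 8) / 2 + (th2 (y * I) ^ 8 + 0 ^ 8) / 2 =
              (tB (y * I) ^ 2 + tC (y * I) ^ 2 + tA (y * I) ^ 2) / 2 := by unfold tA tB tC; ring
            rw [e2, this]; unfold mQ; ring
          rw [e, Complex.add_re]; ring
        · rw [← hI'.tsum_eq]; exact tsum_nonneg fun x => Finset.prod_nonneg fun i _ => (Real.exp_pos _).le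
        · rw [← hH'.tsum_eq]; exact tsum_nonneg fun x => Finset.prod_nonneg fun i _ => (Real.exp_pos _).le

end UO

namespace UO
open Complex

/-! ### Real functions on the imaginary axis -/

lemma conj_tI (t : ℝ) : -(starRingEnd ℂ) ((t : ℂ) * I) = t * I := by simp

lemma th2_axis (t : ℝ) : (th2 (t * I)).im = 0 := by
  have h1 : (starRingEnd ℂ) (jacobiTheta₂ (t * I / 2) (t * I)) = jacobiTheta₂ (t * I / 2) (t * I) := by
    rw [jacobiTheta₂_conj, conj_tI, ← jacobiTheta₂_neg_left]
    congr 1; simp [Complex.conj_ofNat, neg_div]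
  have h2 : (starRingEnd ℂ) (cexp (Real.pi * I * (t * I) / 4)) = cexp (Real.pi * I * (t * I) / 4) := by
    rw [← Complex.exp_conj]; congr 1; simp [Complex.conj_ofNat]
  rw [← Complex.conj_eq_iff_im]
  unfold th2
  rw [map_mul, h1, h2]

lemma th4_axis (t : ℝ) : (th4 (t * I)).im = 0 := by
  rw [← Complex.conj_eq_iff_im]
  unfold th4
  rw [jacobiTheta_eq_jacobiTheta₂, jacobiTheta₂_conj]
  have := jacobiTheta_two_add (-(starRingEnd ℂ) ((t : ℂ) * I + 1))
  rw [jacobiTheta_eq_jacobiTheta₂, jacobiTheta_eq_jacobiTheta₂] at this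
  rw [map_zero, ← this]; congr 1; simp; ring

lemma pow4_axis {w : ℂ} (h : w.im = 0) : w ^ 4 = ((w ^ 4).re : ℂ) ∧ 0 ≤ (w ^ 4).re := by
  have hw : w = (w.re : ℂ) := by apply Complex.ext <;> simp [h]
  have h4 : w ^ 4 = ((w.re ^ 4 : ℝ) : ℂ) := by rw [hw]; push_cast; simp
  rw [h4, Complex.ofReal_re]
  exact ⟨rfl, by positivity⟩

def xa (t : ℝ) : ℝ := (tA (t * I)).re
def xc (t : ℝ) : ℝ := (tC (t * I)).re
def xb (t : ℝ) : ℝ := xa t + xc t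
def xP (t : ℝ) : ℝ := (mP (t * I)).re
def xQ (t : ℝ) : ℝ := xa t ^ 2 + xa t * xc t + xc t ^ 2
def xR (t : ℝ) : ℝ := (2 * xa t + xc t) * (xa t + 2 * xc t) * (xc t - xa t) / 2
def xD (t : ℝ) : ℝ := (xa t * xb t * xc t) ^ 2 / 256
def xu (t : ℝ) : ℝ := xP t * xQ t - xR t

lemma xa_eq (t : ℝ) : tA (t * I) = xa t := (pow4_axis (th2_axis t)).1
lemma xc_eq (t : ℝ) : tC (t * I) = xc t := (pow4_axis (th4_axis t)).1
lemma xb_eq {t : ℝ} (ht : 0 < t) : tB (t * I) = xb t := by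
  rw [jacobi_id (im_yI ht), xa_eq, xc_eq, xb]; push_cast; ring
lemma xQ_eq (t : ℝ) : mQ (t * I) = xQ t := by
  rw [mQ, xa_eq, xc_eq, xQ]; push_cast; ring
lemma xR_eq (t : ℝ) : mR (t * I) = xR t := by
  rw [mR, xa_eq, xc_eq, xR]; push_cast; ring
lemma xD_eq {t : ℝ} (ht : 0 < t) : mD (t * I) = xD t := by
  rw [mD, tP, xa_eq, xb_eq ht, xc_eq, xD]; push_cast; ring

lemma xa_pos {t : ℝ} (ht : 0 < t) : 0 < xa t := by
  refine lt_of_le_of_ne (pow4_axis (th2_axis t)).2 fun h => tA_ne (im_yI ht) ?_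
  rw [xa_eq, ← h]; rfl
lemma xc_pos {t : ℝ} (ht : 0 < t) : 0 < xc t := by
  refine lt_of_le_of_ne (pow4_axis (th4_axis t)).2 fun h => tC_ne (im_yI ht) ?_
  rw [xc_eq, ← h]; rfl
lemma xb_pos {t : ℝ} (ht : 0 < t) : 0 < xb t := add_pos (xa_pos ht) (xc_pos ht)
lemma xQ_pos {t : ℝ} (ht : 0 < t) : 0 < xQ t := by
  have := xa_pos ht; have := xc_pos ht; unfold xQ; positivity
lemma xD_pos {t : ℝ} (ht : 0 < t) : 0 < xD t := by
  have := xa_pos ht; have := xc_pos ht; have := xb_pos ht; unfold xD; positivity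

lemma xD_rel (t : ℝ) : xQ t ^ 3 - xR t ^ 2 = 1728 * xD t := by
  unfold xQ xR xD xb; ring

/-- derivative along the axis -/
lemma axis_deriv {f : ℂ → ℂ} {t : ℝ} (hf : DifferentiableAt ℂ f (t * I)) :
    HasDerivAt (fun s : ℝ => f (s * I)) (I * deriv f (t * I)) t := by
  have h1 : HasDerivAt (fun s : ℝ => (s : ℂ) * I) I t := by
    simpa using (Complex.ofRealCLM.hasDerivAt (x := t)).mul_const I
  have := HasDerivAt.scomp (h := fun s : ℝ => (s : ℂ) * I) (g₁ := f) t hf.hasDerivAt h1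
  simpa [smul_eq_mul, Function.comp_def] using this

lemma axis_deriv_re {f : ℂ → ℂ} {t : ℝ} (hf : DifferentiableAt ℂ f (t * I)) :
    HasDerivAt (fun s : ℝ => (f (s * I)).re) (I * deriv f (t * I)).re t :=
  Complex.reCLM.hasFDerivAt.comp_hasDerivAt t (axis_deriv hf)

lemma axis_deriv_im {f : ℂ → ℂ} {t : ℝ} (hf : DifferentiableAt ℂ f (t * I)) :
    HasDerivAt (fun s : ℝ => (f (s * I)).im) (I * deriv f (t * I)).im t :=
  Complex.imCLM.hasFDerivAt.comp_hasDerivAt t (axis_deriv hf)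

lemma xP_eq {t : ℝ} (ht : 0 < t) : mP (t * I) = xP t := by
  have h := axis_deriv_im (tA_diff (im_yI ht))
  have h0 : (I * deriv tA (t * I)).im = 0 := by
    have h1 : (fun s : ℝ => (tA (s * I)).im) = fun _ => 0 := by
      ext s; rw [xa_eq]; simp
    rw [h1] at h
    exact h.unique (hasDerivAt_const t 0)
  rw [(tA_deriv (im_yI ht)).deriv, xa_eq, xc_eq] at h0
  have h2 : I * (Real.pi * I / 3 * (xa t) * (mP (t * I) + xa t + 2 * xc t)) =
    ((-(Real.pi / 3) * xa t : ℝ) : ℂ) * (mP (t * I) + xa t + 2 * xc t) := by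
    have := I_mul_I
    push_cast; linear_combination (Real.pi / 3 * (xa t) * (mP (t * I) + xa t + 2 * xc t)) * this
  rw [h2, Complex.im_ofReal_mul] at h0
  have h3 : (mP (t * I)).im = 0 := by
    have := (xa_pos ht).ne'
    have := Real.pi_ne_zero
    simpa [*] using h0
  apply Complex.ext <;> simp [h3, xP]

lemma xa_deriv {t : ℝ} (ht : 0 < t) :
    HasDerivAt xa (-(Real.pi / 3) * xa t * (xP t + xa t + 2 * xc t)) t := by
  have h := axis_deriv_re (tA_diff (im_yI ht))
  rw [(tA_deriv (im_yI ht)).deriv, xa_eq, xc_eq, xP_eq ht] at h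
  refine h.congr_deriv ?_
  have : I * (Real.pi * I / 3 * (xa t) * (xP t + xa t + 2 * xc t)) =
    ((-(Real.pi / 3) * xa t * (xP t + xa t + 2 * xc t) : ℝ) : ℂ) := by
    push_cast; linear_combination (Real.pi / 3 * (xa t) * (xP t + xa t + 2 * xc t) : ℂ) * I_mul_I
  rw [this, Complex.ofReal_re]

lemma xc_deriv {t : ℝ} (ht : 0 < t) :
    HasDerivAt xc (-(Real.pi / 3) * xc t * (xP t - 2 * xa t - xc t)) t := by
  have h := axis_deriv_re (tC_diff (im_yI ht))
  rw [(tC_deriv (im_yI ht)).deriv, xa_eq, xc_eq, xP_eq ht] at h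
  refine h.congr_deriv ?_
  have : I * (Real.pi * I / 3 * (xc t) * (xP t - 2 * xa t - xc t)) =
    ((-(Real.pi / 3) * xc t * (xP t - 2 * xa t - xc t) : ℝ) : ℂ) := by
    push_cast; linear_combination (Real.pi / 3 * (xc t) * (xP t - 2 * xa t - xc t) : ℂ) * I_mul_I
  rw [this, Complex.ofReal_re]

lemma xP_deriv {t : ℝ} (ht : 0 < t) :
    HasDerivAt xP (Real.pi / 6 * (xQ t - xP t ^ 2)) t := by
  have h := axis_deriv_re (mP_diff (im_yI ht))
  rw [(mP_deriv (im_yI ht)).deriv, xQ_eq, xP_eq ht] at h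
  refine h.congr_deriv ?_
  have : I * (Real.pi * I / 6 * ((xP t) ^ 2 - xQ t)) =
    ((Real.pi / 6 * (xQ t - xP t ^ 2) : ℝ) : ℂ) := by
    push_cast; linear_combination (Real.pi / 6 * ((xP t) ^ 2 - xQ t) : ℂ) * I_mul_I
  rw [this, Complex.ofReal_re]

lemma xQ_deriv {t : ℝ} (ht : 0 < t) :
    HasDerivAt xQ (-(2 * Real.pi / 3) * xu t) t := by
  have ha := xa_deriv ht
  have hc := xc_deriv ht
  refine (((ha.fun_pow 2).fun_add (ha.fun_mul hc)).fun_add (hc.fun_pow 2)).congr_deriv ?_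
  simp only [xu, xQ, xR]; push_cast; ring

lemma xR_deriv {t : ℝ} (ht : 0 < t) :
    HasDerivAt xR (-Real.pi * (xP t * xR t - xQ t ^ 2)) t := by
  have ha := xa_deriv ht
  have hc := xc_deriv ht
  refine (((((ha.const_mul 2).fun_add hc).fun_mul (ha.fun_add (hc.const_mul 2))).fun_mul
    (hc.fun_sub ha)).div_const 2).congr_deriv ?_
  simp only [xQ, xR]; ring

lemma xD_deriv {t : ℝ} (ht : 0 < t) :
    HasDerivAt xD (-(2 * Real.pi) * xP t * xD t) t := by
  have ha := xa_deriv ht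
  have hc := xc_deriv ht
  refine ((((ha.fun_mul (ha.fun_add hc)).fun_mul hc).fun_pow 2).div_const 256).congr_deriv ?_
  simp only [xD, xb]; push_cast; ring

lemma xu_deriv {t : ℝ} (ht : 0 < t) :
    HasDerivAt xu (-(5 * Real.pi / 6) / xQ t * (xu t ^ 2 + 1728 * xD t)) t := by
  refine (((xP_deriv ht).fun_mul (xQ_deriv ht)).fun_sub (xR_deriv ht)).congr_deriv ?_
  have hQ := (xQ_pos ht).ne'
  rw [← xD_rel]
  field_simp
  simp only [xu]; ring

/-! S-transformation on the axis -/
lemma S_axis {t : ℝ} (ht : 0 < t) : (-1 / ((t : ℂ) * I)) = ((1 / t : ℝ) : ℂ) * I := by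
  have : (t : ℂ) ≠ 0 := by exact_mod_cast ht.ne'
  push_cast
  field_simp
  simp

lemma xa_S {t : ℝ} (ht : 0 < t) : xa (1 / t) = t ^ 2 * xc t := by
  have h := tA_S (im_yI ht)
  rw [S_axis ht, xa_eq, xc_eq, mul_pow, I_sq] at h
  have : ((xa (1 / t) : ℝ) : ℂ) = ((t ^ 2 * xc t : ℝ) : ℂ) := by rw [h]; push_cast; ring
  exact_mod_cast this
lemma xc_S {t : ℝ} (ht : 0 < t) : xc (1 / t) = t ^ 2 * xa t := by
  have h := tC_S (im_yI ht)
  rw [S_axis ht, xa_eq, xc_eq, mul_pow, I_sq] at h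
  have : ((xc (1 / t) : ℝ) : ℂ) = ((t ^ 2 * xa t : ℝ) : ℂ) := by rw [h]; push_cast; ring
  exact_mod_cast this
lemma xQ_S {t : ℝ} (ht : 0 < t) : xQ (1 / t) = t ^ 4 * xQ t := by
  simp only [xQ, xa_S ht, xc_S ht]; ring
lemma xR_S {t : ℝ} (ht : 0 < t) : xR (1 / t) = -t ^ 6 * xR t := by
  simp only [xR, xa_S ht, xc_S ht]; ring
lemma xD_S {t : ℝ} (ht : 0 < t) : xD (1 / t) = t ^ 12 * xD t := by
  simp only [xD, xb, xa_S ht, xc_S ht]; ring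
lemma xP_S {t : ℝ} (ht : 0 < t) : xP (1 / t) = -t ^ 2 * xP t + 6 * t / Real.pi := by
  have h := mP_S (im_yI ht)
  rw [S_axis ht, xP_eq ht, xP_eq (by positivity), mul_pow, I_sq] at h
  have h2 : 6 * ((t : ℂ) * I) / (Real.pi * I) = 6 * t / Real.pi := by
    have : (Real.pi : ℂ) ≠ 0 := by exact_mod_cast Real.pi_ne_zero
    field_simp
  rw [h2] at h
  have : ((xP (1 / t) : ℝ) : ℂ) = ((-t ^ 2 * xP t + 6 * t / Real.pi : ℝ) : ℂ) := by
    rw [h]; push_cast; ring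
  exact_mod_cast this

/-! limits -/
lemma tendsto_axis : Tendsto (fun t : ℝ => (t : ℂ) * I) atTop iInfty := by
  unfold iInfty
  rw [tendsto_comap_iff]
  have : Complex.im ∘ (fun t : ℝ => (t : ℂ) * I) = id := by ext t; simp
  rw [this]; exact tendsto_id

lemma axis_lim {f : ℂ → ℂ} {l : ℂ} (h : Tendsto f iInfty (nhds l)) :
    Tendsto (fun t : ℝ => (f (t * I)).re) atTop (nhds l.re) :=
  (Complex.continuous_re.tendsto l).comp (h.comp tendsto_axis)

lemma xa_lim : Tendsto xa atTop (nhds 0) := by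
  have h := axis_lim tA_lim
  norm_num at h; exact h
lemma xc_lim : Tendsto xc atTop (nhds 1) := by
  have h := axis_lim tC_lim
  norm_num at h; exact h
lemma xP_lim : Tendsto xP atTop (nhds 1) := by
  have h := axis_lim mP_lim
  norm_num at h; exact h
lemma xQ_lim : Tendsto xQ atTop (nhds 1) := by
  have := ((xa_lim.pow 2).add (xa_lim.mul xc_lim)).add (xc_lim.pow 2)
  norm_num at this; exact this
lemma xR_lim : Tendsto xR atTop (nhds 1) := by
  have := ((((xa_lim.const_mul 2).add xc_lim).mul (xa_lim.add (xc_lim.const_mul 2))).mul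
    (xc_lim.sub xa_lim)).div_const 2
  norm_num at this; exact this
lemma xD_lim : Tendsto xD atTop (nhds 0) := by
  have := (((xa_lim.mul (xa_lim.add xc_lim)).mul xc_lim).pow 2).div_const 256
  norm_num at this; exact this
lemma xu_lim : Tendsto xu atTop (nhds 0) := by
  have := (xP_lim.mul xQ_lim).sub xR_lim
  norm_num at this; exact this

end UO

namespace UO
open Complex

/-! ### One-variable inequalities on the imaginary axis -/

lemma strictAntiOn_of_hasDerivAt {f f' : ℝ → ℝ} {a : ℝ} (h : ∀ t, a < t → HasDerivAt f (f' t) t)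
    (h' : ∀ t, a < t → f' t < 0) : StrictAntiOn f (Set.Ioi a) := by
  refine strictAntiOn_of_deriv_neg (convex_Ioi a)
    (fun t ht => (h t ht).continuousAt.continuousWithinAt) fun t ht => ?_
  rw [interior_Ioi] at ht
  rw [(h t ht).deriv]; exact h' t ht

lemma gt_lim_of_strictAntiOn {f : ℝ → ℝ} {a l : ℝ} (h : StrictAntiOn f (Set.Ioi a))
    (hl : Tendsto f atTop (nhds l)) {t : ℝ} (ht : a < t) : l < f t := by
  have h1 : f (t + 1) < f t := h ht (show a < t + 1 by linarith) (by linarith)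
  refine lt_of_le_of_lt (le_of_tendsto hl ?_) h1
  filter_upwards [eventually_ge_atTop (t + 1)] with s hs
  exact h.antitoneOn (show a < t + 1 by linarith) (show a < s by linarith) hs

/-- barrier from the left -/
lemma barrier_left {f f' : ℝ → ℝ} {a b : ℝ} (hab : a ≤ b)
    (h : ∀ t ∈ Set.Icc a b, HasDerivAt f (f' t) t)
    (h' : ∀ t ∈ Set.Icc a b, f t < 0 → 0 ≤ f' t) (ha : 0 ≤ f a) : 0 ≤ f b := by
  by_contra hb
  push Not at hb
  have hc : ContinuousOn f (Set.Icc a b) := fun t ht => (h t ht).continuousAt.continuousWithinAt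
  have hcl : IsClosed (Set.Icc a b ∩ f ⁻¹' Set.Ici 0) := hc.preimage_isClosed_of_isClosed
    isClosed_Icc isClosed_Ici
  have hbd : BddAbove (Set.Icc a b ∩ f ⁻¹' Set.Ici 0) := ⟨b, fun t ht => ht.1.2⟩
  have hne : (Set.Icc a b ∩ f ⁻¹' Set.Ici 0).Nonempty := ⟨a, ⟨le_refl a, hab⟩, ha⟩
  have hm := hcl.csSup_mem hne hbd
  set c := sSup (Set.Icc a b ∩ f ⁻¹' Set.Ici 0)
  have hmono : MonotoneOn f (Set.Icc c b) := by
    refine monotoneOn_of_deriv_nonneg (convex_Icc c b)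
      (hc.mono (Set.Icc_subset_Icc_left hm.1.1)) ?_ ?_
    · intro t ht
      rw [interior_Icc] at ht
      exact (h t ⟨hm.1.1.trans ht.1.le, ht.2.le⟩).differentiableAt.differentiableWithinAt
    · intro t ht
      rw [interior_Icc] at ht
      have ht' : t ∈ Set.Icc a b := ⟨hm.1.1.trans ht.1.le, ht.2.le⟩
      rw [(h t ht').deriv]
      refine h' t ht' ?_
      by_contra hn
      push Not at hn
      exact absurd (le_csSup hbd (⟨ht', hn⟩ : t ∈ Set.Icc a b ∩ f ⁻¹' Set.Ici 0)) (not_le.mpr ht.1)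
  have := hmono (Set.left_mem_Icc.mpr hm.1.2) (Set.right_mem_Icc.mpr hm.1.2) hm.1.2
  have h2 : 0 ≤ f c := hm.2
  linarith

/-- barrier from infinity -/
lemma barrier_right {f f' : ℝ → ℝ} {a l : ℝ} (h : ∀ t, a ≤ t → HasDerivAt f (f' t) t)
    (h' : ∀ t, a ≤ t → f t < 0 → f' t ≤ 0) (hl : Tendsto f atTop (nhds l)) (hl0 : 0 ≤ l) :
    0 ≤ f a := by
  by_contra hb
  push Not at hb
  -- `f t ≤ f a` for all `t ≥ a`
  have key : ∀ t, a ≤ t → f t ≤ f a / 2 := by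
    intro t hat
    by_contra hcon
    push Not at hcon
    have hc : ContinuousOn f (Set.Icc a t) :=
      fun x hx => (h x hx.1).continuousAt.continuousWithinAt
    have hcl : IsClosed (Set.Icc a t ∩ f ⁻¹' Set.Ici (f a / 2)) :=
      hc.preimage_isClosed_of_isClosed isClosed_Icc isClosed_Ici
    have hbd : BddBelow (Set.Icc a t ∩ f ⁻¹' Set.Ici (f a / 2)) := ⟨a, fun x hx => hx.1.1⟩
    have hne : (Set.Icc a t ∩ f ⁻¹' Set.Ici (f a / 2)).Nonempty :=
      ⟨t, ⟨hat, le_refl t⟩, hcon.le⟩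
    have hm := hcl.csInf_mem hne hbd
    set c := sInf (Set.Icc a t ∩ f ⁻¹' Set.Ici (f a / 2))
    have hanti : AntitoneOn f (Set.Icc a c) := by
      refine antitoneOn_of_deriv_nonpos (convex_Icc a c)
        (hc.mono (Set.Icc_subset_Icc_right hm.1.2)) ?_ ?_
      · intro x hx
        rw [interior_Icc] at hx
        exact (h x hx.1.le).differentiableAt.differentiableWithinAt
      · intro x hx
        rw [interior_Icc] at hx
        rw [(h x hx.1.le).deriv]
        refine h' x hx.1.le ?_
        by_contra hn
        push Not at hn
        exact absurd (csInf_le hbd (⟨⟨hx.1.le, hx.2.le.trans hm.1.2⟩, by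
          simp only [Set.mem_preimage, Set.mem_Ici]; linarith⟩ :
            x ∈ Set.Icc a t ∩ f ⁻¹' Set.Ici (f a / 2))) (not_le.mpr hx.2)
    have h6 := hanti (Set.left_mem_Icc.mpr hm.1.1) (Set.right_mem_Icc.mpr hm.1.1) hm.1.1
    have h7 : f a / 2 ≤ f c := hm.2
    linarith
  have := le_of_tendsto hl ((eventually_ge_atTop a).mono key)
  linarith

lemma xu_pos {t : ℝ} (ht : 0 < t) : 0 < xu t := by
  refine gt_lim_of_strictAntiOn (strictAntiOn_of_hasDerivAt (fun s hs => xu_deriv hs)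
    fun s hs => ?_) xu_lim ht
  have := xQ_pos hs
  have := xD_pos hs
  have : 0 < 5 * Real.pi / 6 / xQ s * (xu s ^ 2 + 1728 * xD s) := by positivity
  rw [neg_div, neg_mul]; linarith

lemma xQ_anti : StrictAntiOn xQ (Set.Ioi 0) :=
  strictAntiOn_of_hasDerivAt (fun s hs => xQ_deriv hs) fun s hs => by
    have := xu_pos hs
    have : 0 < 2 * Real.pi / 3 * xu s := by positivity
    linarith

lemma xQ_gt_one {t : ℝ} (ht : 0 < t) : 1 < xQ t := gt_lim_of_strictAntiOn xQ_anti xQ_lim ht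

def xE (t : ℝ) : ℝ := 6 / Real.pi * xQ t - t * xu t

lemma xu_S {t : ℝ} (ht : 0 < t) : xu (1 / t) = t ^ 5 * xE t := by
  simp only [xu, xE, xP_S ht, xQ_S ht, xR_S ht]; ring

lemma xE_pos {t : ℝ} (ht : 0 < t) : 0 < xE t := by
  have h := xu_pos (show 0 < 1 / t by positivity)
  rw [xu_S ht] at h
  exact pos_of_mul_pos_right h (by positivity)

lemma xP_one : xP 1 = 3 / Real.pi := by
  have := xP_S one_pos
  norm_num at this
  have h2 : (6 : ℝ) / Real.pi = 2 * (3 / Real.pi) := by ring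
  linarith

lemma xac_anti : StrictAntiOn (fun t => xa t / xc t) (Set.Ioi 0) :=
  strictAntiOn_of_hasDerivAt (f' := fun t => -(Real.pi * (xa t / xc t) * xb t))
    (fun t ht => by
      refine ((xa_deriv ht).fun_div (xc_deriv ht) (xc_pos ht).ne').congr_deriv ?_
      have := (xc_pos ht).ne'
      simp only [xb]; field_simp; ring)
    fun t ht => by
      have := xa_pos ht; have := xc_pos ht; have := xb_pos ht
      have : 0 < Real.pi * (xa t / xc t) * xb t := by positivity
      linarith

lemma xac_one : xa 1 / xc 1 = 1 := by
  have := xa_S one_pos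
  norm_num at this
  rw [this, div_self (xc_pos one_pos).ne']

lemma xa_lt_xc {t : ℝ} (ht : 1 < t) : xa t < xc t := by
  have h := xac_anti (show (1:ℝ) ∈ Set.Ioi 0 by simp) (show t ∈ Set.Ioi 0 from (zero_lt_one.trans ht)) ht
  simp only [xac_one] at h
  rwa [div_lt_one (xc_pos (zero_lt_one.trans ht))] at h

lemma xR_pos {t : ℝ} (ht : 1 < t) : 0 < xR t := by
  have h0 := zero_lt_one.trans ht
  have := xa_pos h0; have := xc_pos h0
  have : 0 < xc t - xa t := sub_pos.mpr (xa_lt_xc ht)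
  unfold xR; positivity

lemma xR_one : xR 1 = 0 := by
  have := xR_S one_pos
  norm_num at this
  linarith

lemma xR_nonneg {t : ℝ} (ht : 1 ≤ t) : 0 ≤ xR t := by
  rcases ht.eq_or_lt with h | h
  · rw [← h, xR_one]
  · exact (xR_pos h).le

lemma xP_pos {t : ℝ} (ht : 1 ≤ t) : 0 < xP t := by
  have h0 := zero_lt_one.trans_le ht
  have h1 := xu_pos h0
  have h2 := xR_nonneg ht
  have h3 : 0 < xQ t * xP t := by unfold xu at h1; linarith
  exact pos_of_mul_pos_right h3 (xQ_pos h0).le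

lemma xP_ge {t : ℝ} (ht : 1 ≤ t) : 3 / Real.pi ≤ xP t := by
  have := barrier_left (f := fun s => xP s - 3 / Real.pi) (f' := fun s => Real.pi / 6 * (xQ s - xP s ^ 2))
    ht (fun s hs => (xP_deriv (by linarith [hs.1])).sub_const _) ?_ (by simp [xP_one])
  · simpa using this
  · intro s hs hlt
    have h0 := xP_pos hs.1
    have h1 : xP s < 1 := by
      have : 3 / Real.pi < 1 := by
        rw [div_lt_one Real.pi_pos]; exact Real.pi_gt_three
      linarith
    have h2 := xQ_gt_one (show 0 < s by linarith [hs.1])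
    have h3 : 0 ≤ xQ s - xP s ^ 2 := by nlinarith
    positivity

/-! asymptotics of `u / Δ` -/
lemma axis_D_exp : Tendsto (fun t : ℝ => xD t / Real.exp (-2 * Real.pi * t)) atTop (nhds 1) := by
  have h1 : Tendsto (fun z : ℂ => (tA0 z * tB z * tC z) ^ 2 / 256) iInfty (nhds 1) := by
    have := (((tA0_lim.mul tB_lim).mul tC_lim).pow 2).div_const 256
    norm_num at this; exact this
  have h2 := axis_lim h1
  rw [Complex.one_re] at h2
  refine h2.congr' ?_
  filter_upwards [eventually_gt_atTop 0] with t ht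
  have h3 : mD (t * I) = (Real.exp (-2 * Real.pi * t) : ℂ) * ((tA0 (t * I) * tB (t * I) * tC (t * I)) ^ 2 / 256) := by
    rw [mD, tP, tA_eq]
    have : cexp (Real.pi * I * (t * I)) ^ 2 = (Real.exp (-2 * Real.pi * t) : ℂ) := by
      rw [← Complex.exp_nat_mul]; push_cast; congr 1
      linear_combination (2 * Real.pi * t : ℂ) * I_sq
    rw [← this]; ring
  rw [xD_eq ht] at h3
  have h4 := congrArg Complex.re h3
  rw [Complex.ofReal_re, Complex.re_ofReal_mul] at h4
  rw [h4, mul_div_cancel_left₀ _ (Real.exp_pos _).ne']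

lemma xu_isBigO : (fun t : ℝ => xu t) =O[atTop] fun t => Real.exp (-2 * Real.pi * t) := by
  let f : ℂ → ℂ := fun z => if 0 < z.im then mP z * mQ z - mR z else 0
  have hper : Function.Periodic f (1 : ℝ) := by
    intro z
    simp only [f, Complex.ofReal_one, Complex.add_im, Complex.one_im, add_zero]
    split_ifs with h
    · rw [mP_T, mQ_T h, mR_T h]
    · rfl
  have hev : ∀ᶠ z in iInfty, f z = mP z * mQ z - mR z := by
    filter_upwards [ev_iInfty] with z hz
    simp only [f, if_pos hz]
  have h := Function.Periodic.exp_decay_of_zero_at_inf one_pos hper (by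
    filter_upwards [ev_iInfty] with z hz
    have : f =ᶠ[nhds z] fun z => mP z * mQ z - mR z := by
      filter_upwards [ev_im_pos hz] with w hw
      simp only [f, if_pos hw]
    exact (((mP_diff hz).mul (mQ_diff hz)).sub (mR_diff hz)).congr_of_eventuallyEq this) (by
    have := (mP_lim.mul mQ_lim).sub mR_lim
    norm_num at this
    exact this.congr' (hev.mono fun z hz => hz.symm))
  have h2 := h.comp_tendsto tendsto_axis
  have h3 : (fun t : ℝ => ((xu t : ℝ) : ℂ)) =O[atTop] fun t => Real.exp (-2 * Real.pi * t) := by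
    refine Asymptotics.IsBigO.congr' h2 ?_ ?_
    · filter_upwards [eventually_gt_atTop 0] with t ht
      have : f (t * I) = ((xu t : ℝ) : ℂ) := by
        simp only [f, if_pos (im_yI ht)]
        rw [xP_eq ht, xQ_eq, xR_eq, xu]; push_cast; ring
      exact this
    · filter_upwards with t
      simp
  refine Asymptotics.IsBigO.of_norm_left ?_
  simpa using h3.norm_left

/-- `u / Δ → 720` -/
lemma xuD_lim : Tendsto (fun t => xu t / xD t) atTop (nhds 720) := by
  have h0 : (fun t : ℝ => xu t) =O[atTop] xD := by
    refine xu_isBigO.trans ?_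
    have h := axis_D_exp.inv₀ one_ne_zero
    have h1 : Tendsto (fun t : ℝ => Real.exp (-2 * Real.pi * t) / xD t) atTop (nhds 1) := by
      simpa [inv_div] using h
    refine Asymptotics.isBigO_of_div_tendsto_nhds ?_ 1 h1
    filter_upwards [eventually_gt_atTop 0] with t ht h2
    exact absurd h2 (xD_pos ht).ne'
  have h1 : Tendsto (fun t => xu t ^ 2 / xD t) atTop (nhds 0) := by
    have h2 : (fun t => xu t ^ 2) =o[atTop] xD := by
      have h3 : (fun t => xu t * xu t) =o[atTop] fun t => xD t * 1 :=
        h0.mul_isLittleO ((Asymptotics.isLittleO_one_iff ℝ).mpr xu_lim)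
      simpa [pow_two] using h3
    exact h2.tendsto_div_nhds_zero
  refine HasDerivAt.lhopital_zero_atTop ((eventually_gt_atTop 0).mono fun t ht => xu_deriv ht)
    ((eventually_gt_atTop 0).mono fun t ht => xD_deriv ht)
    ((eventually_ge_atTop 1).mono fun t ht => ?_) xu_lim xD_lim ?_
  · have := xP_pos ht
    have := xD_pos (zero_lt_one.trans_le ht)
    have : 0 < 2 * Real.pi * xP t * xD t := by positivity
    intro h; linarith
  · have h2 : Tendsto (fun t => 5 / 12 / (xP t * xQ t) * (xu t ^ 2 / xD t + 1728)) atTop (nhds 720) := by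
      have := ((tendsto_const_nhds (x := (5 / 12 : ℝ))).div (xP_lim.mul xQ_lim) (by norm_num)).mul (h1.add_const 1728)
      norm_num at this; exact this
    refine h2.congr' ?_
    filter_upwards [eventually_ge_atTop 1] with t ht
    have h3 := (xP_pos ht).ne'
    have h4 := (xD_pos (zero_lt_one.trans_le ht)).ne'
    have h5 := (xQ_pos (zero_lt_one.trans_le ht)).ne'
    have := Real.pi_ne_zero
    field_simp
    ring

/-- upper bound `u Q ≤ 4523 Δ` for `t ≥ 1` -/
lemma uQ_le {t : ℝ} (ht : 1 ≤ t) : xu t * xQ t ≤ 4523 * xD t := by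
  have h := barrier_right (f := fun s => 4523 - xu s * xQ s / xD s)
    (f' := fun s => -(2 * Real.pi / xD s * (xu s * (xu s / 4 + xR s) - 720 * xD s))) (a := t)
    (l := 4523 - 720) ?_ ?_ ?_ (by norm_num)
  · have h1 : xu t * xQ t / xD t ≤ 4523 := by simpa using h
    rwa [div_le_iff₀ (xD_pos (by linarith))] at h1
  · intro s hs
    have h0 : 0 < s := by linarith
    refine ((((xu_deriv h0).fun_mul (xQ_deriv h0)).fun_div (xD_deriv h0) (xD_pos h0).ne').const_sub
      4523).congr_deriv ?_
    have h5 := (xQ_pos h0).ne'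
    have h4 := (xD_pos h0).ne'
    have hR : xR s = xP s * xQ s - xu s := by unfold xu; ring
    rw [hR]
    field_simp
    ring
  · intro s hs hlt
    have h0 : 0 < s := by linarith
    have h1 : 1 ≤ s := by linarith
    have hD := xD_pos h0
    have hu := xu_pos h0
    have hQ := xQ_pos h0
    have h2 : 4523 * xD s < xu s * xQ s := by
      have : 4523 < xu s * xQ s / xD s := by simpa using hlt
      rwa [lt_div_iff₀ hD] at this
    have h3 : 0.8 ≤ xP s := by
      refine le_trans ?_ (xP_ge h1)
      rw [le_div_iff₀ Real.pi_pos]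
      nlinarith [Real.pi_lt_d2]
    have h4 : xQ s * 0.8 ≤ xu s + xR s := by
      have : xu s + xR s = xQ s * xP s := by unfold xu; ring
      rw [this]; gcongr
    have hR := xR_nonneg h1
    have h5 : 0 ≤ xu s * (xu s / 4 + xR s) - 720 * xD s := by
      have : xu s * (xQ s * 0.2) ≤ xu s * (xu s / 4 + xR s) := by
        gcongr; linarith
      nlinarith
    have : 0 ≤ 2 * Real.pi / xD s * (xu s * (xu s / 4 + xR s) - 720 * xD s) := by positivity
    linarith
  · have := (xuD_lim.mul xQ_lim).const_sub 4523
    rw [mul_one] at this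
    refine this.congr fun s => ?_
    ring

/-- lower bound `u Q^{3/2} ≥ 720 Δ` -/
lemma uQ_ge {t : ℝ} (ht : 1 ≤ t) : (720 * xD t) ^ 2 ≤ xu t ^ 2 * xQ t ^ 3 := by
  have h := barrier_right (f := fun s => xu s ^ 2 * xQ s ^ 3 / xD s ^ 2 - 720 ^ 2)
    (f' := fun s => -(4 * Real.pi * xu s * xQ s ^ 2 / xD s ^ 2) * (720 * xD s - xu s * xR s - xu s ^ 2 / 12))
    (a := t) (l := 720 ^ 2 * 1 - 720 ^ 2) ?_ ?_ ?_ (by norm_num)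
  · have hD := xD_pos (zero_lt_one.trans_le ht)
    rw [sub_nonneg, le_div_iff₀ (by positivity)] at h
    rw [mul_pow]; exact h
  · intro s hs
    have h0 : 0 < s := by linarith
    refine (((((xu_deriv h0).fun_pow 2).fun_mul ((xQ_deriv h0).fun_pow 3)).fun_div
      ((xD_deriv h0).fun_pow 2) (pow_ne_zero 2 (xD_pos h0).ne')).sub_const _).congr_deriv ?_
    have h5 := (xQ_pos h0).ne'
    have h4 := (xD_pos h0).ne'
    have hR : xR s = xP s * xQ s - xu s := by unfold xu; ring
    rw [hR]
    field_simp
    push_cast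
    ring
  · intro s hs hlt
    have h0 : 0 < s := by linarith
    have h1 : 1 ≤ s := by linarith
    have hD := xD_pos h0
    have hu := xu_pos h0
    have hQ := xQ_gt_one h0
    have hR := xR_nonneg h1
    have hrel := xD_rel s
    have h2 : xu s ^ 2 * xQ s ^ 3 < (720 * xD s) ^ 2 := by
      rw [sub_neg, div_lt_iff₀ (by positivity)] at hlt
      rw [mul_pow]; exact hlt
    have h3 : 0 ≤ 720 * xD s - xu s * xR s - xu s ^ 2 / 12 := by
      -- q = Q^{3/2}
      obtain ⟨q, hq0, hq⟩ : ∃ q : ℝ, 1 ≤ q ∧ q ^ 2 = xQ s ^ 3 :=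
        ⟨Real.sqrt (xQ s ^ 3), Real.one_le_sqrt.mpr (one_le_pow₀ hQ.le), Real.sq_sqrt (by positivity)⟩
      have h4 : xu s * q < 720 * xD s := by
        rw [← hq, ← mul_pow] at h2
        exact lt_of_pow_lt_pow_left₀ 2 (by positivity) h2
      have h5 : xR s ≤ q := by
        refine le_of_sq_le_sq ?_ (by linarith)
        nlinarith
      -- (q - R)(q+R) = 1728 Δ
      have h6 : (q - xR s) * (q + xR s) = 1728 * xD s := by rw [← hrel, ← hq]; ring
      have h7 : 864 * xD s ≤ (q - xR s) * q := by nlinarith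
      have h8 : xu s * (xR s + xu s / 12) ≤ xu s * q := by
        gcongr
        -- u/12 ≤ q - R
        have : xu s / 12 * q ≤ (q - xR s) * q := by nlinarith
        have := le_of_mul_le_mul_right this (by linarith)
        linarith
      nlinarith
    have h5 := xQ_pos h0
    have : 0 ≤ (4 * Real.pi * xu s * xQ s ^ 2 / xD s ^ 2) * (720 * xD s - xu s * xR s - xu s ^ 2 / 12) := by
      positivity
    rw [neg_mul]; linarith
  · have := ((xuD_lim.pow 2).mul (xQ_lim.pow 3)).sub_const (720 ^ 2)
    rw [one_pow] at this
    refine this.congr fun s => ?_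
    ring

/-- `n(t) = t u / Q`, `G(t) = t P`, `H(t) = R u E / (Q Δ)` -/
def xn (t : ℝ) : ℝ := t * xu t / xQ t
def xG (t : ℝ) : ℝ := t * xP t
def xH (t : ℝ) : ℝ := xR t * xu t * xE t / (xQ t * xD t)

lemma xE_deriv {t : ℝ} (ht : 0 < t) :
    HasDerivAt xE (-(5 * Real.pi / 6) / xQ t * (xu t * xE t - 1728 * t * xD t)) t := by
  refine (((xQ_deriv ht).const_mul (6 / Real.pi)).fun_sub
    ((hasDerivAt_id' t).fun_mul (xu_deriv ht))).congr_deriv ?_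
  have h5 := (xQ_pos ht).ne'
  have := Real.pi_ne_zero
  unfold xE
  field_simp
  ring

lemma monotoneOn_Ici_of {f f' : ℝ → ℝ} (h : ∀ t, 1 ≤ t → HasDerivAt f (f' t) t)
    (h' : ∀ t, 1 < t → 0 ≤ f' t) : MonotoneOn f (Set.Ici 1) := by
  refine monotoneOn_of_deriv_nonneg (convex_Ici 1)
    (fun t ht => (h t ht).continuousAt.continuousWithinAt) ?_ ?_
  · intro t ht
    rw [interior_Ici] at ht
    exact (h t ht.le).differentiableAt.differentiableWithinAt
  · intro t ht
    rw [interior_Ici] at ht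
    rw [(h t ht.le).deriv]; exact h' t ht

lemma xn_anti : AntitoneOn xn (Set.Ici 1) := by
  have : MonotoneOn (fun t => - xn t) (Set.Ici 1) := by
    refine monotoneOn_Ici_of (f' := fun t => Real.pi / xQ t ^ 2 * (1440 * t * xD t - xu t * xE t / 6)) ?_ ?_
    · intro t ht
      have h0 := zero_lt_one.trans_le ht
      refine ((((hasDerivAt_id' t).fun_mul (xu_deriv h0)).fun_div (xQ_deriv h0)
        (xQ_pos h0).ne').fun_neg).congr_deriv ?_
      have h5 := (xQ_pos h0).ne'
      have := Real.pi_ne_zero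
      unfold xE
      field_simp
      ring
    · intro t ht
      have h0 := zero_lt_one.trans ht
      have hu := xu_pos h0
      have hQ := xQ_pos h0
      have hD := xD_pos h0
      have h1 := uQ_le ht.le
      have h2 : xE t ≤ 1.91 * xQ t := by
        have : 6 / Real.pi ≤ 1.91 := by
          rw [div_le_iff₀ Real.pi_pos]; nlinarith [Real.pi_gt_d4]
        have h3 : 6 / Real.pi * xQ t ≤ 1.91 * xQ t := by gcongr
        have : 0 < t * xu t := by positivity
        unfold xE; linarith
      have h3 : xu t * xE t ≤ 1.91 * (xu t * xQ t) := by
        calc xu t * xE t ≤ xu t * (1.91 * xQ t) := by gcongr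
          _ = _ := by ring
      have h4 : 0 ≤ 1440 * t * xD t - xu t * xE t / 6 := by nlinarith
      positivity
  intro x hx y hy hxy
  have := this hx hy hxy
  simp only at this; linarith

lemma xn_le {t : ℝ} (ht : 1 ≤ t) : xn t ≤ 3 / Real.pi := by
  refine (xn_anti (Set.mem_Ici.mpr le_rfl) ht ht).trans (le_of_eq ?_)
  have := (xQ_pos one_pos).ne'
  rw [xn, xu, xR_one, xP_one]; field_simp; simp

/-- `t u ≤ E` for `t ≥ 1` -/
lemma tu_le_E {t : ℝ} (ht : 1 ≤ t) : t * xu t ≤ xE t := by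
  have hQ := xQ_pos (zero_lt_one.trans_le ht)
  have h := xn_le ht
  rw [xn, div_le_iff₀ hQ] at h
  have : 6 / Real.pi * xQ t = 2 * (3 / Real.pi * xQ t) := by ring
  unfold xE; linarith

lemma xG_mono : StrictMonoOn xG (Set.Ici 1) := by
  refine strictMonoOn_of_deriv_pos (convex_Ici 1) (fun t ht =>
    (((hasDerivAt_id' t).fun_mul (xP_deriv (zero_lt_one.trans_le ht))).continuousAt).continuousWithinAt) ?_
  intro t ht
  rw [interior_Ici] at ht
  have ht : 1 < t := ht
  have h0 := zero_lt_one.trans ht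
  have hd : HasDerivAt xG (Real.pi / 6 / xQ t ^ 2 * (1728 * t * xD t + xu t * xE t + xR t * (xE t - t * xu t))) t := by
    refine ((hasDerivAt_id' t).fun_mul (xP_deriv h0)).congr_deriv ?_
    have h5 := (xQ_pos h0).ne'
    have := Real.pi_ne_zero
    have h1 : 1728 * t * xD t = t * (xQ t ^ 3 - xR t ^ 2) := by rw [xD_rel]; ring
    rw [h1]
    unfold xE xu
    field_simp
    ring
  rw [hd.deriv]
  have hu := xu_pos h0
  have hQ := xQ_pos h0
  have hD := xD_pos h0
  have hE := xE_pos h0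
  have hR := xR_nonneg ht.le
  have : 0 ≤ xE t - t * xu t := sub_nonneg.mpr (tu_le_E ht.le)
  positivity

lemma xH_mono : MonotoneOn xH (Set.Ici 1) := by
  refine monotoneOn_Ici_of (f' := fun t => Real.pi / (xQ t ^ 2 * xD t) *
    (xE t * (xu t * (xR t ^ 2 + xQ t ^ 3) - 1440 * xD t * xR t) + 1440 * t * xD t * xR t * xu t)) ?_ ?_
  · intro t ht
    have h0 := zero_lt_one.trans_le ht
    have h5 := (xQ_pos h0).ne'
    have h4 := (xD_pos h0).ne'
    refine ((((xR_deriv h0).fun_mul (xu_deriv h0)).fun_mul (xE_deriv h0)).fun_div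
      ((xQ_deriv h0).fun_mul (xD_deriv h0)) (mul_ne_zero h5 h4)).congr_deriv ?_
    have hP : xP t = (xu t + xR t) / xQ t := by unfold xu; field_simp; ring
    have hQ3 : xQ t ^ 3 = xR t ^ 2 + 1728 * xD t := by linarith [xD_rel t]
    rw [hP]
    generalize xR t = R at *
    generalize xu t = u at *
    generalize xE t = E at *
    generalize xQ t = Q at *
    generalize xD t = D at *
    field_simp
    have hQ2 : D = (Q ^ 3 - R ^ 2) / 1728 := by rw [hQ3]; ring
    rw [hQ2]
    ring
  · intro t ht
    have h0 := zero_lt_one.trans ht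
    have hu := xu_pos h0
    have hQ := xQ_pos h0
    have hD := xD_pos h0
    have hE := xE_pos h0
    have hR := xR_nonneg ht.le
    have h1 : 1440 * xD t * xR t ≤ xu t * (xR t ^ 2 + xQ t ^ 3) := by
      refine le_of_sq_le_sq ?_ (by positivity)
      have h2 := uQ_ge ht.le
      calc (1440 * xD t * xR t) ^ 2 = 4 * xR t ^ 2 * (720 * xD t) ^ 2 := by ring
        _ ≤ 4 * xR t ^ 2 * (xu t ^ 2 * xQ t ^ 3) := by gcongr
        _ ≤ (xu t * (xR t ^ 2 + xQ t ^ 3)) ^ 2 := by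
          have : 0 ≤ xu t ^ 2 * (xR t ^ 2 - xQ t ^ 3) ^ 2 := by positivity
          nlinarith
    have : 0 ≤ xu t * (xR t ^ 2 + xQ t ^ 3) - 1440 * xD t * xR t := by linarith
    positivity

def xphi1 (t : ℝ) : ℝ := xQ t ^ 2 * (t * xQ t - xP t * (xP t * t - 6 / Real.pi))
def xphi2 (t : ℝ) : ℝ := xQ t * (xR t * (xP t * t - 3 / Real.pi) - t * xQ t ^ 2)
def xal (b : ℝ) : ℝ := xQ b ^ 2 * (b * (xP b ^ 2 * xR b + xQ b * xR b - 2 * xP b * xQ b ^ 2)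
  - 6 / Real.pi * (xP b * xR b - xQ b ^ 2)) / xD b

/-- the function `X(β,t)` -/
def xX (b t : ℝ) : ℝ := Real.pi ^ 2 / 18 * (-(t * xD t * xal b) + b * xR b * xphi1 t
  + 2 * (xP b * b - 3 / Real.pi) * xQ b * xphi2 t)

lemma xX_eq {b : ℝ} (hb : 0 < b) (t : ℝ) : xX b t = Real.pi ^ 2 / 18 * xQ b *
    (xu t * xE t * xG b - (xu t * xE t + xR t * (xE t - t * xu t)) * xn b
      + t * xD t * xH b - t * xD t * (10368 / Real.pi) - 6 / Real.pi * xphi2 t) := by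
  have h5 := (xQ_pos hb).ne'
  have h4 := (xD_pos hb).ne'
  have := Real.pi_ne_zero
  have hQ3 : xQ b ^ 3 - xR b ^ 2 = 1728 * xD b := xD_rel b
  have h3 : xD t = (xQ t ^ 3 - xR t ^ 2) / 1728 := by rw [xD_rel t]; ring
  have hQ2 : xD b = (xQ b ^ 3 - xR b ^ 2) / 1728 := by rw [hQ3]; ring
  unfold xX xG xn xH xE xu xphi1 xphi2 xal
  have hne : xQ b ^ 3 - xR b ^ 2 ≠ 0 := by rw [hQ3]; positivity
  rw [h3, hQ2]
  generalize xP b = P at *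
  generalize xQ b = Q at *
  generalize xR b = R at *
  field_simp
  ring

lemma xX_lt {b b' t : ℝ} (hb : 1 ≤ b) (hbb : b < b') (ht : 1 ≤ t) :
    xX b t / xQ b < xX b' t / xQ b' := by
  have hb0 := zero_lt_one.trans_le hb
  have hb0' := hb0.trans hbb
  have h0 := zero_lt_one.trans_le ht
  have e1 : ∀ b : ℝ, 0 < b → xX b t / xQ b = Real.pi ^ 2 / 18 *
    (xu t * xE t * xG b - (xu t * xE t + xR t * (xE t - t * xu t)) * xn b
      + t * xD t * xH b - t * xD t * (10368 / Real.pi) - 6 / Real.pi * xphi2 t) := by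
    intro b hb
    rw [xX_eq hb]
    have := (xQ_pos hb).ne'
    field_simp
  rw [e1 b hb0, e1 b' hb0']
  have hu := xu_pos h0
  have hD := xD_pos h0
  have hE := xE_pos h0
  have hR := xR_nonneg ht
  have h1 : 0 ≤ xE t - t * xu t := sub_nonneg.mpr (tu_le_E ht)
  have hG := xG_mono (Set.mem_Ici.mpr hb) (Set.mem_Ici.mpr (hb.trans hbb.le)) hbb
  have hn := xn_anti (Set.mem_Ici.mpr hb) (Set.mem_Ici.mpr (hb.trans hbb.le)) hbb.le
  have hH := xH_mono (Set.mem_Ici.mpr hb) (Set.mem_Ici.mpr (hb.trans hbb.le)) hbb.le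
  have g1 : xu t * xE t * xG b < xu t * xE t * xG b' := by gcongr
  have g2 : (xu t * xE t + xR t * (xE t - t * xu t)) * xn b' ≤
    (xu t * xE t + xR t * (xE t - t * xu t)) * xn b := by gcongr
  have g3 : t * xD t * xH b ≤ t * xD t * xH b' := by gcongr
  have hpi : 0 < Real.pi ^ 2 / 18 := by positivity
  exact mul_lt_mul_of_pos_left (by linarith) hpi

lemma xX_one (t : ℝ) : xX 1 t = 0 := by
  have := Real.pi_ne_zero
  unfold xX xal
  rw [xR_one, xP_one]
  field_simp
  ring

lemma xX_diag {t : ℝ} (ht : 0 < t) : xX t t = xQ t * (xQ t * xR t) := by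
  have h4 := (xD_pos ht).ne'
  have := Real.pi_ne_zero
  unfold xX xal xphi1 xphi2
  field_simp
  ring

/-- final sign statements -/
lemma xX_pos {b t : ℝ} (hb : 1 < b) (ht : 1 ≤ t) : 0 < xX b t := by
  have h := xX_lt (le_refl 1) hb ht
  rw [xX_one, zero_div] at h
  exact (div_pos_iff_of_pos_right (xQ_pos (zero_lt_one.trans hb))).mp h

lemma xX_lt_of_lt {b t : ℝ} (hb : 1 ≤ b) (hbt : b < t) : xX b t < xQ b * (xQ t * xR t) := by
  have h0 := zero_lt_one.trans_le hb
  have h := xX_lt hb hbt (hb.trans hbt.le)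
  rw [xX_diag (h0.trans hbt), div_lt_iff₀ (xQ_pos h0), mul_div_cancel_left₀ _ (xQ_pos (h0.trans hbt)).ne'] at h
  linarith

lemma xX_gt_of_lt {b t : ℝ} (ht : 1 ≤ t) (hbt : t < b) : xQ b * (xQ t * xR t) < xX b t := by
  have h0 := zero_lt_one.trans_le ht
  have h := xX_lt ht hbt ht
  rw [xX_diag h0, lt_div_iff₀ (xQ_pos (h0.trans hbt)), mul_div_cancel_left₀ _ (xQ_pos h0).ne'] at h
  linarith

end UO

namespace UO
open Complex

/-! ### Logarithms of λ and 1-λ -/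

lemma convex_im_pos : Convex ℝ {z : ℂ | 0 < z.im} := convex_halfSpace_im_gt 0

lemma const_of_deriv_zero {f : ℂ → ℂ} (h : ∀ z : ℂ, 0 < z.im → HasDerivAt f 0 z) {z w : ℂ}
    (hz : 0 < z.im) (hw : 0 < w.im) : f z = f w :=
  isOpen_im_pos.is_const_of_deriv_eq_zero convex_im_pos.isPreconnected
    (fun x hx => (h x hx).differentiableAt.differentiableWithinAt)
    (fun x hx => (h x hx).deriv) hz hw

lemma exists_tL : ∃ g : ℂ → ℂ, (∀ z : ℂ, 0 < z.im → HasDerivAt g (Real.pi * I * tC z) z) ∧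
    g I = Real.log (xa 1 / xb 1) := by
  obtain ⟨g, hg⟩ := convex_im_pos.exists_forall_hasDerivWithinAt (𝕜 := ℂ)
    (f := fun z => Real.pi * I * tC z)
    (fun z hz => ((tC_diff hz).const_mul _).differentiableWithinAt)
  refine ⟨fun z => g z - g I + Real.log (xa 1 / xb 1), fun z hz => ?_, by simp⟩
  exact (((hg z hz).hasDerivAt (isOpen_im_pos.mem_nhds hz)).sub_const _).add_const _

/-- `log λ` -/
def tL : ℂ → ℂ := Classical.choose exists_tL
/-- `log (1-λ)` -/
def tM (z : ℂ) : ℂ := tL (-1 / z)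

lemma tL_deriv {z : ℂ} (hz : 0 < z.im) : HasDerivAt tL (Real.pi * I * tC z) z :=
  (Classical.choose_spec exists_tL).1 z hz
lemma tL_I : tL I = Real.log (xa 1 / xb 1) := (Classical.choose_spec exists_tL).2

lemma tM_deriv {z : ℂ} (hz : 0 < z.im) : HasDerivAt tM (-(Real.pi * I * tA z)) z := by
  have h := deriv_S hz (tL_deriv (im_S_pos hz)).differentiableAt
  rw [(tL_deriv (im_S_pos hz)).deriv, tC_S hz] at h
  refine h.congr_deriv ?_
  have := ne_zero_of_im hz
  field_simp

lemma tB_deriv {z : ℂ} (hz : 0 < z.im) :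
    HasDerivAt tB (Real.pi * I / 3 * tB z * (mP z + tA z - tC z)) z := by
  have h1 := (tA_deriv hz).add (tC_deriv hz)
  have h2 : tB =ᶠ[nhds z] (tA + tC) := by
    filter_upwards [ev_im_pos hz] with w hw
    simp [jacobi_id hw]
  refine (h1.congr_of_eventuallyEq h2).congr_deriv ?_
  rw [jacobi_id hz]; ring

lemma exp_tL {z : ℂ} (hz : 0 < z.im) : cexp (tL z) = tA z / tB z := by
  have h : ∀ z : ℂ, 0 < z.im → HasDerivAt (fun z => cexp (-tL z) * (tA z / tB z)) 0 z := by
    intro z hz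
    refine (((tL_deriv hz).fun_neg.cexp).fun_mul ((tA_deriv hz).fun_div (tB_deriv hz) (tB_ne hz))).congr_deriv ?_
    have := tB_ne hz
    field_simp
    rw [jacobi_id hz]; ring
  have h2 := const_of_deriv_zero h hz (w := I) (by simp)
  have h3 : tA I = xa 1 := by simpa using xa_eq 1
  have h4 : tB I = xb 1 := by simpa using xb_eq one_pos
  have h5 : cexp (-tL I) * (tA I / tB I) = 1 := by
    have h6 := div_pos (xa_pos one_pos) (xb_pos one_pos)
    rw [tL_I, h3, h4, ← Complex.ofReal_neg, ← Complex.ofReal_exp, Real.exp_neg, Real.exp_log h6,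
      ← Complex.ofReal_div, ← Complex.ofReal_mul, inv_mul_cancel₀ h6.ne', Complex.ofReal_one]
  rw [h5, Complex.exp_neg] at h2
  field_simp at h2
  rw [eq_div_iff (tB_ne hz)]
  have := tB_ne hz
  field_simp at h2
  linear_combination -h2

lemma exp_tM {z : ℂ} (hz : 0 < z.im) : cexp (tM z) = tC z / tB z := by
  have h := exp_tL (im_S_pos hz)
  rw [tM, h, tA_S hz, tB_S hz]
  have := ne_zero_of_im hz
  have := tB_ne hz
  field_simp

lemma tL_axis {t : ℝ} (ht : 0 < t) : tL (t * I) = Real.log (xa t / xb t) := by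
  have him : (tL (t * I)).im = 0 := by
    have hd : ∀ s : ℝ, 0 < s → HasDerivAt (fun s : ℝ => (tL (s * I)).im) 0 s := by
      intro s hs
      have h := axis_deriv_im (tL_deriv (im_yI hs)).differentiableAt
      rw [(tL_deriv (im_yI hs)).deriv, xc_eq] at h
      refine h.congr_deriv ?_
      simp
    have h2 := (convex_Ioi (0:ℝ)).is_const_of_fderivWithin_eq_zero (𝕜 := ℝ)
      (f := fun s : ℝ => (tL (s * I)).im)
      (fun s hs => (hd s hs).differentiableAt.differentiableWithinAt)
      (fun s hs => by
        have := (hd s hs).hasFDerivAt.hasFDerivWithinAt (s := Set.Ioi (0:ℝ))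
        rw [this.fderivWithin (isOpen_Ioi.uniqueDiffWithinAt hs)]; ext; simp)
      (show t ∈ Set.Ioi (0:ℝ) from ht) (show (1:ℝ) ∈ Set.Ioi (0:ℝ) by simp)
    rw [h2]; simp only [Complex.ofReal_one, one_mul, tL_I, Complex.ofReal_im]
  have h1 : tL (t * I) = ((tL (t * I)).re : ℂ) := by apply Complex.ext <;> simp [him]
  have h2 := exp_tL (im_yI ht)
  rw [h1, xa_eq, xb_eq ht] at h2
  have h3 : Real.exp (tL (t * I)).re = xa t / xb t := by exact_mod_cast h2
  rw [h1, ← h3, Real.log_exp]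

def xL (t : ℝ) : ℝ := Real.log (xa t / xb t)
def xM (t : ℝ) : ℝ := Real.log (xc t / xb t)

lemma tM_axis {t : ℝ} (ht : 0 < t) : tM (t * I) = xM t := by
  rw [tM, S_axis ht, tL_axis (by positivity)]
  congr 2
  unfold xb
  rw [xa_S ht, xc_S ht]
  have := xb_pos ht
  unfold xb at this
  have h2 : xc t + xa t ≠ 0 := ne_of_gt (by linarith)
  field_simp
  ring

/-- the strip filter at `i∞` -/
abbrev sI : Filter ℂ := iInfty ⊓ 𝓟 {z | |z.re| ≤ 2}

lemma tendsto_sI_of_axis {f f' : ℂ → ℂ} {l : ℂ} (hf : ∀ z : ℂ, 0 < z.im → HasDerivAt f (f' z) z)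
    (hf' : Tendsto f' iInfty (nhds 0)) (hl : Tendsto (fun t : ℝ => f (t * I)) atTop (nhds l)) :
    Tendsto f sI (nhds l) := by
  rw [Metric.tendsto_nhds] at hf' hl ⊢
  intro ε hε
  have h1 := hf' (ε / 6) (by positivity)
  have h2 := hl (ε / 2) (by positivity)
  rw [eventually_comap, eventually_atTop] at h1
  rw [eventually_atTop] at h2
  obtain ⟨M, hM⟩ := h1
  obtain ⟨M', hM'⟩ := h2
  rw [eventually_inf_principal, eventually_comap, eventually_atTop]
  refine ⟨max (max M M') 1, fun y hy z hzy hz => ?_⟩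
  have hy1 : M ≤ y := (le_max_left M M').trans ((le_max_left _ _).trans hy)
  have hy2 : M' ≤ y := (le_max_right M M').trans ((le_max_left _ _).trans hy)
  have hy3 : 0 < y := by have := (le_max_right (max M M') 1).trans hy; linarith
  have hmv := Convex.norm_image_sub_le_of_norm_hasDerivWithin_le (f := f) (f' := f') (C := ε / 6)
    (s := segment ℝ ((y : ℂ) * I) z) (x := (y : ℂ) * I) (y := z) (fun w hw => ?_) (fun w hw => ?_)
    (convex_segment _ _) (left_mem_segment ℝ _ _) (right_mem_segment ℝ _ _)
  · have h3 : ‖z - y * I‖ ≤ 2 := by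
      have : z - y * I = ((z.re : ℝ) : ℂ) := by apply Complex.ext <;> simp [hzy]
      rw [this, Complex.norm_real]; exact hz
    have h4 := hM' y hy2
    rw [dist_eq_norm] at h4 ⊢
    calc ‖f z - l‖ = ‖(f z - f (y * I)) + (f (y * I) - l)‖ := by ring_nf
      _ ≤ ‖f z - f (y * I)‖ + ‖f (y * I) - l‖ := norm_add_le _ _
      _ < ε := by nlinarith
  all_goals
    have him : w.im = y := by
      obtain ⟨a, b, _, _, hab, rfl⟩ := hw
      simp [hzy, ← add_mul, hab]
  · exact (hf w (by rw [him]; exact hy3)).hasDerivWithinAt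
  · have := hM y hy1 w him
    rw [dist_zero_right] at this; exact this.le

lemma tM_lim : Tendsto tM sI (nhds 0) := by
  refine tendsto_sI_of_axis (fun z hz => tM_deriv hz) ?_ ?_
  · have := (tA_lim.const_mul (Real.pi * I : ℂ)).neg
    simpa using this
  · have h1 : Tendsto xM atTop (nhds 0) := by
      have h2 := (xc_lim.div (xa_lim.add xc_lim) (by norm_num))
      have h3 := h2.log (by norm_num)
      norm_num at h3
      exact h3
    have h2 : Tendsto (fun t : ℝ => ((xM t : ℝ) : ℂ)) atTop (nhds ((0 : ℝ) : ℂ)) :=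
      (Complex.continuous_ofReal.tendsto 0).comp h1
    rw [Complex.ofReal_zero] at h2
    refine h2.congr' ?_
    filter_upwards [eventually_gt_atTop 0] with t ht
    rw [tM_axis ht]

lemma xa_exp_lim : Tendsto (fun t => xa t * Real.exp (Real.pi * t)) atTop (nhds 16) := by
  have h := axis_lim tA0_lim
  norm_num at h
  refine h.congr fun t => ?_
  have h3 : tA0 (t * I) = (Real.exp (Real.pi * t) : ℂ) * tA (t * I) := by
    rw [tA_eq]
    rw [← mul_assoc]
    have : (Real.exp (Real.pi * t) : ℂ) * cexp (Real.pi * I * (t * I)) = 1 := by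
      rw [Complex.ofReal_exp, ← Complex.exp_add]
      have : ((Real.pi * t : ℝ) : ℂ) + Real.pi * I * (t * I) = 0 := by
        push_cast; linear_combination (Real.pi * t : ℂ) * I_sq
      rw [this, Complex.exp_zero]
    rw [this, one_mul]
  rw [h3, xa_eq, ← Complex.ofReal_mul, Complex.ofReal_re]; ring

lemma xL_lim : Tendsto (fun t => xL t + Real.pi * t) atTop (nhds (Real.log 16)) := by
  have h1 := (xa_exp_lim.div (xa_lim.add xc_lim) (by norm_num)).log (by norm_num)
  norm_num at h1
  refine h1.congr' ?_
  filter_upwards [eventually_gt_atTop 0] with t ht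
  have h2 := xa_pos ht
  have h3 := xb_pos ht
  have : (fun t => xa t * Real.exp (Real.pi * t)) t / (xa t + xc t) = xa t / xb t * Real.exp (Real.pi * t) := by
    simp only [xb]; ring
  unfold xL
  rw [show xa t * Real.exp (Real.pi * t) / (xa t + xc t) = xa t / xb t * Real.exp (Real.pi * t) by
    simp only [xb]; ring, Real.log_mul (by positivity) (Real.exp_pos _).ne', Real.log_exp]

lemma tL_lim : Tendsto (fun z => tL z - Real.pi * I * z) sI (nhds (Real.log 16)) := by
  refine tendsto_sI_of_axis (f' := fun z => Real.pi * I * tC z - Real.pi * I) (fun z hz => ?_) ?_ ?_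
  · refine ((tL_deriv hz).fun_sub ((hasDerivAt_id' z).const_mul (Real.pi * I : ℂ))).congr_deriv (by simp)
  · have := (tC_lim.const_mul (Real.pi * I : ℂ)).sub_const (Real.pi * I : ℂ)
    simpa using this
  · have h2 : Tendsto (fun t : ℝ => ((xL t + Real.pi * t : ℝ) : ℂ)) atTop (nhds ((Real.log 16 : ℝ) : ℂ)) :=
      (Complex.continuous_ofReal.tendsto _).comp xL_lim
    refine h2.congr' ?_
    filter_upwards [eventually_gt_atTop 0] with t ht
    rw [tL_axis ht, ← xL]; push_cast
    linear_combination (Real.pi * t : ℂ) * I_sq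

lemma tendsto_axis_sI {x : ℝ} (hx : |x| ≤ 2) : Tendsto (fun t : ℝ => (t : ℂ) * I + x) atTop sI := by
  rw [tendsto_inf, tendsto_principal]
  constructor
  · unfold iInfty
    rw [tendsto_comap_iff]
    have : Complex.im ∘ (fun t : ℝ => (t : ℂ) * I + x) = id := by ext t; simp
    rw [this]; exact tendsto_id
  · filter_upwards with t
    simpa using hx

lemma tM_T {z : ℂ} (hz : 0 < z.im) : tM (z + 1) = - tM z := by
  have h : ∀ z : ℂ, 0 < z.im → HasDerivAt (fun z => tM (z + 1) + tM z) 0 z := by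
    intro z hz
    have hz1 : 0 < (z + 1).im := by simpa using hz
    refine (((tM_deriv hz1).comp_add_const z 1).fun_add (tM_deriv hz)).congr_deriv ?_
    rw [tA_T]; ring
  have h2 : Tendsto (fun t : ℝ => tM (t * I + (1 : ℝ)) + tM (t * I + (0 : ℝ))) atTop (nhds (0 + 0)) :=
    (tM_lim.comp (tendsto_axis_sI (x := 1) (by norm_num))).add
      (tM_lim.comp (tendsto_axis_sI (x := 0) (by norm_num)))
  have h3 : (fun t : ℝ => tM (t * I + (1 : ℝ)) + tM (t * I + (0 : ℝ))) =ᶠ[atTop] fun _ => tM (z + 1) + tM z := by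
    filter_upwards [eventually_gt_atTop 0] with t ht
    have := const_of_deriv_zero h (im_yI ht) hz
    simpa using this
  have h4 := tendsto_nhds_unique (tendsto_const_nhds.congr' h3.symm) h2
  linear_combination h4

lemma tL_T {z : ℂ} (hz : 0 < z.im) : tL (z + 1) = tL z - tM z + Real.pi * I := by
  have h : ∀ z : ℂ, 0 < z.im → HasDerivAt (fun z => tL (z + 1) - tL z + tM z) 0 z := by
    intro z hz
    have hz1 : 0 < (z + 1).im := by simpa using hz
    refine ((((tL_deriv hz1).comp_add_const z 1).fun_sub (tL_deriv hz)).fun_add (tM_deriv hz)).congr_deriv ?_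
    rw [tC_T, jacobi_id hz]; ring
  have h2 := (((tL_lim.comp (tendsto_axis_sI (x := 1) (by norm_num))).sub
      (tL_lim.comp (tendsto_axis_sI (x := 0) (by norm_num)))).add
      (tM_lim.comp (tendsto_axis_sI (x := 0) (by norm_num)))).add_const (Real.pi * I : ℂ)
  have h3 : (fun t : ℝ => tL (t * I + (1 : ℝ)) - Real.pi * I * (t * I + (1 : ℝ)) -
      (tL (t * I + (0 : ℝ)) - Real.pi * I * (t * I + (0 : ℝ))) + tM (t * I + (0 : ℝ)) + Real.pi * I) =ᶠ[atTop]
      fun _ => tL (z + 1) - tL z + tM z := by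
    filter_upwards [eventually_gt_atTop 0] with t ht
    have := const_of_deriv_zero h (im_yI ht) hz
    rw [← this]
    push_cast
    rw [add_zero]
    ring
  have h4 := tendsto_nhds_unique (tendsto_const_nhds.congr' h3.symm) h2
  linear_combination h4

lemma tM_S {z : ℂ} : tM (-1 / z) = tL z := by
  rw [tM]; congr 1
  by_cases h : z = 0
  · simp [h]
  · field_simp

/-- `log(1-λ) / a → -1` -/
lemma tM_div_lim : Tendsto (fun z => tM z / tA z) sI (nhds (-1)) := by
  have h1 : Tendsto (fun w : ℂ => w⁻¹ * (cexp w - 1)) (nhdsWithin 0 {0}ᶜ) (nhds 1) := by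
    have := (Complex.hasDerivAt_exp 0).tendsto_slope_zero
    simpa using this
  have hev : ∀ᶠ z in sI, 0 < z.im := ev_iInfty.filter_mono inf_le_left
  have hne : ∀ z : ℂ, 0 < z.im → tM z ≠ 0 := by
    intro z hz h0
    have := exp_tM hz
    rw [h0, Complex.exp_zero, eq_div_iff (tB_ne hz), jacobi_id hz] at this
    exact tA_ne hz (by linear_combination this)
  have h2 : Tendsto tM sI (nhdsWithin 0 {0}ᶜ) := by
    rw [tendsto_nhdsWithin_iff]
    exact ⟨tM_lim, hev.mono fun z hz => hne z hz⟩
  have h3 := (h1.comp h2).inv₀ one_ne_zero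
  have h4 : Tendsto tB sI (nhds 1) := tB_lim.mono_left inf_le_left
  have h5 := (h3.div h4 one_ne_zero).neg
  rw [inv_one, div_one] at h5
  refine h5.congr' ?_
  filter_upwards [hev] with z hz
  simp only [Function.comp, Pi.div_apply]
  have e : cexp (tM z) - 1 = -(tA z / tB z) := by
    rw [exp_tM hz]
    have := tB_ne hz
    field_simp
    rw [jacobi_id hz]; ring
  rw [e]
  have := tB_ne hz
  have := tA_ne hz
  have := hne z hz
  field_simp

end UO

namespace UO
open Complex

/-! ### The kernel -/

/-- the constant `6/(πi)` -/
def kC : ℂ := -(6 / Real.pi : ℝ) * I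
def kS (b : ℝ) : ℝ := xQ b ^ 2 * (xa b * xL b + xc b * xM b) / (2 * xa b * xb b * xc b)
def kV (b : ℝ) : ℝ := (xa b ^ 2 - 2 * xa b * xc b - 2 * xc b ^ 2) * xL b
  + (xc b ^ 2 - 2 * xa b ^ 2 - 2 * xa b * xc b) * xM b
def kG (b : ℝ) : ℝ := 2 * (xP b * b - 3 / Real.pi) * xQ b
def kJ (b : ℝ) : ℝ := xQ b ^ 3 / xD b

def nPl (b : ℝ) (z : ℂ) : ℂ := (Real.pi ^ 2 / 36 : ℝ) * (-(z ^ 2 * mD z * xal b)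
  + b * xR b * (mQ z ^ 2 * (z ^ 2 * mQ z - (mP z * z + kC) ^ 2))
  + kG b * (mQ z * mR z * (z * (z * mP z + kC)) - z ^ 2 * mQ z ^ 3))
def nPlS (b : ℝ) (z : ℂ) : ℂ := (Real.pi ^ 2 / 36 : ℝ) * (-(mD z * xal b)
  + b * xR b * (mQ z ^ 2 * (mQ z - mP z ^ 2))
  + kG b * (mQ z * (mP z * mR z - mQ z ^ 2)))
def nX (b : ℝ) (z : ℂ) : ℂ := 2 * z * nPlS b z + (Real.pi ^ 2 / 36 : ℝ) * kC *
  (-(2 * b * xR b * mP z * mQ z ^ 2) + kG b * (mQ z * mR z))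
def nMi (b : ℝ) (z : ℂ) : ℂ := (1 / Real.pi : ℝ) * (xQ b * tL z * (mQ z * mR z)
  + kS b * tP z * (2 * tA z ^ 2 + 2 * tA z * tC z - tC z ^ 2) + kV b / 2 * mQ z ^ 2 * tC z)
def nMiS (b : ℝ) (z : ℂ) : ℂ := (1 / Real.pi : ℝ) * (xQ b * tM z * (mQ z * mR z)
  - kS b * tP z * (2 * tC z ^ 2 + 2 * tA z * tC z - tA z ^ 2) - kV b / 2 * mQ z ^ 2 * tA z)
def kD (b : ℝ) (z : ℂ) : ℂ := kJ b * mD z - mQ z ^ 3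

lemma mP_S' {z : ℂ} (hz : 0 < z.im) : mP (-1 / z) = z ^ 2 * mP z + kC * z := by
  have : (Real.pi : ℂ) ≠ 0 := by exact_mod_cast Real.pi_ne_zero
  rw [mP_S hz, kC]; push_cast
  rw [div_mul_eq_div_mul_one_div, one_div, Complex.inv_I]
  ring

lemma sub_im {z : ℂ} (hz : 0 < z.im) : 0 < (z - 1).im := by simpa using hz
lemma add_im {z : ℂ} (hz : 0 < z.im) : 0 < (z + 1).im := by simpa using hz
lemma tA_T' (z : ℂ) : tA (z - 1) = - tA z := by have := tA_T (z - 1); rw [sub_add_cancel] at this; rw [this, neg_neg]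
lemma tB_T' (z : ℂ) : tB (z - 1) = tC z := by have := tC_T (z - 1); rw [sub_add_cancel] at this; rw [this]
lemma tC_T' (z : ℂ) : tC (z - 1) = tB z := by have := tB_T (z - 1); rw [sub_add_cancel] at this; rw [this]
lemma mP_T' (z : ℂ) : mP (z - 1) = mP z := by have := mP_T (z - 1); rw [sub_add_cancel] at this; rw [this]
lemma mD_T' (z : ℂ) : mD (z - 1) = mD z := by
  have := mD_T (z := z - 1); rw [sub_add_cancel] at this; rw [this]
lemma mQ_T' {z : ℂ} (hz : 0 < z.im) : mQ (z - 1) = mQ z := by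
  have := mQ_T (sub_im hz); rw [sub_add_cancel] at this; rw [this]
lemma mR_T' {z : ℂ} (hz : 0 < z.im) : mR (z - 1) = mR z := by
  have := mR_T (sub_im hz); rw [sub_add_cancel] at this; rw [this]
lemma tM_T' {z : ℂ} (hz : 0 < z.im) : tM (z - 1) = - tM z := by
  have := tM_T (sub_im hz); rw [sub_add_cancel] at this; rw [this, neg_neg]
lemma tL_T' {z : ℂ} (hz : 0 < z.im) : tL (z - 1) = tL z - tM z - Real.pi * I := by
  have := tL_T (sub_im hz); rw [sub_add_cancel, tM_T' hz] at this; rw [this]; ring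

lemma kD_T (b : ℝ) {z : ℂ} (hz : 0 < z.im) : kD b (z + 1) = kD b z := by
  rw [kD, kD, mD_T, mQ_T hz]
lemma kD_T' (b : ℝ) {z : ℂ} (hz : 0 < z.im) : kD b (z - 1) = kD b z := by
  rw [kD, kD, mD_T', mQ_T' hz]
lemma kD_S (b : ℝ) {z : ℂ} (hz : 0 < z.im) : kD b (-1 / z) = z ^ 12 * kD b z := by
  rw [kD, kD, mD_S hz, mQ_S hz]; ring

lemma nPl_S (b : ℝ) {z : ℂ} (hz : 0 < z.im) : nPl b (-1 / z) = z ^ 10 * nPlS b z := by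
  have := ne_zero_of_im hz
  rw [nPl, nPlS, mD_S hz, mQ_S hz, mR_S hz, mP_S' hz]
  field_simp
  ring
lemma nMi_S (b : ℝ) {z : ℂ} (hz : 0 < z.im) : nMi b (-1 / z) = z ^ 10 * nMiS b z := by
  rw [nMi, nMiS, mQ_S hz, mR_S hz, tP, tP, tA_S hz, tB_S hz, tC_S hz, ← tM]
  ring
lemma nPl_T (b : ℝ) {z : ℂ} (hz : 0 < z.im) :
    nPl b (z + 1) = nPl b z + nPlS b z + nX b z := by
  rw [nPl, nPl, nX, nPlS, mD_T, mQ_T hz, mR_T hz, mP_T]; ring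
lemma nPl_T' (b : ℝ) {z : ℂ} (hz : 0 < z.im) :
    nPl b (z - 1) = nPl b z + nPlS b z - nX b z := by
  rw [nPl, nPl, nX, nPlS, mD_T', mQ_T' hz, mR_T' hz, mP_T']; ring
lemma nMi_T (b : ℝ) {z : ℂ} (hz : 0 < z.im) :
    nMi b (z + 1) = nMi b z - nMiS b z + I * (xQ b * (mQ z * mR z)) := by
  have : (Real.pi : ℂ) ≠ 0 := by exact_mod_cast Real.pi_ne_zero
  rw [nMi, nMi, nMiS, mQ_T hz, mR_T hz, tP, tP, tA_T, tB_T, tC_T, tL_T hz, jacobi_id hz]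
  push_cast; field_simp; ring
lemma nMi_T' (b : ℝ) {z : ℂ} (hz : 0 < z.im) :
    nMi b (z - 1) = nMi b z - nMiS b z - I * (xQ b * (mQ z * mR z)) := by
  have : (Real.pi : ℂ) ≠ 0 := by exact_mod_cast Real.pi_ne_zero
  rw [nMi, nMi, nMiS, mQ_T' hz, mR_T' hz, tP, tP, tA_T', tB_T', tC_T', tL_T' hz, jacobi_id hz]
  push_cast; field_simp; ring

lemma one_sub_im {z : ℂ} (hz : 0 < z.im) : 0 < (1 - 1 / z).im := by
  have := im_S_pos hz
  rw [show 1 - 1 / z = -1 / z + 1 by ring]; exact add_im this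

lemma nPl_TS (b : ℝ) {z : ℂ} (hz : 0 < z.im) : nPl b (1 - 1 / z) = z ^ 10 * nPl b (z - 1) := by
  have h0 := ne_zero_of_im hz
  have h := im_S_pos hz
  rw [show 1 - 1 / z = -1 / z + 1 by ring, nPl, nPl, mD_T, mQ_T h, mR_T h, mP_T, mD_S hz, mQ_S hz, mR_S hz, mP_S' hz,
    mD_T', mQ_T' hz, mR_T' hz, mP_T']
  field_simp
  ring
lemma nMi_TS (b : ℝ) {z : ℂ} (hz : 0 < z.im) : nMi b (1 - 1 / z) = -z ^ 10 * nMi b (z - 1) := by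
  have h := im_S_pos hz
  rw [show 1 - 1 / z = -1 / z + 1 by ring, nMi, nMi, mQ_T h, mR_T h, tP, tP, tA_T, tB_T, tC_T, tL_T h, tM_S,
    ← tM, mQ_S hz, mR_S hz, tA_S hz, tB_S hz, tC_S hz,
    mQ_T' hz, mR_T' hz, tA_T', tB_T', tC_T', tL_T' hz, jacobi_id hz]
  ring
lemma kD_TS (b : ℝ) {z : ℂ} (hz : 0 < z.im) : kD b (1 - 1 / z) = z ^ 12 * kD b (z - 1) := by
  rw [show 1 - 1 / z = -1 / z + 1 by ring, kD_T b (im_S_pos hz), kD_S b hz, kD_T' b hz]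

/-- the kernels -/
def kK (b : ℝ) (z : ℂ) : ℂ := I * (nPl b z + nMi b z) / (2 * kD b z)
def kT (b : ℝ) (z : ℂ) : ℂ := I * (nPl b z - nMi b z) / (2 * kD b z)

lemma kK_TS (b : ℝ) {z : ℂ} (hz : 0 < z.im) : kK b (1 - 1 / z) = (z ^ 2)⁻¹ * kT b (z - 1) := by
  have h0 := ne_zero_of_im hz
  rw [kK, kT, nPl_TS b hz, nMi_TS b hz, kD_TS b hz]
  by_cases h : kD b (z - 1) = 0
  · simp [h]
  · field_simp
    ring

lemma nPl_diff (b : ℝ) {z : ℂ} (hz : 0 < z.im) : DifferentiableAt ℂ (nPl b) z := by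
  have := mD_diff hz; have := mQ_diff hz; have := mR_diff hz; have := mP_diff hz
  unfold nPl; fun_prop
lemma nPlS_diff (b : ℝ) {z : ℂ} (hz : 0 < z.im) : DifferentiableAt ℂ (nPlS b) z := by
  have := mD_diff hz; have := mQ_diff hz; have := mR_diff hz; have := mP_diff hz
  unfold nPlS; fun_prop
lemma nMi_diff (b : ℝ) {z : ℂ} (hz : 0 < z.im) : DifferentiableAt ℂ (nMi b) z := by
  have := tP_diff hz; have := mQ_diff hz; have := mR_diff hz; have := tA_diff hz
  have := tC_diff hz; have := (tL_deriv hz).differentiableAt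
  unfold nMi; fun_prop
lemma nMiS_diff (b : ℝ) {z : ℂ} (hz : 0 < z.im) : DifferentiableAt ℂ (nMiS b) z := by
  have := tP_diff hz; have := mQ_diff hz; have := mR_diff hz; have := tA_diff hz
  have := tC_diff hz; have := (tM_deriv hz).differentiableAt
  unfold nMiS; fun_prop
lemma kD_deriv (b : ℝ) {z : ℂ} (hz : 0 < z.im) :
    HasDerivAt (kD b) (2 * Real.pi * I * (mP z * kD b z + mQ z ^ 2 * mR z)) z := by
  have hD : HasDerivAt mD (2 * Real.pi * I * (mP z * mD z)) z := by
    have e : mD =ᶠ[nhds z] fun z => (mQ z ^ 3 - mR z ^ 2) / 1728 := by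
      filter_upwards [ev_im_pos hz] with w hw
      rw [mD_eq hw]; ring
    have h := (((mQ_deriv hz).fun_pow 3).fun_sub ((mR_deriv hz).fun_pow 2)).div_const 1728
    refine (h.congr_of_eventuallyEq e).congr_deriv ?_
    have : mD z = (mQ z ^ 3 - mR z ^ 2) / 1728 := by rw [mD_eq hz]; ring
    rw [this]; push_cast; ring
  have h := (hD.const_mul (kJ b : ℂ)).fun_sub ((mQ_deriv hz).fun_pow 3)
  refine h.congr_deriv ?_
  rw [kD]; push_cast; ring
lemma kD_diff (b : ℝ) {z : ℂ} (hz : 0 < z.im) : DifferentiableAt ℂ (kD b) z :=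
  (kD_deriv b hz).differentiableAt

/-! #### axis values -/
def xnP (b t : ℝ) : ℝ := Real.pi ^ 2 / 36 * (t ^ 2 * xD t * xal b
  + b * xR b * (xQ t ^ 2 * (-(t ^ 2 * xQ t) + (xP t * t - 6 / Real.pi) ^ 2))
  + kG b * (-(xQ t * xR t * (t * (t * xP t - 6 / Real.pi))) + t ^ 2 * xQ t ^ 3))
def xnPS (b t : ℝ) : ℝ := Real.pi ^ 2 / 36 * (-(xD t * xal b)
  + b * xR b * (xQ t ^ 2 * (xQ t - xP t ^ 2))
  + kG b * (xQ t * (xP t * xR t - xQ t ^ 2)))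
def xnM (b t : ℝ) : ℝ := 1 / Real.pi * (xQ b * xL t * (xQ t * xR t)
  + kS b * (xa t * xb t * xc t) * (2 * xa t ^ 2 + 2 * xa t * xc t - xc t ^ 2) + kV b / 2 * xQ t ^ 2 * xc t)
def xnMS (b t : ℝ) : ℝ := 1 / Real.pi * (xQ b * xM t * (xQ t * xR t)
  - kS b * (xa t * xb t * xc t) * (2 * xc t ^ 2 + 2 * xa t * xc t - xa t ^ 2) - kV b / 2 * xQ t ^ 2 * xa t)
def xkD (b t : ℝ) : ℝ := kJ b * xD t - xQ t ^ 3

lemma nPl_axis (b : ℝ) {t : ℝ} (ht : 0 < t) : nPl b (t * I) = xnP b t := by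
  rw [nPl, xnP, xD_eq ht, xQ_eq, xR_eq, xP_eq ht, kC]
  push_cast
  rw [show (xP t : ℂ) * (t * I) + -(6 / Real.pi) * I = (xP t * t - 6 / Real.pi) * I by ring,
    show (t : ℂ) * I * xP t + -(6 / Real.pi) * I = (t * xP t - 6 / Real.pi) * I by ring,
    show (t : ℂ) * I * ((t * xP t - 6 / Real.pi) * I) = t * (t * xP t - 6 / Real.pi) * I ^ 2 by ring,
    mul_pow, mul_pow, I_sq]
  ring
lemma nPlS_axis (b : ℝ) {t : ℝ} (ht : 0 < t) : nPlS b (t * I) = xnPS b t := by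
  rw [nPlS, xnPS, xD_eq ht, xQ_eq, xR_eq, xP_eq ht]
  push_cast
  ring
lemma nX_axis (b : ℝ) {t : ℝ} (ht : 0 < t) : nX b (t * I) = I * xX b t := by
  have : (Real.pi : ℂ) ≠ 0 := by exact_mod_cast Real.pi_ne_zero
  rw [nX, nPlS_axis b ht, xX, xnPS, xQ_eq, xR_eq, xP_eq ht, kC, kG, xphi1, xphi2]
  push_cast
  field_simp
  ring
lemma nMi_axis (b : ℝ) {t : ℝ} (ht : 0 < t) : nMi b (t * I) = xnM b t := by
  rw [nMi, xnM, xQ_eq, xR_eq, tP, xa_eq, xb_eq ht, xc_eq, tL_axis ht, ← xL]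
  push_cast; ring
lemma nMiS_axis (b : ℝ) {t : ℝ} (ht : 0 < t) : nMiS b (t * I) = xnMS b t := by
  rw [nMiS, xnMS, xQ_eq, xR_eq, tP, xa_eq, xb_eq ht, xc_eq, tM_axis ht]
  push_cast; ring
lemma kD_axis (b : ℝ) {t : ℝ} (ht : 0 < t) : kD b (t * I) = xkD b t := by
  rw [kD, xkD, xQ_eq, xD_eq ht]
  push_cast; ring

lemma xkD_S (b : ℝ) {t : ℝ} (ht : 0 < t) : xkD b (1 / t) = t ^ 12 * xkD b t := by
  rw [xkD, xkD, xD_S ht, xQ_S ht]; ring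
lemma xnP_S (b : ℝ) {t : ℝ} (ht : 0 < t) : xnP b (1 / t) = -t ^ 10 * xnPS b t := by
  have h := nPl_S b (im_yI ht)
  rw [S_axis ht, nPl_axis b (by positivity), nPlS_axis b ht, mul_pow,
    show I ^ 10 = -1 by rw [show (10 : ℕ) = 2 * 5 by rfl, pow_mul, I_sq]; norm_num] at h
  apply Complex.ofReal_injective
  rw [h]; push_cast; ring
lemma xnM_S (b : ℝ) {t : ℝ} (ht : 0 < t) : xnM b (1 / t) = -t ^ 10 * xnMS b t := by
  have h := nMi_S b (im_yI ht)
  rw [S_axis ht, nMi_axis b (by positivity), nMiS_axis b ht, mul_pow,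
    show I ^ 10 = -1 by rw [show (10 : ℕ) = 2 * 5 by rfl, pow_mul, I_sq]; norm_num] at h
  apply Complex.ofReal_injective
  rw [h]; push_cast; ring

/-! #### zeros of the numerators -/
lemma xnP_self {b : ℝ} (hb : 0 < b) : xnP b b = 0 := by
  have h1 := (xD_pos hb).ne'
  have := Real.pi_ne_zero
  rw [xnP, xal, kG]; field_simp; ring
lemma xnPS_self {b : ℝ} (hb : 0 < b) : xnPS b b = 0 := by
  have h1 := (xD_pos hb).ne'
  have := Real.pi_ne_zero
  rw [xnPS, xal, kG]; field_simp; ring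
lemma xnM_self {b : ℝ} (hb : 0 < b) : xnM b b = 0 := by
  have h1 := (xa_pos hb).ne'
  have h2 := (xb_pos hb).ne'
  have h3 := (xc_pos hb).ne'
  have := Real.pi_ne_zero
  rw [xnM, kS, kV, xR, xQ]; field_simp; ring
lemma xnMS_self {b : ℝ} (hb : 0 < b) : xnMS b b = 0 := by
  have h1 := (xa_pos hb).ne'
  have h2 := (xb_pos hb).ne'
  have h3 := (xc_pos hb).ne'
  have := Real.pi_ne_zero
  rw [xnMS, kS, kV, xR, xQ]; field_simp; ring
lemma xkD_self {b : ℝ} (hb : 0 < b) : xkD b b = 0 := by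
  have h1 := (xD_pos hb).ne'
  rw [xkD, kJ]; field_simp; ring

def xK (b t : ℝ) : ℝ := (xnP b t + xnM b t) / (2 * xkD b t)
def xT (b t : ℝ) : ℝ := (xnM b t - xnP b t) / (2 * xkD b t)

lemma kK_axis (b : ℝ) {t : ℝ} (ht : 0 < t) : kK b (t * I) = I * xK b t := by
  rw [kK, xK, nPl_axis b ht, nMi_axis b ht, kD_axis b ht]; push_cast; ring
lemma kT_axis (b : ℝ) {t : ℝ} (ht : 0 < t) : kT b (t * I) = -(I * xT b t) := by
  rw [kT, xT, nPl_axis b ht, nMi_axis b ht, kD_axis b ht]; push_cast; ring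

/-- `K(1+it)` -/
lemma kK_one (b : ℝ) {t : ℝ} (ht : 0 < t) : kK b (t * I + 1) =
    (-(xX b t + xQ b * (xQ t * xR t)) / (2 * xkD b t) : ℝ) + I * (xK b t + t ^ 2 * xT b (1 / t) : ℝ) := by
  have h := im_yI ht
  have hT : t ^ 2 * xT b (1 / t) = (xnPS b t - xnMS b t) / (2 * xkD b t) := by
    rw [xT, xnP_S b ht, xnM_S b ht, xkD_S b ht]
    by_cases h0 : xkD b t = 0
    · simp [h0]
    · field_simp; ring
  rw [hT, kK, nPl_T b h, nMi_T b h, kD_T b h, nPl_axis b ht, nMi_axis b ht, kD_axis b ht, nPlS_axis b ht,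
    nMiS_axis b ht, nX_axis b ht, xQ_eq, xR_eq, xK]
  push_cast
  by_cases h0 : (xkD b t : ℂ) = 0
  · simp [h0]
  · field_simp
    linear_combination (xX b t + xQ b * (xQ t * xR t) : ℂ) * I_sq

end UO

namespace UO
open Complex

/-! ### Zeros of the denominator -/

lemma kD_factor {b : ℝ} (hb : 0 < b) {z : ℂ} (hz : 0 < z.im) :
    (xa b * xb b * xc b) ^ 2 * kD b z = -((tA z * xc b - tC z * xa b) * (tA z * xa b - tC z * xc b)
      * (tA z * xb b + tC z * xa b) * (tA z * xa b + tC z * xb b) * (tA z * xb b + tC z * xc b)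
      * (tA z * xc b + tC z * xb b)) := by
  have h1 : (xa b : ℂ) ≠ 0 := by exact_mod_cast (xa_pos hb).ne'
  have h2 : (xb b : ℂ) ≠ 0 := by exact_mod_cast (xb_pos hb).ne'
  have h3 : (xc b : ℂ) ≠ 0 := by exact_mod_cast (xc_pos hb).ne'
  have e : (xa b * xb b * xc b : ℂ) ^ 2 * kD b z = xQ b ^ 3 * (tA z * tB z * tC z) ^ 2
      - (xa b * xb b * xc b) ^ 2 * mQ z ^ 3 := by
    rw [kD, kJ, xD, mD, tP]; push_cast; field_simp
  rw [e, jacobi_id hz, xQ, xb, mQ]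
  push_cast
  ring

lemma xkD_factor {b t : ℝ} (hb : 0 < b) (ht : 0 < t) :
    (xa b * xb b * xc b) ^ 2 * xkD b t = -((xa t * xc b - xc t * xa b) * (xa t * xa b - xc t * xc b)
      * (xa t * xb b + xc t * xa b) * (xa t * xa b + xc t * xb b) * (xa t * xb b + xc t * xc b)
      * (xa t * xc b + xc t * xb b)) := by
  have h := kD_factor hb (im_yI ht)
  rw [kD_axis b ht, xa_eq, xc_eq] at h
  exact_mod_cast h

lemma xac_lt {t b : ℝ} (hb : 0 < b) (h : b < t) : xa t * xc b < xc t * xa b := by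
  have ht := hb.trans h
  have := xac_anti (show b ∈ Set.Ioi (0:ℝ) from hb) (show t ∈ Set.Ioi (0:ℝ) from ht) h
  simp only at this
  rw [div_lt_div_iff₀ (xc_pos ht) (xc_pos hb)] at this
  linarith

lemma xac_lt' {t b : ℝ} (hb : 0 < b) (h : 1 / b < t) : xa t * xa b < xc t * xc b := by
  have := xac_lt (by positivity) h
  rw [xa_S hb, xc_S hb] at this
  have hb2 : 0 < b ^ 2 := by positivity
  nlinarith

lemma xac_gt' {t b : ℝ} (hb : 0 < b) (ht : 0 < t) (h : t < 1 / b) : xc t * xc b < xa t * xa b := by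
  have := xac_lt ht h
  rw [xa_S hb, xc_S hb] at this
  have hb2 : 0 < b ^ 2 := by positivity
  nlinarith

lemma inv_lt_self' {b : ℝ} (hb : 1 < b) : 1 / b < b := by
  rw [div_lt_iff₀ (by linarith)]; nlinarith

lemma xkD_eq_neg {b t : ℝ} (hb : 0 < b) (ht : 0 < t) : ∃ k : ℝ, 0 < k ∧
    xkD b t = -k * ((xa t * xc b - xc t * xa b) * (xa t * xa b - xc t * xc b)) := by
  have ha := xa_pos ht; have hc := xc_pos ht
  have ha0 := xa_pos hb; have hc0 := xc_pos hb; have hb0 := xb_pos hb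
  refine ⟨(xa t * xb b + xc t * xa b) * (xa t * xa b + xc t * xb b) * (xa t * xb b + xc t * xc b)
      * (xa t * xc b + xc t * xb b) / (xa b * xb b * xc b) ^ 2, by positivity, ?_⟩
  have := xkD_factor hb ht
  field_simp
  linear_combination this

lemma xkD_neg {b t : ℝ} (hb : 1 < b) (ht : b < t) : xkD b t < 0 := by
  have h0 := zero_lt_one.trans hb
  obtain ⟨k, hk, e⟩ := xkD_eq_neg h0 (h0.trans ht)
  have h1 := xac_lt h0 ht
  have h2 := xac_lt' h0 ((inv_lt_self' hb).trans ht)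
  rw [e]
  have := mul_pos (sub_pos.2 h1) (sub_pos.2 h2)
  nlinarith

lemma xkD_neg' {b t : ℝ} (hb : 1 < b) (ht0 : 0 < t) (ht : t < 1 / b) : xkD b t < 0 := by
  have h0 := zero_lt_one.trans hb
  obtain ⟨k, hk, e⟩ := xkD_eq_neg h0 ht0
  have h1 := xac_lt ht0 (ht.trans (inv_lt_self' hb))
  have h2 := xac_gt' h0 ht0 ht
  rw [e]
  have := mul_pos (sub_pos.2 h1) (sub_pos.2 h2)
  nlinarith

lemma xkD_pos {b t : ℝ} (hb : 1 < b) (ht0 : 1 / b < t) (ht : t < b) : 0 < xkD b t := by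
  have h0 := zero_lt_one.trans hb
  have ht1 : 0 < t := lt_trans (by positivity) ht0
  obtain ⟨k, hk, e⟩ := xkD_eq_neg h0 ht1
  have h1 := xac_lt ht1 ht
  have h2 := xac_lt' h0 ht0
  rw [e]
  have := mul_pos (sub_pos.2 h1) (sub_pos.2 h2)
  nlinarith

lemma xkD_ne {b t : ℝ} (hb : 1 < b) (ht0 : 0 < t) (h1 : t ≠ b) (h2 : t ≠ 1 / b) : xkD b t ≠ 0 := by
  rcases lt_or_gt_of_ne h1 with h | h
  · rcases lt_or_gt_of_ne h2 with h' | h'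
    · exact (xkD_neg' hb ht0 h').ne
    · exact (xkD_pos hb h' h).ne'
  · exact (xkD_neg hb h).ne

lemma xX_S (b : ℝ) {t : ℝ} (ht : 0 < t) : xX b (1 / t) = t ^ 10 * xX b t := by
  rw [xX, xX, xphi1, xphi1, xphi2, xphi2, xD_S ht, xQ_S ht, xR_S ht, xP_S ht]
  field_simp
  ring

/-- the real part of `K(1+it)` -/
def xRe (b t : ℝ) : ℝ := -(xX b t + xQ b * (xQ t * xR t)) / (2 * xkD b t)

lemma xRe_pos {b t : ℝ} (hb : 1 < b) (ht : b < t) : 0 < xRe b t := by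
  have h0 := zero_lt_one.trans hb
  have h1 := xkD_neg hb ht
  have h2 := xX_pos hb (hb.trans ht).le
  have h3 := mul_pos (xQ_pos h0) (mul_pos (xQ_pos (h0.trans ht)) (xR_pos (hb.trans ht)))
  exact div_pos_of_neg_of_neg (by linarith) (by linarith)

lemma xRe_nonpos {b t : ℝ} (hb : 1 < b) (ht0 : 0 < t) (ht : t < b) : xRe b t ≤ 0 := by
  have h0 := zero_lt_one.trans hb
  rcases le_or_gt 1 t with h | h
  · have h1 := xkD_pos hb (((div_lt_one h0).2 hb).trans_le h) ht
    have h2 := xX_pos hb h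
    have h3 := mul_nonneg (xQ_pos h0).le (mul_nonneg (xQ_pos ht0).le (xR_nonneg h))
    exact div_nonpos_of_nonpos_of_nonneg (by linarith) (by linarith)
  · obtain ⟨s, hs⟩ : ∃ s, s = 1 / t := ⟨_, rfl⟩
    have hts : t = 1 / s := by rw [hs]; simp
    have hs1 : 1 < s := by rw [hs, lt_div_iff₀ ht0]; linarith
    have hs0 := zero_lt_one.trans hs1
    have hp : 0 < s ^ 10 := by positivity
    have e : xX b t + xQ b * (xQ t * xR t) = s ^ 10 * (xX b s - xQ b * (xQ s * xR s)) := by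
      rw [hts, xX_S b hs0, xQ_S hs0, xR_S hs0]; ring
    rw [xRe, e]
    rcases lt_trichotomy s b with h1 | h1 | h1
    · have h2 := xX_gt_of_lt hs1.le h1
      have h3 := xkD_pos (t := t) hb (by rw [hts]; exact one_div_lt_one_div_of_lt hs0 h1) ht
      refine div_nonpos_of_nonpos_of_nonneg ?_ (by linarith)
      have := mul_pos hp (sub_pos.2 h2); linarith
    · rw [hts, h1, xkD_S b h0, xkD_self h0]; simp
    · have h2 := xX_lt_of_lt hb.le h1
      have h3 := xkD_neg' (t := t) hb ht0 (by rw [hts]; exact one_div_lt_one_div_of_lt h0 h1)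
      refine div_nonpos_of_nonneg_of_nonpos ?_ (by linarith)
      have := mul_pos hp (sub_pos.2 h2); linarith

/-! ### The triangle -/

/-- the open ideal triangle with vertices `0,1,∞` -/
def tri : Set ℂ := {z | 0 < z.im ∧ 0 < z.re ∧ z.re < 1 ∧ z.re < z.re ^ 2 + z.im ^ 2}

lemma tri_isOpen : IsOpen tri := by
  refine (isOpen_lt continuous_const continuous_im).inter ((isOpen_lt continuous_const continuous_re).inter
    ((isOpen_lt continuous_re continuous_const).inter (isOpen_lt continuous_re (by fun_prop))))

lemma tC_re_pos {z : ℂ} (hz : 3 / 4 ≤ z.im ^ 2) (hz0 : 0 < z.im) : 0 < (tC z).re := by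
  have h1 := norm_jacobiTheta_sub_one_le (add_im hz0)
  have h2 : (z + 1).im = z.im := by simp
  rw [h2] at h1
  have h3 : 5 / 2 ≤ Real.pi * z.im := by
    have := Real.pi_gt_three
    have h4 : 0.86 ≤ z.im := by nlinarith
    nlinarith
  have h4 : Real.exp (-Real.pi * z.im) ≤ 1 / 12 := by
    rw [neg_mul, Real.exp_neg]
    have h5 : (12 : ℝ) ≤ Real.exp (5 / 2) := by
      have h6 : Real.exp (5 / 2) = Real.exp 1 * Real.exp 1 * Real.exp (1 / 2) := by
        rw [← Real.exp_add, ← Real.exp_add]; norm_num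
      have h7 := Real.exp_one_gt_d9
      have h8 := Real.sum_le_exp_of_nonneg (x := 1 / 2) (by norm_num) 4
      norm_num [Finset.sum_range_succ, Nat.factorial] at h8
      have h9 : (7.38 : ℝ) ≤ Real.exp 1 * Real.exp 1 := by nlinarith
      rw [h6]
      have h10 : (1.645 : ℝ) ≤ Real.exp (1 / 2) := by linarith
      nlinarith
    have h6 := Real.exp_le_exp.2 h3
    rw [inv_eq_one_div]
    exact one_div_le_one_div_of_le (by norm_num) (h5.trans h6)
  have h5 : ‖jacobiTheta (z + 1) - 1‖ ≤ 2 / 11 := by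
    refine h1.trans ?_
    have := Real.exp_pos (-Real.pi * z.im)
    rw [div_mul_eq_mul_div, div_le_div_iff₀ (by linarith) (by norm_num)]
    linarith
  set w := jacobiTheta (z + 1) - 1 with hw
  have h6 : tC z = 1 + w * (4 + 6 * w + 4 * w ^ 2 + w ^ 3) := by
    rw [tC, th4, show jacobiTheta (z + 1) = w + 1 by rw [hw]; ring]; ring
  have h7 : ‖w * (4 + 6 * w + 4 * w ^ 2 + w ^ 3)‖ < 1 := by
    have : ‖4 + 6 * w + 4 * w ^ 2 + w ^ 3‖ ≤ 4 + 6 * ‖w‖ + 4 * ‖w‖ ^ 2 + ‖w‖ ^ 3 := by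
      refine (norm_add_le _ _).trans (add_le_add ((norm_add_le _ _).trans (add_le_add
        ((norm_add_le _ _).trans (add_le_add ?_ ?_)) ?_)) ?_) <;> simp
    have h0 := norm_nonneg w
    have h8 : 4 + 6 * ‖w‖ + 4 * ‖w‖ ^ 2 + ‖w‖ ^ 3 ≤ 4 + 6 * (2 / 11) + 4 * (2 / 11) ^ 2 + (2 / 11) ^ 3 := by
      gcongr
    rw [norm_mul]
    calc ‖w‖ * _ ≤ 2 / 11 * (4 + 6 * (2 / 11) + 4 * (2 / 11) ^ 2 + (2 / 11) ^ 3) := by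
          gcongr; exact this.trans h8
      _ < 1 := by norm_num
  rw [h6, Complex.add_re, Complex.one_re]
  have := (abs_le.1 (Complex.abs_re_le_norm (w * (4 + 6 * w + 4 * w ^ 2 + w ^ 3)))).1
  linarith

lemma tL_im_mem {z : ℂ} (hz : 3 / 4 ≤ z.im ^ 2) (hz0 : 0 < z.im) (h0 : 0 < z.re) (h1 : z.re < 1) :
    0 < (tL z).im ∧ (tL z).im < Real.pi := by
  set y := z.im with hy
  have him : ∀ x : ℝ, ((x : ℂ) + y * I).im = y := by intro x; simp
  have hd : ∀ x : ℝ, HasDerivAt (fun x : ℝ => (tL (x + y * I)).im) (Real.pi * (tC (x + y * I)).re) x := by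
    intro x
    have hp : 0 < ((x : ℂ) + y * I).im := by rw [him]; exact hz0
    have h2 : HasDerivAt (fun x : ℝ => (x : ℂ) + y * I) 1 x := (Complex.ofRealCLM.hasDerivAt (x := x)).add_const _
    have h3 := (tL_deriv hp).scomp x h2
    have h4 := Complex.imCLM.hasFDerivAt.comp_hasDerivAt x h3
    refine h4.congr_deriv ?_
    simp
  have hm : StrictMono (fun x : ℝ => (tL (x + y * I)).im) := by
    refine strictMono_of_deriv_pos fun x => ?_
    rw [(hd x).deriv]
    refine mul_pos Real.pi_pos (tC_re_pos ?_ ?_)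
    · rw [him]; exact hz
    · rw [him]; exact hz0
  have e0 : (tL ((0 : ℝ) + y * I)).im = 0 := by
    rw [Complex.ofReal_zero, zero_add, tL_axis hz0, Complex.ofReal_im]
  have e1 : (tL ((1 : ℝ) + y * I)).im = Real.pi := by
    rw [Complex.ofReal_one, add_comm, tL_T (im_yI hz0), tL_axis hz0, tM_axis hz0]; simp
  have ez : ((z.re : ℝ) : ℂ) + y * I = z := Complex.re_add_im z
  have a0 := hm h0
  have a1 := hm h1
  simp only [e0, e1, ez] at a0 a1
  exact ⟨a0, a1⟩

/-- `λ` is not real in the triangle -/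
lemma ratio_not_real_aux {z : ℂ} (hz : 3 / 4 ≤ z.im ^ 2) (hz0 : 0 < z.im) (h0 : 0 < z.re) (h1 : z.re < 1)
    (u v : ℝ) (huv : u ≠ 0 ∨ v ≠ 0) : tA z * u + tC z * v ≠ 0 := by
  intro h
  obtain ⟨l0, l1⟩ := tL_im_mem hz hz0 h0 h1
  have hb := tB_ne hz0
  have e1 := exp_tL hz0
  have e2 : tA z = cexp (tL z) * tB z := by rw [e1]; field_simp
  have e3 : tC z = (1 - cexp (tL z)) * tB z := by
    have := jacobi_id hz0
    linear_combination (-1 : ℂ) * e2 - this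
  rw [e2, e3] at h
  have h' : cexp (tL z) * u + (1 - cexp (tL z)) * v = 0 := by
    apply mul_right_cancel₀ hb; rw [zero_mul]; linear_combination h
  have hi : (cexp (tL z)).im ≠ 0 := by
    rw [Complex.exp_im]
    exact (mul_pos (Real.exp_pos _) (Real.sin_pos_of_pos_of_lt_pi l0 l1)).ne'
  have h2 := congrArg Complex.im h'
  have h3 := congrArg Complex.re h'
  simp at h2 h3
  have h4 : u = v := by
    have : (cexp (tL z)).im * (u - v) = 0 := by linarith
    rcases mul_eq_zero.1 this with h | h
    · exact absurd h hi
    · linarith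
  rw [h4] at h3 huv
  have : v = 0 := by linarith
  simp [this] at huv

lemma tri_high {z : ℂ} (h : z ∈ tri) (h1 : 1 ≤ normSq z) (h2 : 1 ≤ normSq (z - 1)) : 3 / 4 ≤ z.im ^ 2 := by
  obtain ⟨_, h3, h4, _⟩ := h
  rw [normSq_apply] at h1 h2
  simp at h2
  rcases le_or_gt z.re (1 / 2) with h | h <;> nlinarith

lemma ratio_not_real {z : ℂ} (hz : z ∈ tri) (u v : ℝ) (huv : u ≠ 0 ∨ v ≠ 0) :
    tA z * u + tC z * v ≠ 0 := by
  obtain ⟨hz0, h0, h1, h2⟩ := id hz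
  have hn : 0 < normSq z := normSq_pos.2 (ne_zero_of_im hz0)
  have hn1 : 0 < normSq (z - 1) := normSq_pos.2 (ne_zero_of_im (sub_im hz0))
  have e0 : normSq z = z.re ^ 2 + z.im ^ 2 := by rw [normSq_apply]; ring
  have e1 : normSq (z - 1) = (z.re - 1) ^ 2 + z.im ^ 2 := by rw [normSq_apply]; simp; ring
  by_cases hc : 1 ≤ normSq z ∧ 1 ≤ normSq (z - 1)
  · exact ratio_not_real_aux (tri_high hz hc.1 hc.2) hz0 h0 h1 u v huv
  rcases le_or_gt (normSq z) (normSq (z - 1)) with hle | hlt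
  · have hlt1 : normSq z < 1 := by
      by_contra h; push Not at h; exact hc ⟨h, h.trans hle⟩
    have him := im_S_pos hz0
    have hz' : 0 < (-1 / z + 1).im := add_im him
    have ere : (-1 / z + 1).re = 1 - z.re / normSq z := by
      simp [Complex.div_re]; ring
    have eim : (-1 / z + 1).im = z.im / normSq z := by
      simp [Complex.div_im]; ring
    have hA : tA (-1 / z + 1) = z ^ 2 * tC z := by rw [tA_T, tA_S hz0]; ring
    have hC : tC (-1 / z + 1) = -z ^ 2 * (tA z + tC z) := by rw [tC_T, tB_S hz0, jacobi_id hz0]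
    have hrat : z.re / normSq z < 1 := by rw [div_lt_one hn, e0]; exact h2
    have hrat0 : 0 < z.re / normSq z := by positivity
    have key : 3 / 4 ≤ (-1 / z + 1).im ^ 2 := by
      rw [eim, div_pow, le_div_iff₀ (by positivity)]
      rw [e0] at *
      rw [e1] at hle
      nlinarith
    have := ratio_not_real_aux key hz' (by rw [ere]; linarith) (by rw [ere]; linarith)
      (v - u) (-u) (by
        rcases huv with h | h
        · right; simpa using h
        · by_cases hu : u = 0
          · left; simpa [hu] using h
          · right; simpa using hu)
    rw [hA, hC] at this
    intro h
    apply this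
    push_cast
    linear_combination z ^ 2 * h
  · have hlt1 : normSq (z - 1) < 1 := by
      by_contra h; push Not at h; exact hc ⟨h.trans hlt.le, h⟩
    have hs := sub_im hz0
    have him := im_S_pos hs
    have ere : (-1 / (z - 1)).re = (1 - z.re) / normSq (z - 1) := by
      simp [Complex.div_re]
    have eim : (-1 / (z - 1)).im = z.im / normSq (z - 1) := by
      simp [Complex.div_im]; ring
    have hA : tA (-1 / (z - 1)) = -(z - 1) ^ 2 * (tA z + tC z) := by
      rw [tA_S hs, tC_T', jacobi_id hz0]
    have hC : tC (-1 / (z - 1)) = (z - 1) ^ 2 * tA z := by rw [tC_S hs, tA_T']; ring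
    have hrat : (1 - z.re) / normSq (z - 1) < 1 := by rw [div_lt_one hn1, e1]; nlinarith
    have hrat0 : 0 < (1 - z.re) / normSq (z - 1) := by
      have : 0 < 1 - z.re := by linarith
      positivity
    have key : 3 / 4 ≤ (-1 / (z - 1)).im ^ 2 := by
      rw [eim, div_pow, le_div_iff₀ (by positivity)]
      rw [e1] at *
      rw [e0] at hlt
      nlinarith
    have := ratio_not_real_aux key him (by rw [ere]; exact hrat0) (by rw [ere]; exact hrat)
      (-v) (u - v) (by
        rcases huv with h | h
        · by_cases hv : v = 0
          · right; simpa [hv] using h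
          · left; simpa using hv
        · left; simpa using h)
    rw [hA, hC] at this
    intro h
    apply this
    push_cast
    linear_combination (z - 1) ^ 2 * h

lemma kD_ne_tri {b : ℝ} (hb : 0 < b) {z : ℂ} (hz : z ∈ tri) : kD b z ≠ 0 := by
  intro h
  have h1 := kD_factor hb hz.1
  rw [h, mul_zero] at h1
  have ha := (xa_pos hb).ne'; have hb := (xb_pos hb).ne'
  have h' := neg_eq_zero.1 h1.symm
  have f1 := ratio_not_real hz (xc b) (-xa b) (Or.inr (neg_ne_zero.2 ha))
  have f2 := ratio_not_real hz (xa b) (-xc b) (Or.inl ha)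
  have f3 := ratio_not_real hz (xb b) (xa b) (Or.inr ha)
  have f4 := ratio_not_real hz (xa b) (xb b) (Or.inl ha)
  have f5 := ratio_not_real hz (xb b) (xc b) (Or.inl hb)
  have f6 := ratio_not_real hz (xc b) (xb b) (Or.inr hb)
  push_cast [mul_neg, ← sub_eq_add_neg] at f1 f2
  exact mul_ne_zero (mul_ne_zero (mul_ne_zero (mul_ne_zero (mul_ne_zero f1 f2) f3) f4) f5) f6 h'

end UO

namespace UO
open Complex

/-! ### Maximum principle -/

lemma max_principle {U : Set ℂ} (hU : IsOpen U) {F : ℂ → ℂ} (hF : ∀ z ∈ U, DifferentiableAt ℂ F z)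
    (hb : ∀ p ∈ closure U \ U, ∀ c : ℝ, 1 < c → ∀ᶠ z in nhdsWithin p U, ‖F z‖ < c)
    (hinf : ∀ c : ℝ, 1 < c → ∃ R : ℝ, ∀ z ∈ U, R ≤ ‖z‖ → ‖F z‖ < c) : ∀ z ∈ U, ‖F z‖ ≤ 1 := by
  intro z0 hz0
  by_contra hcon
  push Not at hcon
  set A : Set ℂ := {z | z ∈ U ∧ ‖F z0‖ ≤ ‖F z‖} with hA
  have hz0A : z0 ∈ A := ⟨hz0, le_refl _⟩
  have hAc : IsClosed A := by
    rw [isClosed_iff_frequently]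
    intro p hp
    have hpU : p ∈ closure U := by
      rw [mem_closure_iff_frequently]; exact hp.mono fun z hz => hz.1
    by_cases hpu : p ∈ U
    · refine ⟨hpu, ?_⟩
      by_contra hlt
      push Not at hlt
      have := (hF p hpu).continuousAt.norm.eventually_lt_const hlt
      exact hp (this.mono fun z hz h => absurd h.2 (not_le.2 hz))
    · have := hb p ⟨hpU, hpu⟩ _ hcon
      rw [eventually_nhdsWithin_iff] at this
      exact absurd (this.mono fun z hz (h : z ∈ A) => absurd h.2 (not_le.2 (hz h.1))) hp
  obtain ⟨R, hR⟩ := hinf _ hcon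
  have hAb : Bornology.IsBounded A := by
    refine (Metric.isBounded_closedBall (x := (0:ℂ)) (r := R)).subset fun z hz => ?_
    rw [mem_closedBall_zero_iff]
    by_contra h
    push Not at h
    exact absurd hz.2 (not_le.2 (hR z hz.1 h.le))
  have hAk : IsCompact A := Metric.isCompact_of_isClosed_isBounded hAc hAb
  obtain ⟨z1, hz1, hmax⟩ := hAk.exists_isMaxOn ⟨z0, hz0A⟩
    (fun z hz => (hF z hz.1).continuousAt.norm.continuousWithinAt)
  have hmaxU : ∀ z ∈ U, ‖F z‖ ≤ ‖F z1‖ := by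
    intro z hz
    by_cases h : z ∈ A
    · exact hmax h
    · have : ‖F z‖ < ‖F z0‖ := by
        by_contra h'; push Not at h'; exact h ⟨hz, h'⟩
      exact this.le.trans hz1.2
  set B : Set ℂ := {z | z ∈ A ∧ ‖F z‖ = ‖F z1‖} with hB
  have hBc : IsClosed B := by
    have : B = A ∩ {z | z ∈ A ∧ ‖F z1‖ ≤ ‖F z‖} := by
      ext z; constructor
      · rintro ⟨h1, h2⟩; exact ⟨h1, h1, h2.ge⟩
      · rintro ⟨h1, _, h2⟩; exact ⟨h1, le_antisymm (hmaxU z h1.1) h2⟩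
    rw [this]
    have hc : ContinuousOn (fun z => ‖F z‖) A := fun z hz => (hF z hz.1).continuousAt.norm.continuousWithinAt
    have := hc.preimage_isClosed_of_isClosed hAc (isClosed_Ici (a := ‖F z1‖))
    exact hAc.inter this
  have hBo : IsOpen B := by
    rw [isOpen_iff_mem_nhds]
    rintro z ⟨hzA, hzF⟩
    have hloc : IsLocalMax (norm ∘ F) z := by
      filter_upwards [hU.mem_nhds hzA.1] with w hw
      simp only [Function.comp]; rw [hzF]; exact hmaxU w hw
    have hd : ∀ᶠ w in nhds z, DifferentiableAt ℂ F w := by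
      filter_upwards [hU.mem_nhds hzA.1] with w hw using hF w hw
    filter_upwards [Complex.eventually_eq_of_isLocalMax_norm hd hloc, hU.mem_nhds hzA.1] with w hw hwU
    refine ⟨⟨hwU, ?_⟩, ?_⟩
    · rw [hw]; exact hzA.2
    · rw [hw]; exact hzF
  have hBu : B = Set.univ := IsClopen.eq_univ ⟨hBc, hBo⟩ ⟨z1, hz1, rfl⟩
  have : IsCompact (Set.univ : Set ℂ) := by
    rw [← hBu]; exact hAk.of_isClosed_subset hBc fun z hz => hz.1
  exact noncompact_univ ℂ this

lemma closure_tri {p : ℂ} (hp : p ∈ closure tri) :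
    0 ≤ p.im ∧ 0 ≤ p.re ∧ p.re ≤ 1 ∧ p.re ≤ p.re ^ 2 + p.im ^ 2 := by
  have hc : IsClosed {z : ℂ | 0 ≤ z.im ∧ 0 ≤ z.re ∧ z.re ≤ 1 ∧ z.re ≤ z.re ^ 2 + z.im ^ 2} :=
    (isClosed_le continuous_const continuous_im).inter ((isClosed_le continuous_const continuous_re).inter
    ((isClosed_le continuous_re continuous_const).inter (isClosed_le continuous_re (by fun_prop))))
  have hs : tri ⊆ {z : ℂ | 0 ≤ z.im ∧ 0 ≤ z.re ∧ z.re ≤ 1 ∧ z.re ≤ z.re ^ 2 + z.im ^ 2} :=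
    fun z hz => ⟨hz.1.le, hz.2.1.le, hz.2.2.1.le, hz.2.2.2.le⟩
  exact closure_minimal hs hc hp

/-- positivity of the real part in the triangle -/
lemma re_nonneg_tri {W : ℂ → ℂ} (hW : ∀ z ∈ tri, DifferentiableAt ℂ W z) (E : Finset ℂ)
    (hE : ∀ p ∈ E, p ∈ closure tri \ tri)
    (hbE : ∀ p ∈ E, ∃ B : ℝ, ∀ᶠ z in nhdsWithin p tri, -B ≤ (W z).re)
    (hb : ∀ p ∈ closure tri \ tri, p ∉ E → ∃ w : ℂ, 0 ≤ w.re ∧ Tendsto W (nhdsWithin p tri) (nhds w))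
    (hinf : ∃ B M : ℝ, ∀ z ∈ tri, M ≤ z.im → -B ≤ (W z).re) : ∀ z ∈ tri, 0 ≤ (W z).re := by
  obtain ⟨M, hM0, hM⟩ : ∃ M : ℝ, 1 ≤ M ∧ ∀ p ∈ E, ‖p‖ ≤ M := by
    refine ⟨1 + ∑ p ∈ E, ‖p‖, by have := Finset.sum_nonneg (s := E) (fun p _ => norm_nonneg p); linarith, ?_⟩
    intro p hp
    have := Finset.single_le_sum (f := fun p : ℂ => ‖p‖) (fun p _ => norm_nonneg p) hp
    linarith
  have hden : ∀ z : ℂ, 0 ≤ z.im → z + M * I ≠ 0 := by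
    intro z hz h
    have := congrArg Complex.im h
    simp at this; linarith
  have hden1 : ∀ z : ℂ, 0 ≤ z.im → 1 ≤ ‖z + M * I‖ := by
    intro z hz
    have := Complex.abs_im_le_norm (z + M * I)
    simp at this
    have h2 := le_abs_self (z.im + M)
    linarith
  have hfac : ∀ p ∈ E, ∀ z ∈ tri, ‖(z - p) / (z + M * I)‖ ≤ 1 := by
    intro p hp z hz
    rw [norm_div, div_le_one (norm_pos_iff.2 (hden z hz.1.le))]
    rw [← abs_of_nonneg (norm_nonneg (z - p)), ← abs_of_nonneg (norm_nonneg (z + M * I)), ← sq_le_sq,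
      ← Complex.normSq_eq_norm_sq, ← Complex.normSq_eq_norm_sq, normSq_apply, normSq_apply]
    have h1 := hM p hp
    have h2 : p.re * p.re + p.im * p.im ≤ M ^ 2 := by
      rw [← normSq_apply, Complex.normSq_eq_norm_sq]
      gcongr
    obtain ⟨a1, a2, _⟩ := closure_tri (hE p hp).1
    obtain ⟨b1, b2, _⟩ := hz
    simp
    nlinarith [mul_nonneg b2.le a2, mul_nonneg b1.le a1, mul_pos b1 (zero_lt_one.trans_le hM0)]
  set m : ℂ → ℂ := fun z => (∏ p ∈ E, (z - p) / (z + M * I)) * (1 / (z + M * I)) with hm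
  have hm1 : ∀ z ∈ tri, ‖m z‖ ≤ 1 := by
    intro z hz
    rw [hm]; simp only
    rw [norm_mul, norm_prod, norm_div, norm_one]
    have h1 : ∏ p ∈ E, ‖(z - p) / (z + M * I)‖ ≤ 1 :=
      Finset.prod_le_one (fun p _ => norm_nonneg _) (fun p hp => hfac p hp z hz)
    have h2 : 1 / ‖z + M * I‖ ≤ 1 := by
      rw [div_le_one (norm_pos_iff.2 (hden z hz.1.le))]; exact hden1 z hz.1.le
    have h3 : 0 ≤ ∏ p ∈ E, ‖(z - p) / (z + M * I)‖ := Finset.prod_nonneg fun p _ => norm_nonneg _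
    have h4 : 0 ≤ 1 / ‖z + M * I‖ := by positivity
    nlinarith
  have hm2 : ∀ z ∈ tri, ‖m z‖ ≤ 1 / ‖z + M * I‖ := by
    intro z hz
    rw [hm]; simp only
    rw [norm_mul, norm_prod, norm_div, norm_one]
    have h1 : ∏ p ∈ E, ‖(z - p) / (z + M * I)‖ ≤ 1 :=
      Finset.prod_le_one (fun p _ => norm_nonneg _) (fun p hp => hfac p hp z hz)
    have h4 : 0 ≤ 1 / ‖z + M * I‖ := by positivity
    exact mul_le_of_le_one_left h4 h1
  have hmd : ∀ z : ℂ, 0 ≤ z.im → DifferentiableAt ℂ m z := by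
    intro z hz
    have := hden z hz
    have h1 : DifferentiableAt ℂ (fun z : ℂ => ∏ p ∈ E, (z - p) / (z + M * I)) z := by
      refine DifferentiableAt.fun_finsetProd fun p _ => ?_
      exact (by fun_prop : DifferentiableAt ℂ (fun z : ℂ => z - p) z).fun_div (by fun_prop) this
    exact h1.fun_mul ((differentiableAt_const _).fun_div (by fun_prop) this)
  have hm0 : ∀ p ∈ E, m p = 0 := by
    intro p hp
    rw [hm]; simp only
    rw [Finset.prod_eq_zero hp (by simp), zero_mul]
  have hmne : ∀ z ∈ tri, m z ≠ 0 := by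
    intro z hz
    have h0 := hden z hz.1.le
    refine mul_ne_zero (Finset.prod_ne_zero_iff.2 fun p hp => div_ne_zero ?_ h0) (one_div_ne_zero h0)
    intro h
    rw [sub_eq_zero] at h
    exact (hE p hp).2 (h ▸ hz)
  -- the main bound
  have main : ∀ n : ℕ, ∀ z ∈ tri, ‖cexp (-(n * W z)) * m z‖ ≤ 1 := by
    intro n
    have hnorm : ∀ z, ‖cexp (-(n * W z)) * m z‖ = Real.exp (-(n * (W z).re)) * ‖m z‖ := by
      intro z; rw [norm_mul, Complex.norm_exp]; simp
    have hn0 : (0 : ℝ) ≤ n := Nat.cast_nonneg n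
    refine max_principle tri_isOpen ?_ ?_ ?_
    · intro z hz
      exact (((hW z hz).const_mul _).neg.cexp).mul (hmd z hz.1.le)
    · intro p hp c hc
      by_cases hpE : p ∈ E
      · obtain ⟨B, hB⟩ := hbE p hpE
        have h1 : Tendsto (fun z => Real.exp (n * B) * ‖m z‖) (nhdsWithin p tri) (nhds (Real.exp (n * B) * ‖m p‖)) :=
          ((hmd p (closure_tri hp.1).1).continuousAt.norm.continuousWithinAt).tendsto.const_mul _
        rw [hm0 p hpE, norm_zero, mul_zero] at h1
        filter_upwards [hB, h1.eventually_lt_const (zero_lt_one.trans hc)] with z h2 h3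
        rw [hnorm]
        refine lt_of_le_of_lt ?_ h3
        gcongr
        nlinarith
      · obtain ⟨w, hw, hl⟩ := hb p hp hpE
        have h1 : Tendsto (fun z => Real.exp (-(n * (W z).re))) (nhdsWithin p tri) (nhds (Real.exp (-(n * w.re)))) :=
          ((Complex.continuous_re.tendsto w).comp hl).const_mul (n : ℝ) |>.neg.rexp
        have h2 : Real.exp (-(n * w.re)) < c := by
          refine lt_of_le_of_lt ?_ hc
          rw [Real.exp_le_one_iff]
          have := mul_nonneg hn0 hw; linarith
        filter_upwards [h1.eventually_lt_const h2, self_mem_nhdsWithin] with z h3 hz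
        rw [hnorm]
        exact lt_of_le_of_lt (mul_le_of_le_one_right (Real.exp_pos _).le (hm1 z hz)) h3
    · intro c hc
      obtain ⟨B, L, hBL⟩ := hinf
      refine ⟨max (L + 1) (L + 1) + 2 + Real.exp (n * B) + M + |L|, fun z hz hzR => ?_⟩
      have hre : |z.re| ≤ 1 := by rw [abs_of_pos hz.2.1]; exact hz.2.2.1.le
      have h1 := Complex.norm_le_abs_re_add_abs_im z
      rw [abs_of_pos hz.1] at h1
      have hexp := Real.exp_pos (n * B)
      have habs := abs_nonneg L
      have hneg := neg_abs_le L
      rw [max_self] at hzR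
      have him : L + Real.exp (n * B) ≤ z.im := by linarith
      have h2 := hBL z hz (by linarith)
      rw [hnorm]
      have h3 : Real.exp (n * B) < ‖z + M * I‖ := by
        have := Complex.abs_im_le_norm (z + M * I)
        simp at this
        have h5 := le_abs_self (z.im + M)
        linarith
      have h4 : ‖m z‖ ≤ 1 / ‖z + M * I‖ := hm2 z hz
      calc Real.exp (-(n * (W z).re)) * ‖m z‖ ≤ Real.exp (n * B) * (1 / ‖z + M * I‖) := by
            gcongr; nlinarith
        _ ≤ 1 := by rw [mul_one_div, div_le_one (by linarith)]; exact h3.le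
        _ < c := hc
  intro z hz
  by_contra hneg
  push Not at hneg
  have hmz := norm_pos_iff.2 (hmne z hz)
  obtain ⟨n, hn⟩ := exists_nat_gt ((1 / ‖m z‖) / (-(W z).re))
  have h1 := main n z hz
  rw [norm_mul, Complex.norm_exp] at h1
  simp at h1
  rw [div_lt_iff₀ (by linarith)] at hn
  have h2 := Real.add_one_le_exp (-(n * (W z).re))
  have h3 : 1 / ‖m z‖ < Real.exp (-(n * (W z).re)) := by linarith
  rw [div_lt_iff₀ hmz] at h3
  linarith

end UO

namespace UO
open Complex Asymptotics

/-! ### Asymptotics at the cusps -/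

lemma sI_le : sI ≤ iInfty := inf_le_left

/-- exponential decay of order `c` -/
def ExO (c : ℝ) (f : ℂ → ℂ) : Prop := f =O[sI] fun z => Real.exp (-(c * z.im))

lemma ExO.add {c : ℝ} {f g : ℂ → ℂ} (hf : ExO c f) (hg : ExO c g) : ExO c (fun z => f z + g z) :=
  IsBigO.add hf hg
lemma ExO.mul {c : ℝ} {f g : ℂ → ℂ} {l : ℂ} (hf : ExO c f) (hg : Tendsto g sI (nhds l)) :
    ExO c (fun z => f z * g z) := by
  have h := IsBigO.mul hf (hg.isBigO_one ℝ)
  simp only [mul_one] at h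
  exact h
lemma ExO.const {c : ℝ} {f : ℂ → ℂ} (hf : ExO c f) (k : ℂ) : ExO c (fun z => k * f z) :=
  IsBigO.const_mul_left hf k
lemma ExO.mono {c d : ℝ} {f : ℂ → ℂ} (hcd : d ≤ c) (hf : ExO c f) : ExO d f := by
  refine IsBigO.trans hf (IsBigO.of_bound 1 ?_)
  have h : ∀ᶠ z : ℂ in sI, 0 < z.im := sI_le (tendsto_comap.eventually (eventually_gt_atTop 0))
  filter_upwards [h] with z hz
  rw [Real.norm_eq_abs, Real.norm_eq_abs, abs_of_pos (Real.exp_pos _), abs_of_pos (Real.exp_pos _), one_mul]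
  exact Real.exp_le_exp.2 (by nlinarith)
lemma ExO.congr {c : ℝ} {f g : ℂ → ℂ} (hf : ExO c f) (h : ∀ z : ℂ, 0 < z.im → g z = f z) : ExO c g := by
  have h' : ∀ᶠ z : ℂ in sI, 0 < z.im := sI_le (tendsto_comap.eventually (eventually_gt_atTop 0))
  refine IsBigO.congr' hf ?_ (EventuallyEq.refl _ _)
  filter_upwards [h'] with z hz
  exact (h z hz).symm

lemma ev_sI {p : ℂ → Prop} (h : ∀ z : ℂ, 0 < z.im → p z) : ∀ᶠ z in sI, p z := by
  have h' : ∀ᶠ z : ℂ in sI, 0 < z.im := sI_le (tendsto_comap.eventually (eventually_gt_atTop 0))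
  exact h'.mono fun z hz => h z hz

lemma ExO.pow_mul {c : ℝ} (hc : 0 < c) {f : ℂ → ℂ} (hf : ExO c f) (k : ℕ) :
    Tendsto (fun z => z ^ k * f z) sI (nhds 0) := by
  have h1 : (fun z : ℂ => z ^ k) =O[sI] fun z : ℂ => (z.im) ^ k := by
    apply IsBigO.pow
    refine IsBigO.of_bound 2 ?_
    have h2 : ∀ᶠ z : ℂ in sI, 2 < z.im := sI_le (tendsto_comap.eventually (eventually_gt_atTop 2))
    have h3 : ∀ᶠ z : ℂ in sI, |z.re| ≤ 2 := by
      have := (mem_inf_of_right (mem_principal_self _) : {z : ℂ | |z.re| ≤ 2} ∈ sI)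
      exact this
    filter_upwards [h2, h3] with z h2 h3
    have := Complex.norm_le_abs_re_add_abs_im z
    rw [Real.norm_eq_abs]
    have := le_abs_self z.im
    linarith
  have h2 := h1.mul hf
  refine h2.trans_tendsto ?_
  have h3 : Tendsto (fun y : ℝ => y ^ k * Real.exp (-(c * y))) atTop (nhds 0) := by
    have := Real.tendsto_pow_mul_exp_neg_atTop_nhds_zero k
    have h4 : Tendsto (fun y : ℝ => (c * y) ^ k * Real.exp (-(c * y))) atTop (nhds 0) :=
      this.comp (tendsto_id.const_mul_atTop hc)
    have h5 := h4.const_mul ((c ^ k)⁻¹)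
    rw [mul_zero] at h5
    refine h5.congr fun y => ?_
    rw [mul_pow]; field_simp
  exact (h3.comp tendsto_comap).mono_left sI_le

lemma ExO.tendsto {c : ℝ} (hc : 0 < c) {f : ℂ → ℂ} (hf : ExO c f) : Tendsto f sI (nhds 0) := by
  simpa using hf.pow_mul hc 0

lemma exO_periodic {f g : ℂ → ℂ} {h : ℝ} (hh : 0 < h) (hf : ∀ z, f (z + h) = f z)
    (hfg : ∀ z : ℂ, 0 < z.im → g z = f z)
    (hd : ∀ z : ℂ, 0 < z.im → DifferentiableAt ℂ g z) {l : ℂ} (hl : Tendsto g iInfty (nhds l)) :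
    ExO (2 * Real.pi / h) (fun z => g z - l) := by
  have h' : ∀ᶠ z : ℂ in iInfty, 0 < z.im := tendsto_comap.eventually (eventually_gt_atTop 0)
  have := Function.Periodic.exp_decay_of_zero_at_inf (f := fun z => f z - l) hh
    (fun z => by simp only [hf]) (by
      filter_upwards [h'] with z hz
      have e : f =ᶠ[nhds z] g := by
        filter_upwards [ev_im_pos hz] with w hw using (hfg w hw).symm
      exact ((hd z hz).congr_of_eventuallyEq e).sub_const l) (by
      have h2 := hl.sub_const l
      rw [sub_self] at h2
      refine h2.congr' ?_
      filter_upwards [h'] with z hz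
      rw [hfg z hz])
  refine ExO.congr (f := fun z => f z - l) ?_ (fun z hz => by simp only [hfg z hz])
  have h3 := this.mono sI_le
  refine h3.congr_right fun z => ?_
  congr 1; ring

lemma mP_ex : ExO (2 * Real.pi) (fun z => mP z - 1) := by
  have := exO_periodic (f := mP) (g := mP) one_pos (fun z => by simpa using mP_T z) (fun _ _ => rfl)
    (fun z hz => mP_diff hz) mP_lim
  simpa using this
lemma mQ_ex : ExO (2 * Real.pi) (fun z => mQ z - 1) := by
  have := exO_periodic (f := fun z => (tA z ^ 2 + tB z ^ 2 + tC z ^ 2) / 2) (g := mQ) one_pos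
    (fun z => by simp only [ofReal_one, tA_T, tB_T, tC_T]; ring)
    (fun z hz => by rw [mQ, jacobi_id hz]; ring)
    (fun z hz => mQ_diff hz) mQ_lim
  simpa using this
lemma mR_ex : ExO (2 * Real.pi) (fun z => mR z - 1) := by
  have := exO_periodic (f := fun z => (tA z + tB z) * (tB z + tC z) * (tC z - tA z) / 2) (g := mR) one_pos
    (fun z => by simp only [ofReal_one, tA_T, tB_T, tC_T]; ring)
    (fun z hz => by rw [mR, jacobi_id hz]; ring)
    (fun z hz => mR_diff hz) mR_lim
  simpa using this
lemma tC_ex : ExO Real.pi (fun z => tC z - 1) := by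
  have := exO_periodic (f := tC) (g := tC) two_pos
    (fun z => by rw [show z + ((2 : ℝ) : ℂ) = z + 1 + 1 by push_cast; ring, tC_T, tB_T]) (fun _ _ => rfl)
    (fun z hz => tC_diff hz) tC_lim
  simpa using this
lemma tA_ex : ExO Real.pi tA := by
  have h1 : ExO Real.pi (fun z => cexp (Real.pi * I * z)) := by
    refine IsBigO.of_bound 1 (Eventually.of_forall fun z => ?_)
    rw [Complex.norm_exp]
    simp
  exact (h1.mul (tA0_lim.mono_left sI_le)).congr fun z _ => tA_eq z
lemma tB_ex : ExO Real.pi (fun z => tB z - 1) :=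
  (tA_ex.add tC_ex).congr fun z hz => by rw [jacobi_id hz]; ring

lemma mD_ex : ExO (2 * Real.pi) mD := by
  have h1 := mQ_lim.mono_left sI_le
  have h2 := mR_lim.mono_left sI_le
  have := ((mQ_ex.mul (((h1.pow 2).add h1).add_const 1)).add ((mR_ex.mul (h2.add_const 1)).const (-1))).const (1 / 1728)
  refine this.congr fun z hz => ?_
  have := mD_eq hz
  linear_combination (-1 / 1728 : ℂ) * this
lemma nPlS_ex (b : ℝ) : ExO (2 * Real.pi) (nPlS b) := by
  have hP := mP_lim.mono_left sI_le
  have hQ := mQ_lim.mono_left sI_le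
  have hR := mR_lim.mono_left sI_le
  have e1 : ExO (2 * Real.pi) (fun z => mQ z - mP z ^ 2) :=
    (mQ_ex.add ((mP_ex.mul (hP.add_const 1)).const (-1))).congr fun z _ => by ring
  have e2 : ExO (2 * Real.pi) (fun z => mP z * mR z - mQ z ^ 2) :=
    (((mP_ex.mul hR).add mR_ex).add ((mQ_ex.mul (hQ.add_const 1)).const (-1))).congr fun z _ => by ring
  have := (((mD_ex.const (-(xal b : ℂ))).add ((e1.mul (hQ.pow 2)).const (b * xR b : ℂ))).add
    ((e2.mul hQ).const (kG b))).const ((Real.pi ^ 2 / 36 : ℝ) : ℂ)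
  exact this.congr fun z _ => by rw [nPlS]; ring

lemma nPlS_div_lim (b : ℝ) : Tendsto (fun z => nPlS b z / tA z) sI (nhds 0) := by
  have hpi := Real.pi_pos
  have h1 : Tendsto (fun z => nPlS b z * cexp (-(Real.pi * I * z))) sI (nhds 0) := by
    have h2 : ExO Real.pi (fun z => nPlS b z * cexp (-(Real.pi * I * z))) := by
      have h3 : (fun z => cexp (-(Real.pi * I * z))) =O[sI] fun z : ℂ => Real.exp (Real.pi * z.im) := by
        refine IsBigO.of_bound 1 (Eventually.of_forall fun z => ?_)
        rw [Complex.norm_exp]; simp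
      have h4 := IsBigO.mul (nPlS_ex b) h3
      refine h4.congr_right fun z => ?_
      rw [← Real.exp_add]; congr 1; ring
    exact h2.tendsto hpi
  have h5 := h1.div (tA0_lim.mono_left sI_le) (by norm_num)
  rw [zero_div] at h5
  refine h5.congr fun z => ?_
  simp only [Pi.div_apply, tA_eq, Complex.exp_neg]
  rw [← div_eq_mul_inv, div_div]

lemma nMiS_div_lim (b : ℝ) : Tendsto (fun z => nMiS b z / tA z) sI
    (nhds ((1 / Real.pi * (-xQ b - 2 * kS b - kV b / 2) : ℝ))) := by
  have hQ := mQ_lim.mono_left sI_le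
  have hR := mR_lim.mono_left sI_le
  have hA := tA_lim.mono_left sI_le
  have hB := tB_lim.mono_left sI_le
  have hC := tC_lim.mono_left sI_le
  have h := ((((tM_div_lim.const_mul (xQ b : ℂ)).mul (hQ.mul hR)).sub (((hB.mul hC).const_mul (kS b : ℂ)).mul
    ((((hC.pow 2).const_mul 2).add ((hA.mul hC).const_mul 2)).sub (hA.pow 2)))).sub
    ((hQ.pow 2).const_mul (kV b / 2 : ℂ))).const_mul ((1 / Real.pi : ℝ) : ℂ)
  have e : ((1 / Real.pi * (-xQ b - 2 * kS b - kV b / 2) : ℝ) : ℂ) = ((1 / Real.pi : ℝ) : ℂ) *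
    ((xQ b : ℂ) * -1 * (1 * 1) - kS b * (1 * 1) * (2 * 1 ^ 2 + 2 * (0 * 1) - 0 ^ 2) - kV b / 2 * 1 ^ 2) := by
    push_cast; ring
  rw [e]
  refine h.congr' (ev_sI fun z hz => ?_)
  have := tA_ne hz
  simp only [nMiS, tP]
  field_simp

lemma kD_ex (b : ℝ) : ExO (2 * Real.pi) (fun z => kD b z + 1) := by
  have hQ := mQ_lim.mono_left sI_le
  exact ((mD_ex.const (kJ b)).add ((mQ_ex.mul (((hQ.pow 2).add hQ).add_const 1)).const (-1))).congr
    fun z _ => by rw [kD]; ring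
lemma kD_lim (b : ℝ) : Tendsto (kD b) sI (nhds (-1)) := by
  have := ((kD_ex b).tendsto (by positivity)).sub_const 1
  simpa using this

/-- slopes at infinity -/
def sP (b : ℝ) : ℝ := -(Real.pi / 6) * (kG b - 2 * b * xR b)

lemma nPl_asym (b : ℝ) : ∃ l : ℂ, Tendsto (fun z => nPl b z - I * sP b * z) sI (nhds l) := by
  have hpi := Real.pi_pos
  have hP := mP_lim.mono_left sI_le
  have hQ := mQ_lim.mono_left sI_le
  have hR := mR_lim.mono_left sI_le
  have h1 := (nPlS_ex b).pow_mul (by positivity) 2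
  have e1 : ExO (2 * Real.pi) (fun z => mP z * mQ z ^ 2 - 1) :=
    ((mP_ex.mul (hQ.pow 2)).add (mQ_ex.mul (hQ.add_const 1))).congr fun z _ => by ring
  have e2 : ExO (2 * Real.pi) (fun z => mQ z * mR z - 1) :=
    ((mQ_ex.mul hR).add mR_ex).congr fun z _ => by ring
  have h2 := ((((e1.const (-(2 * b * xR b) : ℂ)).add (e2.const (kG b))).pow_mul (by positivity) 1)).const_mul
    (((Real.pi ^ 2 / 36 : ℝ) : ℂ) * kC)
  have h3 := (hQ.pow 2).const_mul (-((Real.pi ^ 2 / 36 : ℝ) : ℂ) * b * xR b * kC ^ 2)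
  refine ⟨_, ((h1.add h2).add h3).congr fun z => ?_⟩
  have : (Real.pi : ℂ) ≠ 0 := by exact_mod_cast Real.pi_ne_zero
  rw [nPl, nPlS, sP, kC]
  push_cast; field_simp; ring

lemma nMi_asym (b : ℝ) : ∃ l : ℂ, Tendsto (fun z => nMi b z - I * xQ b * z) sI (nhds l) := by
  have hpi := Real.pi_pos
  have hQ := mQ_lim.mono_left sI_le
  have hR := mR_lim.mono_left sI_le
  have hA := tA_lim.mono_left sI_le
  have hB := tB_lim.mono_left sI_le
  have hC := tC_lim.mono_left sI_le
  have e2 : ExO (2 * Real.pi) (fun z => mQ z * mR z - 1) :=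
    ((mQ_ex.mul hR).add mR_ex).congr fun z _ => by ring
  have h1 := (e2.pow_mul (by positivity) 1).const_mul (xQ b * (Real.pi * I))
  have h2 := (tL_lim.mul (hQ.mul hR)).const_mul (xQ b : ℂ)
  have h3 := ((((hA.mul hB).mul hC).const_mul (kS b : ℂ)).mul
    ((((hA.pow 2).const_mul 2).add ((hA.mul hC).const_mul 2)).sub (hC.pow 2)))
  have h4 := ((hQ.pow 2).const_mul (kV b / 2 : ℂ)).mul hC
  refine ⟨_, ((((h1.add h2).add h3).add h4).const_mul ((1 / Real.pi : ℝ) : ℂ)).congr fun z => ?_⟩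
  have : (Real.pi : ℂ) ≠ 0 := by exact_mod_cast Real.pi_ne_zero
  rw [nMi, tP]
  push_cast; field_simp; ring

lemma quot_asym {b s : ℝ} {f : ℂ → ℂ} {l : ℂ} (h : Tendsto (fun z => f z - I * s * z) sI (nhds l)) :
    ∃ l : ℂ, Tendsto (fun z => I * f z / (2 * kD b z) - (s / 2 : ℝ) * z) sI (nhds l) := by
  have h1 := (h.const_mul I).div ((kD_lim b).const_mul 2) (by norm_num)
  have h2 := ((kD_ex b).pow_mul (by positivity) 1).div ((kD_lim b).const_mul 2) (by norm_num)
  have h3 := h1.sub (h2.const_mul (s : ℂ))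
  refine ⟨_, h3.congr' ?_⟩
  filter_upwards [(kD_lim b).eventually_ne (b₂ := 0) (by norm_num)] with z hz
  simp only [Pi.div_apply]
  push_cast
  field_simp
  linear_combination (-(s * z) : ℂ) * I_sq

lemma kK_asym (b : ℝ) : ∃ l : ℂ, Tendsto (fun z => kK b z - ((xQ b + sP b) / 2 : ℝ) * z) sI (nhds l) := by
  obtain ⟨l1, h1⟩ := nPl_asym b
  obtain ⟨l2, h2⟩ := nMi_asym b
  have h : Tendsto (fun z => (nPl b z + nMi b z) - I * (xQ b + sP b : ℝ) * z) sI (nhds (l1 + l2)) :=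
    (h1.add h2).congr fun z => by push_cast; ring
  exact quot_asym h
lemma kT_asym (b : ℝ) : ∃ l : ℂ, Tendsto (fun z => kT b z - ((sP b - xQ b) / 2 : ℝ) * z) sI (nhds l) := by
  obtain ⟨l1, h1⟩ := nPl_asym b
  obtain ⟨l2, h2⟩ := nMi_asym b
  have h : Tendsto (fun z => (nPl b z - nMi b z) - I * (sP b - xQ b : ℝ) * z) sI (nhds (l1 - l2)) :=
    (h1.sub h2).congr fun z => by push_cast; ring
  exact quot_asym h

lemma tendsto_cusp0 : Tendsto (fun z : ℂ => -1 / z) (nhdsWithin 0 tri) sI := by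
  refine tendsto_inf.2 ⟨?_, ?_⟩
  · refine tendsto_comap_iff.2 (tendsto_atTop.2 fun M => ?_)
    have h1 : ∀ᶠ z : ℂ in nhdsWithin 0 tri, ‖z‖ < 1 / (|M| + 1) := by
      apply nhdsWithin_le_nhds
      have : Tendsto (fun z : ℂ => ‖z‖) (nhds 0) (nhds 0) := by simpa using (continuous_norm (E := ℂ)).tendsto 0
      exact this.eventually_lt_const (by positivity)
    filter_upwards [h1, self_mem_nhdsWithin] with z h1 hz
    have hz0 := ne_zero_of_im hz.1
    have hn : 0 < ‖z‖ := norm_pos_iff.2 hz0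
    have h2 := Complex.norm_le_abs_re_add_abs_im (-1 / z)
    have h3 := im_S_pos hz.1
    rw [abs_of_pos h3, norm_div, norm_neg, norm_one] at h2
    have h4 : |(-1 / z).re| ≤ 1 := by
      rw [div_re]; simp
      rw [abs_div, abs_neg, abs_of_pos hz.2.1, abs_of_pos (normSq_pos.2 hz0), div_le_one (normSq_pos.2 hz0), normSq_apply]
      nlinarith [hz.2.2.2]
    have h5 : |M| + 1 ≤ 1 / ‖z‖ := by
      rw [le_div_iff₀ hn]
      rw [lt_div_iff₀ (by positivity)] at h1
      linarith
    have := le_abs_self M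
    simp only [Function.comp]
    linarith
  · refine tendsto_principal.2 ?_
    filter_upwards [self_mem_nhdsWithin] with z hz
    have hz0 := ne_zero_of_im hz.1
    have h4 : |(-1 / z).re| ≤ 1 := by
      rw [div_re]; simp
      rw [abs_div, abs_neg, abs_of_pos hz.2.1, abs_of_pos (normSq_pos.2 hz0), div_le_one (normSq_pos.2 hz0), normSq_apply]
      nlinarith [hz.2.2.2]
    exact h4.trans (by norm_num)

lemma tri_rot {z : ℂ} (hz : z ∈ tri) : -1 / (z - 1) - 1 ∈ {w : ℂ | 0 < w.im ∧ -1 < w.re ∧ w.re < 0} := by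
  obtain ⟨h0, h1, h2, h3⟩ := hz
  have hz0 := ne_zero_of_im (sub_im h0)
  have hn := normSq_pos.2 hz0
  have h4 : normSq (z - 1) = (z.re - 1) * (z.re - 1) + z.im * z.im := by rw [normSq_apply]; simp
  refine ⟨by have := im_S_pos (sub_im h0); simpa using this, ?_, ?_⟩
  · have : 0 < (-1 / (z - 1)).re := by
      rw [div_re]; simp
      exact div_pos (by linarith) hn
    simp at this ⊢; linarith
  · have : (-1 / (z - 1)).re < 1 := by
      rw [div_re]; simp
      rw [div_lt_one hn, h4]
      nlinarith
    simp at this ⊢; linarith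

lemma tendsto_cusp1 : Tendsto (fun z : ℂ => -1 / (z - 1) - 1) (nhdsWithin 1 tri) sI := by
  refine tendsto_inf.2 ⟨?_, ?_⟩
  · refine tendsto_comap_iff.2 (tendsto_atTop.2 fun M => ?_)
    have h1 : ∀ᶠ z : ℂ in nhdsWithin 1 tri, ‖z - 1‖ < 1 / (|M| + 1) := by
      apply nhdsWithin_le_nhds
      have : Tendsto (fun z : ℂ => ‖z - 1‖) (nhds 1) (nhds 0) := by
        have := (by fun_prop : Continuous fun z : ℂ => ‖z - 1‖).tendsto 1
        simpa using this
      exact this.eventually_lt_const (by positivity)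
    filter_upwards [h1, self_mem_nhdsWithin] with z h1 hz
    have hz0 := ne_zero_of_im (sub_im hz.1)
    have hn : 0 < ‖z - 1‖ := norm_pos_iff.2 hz0
    have h2 := Complex.norm_le_abs_re_add_abs_im (-1 / (z - 1))
    have h3 := im_S_pos (sub_im hz.1)
    obtain ⟨-, r1, r2⟩ := tri_rot hz
    rw [Complex.sub_re, one_re] at r1 r2
    rw [abs_of_pos h3, norm_div, norm_neg, norm_one] at h2
    have h4 : |(-1 / (z - 1)).re| ≤ 1 := abs_le.2 ⟨by linarith, by linarith⟩
    have h5 : |M| + 1 ≤ 1 / ‖z - 1‖ := by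
      rw [le_div_iff₀ hn]
      rw [lt_div_iff₀ (by positivity)] at h1
      linarith
    have := le_abs_self M
    simp only [Function.comp, Complex.sub_im, one_im]
    linarith
  · refine tendsto_principal.2 ?_
    filter_upwards [self_mem_nhdsWithin] with z hz
    obtain ⟨-, r1, r2⟩ := tri_rot hz
    exact abs_le.2 ⟨by linarith, by linarith⟩

end UO

namespace UO
open Complex

/-! ### Local behaviour of the kernel on the closed triangle -/

lemma quot_lim {f g : ℂ → ℂ} {f' g' p : ℂ} (hf : HasDerivAt f f' p) (hg : HasDerivAt g g' p)
    (h : g p ≠ 0 ∨ (f p = 0 ∧ g p = 0 ∧ g' ≠ 0)) :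
    ∃ w, Tendsto (fun z => f z / g z) (nhdsWithin p {p}ᶜ) (nhds w) := by
  rcases h with h | ⟨h1, h2, h3⟩
  · exact ⟨f p / g p, ((hf.continuousAt.div hg.continuousAt h).tendsto).mono_left nhdsWithin_le_nhds⟩
  · refine ⟨f' / g', ((hasDerivAt_iff_tendsto_slope.1 hf).div (hasDerivAt_iff_tendsto_slope.1 hg) h3).congr' ?_⟩
    filter_upwards [self_mem_nhdsWithin] with z hz
    have : z - p ≠ 0 := sub_ne_zero.2 hz
    simp only [Pi.div_apply, slope_def_field, h1, h2, sub_zero]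
    rw [div_div_div_cancel_right₀ this]

lemma kD_simple {b : ℝ} (hb : 1 < b) {z : ℂ} (hz : 0 < z.im) (h : kD b z = 0) :
    2 * Real.pi * I * (mP z * kD b z + mQ z ^ 2 * mR z) ≠ 0 := by
  have h0 := zero_lt_one.trans hb
  have hD := mD_ne hz
  have hDb := xD_pos h0
  have hQb := zero_lt_one.trans (xQ_gt_one h0)
  have hJ : (kJ b : ℂ) ≠ 0 := by
    rw [kJ]; exact_mod_cast (div_pos (pow_pos hQb 3) hDb).ne'
  have hQ : mQ z ≠ 0 := by
    intro hQ
    rw [kD, hQ] at h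
    have := mul_ne_zero hJ hD
    apply this; linear_combination h
  have hR : mR z ≠ 0 := by
    intro hR
    have h1 := mD_eq hz
    rw [hR] at h1
    rw [kD] at h
    have h2 : ((kJ b : ℂ) - 1728) * mD z = 0 := by linear_combination h + h1
    rcases mul_eq_zero.1 h2 with h3 | h3
    · have h4 : kJ b = 1728 := by
        have : (kJ b : ℂ) = ((1728 : ℝ) : ℂ) := by push_cast; linear_combination h3
        exact_mod_cast this
      have h5 := xD_rel b
      rw [kJ, div_eq_iff hDb.ne'] at h4
      have h6 := pow_pos (xR_pos hb) 2
      linarith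
    · exact hD h3
  rw [h, mul_zero, zero_add]
  have := Real.pi_ne_zero
  refine mul_ne_zero (mul_ne_zero (mul_ne_zero two_ne_zero (by exact_mod_cast this)) I_ne_zero)
    (mul_ne_zero (pow_ne_zero 2 hQ) hR)

lemma bd_cases {p : ℂ} (hp : p ∈ closure tri) (hn : p ∉ tri) : p = 0 ∨ p = 1 ∨
    ∃ t : ℝ, 0 < t ∧ (p = t * I ∨ p = t * I + 1 ∨ p = 1 - 1 / (t * I + 1)) := by
  obtain ⟨h0, h1, h2, h3⟩ := closure_tri hp
  rcases h0.eq_or_lt with h0 | h0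
  · rw [← h0] at h3
    have h4 : p.re * (1 - p.re) = 0 := le_antisymm (by nlinarith) (mul_nonneg h1 (by linarith))
    rcases mul_eq_zero.1 h4 with h | h
    · left; exact Complex.ext h h0.symm
    · right; left; exact Complex.ext (by simp; linarith) h0.symm
  · right; right
    rcases h1.eq_or_lt with h1 | h1
    · exact ⟨p.im, h0, Or.inl (Complex.ext (by simp [← h1]) (by simp))⟩
    rcases h2.eq_or_lt with h2 | h2
    · exact ⟨p.im, h0, Or.inr (Or.inl (Complex.ext (by simp [h2]) (by simp)))⟩
    rcases h3.eq_or_lt with h3 | h3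
    · have hy := h0.ne'
      refine ⟨p.re / p.im, by positivity, Or.inr (Or.inr ?_)⟩
      have h4 : ((p.re / p.im : ℝ) : ℂ) * I + 1 ≠ 0 := by
        intro h; have := congrArg Complex.re h; simp at this
      rw [eq_sub_iff_add_eq, ← eq_sub_iff_add_eq', div_eq_iff h4]
      apply Complex.ext
      · simp; field_simp; nlinarith
      · simp; field_simp; linarith
    · exact absurd ⟨h0, h1, h2, h3⟩ hn

lemma num_self {b : ℝ} (hb : 0 < b) {t : ℝ} (h : t = b ∨ t = 1 / b) : xnP b t = 0 ∧ xnM b t = 0 := by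
  rcases h with rfl | rfl
  · exact ⟨xnP_self hb, xnM_self hb⟩
  · rw [xnP_S b hb, xnM_S b hb, xnPS_self hb, xnMS_self hb]; simp
lemma numS_self {b : ℝ} (hb : 0 < b) {t : ℝ} (h : t = b ∨ t = 1 / b) : xnPS b t = 0 ∧ xnMS b t = 0 := by
  rcases h with rfl | rfl
  · exact ⟨xnPS_self hb, xnMS_self hb⟩
  · have h1 := xnP_S b (t := 1 / b) (by positivity)
    have h2 := xnM_S b (t := 1 / b) (by positivity)
    rw [one_div_one_div, xnP_self hb] at h1
    rw [one_div_one_div, xnM_self hb] at h2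
    have : -(1 / b) ^ 10 ≠ 0 := by simp [hb.ne']
    exact ⟨(mul_eq_zero.1 h1.symm).resolve_left this, (mul_eq_zero.1 h2.symm).resolve_left this⟩

lemma kD_axis_zero {b : ℝ} (hb : 1 < b) {t : ℝ} (ht : 0 < t) (h : kD b (t * I) = 0) : t = b ∨ t = 1 / b := by
  rw [kD_axis b ht] at h
  by_contra hc
  push Not at hc
  exact xkD_ne hb ht hc.1 hc.2 (by exact_mod_cast h)

lemma num_one {b : ℝ} {t : ℝ} (ht : 0 < t) : nPl b (t * I + 1) + nMi b (t * I + 1) =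
    (xnP b t + xnPS b t + xnM b t - xnMS b t : ℝ) + I * (xX b t + xQ b * (xQ t * xR t) : ℝ) := by
  have h := im_yI ht
  rw [nPl_T b h, nMi_T b h, nPl_axis b ht, nMi_axis b ht, nPlS_axis b ht,
    nMiS_axis b ht, nX_axis b ht, xQ_eq, xR_eq]
  push_cast; ring

lemma num_zero {b : ℝ} (hb : 1 < b) {p : ℂ} (hp : p ∈ closure tri) (hp0 : 0 < p.im) (hpb : p ≠ b * I + 1)
    (h : kD b p = 0) : nPl b p + nMi b p = 0 := by
  have h0 := zero_lt_one.trans hb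
  have hn : p ∉ tri := fun hh => kD_ne_tri h0 hh h
  rcases bd_cases hp hn with rfl | rfl | ⟨t, ht, rfl | rfl | rfl⟩
  · simp at hp0
  · simp at hp0
  · obtain ⟨h1, h2⟩ := num_self h0 (kD_axis_zero hb ht h)
    rw [nPl_axis b ht, nMi_axis b ht, h1, h2]; simp
  · rw [kD_T b (im_yI ht)] at h
    have h3 := kD_axis_zero hb ht h
    obtain ⟨h1, h2⟩ := num_self h0 h3
    obtain ⟨h1', h2'⟩ := numS_self h0 h3
    rcases h3 with rfl | h3
    · exact absurd rfl hpb
    rw [num_one ht, h1, h2, h1', h2', h3, xX_S b h0, xX_diag h0, xQ_S h0, xR_S h0]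
    push_cast; ring
  · have hi : 0 < ((t : ℂ) * I + 1).im := by simpa using ht
    rw [kD_TS b hi, add_sub_cancel_right] at h
    have h4 := (mul_eq_zero.1 h).resolve_left (pow_ne_zero _ (ne_zero_of_im hi))
    obtain ⟨h1, h2⟩ := num_self h0 (kD_axis_zero hb ht h4)
    rw [nPl_TS b hi, nMi_TS b hi, add_sub_cancel_right, nPl_axis b ht, nMi_axis b ht, h1, h2]; simp

lemma kK_lim {b : ℝ} (hb : 1 < b) {p : ℂ} (hp : p ∈ closure tri) (hp0 : 0 < p.im) (hpb : p ≠ b * I + 1) :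
    ∃ w, Tendsto (kK b) (nhdsWithin p {p}ᶜ) (nhds w) := by
  have h1 := (((nPl_diff b hp0).fun_add (nMi_diff b hp0)).const_mul I).hasDerivAt
  have h2 := (kD_deriv b hp0).const_mul 2
  refine quot_lim h1 h2 ?_
  by_cases h : kD b p = 0
  · right
    exact ⟨by rw [num_zero hb hp hp0 hpb h, mul_zero], by rw [h, mul_zero], mul_ne_zero two_ne_zero (kD_simple hb hp0 h)⟩
  · left; exact mul_ne_zero two_ne_zero h

lemma pole_lim {f g : ℂ → ℂ} {p ρ : ℂ} {s : Set ℂ} (hs : s ∈ nhds p) (hf : DifferentiableAt ℂ f p)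
    (hg : DifferentiableOn ℂ g s) (g0 : g p = 0) (g1 : deriv g p ≠ 0) (hρ : f p = ρ * deriv g p) :
    ∃ w, Tendsto (fun z => f z / g z - ρ / (z - p)) (nhdsWithin p {p}ᶜ) (nhds w) := by
  have h1 := ((Complex.differentiableOn_dslope hs).2 hg).differentiableAt hs
  have h2 : DifferentiableAt ℂ (fun z => f z / dslope g p z) p :=
    hf.fun_div h1 (by rwa [dslope_same])
  refine ⟨_, (hasDerivAt_iff_tendsto_slope.1 h2.hasDerivAt).congr' ?_⟩
  filter_upwards [self_mem_nhdsWithin] with z hz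
  have hz' : z - p ≠ 0 := sub_ne_zero.2 hz
  rw [slope_def_field, dslope_same, dslope_of_ne _ hz, slope_def_field, g0, hρ, sub_zero, mul_div_cancel_right₀ _ g1]
  by_cases hgz : g z = 0
  · simp [hgz, neg_div]
  · field_simp

lemma kK_pole {b : ℝ} (hb : 1 < b) : ∃ w, Tendsto (fun z => kK b z - (I / (2 * Real.pi)) / (z - (b * I + 1)))
    (nhdsWithin (b * I + 1) {((b : ℂ) * I + 1)}ᶜ) (nhds w) := by
  have h0 := zero_lt_one.trans hb
  have hi : 0 < ((b : ℂ) * I + 1).im := by simpa using h0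
  have hs : {z : ℂ | 0 < z.im} ∈ nhds ((b : ℂ) * I + 1) := isOpen_im_pos.mem_nhds hi
  have hk : kD b (b * I + 1) = 0 := by
    rw [kD_T b (im_yI h0), kD_axis b h0, xkD_self h0]; simp
  have hd := ((kD_deriv b hi).const_mul 2).deriv
  refine pole_lim (f := fun z => I * (nPl b z + nMi b z)) (g := fun z => 2 * kD b z) hs
    (((nPl_diff b hi).fun_add (nMi_diff b hi)).const_mul I)
    (fun z hz => ((kD_diff b hz).const_mul 2).differentiableWithinAt) (by rw [hk, mul_zero]) ?_ ?_
  · rw [hd]; exact mul_ne_zero two_ne_zero (kD_simple hb hi hk)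
  · rw [hd, hk, num_one h0, xnP_self h0, xnPS_self h0, xnM_self h0, xnMS_self h0, xX_diag h0, mQ_T (im_yI h0),
      mR_T (im_yI h0), xQ_eq, xR_eq]
    have : (Real.pi : ℂ) ≠ 0 := by exact_mod_cast Real.pi_ne_zero
    push_cast; field_simp; ring

/-! ### The weighted kernel -/
def wf (b : ℝ) (z : ℂ) : ℂ := tB z / tC z * (tA z + (xa b / xc b : ℝ) * tB z)
def kW (b : ℝ) (z : ℂ) : ℂ := kK b z * wf b z

lemma wf_diff (b : ℝ) {z : ℂ} (hz : 0 < z.im) : DifferentiableAt ℂ (wf b) z := by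
  have := tA_diff hz; have := tB_diff hz; have := tC_diff hz; have := tC_ne hz
  unfold wf; fun_prop (disch := assumption)
lemma kK_diff (b : ℝ) {z : ℂ} (hz : 0 < z.im) (h : kD b z ≠ 0) : DifferentiableAt ℂ (kK b) z :=
  (((nPl_diff b hz).fun_add (nMi_diff b hz)).const_mul I).fun_div ((kD_diff b hz).const_mul 2) (mul_ne_zero two_ne_zero h)
lemma kW_diff (b : ℝ) {z : ℂ} (hz : 0 < z.im) (h : kD b z ≠ 0) : DifferentiableAt ℂ (kW b) z :=
  (kK_diff b hz h).fun_mul (wf_diff b hz)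

lemma wf_one (b : ℝ) {t : ℝ} (ht : 0 < t) :
    wf b (t * I + 1) = (xc t / xb t * (xa b / xc b * xc t - xa t) : ℝ) := by
  rw [wf, tA_T, tB_T, tC_T, xa_eq, xb_eq ht, xc_eq]; push_cast; ring
lemma wf_axis (b : ℝ) {t : ℝ} (ht : 0 < t) :
    wf b (t * I) = (xb t / xc t * (xa t + xa b / xc b * xb t) : ℝ) := by
  rw [wf, xa_eq, xb_eq ht, xc_eq]; push_cast; ring

lemma kW_lim {b : ℝ} (hb : 1 < b) {p : ℂ} (hp : p ∈ closure tri) (hp0 : 0 < p.im) :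
    ∃ w, Tendsto (kW b) (nhdsWithin p {p}ᶜ) (nhds w) := by
  have h0 := zero_lt_one.trans hb
  by_cases hpb : p = b * I + 1
  · have h1 := ((((nPl_diff b hp0).fun_add (nMi_diff b hp0)).const_mul I).fun_mul (wf_diff b hp0)).hasDerivAt
    have h2 := (kD_deriv b hp0).const_mul 2
    have hk : kD b p = 0 := by
      rw [hpb, kD_T b (im_yI h0), kD_axis b h0, xkD_self h0]; simp
    have hw : wf b p = 0 := by
      have := (xc_pos h0).ne'
      rw [hpb, wf_one b h0, div_mul_cancel₀ _ this]; simp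
    obtain ⟨w, h⟩ := quot_lim h1 h2 (Or.inr ⟨by rw [hw, mul_zero], by rw [hk, mul_zero],
      mul_ne_zero two_ne_zero (kD_simple hb hp0 hk)⟩)
    refine ⟨w, h.congr fun z => ?_⟩
    rw [kW, kK]; ring
  · obtain ⟨w, h⟩ := kK_lim hb hp hp0 hpb
    exact ⟨_, h.mul ((wf_diff b hp0).continuousAt.tendsto.mono_left nhdsWithin_le_nhds)⟩

lemma kK_S (b : ℝ) {z : ℂ} (hz : 0 < z.im) :
    kK b (-1 / z) = (z ^ 2)⁻¹ * (I * (nPlS b z + nMiS b z) / (2 * kD b z)) := by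
  have h0 := ne_zero_of_im hz
  rw [kK, nPl_S b hz, nMi_S b hz, kD_S b hz]
  by_cases h : kD b z = 0
  · simp [h]
  · field_simp

lemma kW_S (b : ℝ) {z : ℂ} (hz : 0 < z.im) :
    kW b (-1 / z) = -(I * (nPlS b z / tA z + nMiS b z / tA z) / (2 * kD b z)) *
      (tB z * (tC z + (xa b / xc b : ℝ) * tB z)) := by
  have h0 := ne_zero_of_im hz
  have h1 := tA_ne hz
  rw [kW, kK_S b hz, wf, tA_S hz, tB_S hz, tC_S hz]
  by_cases h : kD b z = 0
  · simp [h]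
  · field_simp
    ring

lemma kW_TS (b : ℝ) {z : ℂ} (hz : 0 < z.im) :
    kW b (1 - 1 / (z + 1)) = -(kT b z * tA z) * (tB z + (xa b / xc b : ℝ) * tA z) / tC z := by
  have h0 := ne_zero_of_im (add_im hz)
  have h1 := tC_ne hz
  have hs := im_S_pos (add_im hz)
  rw [kW, kK_TS b (add_im hz), wf, show 1 - 1 / (z + 1) = -1 / (z + 1) + 1 by ring, tA_T, tB_T, tC_T,
    tA_S (add_im hz), tB_S (add_im hz), tC_S (add_im hz), tA_T, tB_T, tC_T, add_sub_cancel_right]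
  field_simp

lemma kW_cusp0 (b : ℝ) : ∃ l, Tendsto (fun z => kW b (-1 / z)) sI (nhds l) := by
  have hB := tB_lim.mono_left sI_le
  have hC := tC_lim.mono_left sI_le
  have h := (((((nPlS_div_lim b).add (nMiS_div_lim b)).const_mul I).div ((kD_lim b).const_mul 2) (by norm_num)).neg).mul
    (hB.mul (hC.add (hB.const_mul ((xa b / xc b : ℝ) : ℂ))))
  refine ⟨_, h.congr' (ev_sI fun z hz => ?_)⟩
  simp only [Pi.div_apply]
  rw [kW_S b hz]

lemma kTA_lim (b : ℝ) : Tendsto (fun z => kT b z * tA z) sI (nhds 0) := by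
  obtain ⟨l, h⟩ := kT_asym b
  have hA := tA_lim.mono_left sI_le
  have h2 := (h.mul hA).add ((tA_ex.pow_mul Real.pi_pos 1).const_mul (((sP b - xQ b) / 2 : ℝ) : ℂ))
  rw [mul_zero, mul_zero, add_zero] at h2
  exact h2.congr fun z => by ring

lemma kW_cusp1 (b : ℝ) : Tendsto (fun z => kW b (1 - 1 / (z + 1))) sI (nhds 0) := by
  have hA := tA_lim.mono_left sI_le
  have hB := tB_lim.mono_left sI_le
  have hC := tC_lim.mono_left sI_le
  have h := ((kTA_lim b).neg.mul (hB.add (hA.const_mul ((xa b / xc b : ℝ) : ℂ)))).div hC one_ne_zero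
  rw [neg_zero, zero_mul, zero_div] at h
  refine h.congr' (ev_sI fun z hz => ?_)
  simp only [Pi.div_apply]
  rw [kW_TS b hz]

lemma kK_cusp0 (b : ℝ) : Tendsto (kK b) (nhdsWithin 0 tri) (nhds 0) := by
  have hA := tA_ex.pow_mul Real.pi_pos 0
  have h1 := (((nPlS_div_lim b).add (nMiS_div_lim b)).mul hA).const_mul I
  have h2 := h1.div ((kD_lim b).const_mul 2) (by norm_num)
  have h3 : Tendsto (fun z : ℂ => (z ^ 2)⁻¹) sI (nhds 0) := by
    have : Tendsto (fun z : ℂ => ‖z ^ 2‖) sI atTop := by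
      simp only [norm_pow]
      apply (tendsto_pow_atTop two_ne_zero).comp
      refine tendsto_atTop_mono (fun z => (le_abs_self z.im).trans (Complex.abs_im_le_norm z)) ?_
      exact tendsto_comap.mono_left sI_le
    have h := tendsto_inv_atTop_zero.comp this
    rw [tendsto_zero_iff_norm_tendsto_zero]
    refine h.congr fun z => ?_
    simp
  have h4 := h3.mul h2
  rw [zero_mul] at h4
  have h5 : Tendsto (fun z => kK b (-1 / z)) sI (nhds 0) := by
    refine h4.congr' (ev_sI fun z hz => ?_)
    have := tA_ne hz
    simp only [Pi.div_apply]
    rw [kK_S b hz, pow_zero, one_mul, ← add_div, div_mul_cancel₀ _ this]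
  refine (h5.comp tendsto_cusp0).congr' ?_
  filter_upwards [self_mem_nhdsWithin] with z hz
  have := ne_zero_of_im hz.1
  simp only [Function.comp]
  congr 1; field_simp

lemma cusp1_inv {z : ℂ} (hz : 0 < z.im) : 1 - 1 / (-1 / (z - 1) - 1 + 1) = z := by
  have := ne_zero_of_im (sub_im hz)
  rw [sub_add_cancel]; field_simp; ring

lemma kK_cusp1 (b : ℝ) : Tendsto (kK b) (nhdsWithin 1 tri) (nhds 0) := by
  obtain ⟨l, h⟩ := kT_asym b
  have hinv : Tendsto (fun z : ℂ => (z + 1)⁻¹) sI (nhds 0) := by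
    have : Tendsto (fun z : ℂ => ‖z + 1‖) sI atTop := by
      refine tendsto_atTop_mono (fun z => (show z.im ≤ ‖z + 1‖ by
        have := (le_abs_self (z+1).im).trans (Complex.abs_im_le_norm (z + 1)); simpa using this)) ?_
      exact tendsto_comap.mono_left sI_le
    have h := tendsto_inv_atTop_zero.comp this
    rw [tendsto_zero_iff_norm_tendsto_zero]
    refine h.congr fun z => ?_
    simp
  have h1 := ((h.mul (hinv.mul hinv)).add ((hinv.sub (hinv.mul hinv)).const_mul (((sP b - xQ b) / 2 : ℝ) : ℂ)))
  rw [mul_zero, mul_zero, sub_zero, mul_zero, add_zero] at h1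
  have h5 : Tendsto (fun z => kK b (1 - 1 / (z + 1))) sI (nhds 0) := by
    refine h1.congr' (ev_sI fun z hz => ?_)
    have := ne_zero_of_im (add_im hz)
    simp only [Pi.div_apply]
    rw [kK_TS b (add_im hz), add_sub_cancel_right]
    field_simp; ring
  refine (h5.comp tendsto_cusp1).congr' ?_
  filter_upwards [self_mem_nhdsWithin] with z hz
  simp only [Function.comp]
  rw [cusp1_inv hz.1]

end UO

namespace UO
open Complex

/-! ### Positivity of the kernels on the imaginary axis -/

lemma ev_sI_bound {p : ℂ → Prop} (h : ∀ᶠ z in sI, p z) : ∃ M : ℝ, ∀ z : ℂ, M ≤ z.im → |z.re| ≤ 2 → p z := by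
  rw [eventually_inf_principal, eventually_comap, eventually_atTop] at h
  obtain ⟨M, h⟩ := h
  exact ⟨M, fun z h1 h2 => h z.im h1 z rfl h2⟩

lemma wf_ex (b : ℝ) : ExO Real.pi (fun z => wf b z - (xa b / xc b : ℝ)) := by
  have hA := tA_lim.mono_left sI_le
  have hB := tB_lim.mono_left sI_le
  have hC := tC_lim.mono_left sI_le
  have hCi := hC.inv₀ one_ne_zero
  have := ((tA_ex.mul hB).add ((((tB_ex.mul (hB.add_const 1)).add (tC_ex.const (-1)))).const
    ((xa b / xc b : ℝ) : ℂ))).mul hCi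
  refine this.congr fun z hz => ?_
  have := tC_ne hz
  rw [wf]; field_simp; ring

lemma kW_asym (b : ℝ) : ∃ l : ℂ, Tendsto (fun z => kW b z -
    (xa b / xc b * ((xQ b + sP b) / 2) : ℝ) * z) sI (nhds l) := by
  obtain ⟨l, h⟩ := kK_asym b
  have h0 := wf_ex b
  have h1 := h.mul (h0.tendsto Real.pi_pos)
  have h2 := (h0.pow_mul Real.pi_pos 1).const_mul (((xQ b + sP b) / 2 : ℝ) : ℂ)
  have h3 := h.mul_const ((xa b / xc b : ℝ) : ℂ)
  refine ⟨_, ((h1.add h2).add h3).congr fun z => ?_⟩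
  rw [kW]; push_cast; ring

lemma kW_inf (b : ℝ) : ∃ B M : ℝ, ∀ z ∈ tri, M ≤ z.im → -B ≤ (kW b z).re := by
  obtain ⟨l, h⟩ := kW_asym b
  set s := xa b / xc b * ((xQ b + sP b) / 2)
  have h1 := (continuous_re.tendsto l).comp h
  obtain ⟨M, hM⟩ := ev_sI_bound (h1.eventually (lt_mem_nhds (show l.re - 1 < l.re by linarith)))
  refine ⟨-(l.re - 1) + |s|, M, fun z hz hzM => ?_⟩
  have h2 := hM z hzM (by rw [abs_of_pos hz.2.1]; linarith [hz.2.2.1])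
  simp only [Function.comp, Complex.sub_re, re_ofReal_mul] at h2
  have h3 : |s * z.re| ≤ |s| := by
    rw [abs_mul, abs_of_pos hz.2.1]
    exact mul_le_of_le_one_right (abs_nonneg _) hz.2.2.1.le
  have := neg_abs_le (s * z.re)
  linarith

lemma kW_axis (b : ℝ) {t : ℝ} (ht : 0 < t) :
    kW b (t * I) = I * (xK b t * (xb t / xc t * (xa t + xa b / xc b * xb t)) : ℝ) := by
  rw [kW, kK_axis b ht, wf_axis b ht]; push_cast; ring
lemma kW_semi (b : ℝ) {t : ℝ} (ht : 0 < t) :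
    kW b (1 - 1 / (t * I + 1)) = I * (xT b t * (xa t * (xb t + xa b / xc b * xa t) / xc t) : ℝ) := by
  rw [kW_TS b (im_yI ht), kT_axis b ht, xa_eq, xb_eq ht, xc_eq]; push_cast; ring
lemma kW_one_re {b : ℝ} (hb : 1 < b) {t : ℝ} (ht : 0 < t) : 0 ≤ (kW b (t * I + 1)).re := by
  have h0 := zero_lt_one.trans hb
  have e : (kW b (t * I + 1)).re = xRe b t * (xc t / xb t * (xa b / xc b * xc t - xa t)) := by
    rw [kW, kK_one b ht, wf_one b ht, re_mul_ofReal]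
    congr 1
    rw [Complex.add_re, ofReal_re, mul_comm I, re_ofReal_mul, I_re, mul_zero, add_zero, xRe]
  rw [e]
  have hc := xc_pos h0
  have hct := xc_pos ht
  have hbt := xb_pos ht
  have e2 : xa b / xc b * xc t - xa t = (xc t * xa b - xa t * xc b) / xc b := by field_simp
  rw [e2]
  rcases lt_trichotomy t b with h | h | h
  · have h1 := xRe_nonpos hb ht h
    have h2 := xac_lt ht h
    refine mul_nonneg_of_nonpos_of_nonpos h1 (mul_nonpos_of_nonneg_of_nonpos (by positivity) ?_)
    exact div_nonpos_of_nonpos_of_nonneg (by nlinarith) hc.le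
  · subst h; simp [mul_comm]
  · have h1 := (xRe_pos hb h).le
    have h2 := xac_lt h0 h
    refine mul_nonneg h1 (mul_nonneg (by positivity) (div_nonneg (by linarith) hc.le))

lemma re_ev_ge {f : ℂ → ℂ} {F : Filter ℂ} {w : ℂ} (h : Tendsto f F (nhds w)) : ∃ B : ℝ, ∀ᶠ z in F, -B ≤ (f z).re := by
  have h1 := (continuous_re.tendsto w).comp h
  refine ⟨-(w.re - 1), ?_⟩
  filter_upwards [h1.eventually (lt_mem_nhds (show w.re - 1 < w.re by linarith))] with z hz
  simp only [Function.comp] at hz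
  linarith

lemma nhdsWithin_tri_le {p : ℂ} (h : p ∉ tri) : nhdsWithin p tri ≤ nhdsWithin p {p}ᶜ :=
  nhdsWithin_mono _ fun z hz he => h (by rw [Set.mem_singleton_iff] at he; rwa [← he])

lemma kW_re_nonneg {b : ℝ} (hb : 1 < b) : ∀ z ∈ tri, 0 ≤ (kW b z).re := by
  have h0 := zero_lt_one.trans hb
  set E0 : Finset ℂ := {0, 1, (b : ℂ) * I, ((1 / b : ℝ) : ℂ) * I, (b : ℂ) * I + 1, ((1 / b : ℝ) : ℂ) * I + 1,
    1 - 1 / ((b : ℂ) * I + 1), 1 - 1 / (((1 / b : ℝ) : ℂ) * I + 1)} with hE0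
  refine re_nonneg_tri (fun z hz => kW_diff b hz.1 (kD_ne_tri h0 hz)) (E0.filter (· ∈ closure tri \ tri))
    (fun p hp => (Finset.mem_filter.1 hp).2) ?_ ?_ (kW_inf b)
  · intro p hp
    have hp := (Finset.mem_filter.1 hp).2
    by_cases hp0 : 0 < p.im
    · obtain ⟨w, hw⟩ := kW_lim hb hp.1 hp0
      exact re_ev_ge (hw.mono_left (nhdsWithin_tri_le hp.2))
    · rcases bd_cases hp.1 hp.2 with rfl | rfl | ⟨t, ht, h⟩
      · obtain ⟨l, hl⟩ := kW_cusp0 b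
        obtain ⟨B, hB⟩ := re_ev_ge (hl.comp tendsto_cusp0)
        refine ⟨B, ?_⟩
        filter_upwards [hB, self_mem_nhdsWithin] with z h1 hz
        have := ne_zero_of_im hz.1
        simp only [Function.comp] at h1
        rwa [show -1 / (-1 / z) = z by field_simp] at h1
      · obtain ⟨B, hB⟩ := re_ev_ge ((kW_cusp1 b).comp tendsto_cusp1)
        refine ⟨B, ?_⟩
        filter_upwards [hB, self_mem_nhdsWithin] with z h1 hz
        simp only [Function.comp] at h1
        rwa [cusp1_inv hz.1] at h1
      · exfalso; apply hp0
        rcases h with rfl | rfl | rfl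
        · simpa using ht
        · simpa using ht
        · exact one_sub_im (by simpa using ht)
  · intro p hp hpE
    have hpE : p ∉ E0 := fun h => hpE (Finset.mem_filter.2 ⟨h, hp⟩)
    have key : 0 < p.im → kD b p ≠ 0 → 0 ≤ (kW b p).re → ∃ w : ℂ, 0 ≤ w.re ∧ Tendsto (kW b) (nhdsWithin p tri) (nhds w) :=
      fun h1 h2 h3 => ⟨kW b p, h3, (kW_diff b h1 h2).continuousAt.tendsto.mono_left nhdsWithin_le_nhds⟩
    rcases bd_cases hp.1 hp.2 with rfl | rfl | ⟨t, ht, rfl | rfl | rfl⟩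
    · exact absurd (by simp [hE0]) hpE
    · exact absurd (by simp [hE0]) hpE
    · refine key (im_yI ht) (fun h => hpE ?_) ?_
      · rcases kD_axis_zero hb ht h with h | h <;> rw [h, hE0] <;> simp only [Finset.mem_insert, true_or, or_true]
      · rw [kW_axis b ht]; simp
    · refine key (by simpa using ht) (fun h => hpE ?_) (kW_one_re hb ht)
      rw [kD_T b (im_yI ht)] at h
      rcases kD_axis_zero hb ht h with h | h <;> rw [h, hE0] <;> simp only [Finset.mem_insert, true_or, or_true]
    · have hi : 0 < ((t : ℂ) * I + 1).im := by simpa using ht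
      refine key (one_sub_im hi) (fun h => hpE ?_) ?_
      · rw [kD_TS b hi, add_sub_cancel_right] at h
        have h4 := (mul_eq_zero.1 h).resolve_left (pow_ne_zero _ (ne_zero_of_im hi))
        rcases kD_axis_zero hb ht h4 with h | h <;> rw [h, hE0] <;>
          simp only [Finset.mem_insert, Finset.mem_singleton, true_or, or_true]
      · rw [kW_semi b ht]; simp

lemma axis_mem_tri {t : ℝ} (ht : 0 < t) : ∀ᶠ h : ℝ in nhdsWithin 0 (Set.Ioi 0), (t : ℂ) * I + h ∈ tri := by
  have h1 : ∀ᶠ h : ℝ in nhdsWithin 0 (Set.Ioi 0), h < min 1 (t ^ 2) :=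
    nhdsWithin_le_nhds (eventually_lt_nhds (by positivity))
  filter_upwards [h1, self_mem_nhdsWithin] with h h1 h2
  have h3 := h1.trans_le (min_le_left _ _)
  have h4 := h1.trans_le (min_le_right _ _)
  have h2 : 0 < h := h2
  exact ⟨by simpa using ht, by simpa using h2, by simpa using h3, by simp; nlinarith⟩

lemma re_deriv_nonneg {H : ℂ → ℂ} {p H' : ℂ} (hd : HasDerivAt H H' p) (h0 : (H p).re = 0)
    (hpos : ∀ᶠ h : ℝ in nhdsWithin 0 (Set.Ioi 0), 0 ≤ (H (p + h)).re) : 0 ≤ H'.re := by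
  have h1 : HasDerivAt (fun h : ℝ => (H (p + h)).re) H'.re 0 := by
    have h2 : HasDerivAt (fun h : ℝ => p + (h : ℂ)) 1 0 := (Complex.ofRealCLM.hasDerivAt (x := 0)).const_add p
    have h3 : HasDerivAt H H' (p + ((0 : ℝ) : ℂ)) := by simpa using hd
    have h4 := h3.scomp (0 : ℝ) h2
    have h5 := Complex.reCLM.hasFDerivAt.comp_hasDerivAt (0 : ℝ) h4
    exact h5.congr_deriv (by simp)
  have h2 := hasDerivAt_iff_tendsto_slope.1 h1
  have h3 : Tendsto (slope (fun h : ℝ => (H (p + h)).re) 0) (nhdsWithin 0 (Set.Ioi 0)) (nhds H'.re) :=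
    h2.mono_left (nhdsWithin_mono _ fun x hx => ne_of_gt hx)
  refine ge_of_tendsto h3 ?_
  filter_upwards [hpos, self_mem_nhdsWithin] with h h4 h5
  have h5 : 0 < h := h5
  rw [slope_def_field]
  simp only [ofReal_zero, add_zero, h0, sub_zero]
  positivity

lemma nonneg_piece {u u' : ℝ → ℝ} {p q : ℝ} (hd : ∀ t ∈ Set.Ioo p q, HasDerivAt u (u' t) t)
    (hu : ∀ t ∈ Set.Ioo p q, 0 ≤ u' t) {l : ℝ} (hl : Tendsto u (nhdsWithin p (Set.Ioi p)) (nhds l)) (h0 : 0 ≤ l) :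
    ∀ t ∈ Set.Ioo p q, 0 ≤ u t := by
  intro t ht
  have hm : MonotoneOn u (Set.Ioo p q) := by
    refine monotoneOn_of_hasDerivWithinAt_nonneg (f' := u') (convex_Ioo p q)
      (fun s hs => (hd s hs).continuousAt.continuousWithinAt) ?_ ?_
    · intro s hs; rw [interior_Ioo] at hs ⊢; exact (hd s hs).hasDerivWithinAt
    · intro s hs; rw [interior_Ioo] at hs; exact hu s hs
  have : ∀ᶠ s in nhdsWithin p (Set.Ioi p), u s ≤ u t := by
    filter_upwards [Ioo_mem_nhdsGT ht.1] with s hs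
    exact hm ⟨hs.1, hs.2.trans ht.2⟩ ht hs.2.le
  exact h0.trans (le_of_tendsto hl this)

lemma tendsto_axis_ne (t : ℝ) : Tendsto (fun s : ℝ => (s : ℂ) * I) (nhdsWithin t {t}ᶜ)
    (nhdsWithin (t * I) {(t : ℂ) * I}ᶜ) := by
  refine tendsto_nhdsWithin_iff.2 ⟨((by fun_prop : Continuous fun s : ℝ => (s : ℂ) * I).tendsto t).mono_left
    nhdsWithin_le_nhds, ?_⟩
  filter_upwards [self_mem_nhdsWithin] with s hs h
  apply hs
  have := congrArg Complex.im (Set.mem_singleton_iff.1 h)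
  simpa using this

lemma axis_mono {b : ℝ} (hb : 1 < b) {H : ℂ → ℂ} (hH : ∀ z ∈ tri, 0 ≤ (H z).re)
    (hd : ∀ t : ℝ, 0 < t → t ≠ b → t ≠ 1 / b → DifferentiableAt ℂ H (t * I))
    (hr : ∀ t : ℝ, 0 < t → t ≠ b → t ≠ 1 / b → (H (t * I)).re = 0)
    (hp : ∀ t : ℝ, 0 < t → ∃ w, Tendsto H (nhdsWithin (t * I) {(t : ℂ) * I}ᶜ) (nhds w))
    {l : ℂ} (hl : Tendsto (fun t : ℝ => H (t * I)) (nhdsWithin 0 (Set.Ioi 0)) (nhds l)) (h0l : 0 ≤ l.im) :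
    ∀ t : ℝ, 0 < t → t ≠ b → t ≠ 1 / b → 0 ≤ (H (t * I)).im := by
  have h0 := zero_lt_one.trans hb
  have hbb := inv_lt_self' hb
  have h1b : 0 < 1 / b := by positivity
  set u : ℝ → ℝ := fun t => (H (t * I)).im with hu
  have hder : ∀ t : ℝ, 0 < t → t ≠ b → t ≠ 1 / b →
      HasDerivAt u (deriv H (t * I)).re t ∧ 0 ≤ (deriv H (t * I)).re := by
    intro t ht h1 h2
    refine ⟨?_, ?_⟩
    · have := (hd t ht h1 h2).hasDerivAt
      have h4 := this.scomp t ((Complex.ofRealCLM.hasDerivAt (x := t)).mul_const I)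
      have h5 := Complex.imCLM.hasFDerivAt.comp_hasDerivAt t h4
      exact h5.congr_deriv (by simp)
    · refine re_deriv_nonneg (hd t ht h1 h2).hasDerivAt (hr t ht h1 h2) ?_
      filter_upwards [axis_mem_tri ht] with h hh using hH _ hh
  have lim : ∀ t : ℝ, 0 < t → ∃ w : ℝ, Tendsto u (nhdsWithin t {t}ᶜ) (nhds w) := by
    intro t ht
    obtain ⟨w, hw⟩ := hp t ht
    exact ⟨w.im, (continuous_im.tendsto w).comp (hw.comp (tendsto_axis_ne t))⟩
  have left : ∀ {p q w : ℝ}, p < q → Tendsto u (nhdsWithin q {q}ᶜ) (nhds w) → (∀ t ∈ Set.Ioo p q, 0 ≤ u t) → 0 ≤ w := by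
    intro p q w hpq hw h
    have h2 : Tendsto u (nhdsWithin q (Set.Iio q)) (nhds w) :=
      hw.mono_left (nhdsWithin_mono _ fun x hx => ne_of_lt hx)
    refine ge_of_tendsto h2 ?_
    filter_upwards [Ioo_mem_nhdsLT hpq] with t ht using h t ht
  have right : ∀ {q w : ℝ}, Tendsto u (nhdsWithin q {q}ᶜ) (nhds w) → Tendsto u (nhdsWithin q (Set.Ioi q)) (nhds w) :=
    fun hw => hw.mono_left (nhdsWithin_mono _ fun x hx => ne_of_gt hx)
  have hl' : Tendsto u (nhdsWithin 0 (Set.Ioi 0)) (nhds l.im) := (continuous_im.tendsto l).comp hl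
  have p1 : ∀ t ∈ Set.Ioo 0 (1 / b), 0 ≤ u t := nonneg_piece
    (fun t ht => (hder t ht.1 (ht.2.trans hbb).ne ht.2.ne).1)
    (fun t ht => (hder t ht.1 (ht.2.trans hbb).ne ht.2.ne).2) hl' h0l
  obtain ⟨w1, hw1⟩ := lim (1 / b) h1b
  have p2 : ∀ t ∈ Set.Ioo (1 / b) b, 0 ≤ u t := nonneg_piece
    (fun t ht => (hder t (h1b.trans ht.1) ht.2.ne ht.1.ne').1)
    (fun t ht => (hder t (h1b.trans ht.1) ht.2.ne ht.1.ne').2) (right hw1) (left h1b hw1 p1)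
  obtain ⟨w2, hw2⟩ := lim b h0
  have p3 : ∀ q, ∀ t ∈ Set.Ioo b q, 0 ≤ u t := fun q => nonneg_piece
    (fun t ht => (hder t (h0.trans ht.1) ht.1.ne' (hbb.trans ht.1).ne').1)
    (fun t ht => (hder t (h0.trans ht.1) ht.1.ne' (hbb.trans ht.1).ne').2) (right hw2) (left hbb hw2 p2)
  intro t ht h1 h2
  rcases lt_or_gt_of_ne h1 with h | h
  · rcases lt_or_gt_of_ne h2 with h' | h'
    · exact p1 t ⟨ht, h'⟩
    · exact p2 t ⟨h', h⟩
  · exact p3 (t + 1) t ⟨h, by linarith⟩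

lemma rot_tri {z : ℂ} (hz : z ∈ tri) : -1 / (z - 1) ∈ tri := by
  obtain ⟨h1, h2, h3⟩ := tri_rot hz
  rw [Complex.sub_re, one_re] at h2 h3
  obtain ⟨g0, g1, g2, g3⟩ := hz
  refine ⟨im_S_pos (sub_im g0), by linarith, by linarith, ?_⟩
  have hz0 := ne_zero_of_im (sub_im g0)
  have hn := normSq_pos.2 hz0
  have h4 : (-1 / (z - 1)).re ^ 2 + (-1 / (z - 1)).im ^ 2 = normSq (-1 / (z - 1)) := by rw [normSq_apply]; ring
  rw [h4, map_div₀, normSq_neg, normSq_one, div_re]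
  simp
  rw [inv_eq_one_div]
  gcongr
  linarith

lemma axis_closure {t : ℝ} (ht : 0 < t) : (t : ℂ) * I ∈ closure tri := by
  have h : Tendsto (fun h : ℝ => (t : ℂ) * I + h) (nhdsWithin 0 (Set.Ioi 0)) (nhds (t * I)) := by
    have := ((by fun_prop : Continuous fun h : ℝ => (t : ℂ) * I + h).tendsto 0)
    simp only [ofReal_zero, add_zero] at this
    exact this.mono_left nhdsWithin_le_nhds
  exact mem_closure_of_tendsto h (axis_mem_tri ht)

lemma rot_cont {z : ℂ} (hz : 0 < z.im) : ContinuousAt (fun z : ℂ => -1 / (z - 1)) z := by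
  have := ne_zero_of_im (sub_im hz)
  fun_prop (disch := assumption)

lemma rot_closure {t : ℝ} (ht : 0 < t) : -1 / ((t : ℂ) * I - 1) ∈ closure tri := by
  have h : Tendsto (fun h : ℝ => (t : ℂ) * I + h) (nhdsWithin 0 (Set.Ioi 0)) (nhds (t * I)) := by
    have := ((by fun_prop : Continuous fun h : ℝ => (t : ℂ) * I + h).tendsto 0)
    simp only [ofReal_zero, add_zero] at this
    exact this.mono_left nhdsWithin_le_nhds
  refine mem_closure_of_tendsto ((rot_cont (im_yI ht)).tendsto.comp h) ?_
  filter_upwards [axis_mem_tri ht] with h hh using rot_tri hh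

lemma rot_axis {t : ℝ} (ht : 0 < t) : -1 / ((t : ℂ) * I - 1) = 1 - 1 / (((1 / t : ℝ) : ℂ) * I + 1) := by
  have h0 : (t : ℂ) ≠ 0 := by exact_mod_cast ht.ne'
  have h1 := ne_zero_of_im (sub_im (im_yI ht))
  have h2 := ne_zero_of_im (add_im (im_yI (show 0 < 1 / t by positivity)))
  have h3 : (t : ℂ) + I ≠ 0 := by
    intro h; have := congrArg Complex.im h; simp at this
  push_cast
  push_cast at h2
  have h4 : I + (t : ℂ) ≠ 0 := by rwa [add_comm]
  field_simp
  linear_combination (-(t : ℂ)) * I_sq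

lemma tendsto_inv_sI : Tendsto (fun t : ℝ => ((1 / t : ℝ) : ℂ) * I) (nhdsWithin 0 (Set.Ioi 0)) sI := by
  have h := (tendsto_axis_sI (x := 0) (by norm_num)).comp tendsto_inv_nhdsGT_zero
  refine h.congr fun t => ?_
  simp [Function.comp]

lemma xKT_self {b : ℝ} (hb : 1 < b) {t : ℝ} (h : t = b ∨ t = 1 / b) : xK b t = 0 ∧ xT b t = 0 := by
  obtain ⟨h1, h2⟩ := num_self (zero_lt_one.trans hb) h
  rw [xK, xT, h1, h2]; simp

lemma xKT_nonneg {b : ℝ} (hb : 1 < b) {t : ℝ} (ht : 0 < t) : 0 ≤ xT b t ∧ 0 ≤ xK b t := by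
  have h0 := zero_lt_one.trans hb
  have h1b : 0 < 1 / b := by positivity
  have hW := kW_re_nonneg hb
  have ha0 := xa_pos h0
  have hc0 := xc_pos h0
  have e1 : ∀ s : ℝ, s ≠ b → 1 / s ≠ 1 / b := fun s hs h => hs (by
    have := congrArg (fun x => 1 / x) h; simpa using this)
  have e2 : ∀ s : ℝ, s ≠ 1 / b → 1 / s ≠ b := fun s hs h => hs (by rw [← h]; simp)
  have hrlim : ∀ s : ℝ, 0 < s → ∃ w, Tendsto (fun z : ℂ => kW b (-1 / (z - 1)))
      (nhdsWithin (s * I) {(s : ℂ) * I}ᶜ) (nhds w) := by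
    intro s hs
    obtain ⟨w, hw⟩ := kW_lim hb (rot_closure hs) (im_S_pos (sub_im (im_yI hs)))
    refine ⟨w, hw.comp (tendsto_nhdsWithin_iff.2 ⟨(rot_cont (im_yI hs)).tendsto.mono_left nhdsWithin_le_nhds, ?_⟩)⟩
    have h3 : ∀ᶠ z : ℂ in nhdsWithin (s * I) {(s : ℂ) * I}ᶜ, 0 < z.im := nhdsWithin_le_nhds (ev_im_pos (im_yI hs))
    filter_upwards [self_mem_nhdsWithin, h3] with z hz h3 h
    apply hz
    have h5 := ne_zero_of_im (sub_im h3)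
    have h6 := ne_zero_of_im (sub_im (im_yI hs))
    rw [Set.mem_singleton_iff, div_eq_div_iff h5 h6] at h
    rw [Set.mem_singleton_iff]
    linear_combination h
  -- the rotated function
  have A : ∀ s : ℝ, 0 < s → s ≠ b → s ≠ 1 / b → 0 ≤ (kW b (-1 / ((s : ℂ) * I - 1))).im := by
    refine axis_mono hb (H := fun z => kW b (-1 / (z - 1))) (fun z hz => hW _ (rot_tri hz)) ?_ ?_ hrlim (l := 0) ?_ (by simp)
    · intro s hs h1 h2
      have hi := im_yI hs
      have hk : kD b (-1 / ((s : ℂ) * I - 1)) ≠ 0 := by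
        rw [kD_S b (sub_im hi), kD_T' b hi]
        refine mul_ne_zero (pow_ne_zero _ (ne_zero_of_im (sub_im hi))) fun h => ?_
        rcases kD_axis_zero hb hs h with h | h
        exacts [h1 h, h2 h]
      have := kW_diff b (im_S_pos (sub_im hi)) hk
      have h5 := ne_zero_of_im (sub_im hi)
      have h6 : DifferentiableAt ℂ (fun z : ℂ => -1 / (z - 1)) (s * I) := by fun_prop (disch := assumption)
      exact DifferentiableAt.comp (s * I : ℂ) this h6
    · intro s hs h1 h2
      rw [rot_axis hs, kW_semi b (by positivity)]; simp
    · refine ((kW_cusp1 b).comp tendsto_inv_sI).congr' ?_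
      filter_upwards [self_mem_nhdsWithin] with s hs
      simp only [Function.comp]
      rw [rot_axis hs]
  have hT : ∀ s : ℝ, 0 < s → 0 ≤ xT b s := by
    intro s hs
    by_cases hsb : s = b ∨ s = 1 / b
    · rw [(xKT_self hb hsb).2]
    push Not at hsb
    have h1 := A (1 / s) (by positivity) (e2 s hsb.2) (e1 s hsb.1)
    have ha := xa_pos hs
    have hc := xc_pos hs
    have hbb := xb_pos hs
    rw [rot_axis (by positivity), one_div_one_div, kW_semi b hs, mul_comm, im_ofReal_mul, I_im, mul_one] at h1
    exact nonneg_of_mul_nonneg_left h1 (by positivity)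
  obtain ⟨l, hl⟩ := kW_cusp0 b
  have hl0 : 0 ≤ l.im := by
    have h1 := hl.comp (tendsto_axis_sI (x := -1) (by norm_num))
    have h2 := (continuous_im.tendsto l).comp h1
    refine ge_of_tendsto h2 ?_
    filter_upwards [eventually_gt_atTop b, eventually_gt_atTop (1 / b)] with s h1 h2
    have := A s (h0.trans h1) h1.ne' h2.ne'
    simpa [Function.comp, sub_eq_add_neg] using this
  refine ⟨hT t ht, ?_⟩
  by_cases hsb : t = b ∨ t = 1 / b
  · rw [(xKT_self hb hsb).1]
  push Not at hsb
  have B := axis_mono hb hW (fun s hs h1 h2 => kW_diff b (im_yI hs) fun h => by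
      rcases kD_axis_zero hb hs h with h | h
      exacts [h1 h, h2 h]) (fun s hs h1 h2 => by rw [kW_axis b hs]; simp)
    (fun s hs => kW_lim hb (axis_closure hs) (im_yI hs)) (l := l) (by
      refine (hl.comp tendsto_inv_sI).congr' ?_
      filter_upwards [self_mem_nhdsWithin] with s hs
      have hs : 0 < s := hs
      simp only [Function.comp]
      rw [S_axis (by positivity), one_div_one_div]) hl0 t ht hsb.1 hsb.2
  have ha := xa_pos ht
  have hc := xc_pos ht
  have hbb := xb_pos ht
  rw [kW_axis b ht, mul_comm, im_ofReal_mul, I_im, mul_one] at B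
  exact nonneg_of_mul_nonneg_left B (by positivity)

end UO

namespace UO
open Complex

/-! ### Bounds for the kernels on the imaginary axis -/

/-- An admissible kernel on the positive half-line: nonnegative, vanishing to fourth order at `0` and
asymptotically linear with slope `lam`. -/
structure Ker (κ : ℝ → ℝ) (lam C : ℝ) : Prop where
  meas : AEStronglyMeasurable κ (volume.restrict (Set.Ioi 0))
  nonneg : ∀ t, 0 < t → 0 ≤ κ t
  le : ∀ t, 0 < t → κ t ≤ C * t ^ 4
  lin : ∀ t, 0 < t → |κ t - lam * t| ≤ C

lemma bdd_of_local {X : Type*} [TopologicalSpace X] {E : Type*} [Norm E] {K S : Set X} (hK : IsCompact K) {u : X → E}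
    (h : ∀ p ∈ K, ∃ C : ℝ, ∀ᶠ z in nhdsWithin p S, ‖u z‖ ≤ C) : ∃ C : ℝ, ∀ z ∈ K ∩ S, ‖u z‖ ≤ C := by
  refine hK.induction_on (p := fun s => ∃ C : ℝ, ∀ z ∈ s ∩ S, ‖u z‖ ≤ C) ⟨0, by simp⟩ ?_ ?_ ?_
  · rintro s t hst ⟨C, hC⟩
    exact ⟨C, fun z hz => hC z ⟨hst hz.1, hz.2⟩⟩
  · rintro s t ⟨C, hC⟩ ⟨D, hD⟩
    refine ⟨max C D, fun z hz => ?_⟩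
    rcases hz.1 with h | h
    · exact (hC z ⟨h, hz.2⟩).trans (le_max_left _ _)
    · exact (hD z ⟨h, hz.2⟩).trans (le_max_right _ _)
  · intro p hp
    obtain ⟨C, hC⟩ := h p hp
    rw [eventually_nhdsWithin_iff] at hC
    exact ⟨{z | z ∈ S → ‖u z‖ ≤ C}, nhdsWithin_le_nhds hC, C, fun z hz => hz.1 hz.2⟩

lemma bdd_Ioi {v : ℝ → ℝ} (h0 : ∃ C : ℝ, ∀ᶠ t in nhdsWithin 0 (Set.Ioi 0), ‖v t‖ ≤ C)
    (hm : ∀ t, 0 < t → ∃ C : ℝ, ∀ᶠ s in nhdsWithin t {t}ᶜ, ‖v s‖ ≤ C) (hi : ∃ C : ℝ, ∀ᶠ t in atTop, ‖v t‖ ≤ C) :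
    ∃ C : ℝ, ∀ t, 0 < t → |v t| ≤ C := by
  obtain ⟨C1, h1⟩ := hi
  obtain ⟨M, hM⟩ := eventually_atTop.1 h1
  obtain ⟨C2, h2⟩ := bdd_of_local (K := Set.Icc 0 M) (S := Set.Ioi 0) (u := v) isCompact_Icc (by
    intro p hp
    rcases hp.1.eq_or_lt with h | h
    · rw [← h]; exact h0
    · obtain ⟨C, hC⟩ := hm p h
      refine ⟨max C ‖v p‖, nhdsWithin_le_nhds ?_⟩
      rw [eventually_nhdsWithin_iff] at hC
      filter_upwards [hC] with s hs
      by_cases e : s = p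
      · rw [e]; exact le_max_right _ _
      · exact (hs e).trans (le_max_left _ _))
  refine ⟨max C1 C2, fun t ht => ?_⟩
  rcases le_total t M with h | h
  · exact (h2 t ⟨⟨ht.le, h⟩, ht⟩).trans (le_max_right _ _)
  · exact (hM t h).trans (le_max_left _ _)

lemma bdd_of_tendsto {X : Type*} {E : Type*} [NormedAddCommGroup E] {F : Filter X} {u : X → E} {w : E} (h : Tendsto u F (nhds w)) :
    ∃ C : ℝ, ∀ᶠ z in F, ‖u z‖ ≤ C :=
  ⟨‖w‖ + 1, h.norm.eventually (ge_mem_nhds (by linarith))⟩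

/-- Common form of the two kernels (`e = 1` and `e = -1`). -/
def kE (e b : ℝ) (z : ℂ) : ℂ := I * (e * nPl b z + nMi b z) / (2 * kD b z)
def xKE (e b t : ℝ) : ℝ := (e * xnP b t + xnM b t) / (2 * xkD b t)

lemma kE_axis (e b : ℝ) {t : ℝ} (ht : 0 < t) : kE e b (t * I) = I * xKE e b t := by
  rw [kE, nPl_axis b ht, nMi_axis b ht, kD_axis b ht, xKE]; push_cast; ring
lemma xKE_im (e b : ℝ) {t : ℝ} (ht : 0 < t) : xKE e b t = (kE e b (t * I)).im := by
  rw [kE_axis e b ht]; simp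

lemma kE_S (e b : ℝ) {z : ℂ} (hz : 0 < z.im) :
    kE e b (-1 / z) = (z ^ 2)⁻¹ * (I * (e * nPlS b z + nMiS b z) / (2 * kD b z)) := by
  have h0 := ne_zero_of_im hz
  rw [kE, nPl_S b hz, nMi_S b hz, kD_S b hz]
  by_cases h : kD b z = 0
  · simp [h]
  · field_simp

lemma kE_cusp (e b : ℝ) : Tendsto (fun z => z ^ 4 * kE e b (-1 / z)) sI (nhds 0) := by
  have hA := tA_ex.pow_mul Real.pi_pos 2
  have h1 := ((((nPlS_div_lim b).const_mul (e : ℂ)).add (nMiS_div_lim b)).mul hA).const_mul I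
  have h2 := h1.div ((kD_lim b).const_mul 2) (by norm_num)
  simp only [mul_zero, zero_div] at h2
  refine h2.congr' (ev_sI fun z hz => ?_)
  have h0 := ne_zero_of_im hz
  have := tA_ne hz
  simp only [Pi.div_apply]
  rw [kE_S e b hz]
  by_cases h : kD b z = 0
  · simp [h]
  · field_simp

lemma kE_lim (e : ℝ) {b : ℝ} (hb : 1 < b) {t : ℝ} (ht : 0 < t) :
    ∃ w, Tendsto (kE e b) (nhdsWithin (t * I) {(t : ℂ) * I}ᶜ) (nhds w) := by
  have hp0 := im_yI ht
  have h1 := ((((nPl_diff b hp0).const_mul (e : ℂ)).fun_add (nMi_diff b hp0)).const_mul I).hasDerivAt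
  have h2 := (kD_deriv b hp0).const_mul 2
  refine quot_lim h1 h2 ?_
  by_cases h : kD b (t * I) = 0
  · right
    obtain ⟨g1, g2⟩ := num_self (zero_lt_one.trans hb) (kD_axis_zero hb ht h)
    exact ⟨by rw [nPl_axis b ht, nMi_axis b ht, g1, g2]; simp, by rw [h, mul_zero], mul_ne_zero two_ne_zero (kD_simple hb hp0 h)⟩
  · left; exact mul_ne_zero two_ne_zero h

lemma xKE_lim (e : ℝ) {b : ℝ} (hb : 1 < b) {t : ℝ} (ht : 0 < t) :
    ∃ w, Tendsto (xKE e b) (nhdsWithin t {t}ᶜ) (nhds w) := by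
  obtain ⟨w, hw⟩ := kE_lim e hb ht
  refine ⟨w.im, ((continuous_im.tendsto w).comp (hw.comp (tendsto_axis_ne t))).congr' ?_⟩
  filter_upwards [nhdsWithin_le_nhds (lt_mem_nhds ht)] with s hs
  exact (xKE_im e b hs).symm

lemma xKE_zero (e b : ℝ) : Tendsto (fun t => xKE e b t / t ^ 4) (nhdsWithin 0 (Set.Ioi 0)) (nhds 0) := by
  have h := (continuous_im.tendsto _).comp ((kE_cusp e b).comp tendsto_inv_sI)
  refine h.congr' ?_
  filter_upwards [self_mem_nhdsWithin] with t ht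
  have ht : 0 < t := ht
  simp only [Function.comp]
  rw [S_axis (by positivity), one_div_one_div, kE_axis e b ht, mul_pow, I_pow_four]
  rw [show (((1 / t : ℝ) : ℂ) ^ 4 * 1 * (I * (xKE e b t : ℂ))) = ((1 / t ^ 4 * xKE e b t : ℝ) : ℂ) * I by push_cast; ring]
  rw [im_ofReal_mul, I_im]; ring

lemma xKE_meas (e b : ℝ) : AEStronglyMeasurable (xKE e b) (volume.restrict (Set.Ioi 0)) := by
  have c : ∀ f : ℂ → ℂ, (∀ z, 0 < z.im → DifferentiableAt ℂ f z) →
      AEMeasurable (fun t : ℝ => f (t * I)) (volume.restrict (Set.Ioi 0)) := by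
    intro f hf
    refine ContinuousOn.aemeasurable (fun t ht => ?_) measurableSet_Ioi
    have h1 : ContinuousAt (fun t : ℝ => (t : ℂ) * I) t := by fun_prop
    exact ((hf _ (im_yI ht)).continuousAt.comp (f := fun t : ℝ => (t : ℂ) * I) h1).continuousWithinAt
  have h := (((((c _ fun z hz => nPl_diff b hz).const_mul (e : ℂ)).add (c _ fun z hz => nMi_diff b hz)).const_mul I).div
    ((c _ fun z hz => kD_diff b hz).const_mul 2))
  have h2 := (Complex.measurable_im.comp_aemeasurable h).aestronglyMeasurable
  refine h2.congr ?_
  filter_upwards [ae_restrict_mem measurableSet_Ioi] with t ht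
  exact (xKE_im e b ht).symm

lemma xKE_bounds (e : ℝ) {b : ℝ} (hb : 1 < b) {lam : ℝ} {l : ℝ} (h : Tendsto (fun t => xKE e b t - lam * t) atTop (nhds l))
    (hpos : ∀ t, 0 < t → 0 ≤ xKE e b t) : ∃ C, Ker (xKE e b) lam C := by
  have hc : ∀ t : ℝ, 0 < t → ∀ k : ℝ → ℝ, ContinuousAt k t → ∃ C : ℝ, ∀ᶠ s in nhdsWithin t {t}ᶜ, ‖k s‖ ≤ C := fun t ht k hk =>
    bdd_of_tendsto (hk.tendsto.mono_left nhdsWithin_le_nhds)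
  obtain ⟨C1, h1⟩ := bdd_Ioi (v := fun t => xKE e b t / t ^ 4) (bdd_of_tendsto (xKE_zero e b))
    (fun t ht => by
      obtain ⟨w, hw⟩ := xKE_lim e hb ht
      have : Tendsto (fun s : ℝ => s ^ 4) (nhdsWithin t {t}ᶜ) (nhds (t ^ 4)) :=
        ((continuous_pow 4).tendsto t).mono_left nhdsWithin_le_nhds
      exact bdd_of_tendsto (hw.div this (by positivity)))
    (by
      have h2 : Tendsto (fun t : ℝ => (t ^ 4)⁻¹) atTop (nhds 0) := tendsto_inv_atTop_zero.comp (tendsto_pow_atTop (by norm_num))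
      have h3 : Tendsto (fun t : ℝ => (t ^ 3)⁻¹) atTop (nhds 0) := tendsto_inv_atTop_zero.comp (tendsto_pow_atTop (by norm_num))
      have h4 := (h.mul h2).add (h3.const_mul lam)
      refine bdd_of_tendsto (h4.congr' ?_)
      filter_upwards [eventually_gt_atTop 0] with t ht
      field_simp; ring)
  obtain ⟨C2, h2⟩ := bdd_Ioi (v := fun t => xKE e b t - lam * t)
    (by
      have h3 : Tendsto (fun t : ℝ => t) (nhdsWithin 0 (Set.Ioi 0)) (nhds 0) := nhdsWithin_le_nhds
      have h4 := ((xKE_zero e b).mul (h3.pow 4)).sub (h3.const_mul lam)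
      refine bdd_of_tendsto (h4.congr' ?_)
      filter_upwards [self_mem_nhdsWithin] with t ht
      have : t ≠ 0 := ne_of_gt ht
      field_simp)
    (fun t ht => by
      obtain ⟨w, hw⟩ := xKE_lim e hb ht
      have : Tendsto (fun s : ℝ => lam * s) (nhdsWithin t {t}ᶜ) (nhds (lam * t)) :=
        ((continuous_const_mul lam).tendsto t).mono_left nhdsWithin_le_nhds
      exact bdd_of_tendsto (hw.sub this))
    (bdd_of_tendsto h)
  refine ⟨max C1 C2, xKE_meas e b, hpos, fun t ht => ?_, fun t ht => (h2 t ht).trans (le_max_right _ _)⟩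
  have h3 := (le_abs_self _).trans (h1 t ht)
  rw [div_le_iff₀ (by positivity)] at h3
  exact h3.trans (mul_le_mul_of_nonneg_right (le_max_left _ _) (by positivity))

lemma kE_one (b : ℝ) : kE 1 b = kK b := by ext z; rw [kE, kK]; simp
lemma xKE_one (b : ℝ) : xKE 1 b = xK b := by ext z; rw [xKE, xK]; simp
lemma xKE_neg (b : ℝ) : xKE (-1) b = xT b := by ext z; rw [xKE, xT]; ring

lemma xK_ker {b : ℝ} (hb : 1 < b) : ∃ C, Ker (xK b) ((xQ b + sP b) / 2) C := by
  rw [← xKE_one]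
  obtain ⟨l, hl⟩ := kK_asym b
  refine xKE_bounds 1 hb (l := l.im) ?_ fun t ht => by rw [xKE_one]; exact (xKT_nonneg hb ht).2
  refine ((continuous_im.tendsto l).comp (hl.comp (tendsto_axis_sI (x := 0) (by norm_num)))).congr' ?_
  filter_upwards [eventually_gt_atTop 0] with t ht
  simp only [Function.comp, ofReal_zero, add_zero]
  rw [kK_axis b ht, xKE_one, Complex.sub_im, im_ofReal_mul, mul_comm I, im_ofReal_mul]
  simp

lemma xT_ker {b : ℝ} (hb : 1 < b) : ∃ C, Ker (xT b) ((xQ b - sP b) / 2) C := by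
  rw [← xKE_neg]
  obtain ⟨l, hl⟩ := kT_asym b
  refine xKE_bounds (-1) hb (l := -l.im) ?_ fun t ht => by rw [xKE_neg]; exact (xKT_nonneg hb ht).1
  refine ((continuous_im.tendsto l).comp (hl.comp (tendsto_axis_sI (x := 0) (by norm_num)))).neg.congr' ?_
  filter_upwards [eventually_gt_atTop 0] with t ht
  simp only [Function.comp, ofReal_zero, add_zero]
  rw [kT_axis b ht, xKE_neg, Complex.sub_im, im_ofReal_mul, neg_im, mul_comm I, im_ofReal_mul]
  simp; ring

end UO

namespace UO
open Complex

/-! ### A Cauchy theorem for the ideal triangle -/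

def zc (t : ℝ) : ℂ := 1 - 1 / ((t : ℂ) * I + 1)

lemma tI_ne (t : ℝ) : (t : ℂ) * I + 1 ≠ 0 := by
  intro h; have := congrArg Complex.re h; simp at this
lemma zc_inv (t : ℝ) : 1 / ((t : ℂ) * I + 1) = (1 - t * I) / ((1 + t ^ 2 : ℝ) : ℂ) := by
  have h1 := tI_ne t
  have h2 : ((1 + t ^ 2 : ℝ) : ℂ) ≠ 0 := by
    have : (1 + t ^ 2 : ℝ) ≠ 0 := by positivity
    exact_mod_cast this
  rw [div_eq_div_iff h1 h2]; push_cast; linear_combination (t : ℂ) ^ 2 * I_sq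
lemma zc_re (t : ℝ) : (zc t).re = t ^ 2 / (1 + t ^ 2) := by
  have : (1 + t ^ 2 : ℝ) ≠ 0 := by positivity
  rw [zc, zc_inv, Complex.sub_re, div_ofReal_re]; simp; field_simp; ring
lemma zc_im (t : ℝ) : (zc t).im = t / (1 + t ^ 2) := by
  rw [zc, zc_inv, Complex.sub_im, div_ofReal_im]; simp; ring

lemma zc_mem {t y : ℝ} (ht : 0 < t) (hy : 0 < y) : zc t + y * I ∈ tri := by
  have h1 : (0 : ℝ) < 1 + t ^ 2 := by positivity
  have h2 : 0 < t / (1 + t ^ 2) := by positivity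
  have h3 : t ^ 2 / (1 + t ^ 2) = (t ^ 2 / (1 + t ^ 2)) ^ 2 + (t / (1 + t ^ 2)) ^ 2 := by field_simp; ring
  refine ⟨?_, ?_, ?_, ?_⟩ <;> simp [zc_re, zc_im]
  · positivity
  · positivity
  · rw [div_lt_one h1]; linarith
  · nlinarith

lemma zc_deriv (t : ℝ) : HasDerivAt zc (I / ((t : ℂ) * I + 1) ^ 2) t := by
  have h1 : HasDerivAt (fun t : ℝ => (t : ℂ) * I + 1) (1 * I) t :=
    ((Complex.ofRealCLM.hasDerivAt (x := t)).mul_const I).add_const 1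
  have h2 := ((hasDerivAt_const t (1 : ℂ)).fun_div h1 (tI_ne t)).const_sub 1
  exact h2.congr_deriv (by ring)

lemma tri_up {z : ℂ} (hz : z ∈ tri) {s : ℝ} (hs : 0 ≤ s) : z + s * I ∈ tri := by
  obtain ⟨h1, h2, h3, h4⟩ := hz
  refine ⟨?_, ?_, ?_, ?_⟩ <;> simp
  · linarith
  · exact h2
  · exact h3
  · nlinarith

lemma vert_cont (c : ℂ) : Continuous fun y : ℝ => c + y * I := by fun_prop

lemma zc_norm (t : ℝ) : ‖I / ((t : ℂ) * I + 1) ^ 2‖ = (1 + t ^ 2)⁻¹ := by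
  rw [norm_div, norm_I, norm_pow, ← normSq_eq_norm_sq, normSq_apply]; simp
  ring


lemma C_nonneg {g : ℂ → ℂ} {C : ℝ} (hd : ∀ z ∈ tri, DifferentiableAt ℂ g z)
    (hb : ∀ z ∈ tri, ‖g z‖ ≤ C * (1 + z.im ^ 2)⁻¹) : 0 ≤ C := by
  have h := (norm_nonneg _).trans (hb _ (zc_mem one_pos one_pos))
  exact nonneg_of_mul_nonneg_left h (by positivity)

lemma vert_meas {g : ℂ → ℂ} {C : ℝ} (hd : ∀ z ∈ tri, DifferentiableAt ℂ g z)
    (hb : ∀ z ∈ tri, ‖g z‖ ≤ C * (1 + z.im ^ 2)⁻¹) {c : ℂ} {ε : ℝ} (h : ∀ y : ℝ, ε < y → c + y * I ∈ tri) :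
    AEStronglyMeasurable (fun y : ℝ => g (c + y * I)) (volume.restrict (Set.Ioi ε)) := by
  refine ContinuousOn.aestronglyMeasurable (fun y hy => ?_) measurableSet_Ioi
  exact ((hd _ (h y hy)).continuousAt.comp (f := fun y : ℝ => c + y * I) (vert_cont c).continuousAt).continuousWithinAt

lemma vert_bound {g : ℂ → ℂ} {C : ℝ} (hd : ∀ z ∈ tri, DifferentiableAt ℂ g z)
    (hb : ∀ z ∈ tri, ‖g z‖ ≤ C * (1 + z.im ^ 2)⁻¹) {t y : ℝ} (ht : 0 < t) (hy : 0 < y) : ‖g (zc t + y * I)‖ ≤ C * (1 + y ^ 2)⁻¹ := by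
  refine (hb _ (zc_mem ht hy)).trans ?_
  have hC := C_nonneg hd hb
  gcongr
  simp [zc_im]
  have : 0 < t / (1 + t ^ 2) := by positivity
  linarith

lemma side_int {g : ℂ → ℂ} {C : ℝ} (hd : ∀ z ∈ tri, DifferentiableAt ℂ g z)
    (hb : ∀ z ∈ tri, ‖g z‖ ≤ C * (1 + z.im ^ 2)⁻¹) {c : ℂ} {u : ℕ → ℝ} (hu : ∀ n, 0 < u n) (huc : Tendsto (fun n => zc (u n)) atTop (nhds c))
    (hl : ∀ᵐ y : ℝ ∂(volume.restrict (Set.Ioi 0)), Tendsto g (nhdsWithin (c + y * I) tri) (nhds (g (c + y * I)))) :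
    IntegrableOn (fun y : ℝ => g (c + y * I)) (Set.Ioi 0) := by
  have hlim : ∀ᵐ y : ℝ ∂(volume.restrict (Set.Ioi 0)),
      Tendsto (fun n => g (zc (u n) + y * I)) atTop (nhds (g (c + y * I))) := by
    filter_upwards [hl, ae_restrict_mem measurableSet_Ioi] with y h1 hy
    refine h1.comp (tendsto_nhdsWithin_iff.2 ⟨huc.add_const _, Eventually.of_forall fun n => zc_mem (hu n) hy⟩)
  have hi : Integrable (fun y : ℝ => C * (1 + y ^ 2)⁻¹) (volume.restrict (Set.Ioi 0)) :=
    (integrable_inv_one_add_sq.const_mul C).restrict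
  refine hi.mono' (aestronglyMeasurable_of_tendsto_ae atTop
    (fun n => vert_meas hd hb fun y hy => zc_mem (hu n) hy) hlim) ?_
  filter_upwards [hlim, ae_restrict_mem measurableSet_Ioi] with y h1 hy
  exact le_of_tendsto h1.norm (Eventually.of_forall fun n => vert_bound hd hb (hu n) hy)

lemma side_lim {g : ℂ → ℂ} {C : ℝ} (hd : ∀ z ∈ tri, DifferentiableAt ℂ g z)
    (hb : ∀ z ∈ tri, ‖g z‖ ≤ C * (1 + z.im ^ 2)⁻¹) {c : ℂ} {l : Filter ℝ} [l.IsCountablyGenerated] (hu : ∀ᶠ t in l, 0 < t) (huc : Tendsto zc l (nhds c))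
    (hl : ∀ᵐ y : ℝ ∂(volume.restrict (Set.Ioi 0)), Tendsto g (nhdsWithin (c + y * I) tri) (nhds (g (c + y * I))))
    {ε : ℝ} (hε : 0 < ε) :
    Tendsto (fun t => ∫ y in Set.Ioi ε, g (zc t + y * I)) l (nhds (∫ y in Set.Ioi ε, g (c + y * I))) := by
  have hsub : Set.Ioi ε ⊆ Set.Ioi (0 : ℝ) := Set.Ioi_subset_Ioi hε.le
  refine tendsto_integral_filter_of_dominated_convergence (fun y : ℝ => C * (1 + y ^ 2)⁻¹) ?_ ?_
    (integrable_inv_one_add_sq.const_mul C).restrict ?_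
  · filter_upwards [hu] with t ht
    exact vert_meas hd hb fun y hy => zc_mem ht (hε.trans hy)
  · filter_upwards [hu] with t ht
    filter_upwards [ae_restrict_mem measurableSet_Ioi] with y hy using vert_bound hd hb ht (hε.trans hy)
  · filter_upwards [ae_restrict_of_ae_restrict_of_subset hsub hl, ae_restrict_mem measurableSet_Ioi] with y h1 hy
    refine h1.comp (tendsto_nhdsWithin_iff.2 ⟨huc.add_const _, ?_⟩)
    filter_upwards [hu] with t ht using zc_mem ht (hε.trans hy)

lemma deriv_bound {g : ℂ → ℂ} {C : ℝ} (hd : ∀ z ∈ tri, DifferentiableAt ℂ g z)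
    (hb : ∀ z ∈ tri, ‖g z‖ ≤ C * (1 + z.im ^ 2)⁻¹) {t0 ε : ℝ} (ht : 0 < t0) (hε : 0 < ε) : ∃ D : ℝ, ∀ t ∈ Set.Icc (t0 / 2) (2 * t0), ∀ y, ε < y →
    ‖deriv g (zc t + y * I)‖ ≤ D * (1 + (y - ε) ^ 2)⁻¹ := by
  have hC := C_nonneg hd hb
  have hK : IsCompact (Set.image (fun t => zc t + ε * I) (Set.Icc (t0 / 2) (2 * t0))) := isCompact_Icc.image
    ((continuous_iff_continuousAt.2 fun t => (zc_deriv t).continuousAt).add continuous_const)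
  obtain ⟨δ, hδ, hsub⟩ := hK.exists_cthickening_subset_open tri_isOpen (by
    rintro _ ⟨t, h, rfl⟩
    exact zc_mem (by linarith [h.1]) hε)
  refine ⟨C / δ, fun t h y hy => ?_⟩
  have hball : ∀ w ∈ Metric.closedBall (zc t + y * I) δ, w ∈ tri ∧ y - ε ≤ w.im := by
    intro w hw
    have h1 : w - (y - ε : ℝ) * I ∈ tri := by
      refine hsub (Metric.mem_cthickening_of_dist_le _ (zc t + ε * I) δ _ ⟨t, h, rfl⟩ ?_)
      rw [Metric.mem_closedBall, dist_eq] at hw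
      rw [dist_eq]
      refine le_of_eq_of_le (congrArg _ ?_) hw
      push_cast; ring
    have h2 := tri_up h1 (s := y - ε) (by linarith)
    rw [sub_add_cancel] at h2
    refine ⟨h2, ?_⟩
    have := h1.1
    simp at this; linarith
  have hdc : DiffContOnCl ℂ g (Metric.ball (zc t + y * I) δ) := by
    refine DifferentiableOn.diffContOnCl fun w hw => ?_
    rw [closure_ball _ hδ.ne'] at hw
    exact (hd w (hball w hw).1).differentiableWithinAt
  have := norm_deriv_le_of_forall_mem_sphere_norm_le (C := C * (1 + (y - ε) ^ 2)⁻¹) hδ hdc (by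
    intro w hw
    obtain ⟨h1, h2⟩ := hball w (Metric.sphere_subset_closedBall hw)
    refine (hb w h1).trans ?_
    have : 0 ≤ y - ε := by linarith
    gcongr)
  refine this.trans (le_of_eq ?_)
  ring

lemma side_deriv {g : ℂ → ℂ} {C : ℝ} (hd : ∀ z ∈ tri, DifferentiableAt ℂ g z)
    (hb : ∀ z ∈ tri, ‖g z‖ ≤ C * (1 + z.im ^ 2)⁻¹) {t0 ε : ℝ} (ht : 0 < t0) (hε : 0 < ε) :
    HasDerivAt (fun t => ∫ y in Set.Ioi ε, g (zc t + y * I))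
      (I * (I / ((t0 : ℂ) * I + 1) ^ 2 * g (zc t0 + ε * I))) t0 := by
  obtain ⟨D, hD⟩ := deriv_bound hd hb ht hε
  have hmem : ∀ t ∈ Set.Icc (t0 / 2) (2 * t0), ∀ y, ε < y → zc t + y * I ∈ tri := fun t h y hy =>
    zc_mem (by linarith [h.1]) (hε.trans hy)
  have ht0 : t0 ∈ Set.Icc (t0 / 2) (2 * t0) := ⟨by linarith, by linarith⟩
  have hnt : ∀ t, 0 < t → IntegrableOn (fun y : ℝ => g (zc t + y * I)) (Set.Ioi ε) := by
    intro t ht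
    refine (integrable_inv_one_add_sq.const_mul C).restrict.mono' (vert_meas hd hb fun y hy => zc_mem ht (hε.trans hy)) ?_
    filter_upwards [ae_restrict_mem measurableSet_Ioi] with y hy using vert_bound hd hb ht (hε.trans hy)
  have hdd : ∀ z ∈ tri, ContinuousAt (deriv g) z := by
    intro z hz
    have h1 : DifferentiableOn ℂ g tri := fun w hw => (hd w hw).differentiableWithinAt
    exact ((h1.deriv tri_isOpen).differentiableAt (tri_isOpen.mem_nhds hz)).continuousAt
  have hdm : AEStronglyMeasurable (fun y : ℝ => deriv g (zc t0 + y * I)) (volume.restrict (Set.Ioi ε)) := by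
    refine ContinuousOn.aestronglyMeasurable (fun y hy => ?_) measurableSet_Ioi
    exact ((hdd _ (hmem t0 ht0 y hy)).comp (f := fun y : ℝ => zc t0 + y * I) (vert_cont _).continuousAt).continuousWithinAt
  have hbi : Integrable (fun y : ℝ => D * (1 + (y - ε) ^ 2)⁻¹) := (integrable_inv_one_add_sq.comp_sub_right ε).const_mul D
  have hdi : IntegrableOn (fun y : ℝ => deriv g (zc t0 + y * I)) (Set.Ioi ε) := by
    refine hbi.restrict.mono' hdm ?_
    filter_upwards [ae_restrict_mem measurableSet_Ioi] with y hy using hD t0 ht0 y hy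
  have key := hasDerivAt_integral_of_dominated_loc_of_deriv_le (μ := volume.restrict (Set.Ioi ε))
    (F := fun t y => g (zc t + y * I)) (F' := fun t y => I / ((t : ℂ) * I + 1) ^ 2 * deriv g (zc t + y * I))
    (x₀ := t0) (s := Set.Icc (t0 / 2) (2 * t0)) (bound := fun y => D * (1 + (y - ε) ^ 2)⁻¹)
    (Icc_mem_nhds (by linarith) (by linarith))
    (by
      filter_upwards [lt_mem_nhds ht] with t ht
      exact (hnt t ht).aestronglyMeasurable)
    (hnt t0 ht) (hdm.const_mul _)
    (by
      filter_upwards [ae_restrict_mem measurableSet_Ioi] with y hy t h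
      rw [norm_mul, zc_norm]
      refine (mul_le_of_le_one_left (norm_nonneg _) ?_).trans (hD t h y hy)
      exact inv_le_one_of_one_le₀ (by nlinarith))
    hbi.restrict
    (by
      filter_upwards [ae_restrict_mem measurableSet_Ioi] with y hy t h
      have h1 := (hd _ (hmem t h y hy)).hasDerivAt
      have h2 := (zc_deriv t).add_const (y * I : ℂ)
      exact h1.scomp t h2)
  refine key.2.congr_deriv ?_
  rw [integral_const_mul]
  have h3 : ∫ y in Set.Ioi ε, I * deriv g (zc t0 + y * I) = 0 - g (zc t0 + ε * I) := by
    refine integral_Ioi_of_hasDerivAt_of_tendsto (f := fun y : ℝ => g (zc t0 + y * I)) ?_ ?_ (hdi.const_mul I) ?_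
    · exact ((hd _ (zc_mem ht hε)).continuousAt.comp (f := fun y : ℝ => zc t0 + y * I) (vert_cont _).continuousAt).continuousWithinAt
    · intro y hy
      have h1 := (hd _ (hmem t0 ht0 y hy)).hasDerivAt
      have h2 : HasDerivAt (fun y : ℝ => zc t0 + y * I) (1 * I) y :=
        ((Complex.ofRealCLM.hasDerivAt (x := y)).mul_const I).const_add _
      exact (h1.scomp y h2).congr_deriv (by simp)
    · have : Tendsto (fun y : ℝ => C * (1 + y ^ 2)⁻¹) atTop (nhds (C * 0)) := by
        refine Tendsto.const_mul C (tendsto_inv_atTop_zero.comp ?_)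
        exact tendsto_atTop_add_const_left _ _ (tendsto_pow_atTop two_ne_zero)
      rw [mul_zero] at this
      refine squeeze_zero_norm' ?_ this
      filter_upwards [eventually_gt_atTop 0] with y hy using vert_bound hd hb ht hy
  rw [integral_const_mul] at h3
  linear_combination (-I * (I / ((t0 : ℂ) * I + 1) ^ 2)) * h3 + (I / ((t0 : ℂ) * I + 1) ^ 2) * (∫ y in Set.Ioi ε, deriv g (zc t0 + y * I)) * I_sq

lemma zc_lim_zero : Tendsto zc (nhds 0) (nhds 0) := by
  have h := (zc_deriv 0).continuousAt.tendsto
  have e : zc 0 = 0 := by simp [zc]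
  rwa [e] at h
lemma zc_lim_one : Tendsto zc atTop (nhds 1) := by
  have h : Tendsto (fun t : ℝ => 1 / ((t : ℂ) * I + 1)) atTop (nhds 0) := by
    rw [tendsto_zero_iff_norm_tendsto_zero]
    refine squeeze_zero' (Eventually.of_forall fun t => norm_nonneg _) ?_ tendsto_inv_atTop_zero
    filter_upwards [eventually_gt_atTop 0] with t ht
    rw [norm_div, norm_one, one_div]
    refine inv_anti₀ ht ?_
    have := Complex.abs_im_le_norm ((t : ℂ) * I + 1)
    simp at this
    exact (le_abs_self t).trans this
  have := h.const_sub 1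
  rwa [sub_zero] at this

theorem contour {g : ℂ → ℂ} {C : ℝ} (hd : ∀ z ∈ tri, DifferentiableAt ℂ g z)
    (hb : ∀ z ∈ tri, ‖g z‖ ≤ C * (1 + z.im ^ 2)⁻¹)
    (h0 : ∀ᵐ y : ℝ ∂(volume.restrict (Set.Ioi 0)), Tendsto g (nhdsWithin (0 + y * I) tri) (nhds (g (0 + y * I))))
    (h1 : ∀ᵐ y : ℝ ∂(volume.restrict (Set.Ioi 0)), Tendsto g (nhdsWithin (1 + y * I) tri) (nhds (g (1 + y * I))))
    (hs : ∀ᵐ t : ℝ ∂(volume.restrict (Set.Ioi 0)), Tendsto g (nhdsWithin (zc t) tri) (nhds (g (zc t)))) :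
    IntegrableOn (fun y : ℝ => g (0 + y * I)) (Set.Ioi 0) ∧ IntegrableOn (fun y : ℝ => g (1 + y * I)) (Set.Ioi 0) ∧
    IntegrableOn (fun t : ℝ => I / ((t : ℂ) * I + 1) ^ 2 * g (zc t)) (Set.Ioi 0) ∧
    ∫ t in Set.Ioi (0 : ℝ), I / ((t : ℂ) * I + 1) ^ 2 * g (zc t) =
      I * (∫ y in Set.Ioi (0 : ℝ), g (0 + y * I)) - I * ∫ y in Set.Ioi (0 : ℝ), g (1 + y * I) := by
  have hC := C_nonneg hd hb
  have i0 : IntegrableOn (fun y : ℝ => g (0 + y * I)) (Set.Ioi 0) := by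
    refine side_int hd hb (u := fun n : ℕ => 1 / ((n : ℝ) + 1)) (fun n => by positivity) ?_ h0
    exact zc_lim_zero.comp tendsto_one_div_add_atTop_nhds_zero_nat
  have i1 : IntegrableOn (fun y : ℝ => g (1 + y * I)) (Set.Ioi 0) := by
    refine side_int hd hb (u := fun n : ℕ => (n : ℝ) + 1) (fun n => by positivity) ?_ h1
    exact zc_lim_one.comp (tendsto_atTop_add_const_right _ _ tendsto_natCast_atTop_atTop)
  -- the semicircle
  have hzc : Continuous zc := continuous_iff_continuousAt.2 fun t => (zc_deriv t).continuousAt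
  have sm : ∀ ε : ℝ, 0 < ε → AEStronglyMeasurable (fun t : ℝ => I / ((t : ℂ) * I + 1) ^ 2 * g (zc t + ε * I))
      (volume.restrict (Set.Ioi 0)) := by
    intro ε hε
    refine ContinuousOn.aestronglyMeasurable (fun t ht => ContinuousAt.continuousWithinAt ?_) measurableSet_Ioi
    refine ContinuousAt.mul ?_ ?_
    · have := tI_ne t
      have : ContinuousAt (fun t : ℝ => (t : ℂ) * I + 1) t := by fun_prop
      exact continuousAt_const.div (this.pow 2) (pow_ne_zero 2 (tI_ne t))
    · exact (hd _ (zc_mem ht hε)).continuousAt.comp (f := fun t : ℝ => zc t + ε * I) (by fun_prop)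
  have sb : ∀ ε : ℝ, 0 < ε → ∀ t : ℝ, 0 < t → ‖I / ((t : ℂ) * I + 1) ^ 2 * g (zc t + ε * I)‖ ≤ C * (1 + t ^ 2)⁻¹ := by
    intro ε hε t ht
    rw [norm_mul, zc_norm, mul_comm]
    refine mul_le_mul_of_nonneg_right ((vert_bound hd hb ht hε).trans ?_) (by positivity)
    exact mul_le_of_le_one_right hC (inv_le_one_of_one_le₀ (by nlinarith))
  have hbi : IntegrableOn (fun t : ℝ => C * (1 + t ^ 2)⁻¹) (Set.Ioi 0) := (integrable_inv_one_add_sq.const_mul C).restrict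
  have slim : ∀ᵐ t : ℝ ∂(volume.restrict (Set.Ioi 0)), Tendsto (fun ε : ℝ => I / ((t : ℂ) * I + 1) ^ 2 * g (zc t + ε * I))
      (nhdsWithin 0 (Set.Ioi 0)) (nhds (I / ((t : ℂ) * I + 1) ^ 2 * g (zc t))) := by
    filter_upwards [hs, ae_restrict_mem measurableSet_Ioi] with t h ht
    refine Tendsto.const_mul _ (h.comp (tendsto_nhdsWithin_iff.2 ⟨?_, ?_⟩))
    · have := ((vert_cont (zc t)).tendsto 0).mono_left (nhdsWithin_le_nhds (s := Set.Ioi (0 : ℝ)))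
      simpa using this
    · filter_upwards [self_mem_nhdsWithin] with ε hε using zc_mem ht hε
  have i2 : IntegrableOn (fun t : ℝ => I / ((t : ℂ) * I + 1) ^ 2 * g (zc t)) (Set.Ioi 0) := by
    have hseq : Tendsto (fun n : ℕ => 1 / ((n : ℝ) + 1)) atTop (nhdsWithin 0 (Set.Ioi 0)) :=
      tendsto_nhdsWithin_iff.2 ⟨tendsto_one_div_add_atTop_nhds_zero_nat, Eventually.of_forall fun n => by
        simp only [Set.mem_Ioi]; positivity⟩
    refine hbi.mono' (aestronglyMeasurable_of_tendsto_ae atTop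
      (fun n : ℕ => sm (1 / ((n : ℝ) + 1)) (by positivity)) (slim.mono fun t h => h.comp hseq)) ?_
    filter_upwards [slim, ae_restrict_mem measurableSet_Ioi] with t h ht
    refine le_of_tendsto h.norm ?_
    filter_upwards [self_mem_nhdsWithin] with ε hε using sb ε hε t ht
  refine ⟨i0, i1, i2, ?_⟩
  have eq : ∀ ε : ℝ, 0 < ε → I * ∫ t in Set.Ioi (0 : ℝ), I / ((t : ℂ) * I + 1) ^ 2 * g (zc t + ε * I) =
      (∫ y in Set.Ioi ε, g (1 + y * I)) - ∫ y in Set.Ioi ε, g (0 + y * I) := by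
    intro ε hε
    rw [← integral_const_mul]
    have e0 : zc 0 = 0 := by simp [zc]
    rw [integral_Ioi_of_hasDerivAt_of_tendsto (f := fun t => ∫ y in Set.Ioi ε, g (zc t + y * I))
      ?_ (fun t ht => side_deriv hd hb ht hε) ?_ (side_lim hd hb (eventually_gt_atTop 0) zc_lim_one h1 hε), e0]
    · rw [← continuousWithinAt_Ioi_iff_Ici]
      have := side_lim hd hb (l := nhdsWithin 0 (Set.Ioi 0)) self_mem_nhdsWithin
        (zc_lim_zero.mono_left nhdsWithin_le_nhds) h0 hε
      rw [← e0] at this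
      exact this
    · refine Integrable.const_mul (hbi.mono' (sm ε hε) ?_) I
      filter_upwards [ae_restrict_mem measurableSet_Ioi] with t ht using sb ε hε t ht
  have L1 : Tendsto (fun ε : ℝ => I * ∫ t in Set.Ioi (0 : ℝ), I / ((t : ℂ) * I + 1) ^ 2 * g (zc t + ε * I))
      (nhdsWithin 0 (Set.Ioi 0)) (nhds (I * ∫ t in Set.Ioi (0 : ℝ), I / ((t : ℂ) * I + 1) ^ 2 * g (zc t))) := by
    refine Tendsto.const_mul I (tendsto_integral_filter_of_dominated_convergence _ ?_ ?_ hbi slim)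
    · filter_upwards [self_mem_nhdsWithin] with ε hε using sm ε hε
    · filter_upwards [self_mem_nhdsWithin] with ε hε
      filter_upwards [ae_restrict_mem measurableSet_Ioi] with t ht using sb ε hε t ht
  have L2 : ∀ f : ℝ → ℂ, IntegrableOn f (Set.Ioi 0) →
      Tendsto (fun ε : ℝ => ∫ y in Set.Ioi ε, f y) (nhdsWithin 0 (Set.Ioi 0)) (nhds (∫ y in Set.Ioi (0 : ℝ), f y)) := by
    intro f hf
    have e : ∀ᶠ ε : ℝ in nhdsWithin 0 (Set.Ioi 0), ∫ y in Set.Ioi (0 : ℝ), (Set.Ioi ε).indicator f y = ∫ y in Set.Ioi ε, f y := by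
      filter_upwards [self_mem_nhdsWithin] with ε hε
      rw [setIntegral_indicator measurableSet_Ioi, Set.inter_eq_self_of_subset_right (Set.Ioi_subset_Ioi (le_of_lt hε))]
    refine Tendsto.congr' e ?_
    refine tendsto_integral_filter_of_dominated_convergence (fun y => ‖f y‖) ?_ ?_ hf.norm ?_
    · exact Eventually.of_forall fun ε => hf.aestronglyMeasurable.indicator measurableSet_Ioi
    · exact Eventually.of_forall fun ε => Eventually.of_forall fun y => norm_indicator_le_norm_self _ _
    · filter_upwards [ae_restrict_mem measurableSet_Ioi] with y hy
      refine tendsto_const_nhds.congr' ?_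
      filter_upwards [nhdsWithin_le_nhds (gt_mem_nhds hy)] with ε hε
      rw [Set.indicator_of_mem]; exact hε
  have L3 := (L2 _ i1).sub (L2 _ i0)
  have := tendsto_nhds_unique (L1.congr' (by filter_upwards [self_mem_nhdsWithin] with ε hε using eq ε hε)) L3
  linear_combination (-I) * this + (∫ t in Set.Ioi (0 : ℝ), I / ((t : ℂ) * I + 1) ^ 2 * g (zc t)) * I_sq

end UO

namespace UO
open Complex

/-! ### Integrability of the kernels -/

lemma Ker.bound {κ : ℝ → ℝ} {lam C : ℝ} (h : Ker κ lam C) {t : ℝ} (ht : 0 < t) :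
    κ t * (t ^ 4)⁻¹ ≤ 2 * (C + |lam|) * (1 + t ^ 2)⁻¹ := by
  have hC : 0 ≤ C := (abs_nonneg _).trans (h.lin t ht)
  have hl := abs_nonneg lam
  rw [← div_eq_mul_inv, ← div_eq_mul_inv, div_le_div_iff₀ (by positivity) (by positivity)]
  have h4 : 0 < t ^ 4 := by positivity
  rcases le_total t 1 with h1 | h1
  · have h2 := h.le t ht
    have h3 : 1 + t ^ 2 ≤ 2 := by nlinarith
    have h5 := h.nonneg t ht
    calc κ t * (1 + t ^ 2) ≤ κ t * 2 := by gcongr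
      _ ≤ (C * t ^ 4) * 2 := by gcongr
      _ ≤ 2 * (C + |lam|) * t ^ 4 := by nlinarith
  · have h2 := (abs_le.1 (h.lin t ht)).2
    have h3 : lam * t ≤ |lam| * t := mul_le_mul_of_nonneg_right (le_abs_self _) ht.le
    have h5 : κ t ≤ (C + |lam|) * t := by nlinarith
    have h6 : t * (1 + t ^ 2) ≤ 2 * t ^ 4 := by nlinarith [pow_pos ht 2, pow_pos ht 3, mul_nonneg ht.le (sub_nonneg.2 h1), mul_nonneg (pow_pos ht 3).le (sub_nonneg.2 h1), mul_nonneg (pow_pos ht 2).le (sub_nonneg.2 h1)]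
    calc κ t * (1 + t ^ 2) ≤ ((C + |lam|) * t) * (1 + t ^ 2) := by gcongr
      _ = (C + |lam|) * (t * (1 + t ^ 2)) := by ring
      _ ≤ (C + |lam|) * (2 * t ^ 4) := by gcongr
      _ = _ := by ring

lemma Ker.int4 {κ : ℝ → ℝ} {lam C : ℝ} (h : Ker κ lam C) : IntegrableOn (fun t => κ t * (t ^ 4)⁻¹) (Set.Ioi 0) := by
  refine (integrable_inv_one_add_sq.const_mul (2 * (C + |lam|))).restrict.mono' ?_ ?_
  · exact h.meas.mul (by fun_prop : Measurable fun t : ℝ => (t ^ 4)⁻¹).aestronglyMeasurable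
  · filter_upwards [ae_restrict_mem measurableSet_Ioi] with t ht
    have ht : 0 < t := ht
    have := h.nonneg t ht
    rw [Real.norm_of_nonneg (by positivity)]
    exact h.bound ht

/-- Any bounded measurable multiple of `κ(t) t⁻⁴` is integrable. -/
lemma Ker.int_of {κ : ℝ → ℝ} {lam C : ℝ} (h : Ker κ lam C) {f : ℝ → ℂ} (hf : Continuous f) {D : ℝ}
    (hD : ∀ t, 0 < t → ‖f t‖ ≤ D * (t ^ 4)⁻¹) : IntegrableOn (fun t => (κ t : ℂ) * f t) (Set.Ioi 0) := by
  refine (h.int4.const_mul D).mono' ?_ ?_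
  · exact (Complex.continuous_ofReal.comp_aestronglyMeasurable h.meas).mul hf.aestronglyMeasurable
  · filter_upwards [ae_restrict_mem measurableSet_Ioi] with t ht
    have ht : 0 < t := ht
    have h0 := h.nonneg t ht
    rw [norm_mul, norm_real, Real.norm_of_nonneg h0]
    calc κ t * ‖f t‖ ≤ κ t * (D * (t ^ 4)⁻¹) := by gcongr; exact hD t ht
      _ = _ := by ring

lemma exp_le_pow4 {r t : ℝ} (hr : 0 < r) (ht : 0 < t) :
    Real.exp (-(Real.pi * r * t)) ≤ 24 / (Real.pi * r) ^ 4 * (t ^ 4)⁻¹ := by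
  have hpi := Real.pi_pos
  have h := Real.pow_div_factorial_le_exp (Real.pi * r * t) (by positivity) 4
  rw [Real.exp_neg]
  have h2 : (0 : ℝ) < (Real.pi * r * t) ^ 4 / (Nat.factorial 4) := by positivity
  refine (inv_anti₀ h2 h).trans (le_of_eq ?_)
  have : ((Nat.factorial 4 : ℕ) : ℝ) = 24 := by norm_num [Nat.factorial]
  rw [this]; field_simp

lemma Ker.intexp {κ : ℝ → ℝ} {lam C : ℝ} (h : Ker κ lam C) {r : ℝ} (hr : 0 < r) :
    IntegrableOn (fun t => (κ t : ℂ) * (Real.exp (-(Real.pi * r * t)) : ℝ)) (Set.Ioi 0) := by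
  refine h.int_of (D := 24 / (Real.pi * r) ^ 4) (by fun_prop) fun t ht => ?_
  rw [norm_real, Real.norm_of_nonneg (Real.exp_pos _).le]
  exact exp_le_pow4 hr ht

lemma Ker.intexpR {κ : ℝ → ℝ} {lam C : ℝ} (h : Ker κ lam C) {r : ℝ} (hr : 0 < r) :
    IntegrableOn (fun t => κ t * Real.exp (-(Real.pi * r * t))) (Set.Ioi 0) := by
  have := (h.intexp hr).re
  refine this.congr (Eventually.of_forall fun t => ?_)
  show ((κ t : ℂ) * ((Real.exp (-(Real.pi * r * t)) : ℝ) : ℂ)).re = _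
  rw [re_ofReal_mul, ofReal_re]

lemma tI_norm (t : ℝ) : ‖(t : ℂ) * I + 1‖ ^ 2 = 1 + t ^ 2 := by
  rw [← normSq_eq_norm_sq, normSq_apply]; simp; ring

lemma inv_pow4_le {t : ℝ} (ht : 0 < t) : ‖((t : ℂ) * I + 1) ^ 4‖⁻¹ ≤ (t ^ 4)⁻¹ := by
  have : ‖((t : ℂ) * I + 1) ^ 4‖ = (1 + t ^ 2) ^ 2 := by
    rw [norm_pow, ← tI_norm]; ring
  rw [this]
  refine inv_anti₀ (by positivity) ?_
  nlinarith [pow_pos ht 2]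

lemma zc_sub (t : ℝ) : zc t - 1 = -1 / ((t : ℂ) * I + 1) := by rw [zc]; ring

/-! ### The Fourier identity via contour integration -/

def eX (r : ℝ) (z : ℂ) : ℂ := cexp (Real.pi * I * r * (z - 1))
def gE (b r : ℝ) (z : ℂ) : ℂ := -((b / Real.pi * Real.exp (-(Real.pi * r * b)) : ℝ) : ℂ) / ((z - 1) ^ 2 + (b : ℂ) ^ 2)
def g1 (b r : ℝ) (z : ℂ) : ℂ := kK b z * eX r z - gE b r z

lemma eX_norm (r : ℝ) (z : ℂ) : ‖eX r z‖ = Real.exp (-(Real.pi * r * z.im)) := by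
  rw [eX, Complex.norm_exp]; simp
lemma eX_diff (r : ℝ) : Differentiable ℂ (eX r) := by unfold eX; fun_prop
lemma eX_pole (b r : ℝ) : eX r (b * I + 1) = (Real.exp (-(Real.pi * r * b)) : ℝ) := by
  rw [eX, add_sub_cancel_right, ofReal_exp]; congr 1; push_cast; linear_combination (Real.pi * r * b : ℂ) * I_sq

lemma gE_ne {b : ℝ} (hb : 0 < b) {z : ℂ} (hz : 0 ≤ z.im) (h : z ≠ b * I + 1) : (z - 1) ^ 2 + (b : ℂ) ^ 2 ≠ 0 := by
  have e : (z - 1) ^ 2 + (b : ℂ) ^ 2 = (z - (b * I + 1)) * (z - 1 + b * I) := by linear_combination ((b : ℂ) ^ 2) * I_sq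
  rw [e]
  refine mul_ne_zero (sub_ne_zero.2 h) fun h2 => ?_
  have := congrArg Complex.im h2
  simp at this; linarith

lemma gE_diff {b : ℝ} (r : ℝ) (hb : 0 < b) {z : ℂ} (hz : 0 ≤ z.im) (h : z ≠ b * I + 1) : DifferentiableAt ℂ (gE b r) z := by
  have := gE_ne hb hz h
  unfold gE
  fun_prop (disch := assumption)

lemma g1_pole {b : ℝ} (hb : 1 < b) (r : ℝ) :
    ∃ w, Tendsto (g1 b r) (nhdsWithin (b * I + 1) {(b : ℂ) * I + 1}ᶜ) (nhds w) := by
  have h0 := zero_lt_one.trans hb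
  obtain ⟨w, hw⟩ := kK_pole hb
  set p : ℂ := b * I + 1 with hp
  have h1 : Tendsto (eX r) (nhdsWithin p {p}ᶜ) (nhds (eX r p)) := ((eX_diff r).continuous.tendsto p).mono_left nhdsWithin_le_nhds
  have h2 := hasDerivAt_iff_tendsto_slope.1 (eX_diff r p).hasDerivAt
  have hq : p - 1 + b * I ≠ 0 := by
    intro h; have := congrArg Complex.im h; simp [hp] at this; linarith
  have h3 : Tendsto (fun z => (z - 1 + b * I)⁻¹) (nhdsWithin p {p}ᶜ) (nhds (p - 1 + b * I)⁻¹) := by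
    have : ContinuousAt (fun z => (z - 1 + b * I)⁻¹) p := by fun_prop (disch := assumption)
    exact this.tendsto.mono_left nhdsWithin_le_nhds
  refine ⟨_, (((hw.mul h1).add (h2.const_mul (I / (2 * Real.pi)))).add (h3.const_mul (I / (2 * Real.pi) * eX r p))).congr' ?_⟩
  have h4 : ∀ᶠ z in nhdsWithin p {p}ᶜ, 0 < z.im := nhdsWithin_le_nhds (ev_im_pos (by simp [hp]; exact h0))
  filter_upwards [self_mem_nhdsWithin, h4] with z hz hz0
  have e1 : z - p ≠ 0 := sub_ne_zero.2 hz
  have e2 : z - 1 + b * I ≠ 0 := by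
    intro h; have := congrArg Complex.im h; simp at this; linarith
  have e : (z - 1) ^ 2 + (b : ℂ) ^ 2 = (z - p) * (z - 1 + b * I) := by rw [hp]; linear_combination ((b : ℂ) ^ 2) * I_sq
  have hpi : (Real.pi : ℂ) ≠ 0 := by exact_mod_cast Real.pi_ne_zero
  have e3 : gE b r z = I / (2 * Real.pi) * eX r p * (1 / (z - p) - 1 / (z - 1 + b * I)) := by
    rw [gE, e, hp, eX_pole, ← hp]
    push_cast
    field_simp
    rw [hp]
    ring_nf
    rw [I_sq]; ring
  rw [g1, e3, slope_def_field]
  field_simp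
  ring

lemma g1_lim {b : ℝ} (hb : 1 < b) (r : ℝ) {p : ℂ} (hp : p ∈ closure tri) (hn : p ∉ tri) :
    ∃ w, Tendsto (g1 b r) (nhdsWithin p tri) (nhds w) := by
  have h0 := zero_lt_one.trans hb
  by_cases hpb : p = b * I + 1
  · obtain ⟨w, hw⟩ := g1_pole hb r
    rw [← hpb] at hw
    exact ⟨w, hw.mono_left (nhdsWithin_tri_le hn)⟩
  have him := (closure_tri hp).1
  have h1 : Tendsto (eX r) (nhdsWithin p tri) (nhds (eX r p)) := ((eX_diff r).continuous.tendsto p).mono_left nhdsWithin_le_nhds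
  have h2 : Tendsto (gE b r) (nhdsWithin p tri) (nhds (gE b r p)) :=
    (gE_diff r h0 him hpb).continuousAt.tendsto.mono_left nhdsWithin_le_nhds
  obtain ⟨w, hw⟩ : ∃ w, Tendsto (kK b) (nhdsWithin p tri) (nhds w) := by
    rcases bd_cases hp hn with rfl | rfl | ⟨t, ht, h⟩
    · exact ⟨_, kK_cusp0 b⟩
    · exact ⟨_, kK_cusp1 b⟩
    · have : 0 < p.im := by
        rcases h with rfl | rfl | rfl
        · simpa using ht
        · simpa using ht
        · exact one_sub_im (by simpa using ht)
      obtain ⟨w, hw⟩ := kK_lim hb hp this hpb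
      exact ⟨w, hw.mono_left (nhdsWithin_tri_le hn)⟩
  exact ⟨_, (hw.mul h1).sub h2⟩

lemma tri_ne_pole {b : ℝ} {z : ℂ} (hz : z ∈ tri) : z ≠ b * I + 1 := by
  rintro rfl; have := hz.2.2.1; simp at this

lemma g1_diff {b : ℝ} (hb : 1 < b) (r : ℝ) {z : ℂ} (hz : 0 < z.im) (h : kD b z ≠ 0) (hp : z ≠ b * I + 1) :
    DifferentiableAt ℂ (g1 b r) z :=
  ((kK_diff b hz h).mul (eX_diff r z)).sub (gE_diff r (zero_lt_one.trans hb) hz.le hp)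

lemma eX_ex (r : ℝ) : ExO (Real.pi * r) (eX r) :=
  Asymptotics.IsBigO.of_bound 1 (Eventually.of_forall fun z => by rw [eX_norm]; simp)

lemma g1_bound {b : ℝ} (hb : 1 < b) {r : ℝ} (hr : 0 < r) : ∃ C : ℝ, ∀ z ∈ tri, ‖g1 b r z‖ ≤ C * (1 + z.im ^ 2)⁻¹ := by
  have h0 := zero_lt_one.trans hb
  have hpr : 0 < Real.pi * r := mul_pos Real.pi_pos hr
  -- near infinity
  obtain ⟨l, hl⟩ := kK_asym b
  set s : ℂ := (((xQ b + sP b) / 2 : ℝ) : ℂ) with hs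
  have T : ∀ k : ℕ, Tendsto (fun z => z ^ k * kK b z * eX r z) sI (nhds 0) := by
    intro k
    have h1 := hl.mul ((eX_ex r).pow_mul hpr k)
    have h2 := ((eX_ex r).pow_mul hpr (k + 1)).const_mul s
    have h3 := h1.add h2
    rw [mul_zero, mul_zero, add_zero] at h3
    refine h3.congr fun z => ?_
    ring
  obtain ⟨M0, hM0⟩ := ev_sI_bound ((T 0).norm.eventually (gt_mem_nhds (show ‖(0 : ℂ)‖ < 1 by simp)))
  obtain ⟨M2, hM2⟩ := ev_sI_bound ((T 2).norm.eventually (gt_mem_nhds (show ‖(0 : ℂ)‖ < 1 by simp)))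
  set A := b / Real.pi * Real.exp (-(Real.pi * r * b)) with hA
  have hA0 : 0 ≤ A := by have := Real.pi_pos; positivity
  set M := max (max M0 M2) (2 * b) with hM
  have hinf : ∀ z ∈ tri, M ≤ z.im → (1 + z.im ^ 2) * ‖g1 b r z‖ ≤ 2 + 4 * A := by
    intro z hz hzM
    have hre : |z.re| ≤ 2 := by rw [abs_of_pos hz.2.1]; linarith [hz.2.2.1]
    have m0 := hM0 z (((le_max_left _ _).trans (le_max_left _ _)).trans hzM) hre
    have m2 := hM2 z (((le_max_right _ _).trans (le_max_left _ _)).trans hzM) hre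
    have mb := (le_max_right _ _).trans hzM
    rw [pow_zero, one_mul] at m0
    rw [mul_assoc, norm_mul, norm_pow] at m2
    have hi2 : z.im ^ 2 ≤ ‖z‖ ^ 2 := by
      rw [← sq_abs z.im]
      exact pow_le_pow_left₀ (abs_nonneg _) (Complex.abs_im_le_norm z) 2
    have k1 : (1 + z.im ^ 2) * ‖kK b z * eX r z‖ ≤ 2 := by
      nlinarith [norm_nonneg (kK b z * eX r z)]
    have e : (z - 1) ^ 2 + (b : ℂ) ^ 2 = (z - (b * I + 1)) * (z - 1 + b * I) := by linear_combination ((b : ℂ) ^ 2) * I_sq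
    have n1 : z.im / 2 ≤ ‖z - (b * I + 1)‖ := by
      refine le_trans ?_ ((le_abs_self _).trans (Complex.abs_im_le_norm _))
      simp; linarith
    have n2 : z.im ≤ ‖z - 1 + b * I‖ := by
      refine le_trans ?_ ((le_abs_self _).trans (Complex.abs_im_le_norm _))
      simp; linarith
    have n3 : z.im ^ 2 / 2 ≤ ‖(z - 1) ^ 2 + (b : ℂ) ^ 2‖ := by
      rw [e, norm_mul]
      have := mul_le_mul n1 n2 hz.1.le (norm_nonneg _)
      linarith
    have hi1 : 1 ≤ z.im := by linarith
    have k2 : (1 + z.im ^ 2) * ‖gE b r z‖ ≤ 4 * A := by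
      rw [gE, norm_div, norm_neg, norm_real, Real.norm_of_nonneg hA0, ← mul_div_assoc, div_le_iff₀ (by nlinarith)]
      have : 1 + z.im ^ 2 ≤ 4 * ‖(z - 1) ^ 2 + (b : ℂ) ^ 2‖ := by nlinarith
      nlinarith
    have k3 := norm_sub_le (kK b z * eX r z) (gE b r z)
    rw [g1]
    have : 0 < 1 + z.im ^ 2 := by positivity
    calc (1 + z.im ^ 2) * ‖kK b z * eX r z - gE b r z‖ ≤ (1 + z.im ^ 2) * (‖kK b z * eX r z‖ + ‖gE b r z‖) := by gcongr
      _ ≤ _ := by linarith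
  -- on bounded sets
  have hK : IsCompact (closure tri ∩ {z : ℂ | z.im ≤ M}) := by
    refine Metric.isCompact_of_isClosed_isBounded (isClosed_closure.inter (isClosed_le continuous_im continuous_const)) ?_
    refine (Metric.isBounded_closedBall (x := (0 : ℂ)) (r := 1 + |M|)).subset fun z hz => ?_
    obtain ⟨h1, h2, h3, h4⟩ := closure_tri hz.1
    rw [mem_closedBall_zero_iff]
    refine (Complex.norm_le_abs_re_add_abs_im z).trans ?_
    rw [abs_of_nonneg h1, abs_of_nonneg h2]
    have := hz.2
    simp only [Set.mem_ofPred_eq] at this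
    linarith [le_abs_self M]
  obtain ⟨D, hD⟩ := bdd_of_local (S := tri) (u := g1 b r) hK (by
    intro p hp
    by_cases h : p ∈ tri
    · exact bdd_of_tendsto ((g1_diff hb r h.1 (kD_ne_tri h0 h) (tri_ne_pole h)).continuousAt.tendsto.mono_left nhdsWithin_le_nhds)
    · obtain ⟨w, hw⟩ := g1_lim hb r hp.1 h
      exact bdd_of_tendsto hw)
  refine ⟨max (2 + 4 * A) ((1 + M ^ 2) * D), fun z hz => ?_⟩
  rw [← div_eq_mul_inv, le_div_iff₀ (by positivity), mul_comm]
  rcases le_total z.im M with h | h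
  · refine le_trans ?_ (le_max_right _ _)
    have h1 := hD z ⟨⟨subset_closure hz, h⟩, hz⟩
    have h2 := hz.1
    gcongr
  · exact (hinf z hz h).trans (le_max_left _ _)

lemma ae_ne (c : ℝ) : ∀ᵐ t : ℝ ∂(volume.restrict (Set.Ioi 0)), t ≠ c :=
  ae_restrict_of_ae (by simp [ae_iff, measure_singleton])

theorem g1_contour {b : ℝ} (hb : 1 < b) {r : ℝ} (hr : 0 < r) :
    IntegrableOn (fun y : ℝ => g1 b r (0 + y * I)) (Set.Ioi 0) ∧ IntegrableOn (fun y : ℝ => g1 b r (1 + y * I)) (Set.Ioi 0) ∧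
    IntegrableOn (fun t : ℝ => I / ((t : ℂ) * I + 1) ^ 2 * g1 b r (zc t)) (Set.Ioi 0) ∧
    ∫ t in Set.Ioi (0 : ℝ), I / ((t : ℂ) * I + 1) ^ 2 * g1 b r (zc t) =
      I * (∫ y in Set.Ioi (0 : ℝ), g1 b r (0 + y * I)) - I * ∫ y in Set.Ioi (0 : ℝ), g1 b r (1 + y * I) := by
  have h0 := zero_lt_one.trans hb
  obtain ⟨C, hC⟩ := g1_bound hb hr
  have key : ∀ p : ℂ, 0 < p.im → kD b p ≠ 0 → p ≠ b * I + 1 → Tendsto (g1 b r) (nhdsWithin p tri) (nhds (g1 b r p)) :=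
    fun p h1 h2 h3 => (g1_diff hb r h1 h2 h3).continuousAt.tendsto.mono_left nhdsWithin_le_nhds
  refine contour (fun z hz => g1_diff hb r hz.1 (kD_ne_tri h0 hz) (tri_ne_pole hz)) hC ?_ ?_ ?_
  · filter_upwards [ae_restrict_mem measurableSet_Ioi, ae_ne b, ae_ne (1 / b)] with t ht h1 h2
    rw [zero_add]
    refine key _ (im_yI ht) (fun h => ?_) fun h => ?_
    · rcases kD_axis_zero hb ht h with h | h
      exacts [h1 h, h2 h]
    · have := congrArg Complex.re h; simp at this
  · filter_upwards [ae_restrict_mem measurableSet_Ioi, ae_ne b, ae_ne (1 / b)] with t ht h1 h2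
    have ht : 0 < t := ht
    rw [add_comm]
    refine key _ (by simpa using ht) (fun h => ?_) fun h => ?_
    · rw [kD_T b (im_yI ht)] at h
      rcases kD_axis_zero hb ht h with h | h
      exacts [h1 h, h2 h]
    · have := congrArg Complex.im h; simp at this; exact h1 this
  · filter_upwards [ae_restrict_mem measurableSet_Ioi, ae_ne b, ae_ne (1 / b)] with t ht h1 h2
    have ht : 0 < t := ht
    have hi : 0 < ((t : ℂ) * I + 1).im := by simpa using ht
    rw [zc]
    refine key _ (one_sub_im hi) (fun h => ?_) fun h => ?_
    · rw [kD_TS b hi, add_sub_cancel_right] at h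
      have h4 := (mul_eq_zero.1 h).resolve_left (pow_ne_zero _ (ne_zero_of_im hi))
      rcases kD_axis_zero hb ht h4 with h | h
      exacts [h1 h, h2 h]
    · have := congrArg Complex.re h
      change (zc t).re = _ at this
      rw [zc_re] at this
      simp at this
      have h5 : (1 + t ^ 2 : ℝ) ≠ 0 := by positivity
      field_simp at this
      linarith

end UO

namespace UO
open Complex

/-! ### The pole contribution -/

def eR (b : ℝ) (z : ℂ) : ℂ := (z - 1 - b * I) / (z - 1 + b * I)
def eD (b : ℝ) (z : ℂ) : ℂ := 1 / (z - 1 - b * I) - 1 / (z - 1 + b * I)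

lemma eR_ne {b : ℝ} {z : ℂ} (hz : z.re < 1) : z - 1 - b * I ≠ 0 ∧ z - 1 + b * I ≠ 0 := by
  constructor <;>
  · intro h; have := congrArg Complex.re h; simp at this; linarith

lemma eR_im {b : ℝ} (hb : 0 < b) {z : ℂ} (hz : z.re < 1) : 0 < (eR b z).im := by
  have h := normSq_pos.2 (eR_ne (b := b) hz).2
  rw [eR, Complex.div_im, ← sub_div]
  refine div_pos ?_ h
  simp
  nlinarith [mul_pos hb (sub_pos.2 hz)]

lemma eR_deriv {b : ℝ} (hb : 0 < b) {z : ℂ} (hz : z.re < 1) : HasDerivAt (fun z => Complex.log (eR b z)) (eD b z) z := by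
  obtain ⟨h1, h2⟩ := eR_ne (b := b) hz
  have hd : HasDerivAt (eR b) ((1 * (z - 1 + b * I) - (z - 1 - b * I) * 1) / (z - 1 + b * I) ^ 2) z :=
    (((hasDerivAt_id z).sub_const 1).sub_const (b * I)).fun_div (((hasDerivAt_id z).sub_const 1).add_const (b * I)) h2
  refine (hd.clog (Or.inr (eR_im hb hz).ne')).congr_deriv ?_
  rw [eD, eR]; field_simp

lemma gE_eq {b : ℝ} (r : ℝ) {z : ℂ} (hz : z.re < 1) :
    gE b r z = (I / (2 * Real.pi) * (Real.exp (-(Real.pi * r * b)) : ℝ)) * eD b z := by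
  obtain ⟨h1, h2⟩ := eR_ne (b := b) hz
  have hpi : (Real.pi : ℂ) ≠ 0 := by exact_mod_cast Real.pi_ne_zero
  have e : (z - 1) ^ 2 + (b : ℂ) ^ 2 = (z - 1 - b * I) * (z - 1 + b * I) := by linear_combination ((b : ℂ) ^ 2) * I_sq
  rw [gE, eD, e]
  push_cast
  field_simp
  ring_nf
  rw [I_sq]; ring

lemma zc_re_lt (t : ℝ) : (zc t).re < 1 := by
  rw [zc_re, div_lt_one (by positivity)]; linarith

lemma zc_zero : zc 0 = 0 := by simp [zc]

lemma eD_semi {b : ℝ} (hb : 0 < b) (hi : IntegrableOn (fun t : ℝ => I / ((t : ℂ) * I + 1) ^ 2 * eD b (zc t)) (Set.Ioi 0)) :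
    ∫ t in Set.Ioi (0 : ℝ), I / ((t : ℂ) * I + 1) ^ 2 * eD b (zc t) = Real.pi * I - Complex.log (eR b 0) := by
  have hd : ∀ t : ℝ, HasDerivAt (fun t : ℝ => Complex.log (eR b (zc t))) (I / ((t : ℂ) * I + 1) ^ 2 * eD b (zc t)) t := by
    intro t
    have := (eR_deriv hb (zc_re_lt t)).scomp t (zc_deriv t)
    exact this
  have hb0 : (b : ℂ) ≠ 0 := by exact_mod_cast hb.ne'
  have hlim : Tendsto (fun t : ℝ => Complex.log (eR b (zc t))) atTop (nhds (Real.pi * I)) := by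
    have h1 := Complex.tendsto_log_nhdsWithin_im_nonneg_of_re_neg_of_im_zero (z := -1) (by simp) (by simp)
    have h2 : Tendsto (fun t : ℝ => eR b (zc t)) atTop (nhdsWithin (-1) {z : ℂ | 0 ≤ z.im}) := by
      refine tendsto_nhdsWithin_iff.2 ⟨?_, Eventually.of_forall fun t => (eR_im hb (zc_re_lt t)).le⟩
      have hc : ContinuousAt (eR b) 1 := by
        have : (1 : ℂ) - 1 + b * I ≠ 0 := by simp [hb0]
        unfold eR
        fun_prop (disch := assumption)
      have e : eR b 1 = -1 := by rw [eR]; field_simp; ring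
      have := hc.tendsto.comp zc_lim_one
      rw [e] at this
      exact this
    have h3 := h1.comp h2
    simp only [norm_neg, norm_one, Real.log_one, ofReal_zero, zero_add] at h3
    exact h3
  rw [integral_Ioi_of_hasDerivAt_of_tendsto (hd 0).continuousAt.continuousWithinAt (fun t _ => hd t) hi hlim, zc_zero]

lemma eD_axis {b : ℝ} (hb : 0 < b) (hi : IntegrableOn (fun t : ℝ => I * eD b (0 + t * I)) (Set.Ioi 0)) :
    ∫ t in Set.Ioi (0 : ℝ), I * eD b (0 + t * I) = - Complex.log (eR b 0) := by
  have hd : ∀ t : ℝ, HasDerivAt (fun t : ℝ => Complex.log (eR b (0 + t * I))) (I * eD b (0 + t * I)) t := by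
    intro t
    have h2 : HasDerivAt (fun t : ℝ => (0 : ℂ) + t * I) I t := by
      have := ((Complex.ofRealCLM.hasDerivAt (x := t)).mul_const I).const_add 0
      refine this.congr_deriv ?_
      simp
    exact (eR_deriv hb (by simp)).scomp t h2
  have hlim : Tendsto (fun t : ℝ => Complex.log (eR b (0 + t * I))) atTop (nhds 0) := by
    have h1 : Tendsto (fun t : ℝ => eR b (0 + t * I)) atTop (nhds 1) := by
      have h3 : Tendsto (fun t : ℝ => (((t + b)⁻¹ : ℝ) : ℂ)) atTop (nhds 0) := by
        have : Tendsto (fun t : ℝ => (t + b)⁻¹) atTop (nhds 0) := tendsto_inv_atTop_zero.comp (tendsto_atTop_add_const_right _ _ tendsto_id)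
        have := (Complex.continuous_ofReal.tendsto 0).comp this
        rw [ofReal_zero] at this
        exact this
      have h4 : Tendsto (fun t : ℝ => 1 - 2 * b * I * ((((t + b)⁻¹ : ℝ) : ℂ) / (I - (((t + b)⁻¹ : ℝ) : ℂ)))) atTop (nhds 1) := by
        have := ((h3.div (h3.const_sub I) (by simp)).const_mul (2 * b * I)).const_sub 1
        simp only [Pi.div_apply] at this
        norm_num at this
        simpa using this
      refine h4.congr' ?_
      filter_upwards [eventually_gt_atTop 0] with t ht
      have e1 : ((t : ℂ) + b) ≠ 0 := by exact_mod_cast (by positivity : t + b ≠ 0)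
      have e2 := (eR_ne (b := b) (z := 0 + t * I) (by simp)).2
      have e3 : I - ((t : ℂ) + b)⁻¹ ≠ 0 := by
        intro h
        apply e2
        have : I * ((t : ℂ) + b) - 1 = 0 := by
          rw [← mul_inv_cancel₀ e1, ← sub_eq_zero.1 h]; ring
        linear_combination this
      rw [eR]
      push_cast
      have e4 : ((t : ℂ) + b)⁻¹ / (I - ((t : ℂ) + b)⁻¹) = 1 / (0 + t * I - 1 + b * I) := by
        rw [div_eq_div_iff e3 e2]
        field_simp
        ring
      rw [e4, mul_one_div, eq_div_iff e2, sub_mul, div_mul_cancel₀ _ e2]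
      ring
    have := (continuousAt_clog (by simp : (1 : ℂ) ∈ slitPlane)).tendsto.comp h1
    rw [Complex.log_one] at this
    exact this
  rw [integral_Ioi_of_hasDerivAt_of_tendsto (hd 0).continuousAt.continuousWithinAt (fun t _ => hd t) hi hlim]
  simp

lemma gE_total {b : ℝ} (hb : 0 < b) (r : ℝ) (hi : IntegrableOn (fun t : ℝ => I / ((t : ℂ) * I + 1) ^ 2 * gE b r (zc t)) (Set.Ioi 0))
    (hi2 : IntegrableOn (fun t : ℝ => gE b r (0 + t * I)) (Set.Ioi 0)) :
    (∫ t in Set.Ioi (0 : ℝ), I / ((t : ℂ) * I + 1) ^ 2 * gE b r (zc t)) - I * ∫ t in Set.Ioi (0 : ℝ), gE b r (0 + t * I)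
      = -(((Real.exp (-(Real.pi * r * b)) / 2 : ℝ)) : ℂ) := by
  have hpi : (Real.pi : ℂ) ≠ 0 := by exact_mod_cast Real.pi_ne_zero
  set c : ℂ := I / (2 * Real.pi) * (Real.exp (-(Real.pi * r * b)) : ℝ) with hc
  have hc0 : c ≠ 0 := by
    have : ((Real.exp (-(Real.pi * r * b)) : ℝ) : ℂ) ≠ 0 := by exact_mod_cast (Real.exp_pos _).ne'
    rw [hc]; simp only [ne_eq, mul_eq_zero, div_eq_zero_iff, I_ne_zero, this]; simp [hpi]
  have e1 : (fun t : ℝ => I / ((t : ℂ) * I + 1) ^ 2 * gE b r (zc t)) = fun t : ℝ => c * (I / ((t : ℂ) * I + 1) ^ 2 * eD b (zc t)) := by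
    ext t; rw [gE_eq r (zc_re_lt t)]; ring
  have e2 : (fun t : ℝ => gE b r (0 + t * I)) = fun t : ℝ => (c / I) * (I * eD b (0 + t * I)) := by
    ext t; rw [gE_eq r (by simp), ← hc]; field_simp
  rw [e1] at hi ⊢
  rw [e2] at hi2 ⊢
  have j1 : IntegrableOn (fun t : ℝ => I / ((t : ℂ) * I + 1) ^ 2 * eD b (zc t)) (Set.Ioi 0) := by
    have := hi.const_mul c⁻¹
    refine this.congr (Eventually.of_forall fun t => ?_)
    simp only; field_simp
  have j2 : IntegrableOn (fun t : ℝ => I * eD b (0 + t * I)) (Set.Ioi 0) := by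
    have := hi2.const_mul (c / I)⁻¹
    refine this.congr (Eventually.of_forall fun t => ?_)
    simp only; field_simp
  rw [integral_const_mul, integral_const_mul, eD_semi hb j1, eD_axis hb j2, hc]
  push_cast
  field_simp
  ring_nf
  rw [I_sq]; ring

/-! ### The main identity -/

def wF (r t : ℝ) : ℂ := (((t : ℂ) * I + 1) ^ 4)⁻¹ * cexp (Real.pi * I * r * (-1 / ((t : ℂ) * I + 1)))

lemma wF_cont (r : ℝ) : Continuous (wF r) := by
  unfold wF
  have h : ∀ t : ℝ, (t : ℂ) * I + 1 ≠ 0 := tI_ne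
  have h4 : ∀ t : ℝ, ((t : ℂ) * I + 1) ^ 4 ≠ 0 := fun t => pow_ne_zero _ (h t)
  fun_prop (disch := assumption)

lemma wF_eq (r t : ℝ) : wF r t = (((t : ℂ) * I + 1) ^ 4)⁻¹ * eX r (zc t) := by
  rw [wF, eX, zc_sub]

lemma wF_norm {r t : ℝ} (hr : 0 ≤ r) (ht : 0 < t) : ‖wF r t‖ ≤ 1 * (t ^ 4)⁻¹ := by
  rw [wF_eq, norm_mul, norm_inv, eX_norm, mul_comm]
  have h1 := inv_pow4_le ht
  have h2 : Real.exp (-(Real.pi * r * (zc t).im)) ≤ 1 := by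
    rw [Real.exp_le_one_iff, zc_im]
    have := Real.pi_pos
    have : 0 ≤ Real.pi * r * (t / (1 + t ^ 2)) := by positivity
    linarith
  gcongr

lemma semi_eq {b r t : ℝ} (ht : 0 < t) : I / ((t : ℂ) * I + 1) ^ 2 * (kK b (zc t) * eX r (zc t)) = (xT b t : ℂ) * wF r t := by
  have hi : 0 < ((t : ℂ) * I + 1).im := by simpa using ht
  have h := ne_zero_of_im hi
  have e : kK b (zc t) = _ := kK_TS b hi
  rw [wF_eq, e, add_sub_cancel_right, kT_axis b ht]
  field_simp
  rw [I_sq]; ring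

lemma eX_axis (r y : ℝ) : eX r (0 + y * I) = ((Real.exp (-(Real.pi * r * y)) : ℝ) : ℂ) * cexp (-(Real.pi * r * I : ℂ)) := by
  rw [eX, ofReal_exp, ← Complex.exp_add]; congr 1; push_cast; linear_combination (Real.pi * r * y : ℂ) * I_sq

lemma axis_eq {b r t : ℝ} (ht : 0 < t) : kK b (0 + t * I) * eX r (0 + t * I) =
    (I * cexp (-(Real.pi * r * I : ℂ))) * ((xK b t : ℂ) * (Real.exp (-(Real.pi * r * t)) : ℝ)) := by
  rw [eX_axis, zero_add, kK_axis b ht]; ring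

lemma one_eq {b r t : ℝ} (ht : 0 < t) : (g1 b r (1 + t * I)).im =
    xK b t * Real.exp (-(Real.pi * r * t)) + t ^ 2 * xT b (1 / t) * Real.exp (-(Real.pi * r * t)) := by
  have h1 := kK_one b ht
  have h2 := eX_pole t r
  have h3 : gE b r (1 + t * I) = ((-(b / Real.pi * Real.exp (-(Real.pi * r * b))) / (b ^ 2 - t ^ 2) : ℝ) : ℂ) := by
    rw [gE]; push_cast; congr 1; linear_combination ((t : ℂ) ^ 2) * I_sq
  rw [g1, h3, add_comm (1 : ℂ), h1, h2, Complex.sub_im, ofReal_im, im_mul_ofReal]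
  simp only [Complex.add_im, ofReal_im, Complex.mul_im, I_re, I_im, ofReal_re]
  ring

lemma inv_change (f : ℝ → ℝ) : ∫ t in Set.Ioi (0 : ℝ), (t ^ 2)⁻¹ * f (1 / t) = ∫ t in Set.Ioi (0 : ℝ), f t := by
  rw [← integral_comp_rpow_Ioi f (p := -1) (by norm_num)]
  refine setIntegral_congr_fun measurableSet_Ioi fun t ht => ?_
  have ht : 0 < t := ht
  simp only [smul_eq_mul]
  rw [Real.rpow_neg_one, abs_neg, abs_one, one_mul, one_div]
  congr 1
  rw [show (-1 - 1 : ℝ) = -((2 : ℕ) : ℝ) by norm_num, Real.rpow_neg ht.le, Real.rpow_natCast]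

theorem main_identity {b : ℝ} (hb : 1 < b) {r : ℝ} (hr : 0 < r) :
    (∫ t in Set.Ioi (0 : ℝ), (xT b t : ℂ) * wF r t).re =
      (∫ t in Set.Ioi (0 : ℝ), xT b t * ((t ^ 4)⁻¹ * Real.exp (-(Real.pi * r / t)))) - Real.exp (-(Real.pi * r * b)) / 2
        + (1 - Real.cos (Real.pi * r)) * ∫ t in Set.Ioi (0 : ℝ), xK b t * Real.exp (-(Real.pi * r * t)) := by
  have h0 := zero_lt_one.trans hb
  obtain ⟨i1, i2, i3, H⟩ := g1_contour hb hr
  obtain ⟨C1, kk⟩ := xK_ker hb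
  obtain ⟨C2, kt⟩ := xT_ker hb
  have j1 : IntegrableOn (fun t => (xT b t : ℂ) * wF r t) (Set.Ioi 0) := kt.int_of (wF_cont r) fun t ht => wF_norm hr.le ht
  have j2 := kk.intexp hr
  have j3 := kk.intexpR hr
  -- semicircle
  have e1 : ∀ t ∈ Set.Ioi (0 : ℝ), I / ((t : ℂ) * I + 1) ^ 2 * gE b r (zc t) = (xT b t : ℂ) * wF r t - I / ((t : ℂ) * I + 1) ^ 2 * g1 b r (zc t) := by
    intro t ht
    rw [← semi_eq ht, g1]; ring
  have e2 : ∀ t ∈ Set.Ioi (0 : ℝ), gE b r (0 + t * I) = (I * cexp (-(Real.pi * r * I : ℂ))) * ((xK b t : ℂ) * (Real.exp (-(Real.pi * r * t)) : ℝ)) - g1 b r (0 + t * I) := by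
    intro t ht
    rw [← axis_eq ht, g1]; ring
  have k1 : IntegrableOn (fun t : ℝ => I / ((t : ℂ) * I + 1) ^ 2 * gE b r (zc t)) (Set.Ioi 0) :=
    IntegrableOn.congr_fun (j1.sub i3) (fun t ht => (e1 t ht).symm) measurableSet_Ioi
  have k2 : IntegrableOn (fun t : ℝ => gE b r (0 + t * I)) (Set.Ioi 0) :=
    IntegrableOn.congr_fun ((j2.const_mul _).sub i1) (fun t ht => (e2 t ht).symm) measurableSet_Ioi
  have G := gE_total h0 r k1 k2
  rw [setIntegral_congr_fun measurableSet_Ioi e1, setIntegral_congr_fun measurableSet_Ioi e2,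
    integral_sub j1 i3, integral_sub (j2.const_mul _) i1, integral_const_mul] at G
  have R : (∫ t in Set.Ioi (0 : ℝ), (xK b t : ℂ) * (Real.exp (-(Real.pi * r * t)) : ℝ)) =
      ((∫ t in Set.Ioi (0 : ℝ), xK b t * Real.exp (-(Real.pi * r * t)) : ℝ) : ℂ) := by
    rw [← integral_complex_ofReal]; push_cast; rfl
  rw [R, H] at G
  have I1 : (∫ y in Set.Ioi (0 : ℝ), g1 b r (1 + y * I)).im = (∫ t in Set.Ioi (0 : ℝ), xK b t * Real.exp (-(Real.pi * r * t)))
      + ∫ t in Set.Ioi (0 : ℝ), xT b t * ((t ^ 4)⁻¹ * Real.exp (-(Real.pi * r / t))) := by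
    have a1 : (∫ y in Set.Ioi (0 : ℝ), g1 b r (1 + y * I)).im = ∫ y in Set.Ioi (0 : ℝ), (g1 b r (1 + y * I)).im :=
      (integral_im i2).symm
    have a2 : IntegrableOn (fun t => t ^ 2 * xT b (1 / t) * Real.exp (-(Real.pi * r * t))) (Set.Ioi 0) := by
      refine IntegrableOn.congr_fun (i2.im.sub j3) (fun t ht => ?_) measurableSet_Ioi
      have := one_eq (b := b) (r := r) ht
      show (g1 b r (1 + t * I)).im - _ = _
      rw [this]; ring
    rw [a1, setIntegral_congr_fun measurableSet_Ioi (fun t ht => one_eq (b := b) (r := r) ht), integral_add j3 a2]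
    congr 1
    rw [← inv_change]
    refine setIntegral_congr_fun measurableSet_Ioi fun t ht => ?_
    have ht : 0 < t := ht
    simp only [one_div_one_div]
    rw [mul_one_div]
    field_simp
  have G2 := congrArg Complex.re G
  set A := ∫ t in Set.Ioi (0 : ℝ), (xT b t : ℂ) * wF r t
  set B := ∫ y in Set.Ioi (0 : ℝ), g1 b r (1 + y * I)
  set D := ∫ y in Set.Ioi (0 : ℝ), g1 b r (0 + y * I)
  set K := ∫ t in Set.Ioi (0 : ℝ), xK b t * Real.exp (-(Real.pi * r * t))
  have G3 : A = -(((Real.exp (-(Real.pi * r * b)) / 2 : ℝ)) : ℂ) - I * B - cexp (-(Real.pi * r * I : ℂ)) * K := by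
    linear_combination G + cexp (-(Real.pi * r * I : ℂ)) * K * I_sq
  have e5 : (cexp (-(Real.pi * r * I : ℂ))).re = Real.cos (Real.pi * r) := by
    rw [Complex.exp_re]; simp
  rw [G3, sub_re, sub_re, neg_re, ofReal_re, re_mul_ofReal, e5, I_mul_re, I1]
  ring

end UO

namespace UO
open Complex

/-! ### The radial functions attached to a kernel -/

def chX (x ξ : V8) : ℂ := cexp (-2 * Real.pi * I * (inner ℝ x ξ : ℝ))
def gsG (a : ℂ) (ξ : V8) : ℂ := cexp (-(Real.pi * a) * (‖ξ‖ : ℂ) ^ 2)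
def hX (ξ : V8) (t : ℝ) : ℝ := (2 - 2 * Real.cos (Real.pi * ‖ξ‖ ^ 2)) * Real.exp (-(Real.pi * ‖ξ‖ ^ 2 * t))
def hF (r t : ℝ) : ℝ := 2 * ((t ^ 4)⁻¹ * Real.exp (-(Real.pi * r / t))) - 2 * (wF r t).re
def kL (κ : ℝ → ℝ) (s : ℝ) : ℝ := ∫ t in Set.Ioi (0 : ℝ), κ t * Real.exp (-(Real.pi * s * t))
def kF (κ : ℝ → ℝ) (lam : ℝ) (ξ : V8) : ℝ :=
  if ξ = 0 then lam else (2 - 2 * Real.cos (Real.pi * ‖ξ‖ ^ 2)) * kL κ (‖ξ‖ ^ 2)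
def kf (κ : ℝ → ℝ) (x : V8) : ℝ := ∫ t in Set.Ioi (0 : ℝ), κ t * hF (‖x‖ ^ 2) t

lemma chX_norm (x ξ : V8) : ‖chX x ξ‖ = 1 := by
  rw [chX, Complex.norm_exp]; simp

lemma chX_re (x ξ : V8) : (chX x ξ).re = Real.cos (2 * Real.pi * inner ℝ x ξ) := by
  have : -2 * (Real.pi : ℂ) * I * (inner ℝ x ξ : ℝ) = ((-(2 * Real.pi * inner ℝ x ξ) : ℝ) : ℂ) * I := by push_cast; ring
  rw [chX, this, Complex.exp_ofReal_mul_I_re, Real.cos_neg]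

lemma chX_cont (x : V8) : Continuous (chX x) := by unfold chX; fun_prop

lemma gs_int {a : ℂ} (ha : 0 < a.re) (x : V8) : Integrable fun ξ : V8 => chX x ξ * gsG a ξ := by
  have hb : 0 < (Real.pi * a).re := by simpa using mul_pos Real.pi_pos ha
  refine (GaussianFourier.integrable_cexp_neg_mul_sq_norm_add hb (-2 * Real.pi * I) x).congr (Eventually.of_forall fun ξ => ?_)
  simp only [chX, gsG, ← Complex.exp_add]
  congr 1; ring

lemma gs_four {a : ℂ} (ha : 0 < a.re) (x : V8) : ∫ ξ : V8, chX x ξ * gsG a ξ = (a ^ 4)⁻¹ * cexp (-(Real.pi * ‖x‖ ^ 2) / a) := by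
  have hb : 0 < (Real.pi * a).re := by simpa using mul_pos Real.pi_pos ha
  have ha0 : a ≠ 0 := by rintro rfl; simp at ha
  have hpi : (Real.pi : ℂ) ≠ 0 := by exact_mod_cast Real.pi_ne_zero
  have h := GaussianFourier.integral_cexp_neg_mul_sq_norm_add hb (-2 * Real.pi * I) x
  have e1 : (Real.pi / (Real.pi * a) : ℂ) ^ ((Module.finrank ℝ V8 : ℂ) / 2) = (a ^ 4)⁻¹ := by
    rw [finrank_euclideanSpace_fin, show (((8 : ℕ) : ℂ) / 2) = ((4 : ℕ) : ℂ) by norm_num, Complex.cpow_natCast]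
    field_simp
  rw [e1] at h
  have e2 : (-2 * Real.pi * I) ^ 2 * (‖x‖ : ℂ) ^ 2 / (4 * (Real.pi * a)) = -(Real.pi * ‖x‖ ^ 2) / a := by
    field_simp
    ring_nf
    rw [I_sq]; ring
  rw [e2] at h
  rw [← h]
  congr 1; ext ξ
  simp only [chX, gsG, ← Complex.exp_add]
  congr 1; ring

lemma hX_eq (ξ : V8) (t : ℝ) : (hX ξ t : ℂ) = 2 * gsG t ξ - gsG (t - I) ξ - gsG (t + I) ξ := by
  have h1 : gsG t ξ = (Real.exp (-(Real.pi * ‖ξ‖ ^ 2 * t)) : ℝ) := by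
    rw [gsG, ofReal_exp]; congr 1; push_cast; ring
  have h2 : gsG (t - I) ξ = gsG t ξ * cexp ((Real.pi * ‖ξ‖ ^ 2 : ℝ) * I) := by
    rw [gsG, gsG, ← Complex.exp_add]; congr 1; push_cast; ring
  have h3 : gsG (t + I) ξ = gsG t ξ * cexp (-(Real.pi * ‖ξ‖ ^ 2 : ℝ) * I) := by
    rw [gsG, gsG, ← Complex.exp_add]; congr 1; push_cast; ring
  have h4 := Complex.two_cos (Real.pi * ‖ξ‖ ^ 2 : ℝ)
  rw [h2, h3, h1, hX, ofReal_mul, ofReal_sub, ofReal_mul 2, ofReal_cos]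
  push_cast at h4 ⊢
  linear_combination (-cexp (-(Real.pi * ‖ξ‖ ^ 2 * t))) * h4

lemma hX_nonneg (ξ : V8) (t : ℝ) : 0 ≤ hX ξ t :=
  mul_nonneg (by linarith [Real.cos_le_one (Real.pi * ‖ξ‖ ^ 2)]) (Real.exp_pos _).le

lemma wF_conj (r t : ℝ) : (starRingEnd ℂ) (wF r t) = (((t : ℂ) + I) ^ 4)⁻¹ * cexp (-(Real.pi * r) / (t + I)) := by
  have hne : (t : ℂ) + I ≠ 0 := by intro h; have := congrArg Complex.im h; simp at this
  have h2 : -((t : ℂ) * I) + 1 ≠ 0 := by intro h; have := congrArg Complex.re h; simp at this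
  have e : -((t : ℂ) * I) + 1 = -I * (t + I) := by linear_combination I_sq
  rw [wF, map_mul, map_inv₀, map_pow, ← Complex.exp_conj]
  simp only [map_add, map_mul, map_div₀, map_neg, map_one, conj_ofReal, conj_I]
  congr 1
  · congr 1; rw [mul_neg, e, mul_pow]; norm_num
  · congr 1; rw [mul_neg (t : ℂ), e]; field_simp

lemma hX_four {t : ℝ} (ht : 0 < t) (x : V8) :
    Integrable (fun ξ : V8 => chX x ξ * (hX ξ t : ℂ)) ∧ ∫ ξ : V8, chX x ξ * (hX ξ t : ℂ) = (hF (‖x‖ ^ 2) t : ℂ) := by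
  have a1 : 0 < (t : ℂ).re := by simpa using ht
  have a2 : 0 < ((t : ℂ) - I).re := by simpa using ht
  have a3 : 0 < ((t : ℂ) + I).re := by simpa using ht
  have e : (fun ξ : V8 => chX x ξ * (hX ξ t : ℂ)) = fun ξ => 2 * (chX x ξ * gsG t ξ) - chX x ξ * gsG (t - I) ξ - chX x ξ * gsG (t + I) ξ := by
    ext ξ; rw [hX_eq]; ring
  rw [e]
  have j : Integrable fun ξ => 2 * (chX x ξ * gsG t ξ) - chX x ξ * gsG (t - I) ξ := ((gs_int a1 x).const_mul 2).sub (gs_int a2 x)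
  refine ⟨j.sub (gs_int a3 x), ?_⟩
  rw [integral_sub j (gs_int a3 x), integral_sub ((gs_int a1 x).const_mul 2) (gs_int a2 x),
    integral_const_mul, gs_four a1, gs_four a2, gs_four a3]
  have hne : (t : ℂ) * I + 1 ≠ 0 := tI_ne t
  have hne2 : (t : ℂ) - I ≠ 0 := by intro h; have := congrArg Complex.im h; simp at this
  have w1 : (((t : ℂ) - I) ^ 4)⁻¹ * cexp (-(Real.pi * ‖x‖ ^ 2) / (t - I)) = wF (‖x‖ ^ 2) t := by
    have e : (t : ℂ) * I + 1 = I * (t - I) := by linear_combination I_sq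
    rw [wF, e, mul_pow]
    congr 1
    · norm_num
    · congr 1; push_cast; field_simp
  have w2 : (((t : ℂ) + I) ^ 4)⁻¹ * cexp (-(Real.pi * ‖x‖ ^ 2) / (t + I)) = (starRingEnd ℂ) (wF (‖x‖ ^ 2) t) := by
    rw [wF_conj]; push_cast; rfl
  have w3 := Complex.add_conj (wF (‖x‖ ^ 2) t)
  rw [w1, w2, sub_sub, w3, hF]
  push_cast
  congr 2
  rw [neg_div]

lemma hX_int0 {t : ℝ} (ht : 0 < t) : ∫ ξ : V8, hX ξ t = hF 0 t := by
  have h := (hX_four ht 0).2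
  have : ∀ ξ : V8, chX 0 ξ = 1 := fun ξ => by simp [chX]
  simp only [this, one_mul, norm_zero, ne_eq, OfNat.ofNat_ne_zero, not_false_eq_true, zero_pow] at h
  rw [integral_complex_ofReal] at h
  exact_mod_cast h

lemma hF_int {κ : ℝ → ℝ} {lam C : ℝ} (h : Ker κ lam C) {r : ℝ} (hr : 0 ≤ r) :
    IntegrableOn (fun t => κ t * ((t ^ 4)⁻¹ * Real.exp (-(Real.pi * r / t)))) (Set.Ioi 0) ∧
    IntegrableOn (fun t => (κ t : ℂ) * wF r t) (Set.Ioi 0) := by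
  refine ⟨?_, h.int_of (wF_cont r) fun t ht => wF_norm hr ht⟩
  refine h.int4.mono' (h.meas.mul (by fun_prop : Measurable fun t : ℝ => (t ^ 4)⁻¹ * Real.exp (-(Real.pi * r / t))).aestronglyMeasurable) ?_
  filter_upwards [ae_restrict_mem measurableSet_Ioi] with t ht
  have ht : 0 < t := ht
  have h0 := h.nonneg t ht
  rw [Real.norm_of_nonneg (by positivity)]
  have : Real.exp (-(Real.pi * r / t)) ≤ 1 := by
    rw [Real.exp_le_one_iff]
    have := Real.pi_pos
    have : 0 ≤ Real.pi * r / t := by positivity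
    linarith
  gcongr
  exact mul_le_of_le_one_right (by positivity) this

lemma kf_int {κ : ℝ → ℝ} {lam C : ℝ} (h : Ker κ lam C) {r : ℝ} (hr : 0 ≤ r) :
    IntegrableOn (fun t => κ t * hF r t) (Set.Ioi 0) ∧
    ∫ t in Set.Ioi (0 : ℝ), κ t * hF r t = 2 * (∫ t in Set.Ioi (0 : ℝ), κ t * ((t ^ 4)⁻¹ * Real.exp (-(Real.pi * r / t))))
      - 2 * (∫ t in Set.Ioi (0 : ℝ), (κ t : ℂ) * wF r t).re := by
  obtain ⟨i1, i2⟩ := hF_int h hr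
  have i3 : IntegrableOn (fun t => κ t * (wF r t).re) (Set.Ioi 0) := by
    refine i2.re.congr (Eventually.of_forall fun t => ?_)
    show ((κ t : ℂ) * wF r t).re = _
    rw [re_ofReal_mul]
  have e : (fun t => κ t * hF r t) = fun t => 2 * (κ t * ((t ^ 4)⁻¹ * Real.exp (-(Real.pi * r / t)))) - 2 * (κ t * (wF r t).re) := by
    ext t; rw [hF]; ring
  have e2 : (∫ t in Set.Ioi (0 : ℝ), (κ t : ℂ) * wF r t).re = ∫ t in Set.Ioi (0 : ℝ), κ t * (wF r t).re := by
    have : ∫ t in Set.Ioi (0 : ℝ), ((κ t : ℂ) * wF r t).re = (∫ t in Set.Ioi (0 : ℝ), (κ t : ℂ) * wF r t).re := integral_re i2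
    rw [← this]; simp only [re_ofReal_mul]
  rw [e, e2]
  exact ⟨(i1.const_mul 2).sub (i3.const_mul 2), by rw [integral_sub (i1.const_mul 2) (i3.const_mul 2), integral_const_mul, integral_const_mul]⟩

lemma ae_ne0 : ∀ᵐ ξ : V8, ξ ≠ 0 := by simp [ae_iff, measure_singleton]

lemma kF_eq_ae (κ : ℝ → ℝ) (lam : ℝ) {ξ : V8} (hξ : ξ ≠ 0) : kF κ lam ξ = ∫ t in Set.Ioi (0 : ℝ), κ t * hX ξ t := by
  rw [kF, if_neg hξ, kL, ← integral_const_mul]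
  congr 1; ext t; rw [hX]; ring

lemma prod_int {κ : ℝ → ℝ} {lam C : ℝ} (h : Ker κ lam C) (x : V8) :
    Integrable (Function.uncurry fun (ξ : V8) (t : ℝ) => chX x ξ * ((κ t * hX ξ t : ℝ) : ℂ)) (volume.prod (volume.restrict (Set.Ioi 0))) := by
  have hm : AEStronglyMeasurable (Function.uncurry fun (ξ : V8) (t : ℝ) => chX x ξ * ((κ t * hX ξ t : ℝ) : ℂ)) (volume.prod (volume.restrict (Set.Ioi 0))) := by
    have h1 : AEStronglyMeasurable (fun p : V8 × ℝ => κ p.2) (volume.prod (volume.restrict (Set.Ioi 0))) := h.meas.comp_snd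
    have h2 : Continuous fun p : V8 × ℝ => hX p.1 p.2 := by unfold hX; fun_prop
    have h3 : Continuous fun p : V8 × ℝ => chX x p.1 := (chX_cont x).comp continuous_fst
    exact h3.aestronglyMeasurable.mul (Complex.continuous_ofReal.comp_aestronglyMeasurable (h1.mul h2.aestronglyMeasurable))
  rw [integrable_prod_iff' hm]
  constructor
  · filter_upwards [ae_restrict_mem measurableSet_Ioi] with t ht
    refine ((hX_four ht x).1.const_mul (κ t)).congr (Eventually.of_forall fun ξ => ?_)
    simp only [Function.uncurry]; push_cast; ring
  · refine (kf_int h le_rfl).1.congr_fun (fun t ht => ?_) measurableSet_Ioi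
    have h0 := h.nonneg t ht
    simp only [Function.uncurry, norm_mul, chX_norm, one_mul, norm_real]
    rw [← hX_int0 ht, ← integral_const_mul]
    congr 1; ext ξ
    rw [Real.norm_of_nonneg (hX_nonneg ξ t), Real.norm_of_nonneg h0]

lemma kF_integrable {κ : ℝ → ℝ} {lam C : ℝ} (h : Ker κ lam C) : Integrable (kF κ lam) := by
  have := (prod_int h 0).integral_prod_left
  refine this.re.congr ?_
  filter_upwards [ae_ne0] with ξ hξ
  rw [kF_eq_ae κ lam hξ]
  have e : ∀ ξ : V8, chX 0 ξ = 1 := fun ξ => by simp [chX]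
  simp only [Function.uncurry, e, one_mul]
  rw [integral_complex_ofReal]
  exact ofReal_re _

lemma kF_four {κ : ℝ → ℝ} {lam C : ℝ} (h : Ker κ lam C) (x : V8) :
    ∫ ξ : V8, chX x ξ * (kF κ lam ξ : ℂ) = (kf κ x : ℂ) := by
  have h1 : ∫ ξ : V8, chX x ξ * (kF κ lam ξ : ℂ) = ∫ ξ : V8, ∫ t in Set.Ioi (0 : ℝ), chX x ξ * ((κ t * hX ξ t : ℝ) : ℂ) := by
    refine integral_congr_ae ?_
    filter_upwards [ae_ne0] with ξ hξ
    rw [kF_eq_ae κ lam hξ, integral_const_mul, integral_complex_ofReal]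
  rw [h1, integral_integral_swap (prod_int h x), kf, ← integral_complex_ofReal]
  refine setIntegral_congr_fun measurableSet_Ioi fun t ht => ?_
  rw [ofReal_mul, ← (hX_four ht x).2, ← integral_const_mul]
  congr 1; ext ξ; push_cast; ring

end UO

namespace UO
open Complex

/-! ### Behaviour at the origin, continuity, inversion and the final assembly -/

lemma exp_moments {a : ℝ} (ha : 0 < a) :
    (∫ t in Set.Ioi (0 : ℝ), Real.exp (-(a * t)) = 1 / a) ∧ (∫ t in Set.Ioi (0 : ℝ), t * Real.exp (-(a * t)) = 1 / a ^ 2) := by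
  constructor
  · have h := Real.integral_rpow_mul_exp_neg_mul_Ioi (a := 1) one_pos ha
    simpa using h
  · have h := Real.integral_rpow_mul_exp_neg_mul_Ioi (a := 2) two_pos ha
    norm_num at h
    simpa using h

lemma kL_bound {κ : ℝ → ℝ} {lam C : ℝ} (h : Ker κ lam C) {s : ℝ} (hs : 0 < s) :
    |(Real.pi * s) ^ 2 * kL κ s - lam| ≤ C * (Real.pi * s) := by
  have ha : 0 < Real.pi * s := mul_pos Real.pi_pos hs
  obtain ⟨m0, m1⟩ := exp_moments ha
  have i1 := h.intexpR hs
  have i0 : IntegrableOn (fun t => Real.exp (-(Real.pi * s * t))) (Set.Ioi 0) := by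
    by_contra hn
    have := integral_undef hn
    rw [m0] at this
    have : 0 < 1 / (Real.pi * s) := by positivity
    linarith
  have i2 : IntegrableOn (fun t => t * Real.exp (-(Real.pi * s * t))) (Set.Ioi 0) := by
    by_contra hn
    have := integral_undef hn
    rw [m1] at this
    have : 0 < 1 / (Real.pi * s) ^ 2 := by positivity
    linarith
  have e : kL κ s - lam * (1 / (Real.pi * s) ^ 2) = ∫ t in Set.Ioi (0 : ℝ), (κ t * Real.exp (-(Real.pi * s * t)) - lam * (t * Real.exp (-(Real.pi * s * t)))) := by
    rw [integral_sub i1 (i2.const_mul lam), integral_const_mul, m1, kL]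
  have b : |kL κ s - lam * (1 / (Real.pi * s) ^ 2)| ≤ C * (1 / (Real.pi * s)) := by
    rw [e, ← m0, ← integral_const_mul, ← Real.norm_eq_abs]
    refine norm_integral_le_of_norm_le (i0.const_mul C) ?_
    filter_upwards [ae_restrict_mem measurableSet_Ioi] with t ht
    rw [← mul_assoc, ← sub_mul, norm_mul, Real.norm_of_nonneg (Real.exp_pos _).le, Real.norm_eq_abs]
    exact mul_le_mul_of_nonneg_right (h.lin t ht) (Real.exp_pos _).le
  have e2 : (Real.pi * s) ^ 2 * kL κ s - lam = (Real.pi * s) ^ 2 * (kL κ s - lam * (1 / (Real.pi * s) ^ 2)) := by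
    field_simp
  rw [e2, abs_mul, abs_of_pos (by positivity : 0 < (Real.pi * s) ^ 2)]
  calc (Real.pi * s) ^ 2 * |kL κ s - lam * (1 / (Real.pi * s) ^ 2)| ≤ (Real.pi * s) ^ 2 * (C * (1 / (Real.pi * s))) := by gcongr
    _ = C * (Real.pi * s) := by field_simp

lemma kL_lim {κ : ℝ → ℝ} {lam C : ℝ} (h : Ker κ lam C) :
    Tendsto (fun s => (2 - 2 * Real.cos (Real.pi * s)) * kL κ s) (nhdsWithin 0 (Set.Ioi 0)) (nhds lam) := by
  have h1 : Tendsto (fun s => (Real.pi * s) ^ 2 * kL κ s) (nhdsWithin 0 (Set.Ioi 0)) (nhds lam) := by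
    rw [tendsto_iff_norm_sub_tendsto_zero]
    have hz : Tendsto (fun s : ℝ => C * (Real.pi * s)) (nhdsWithin 0 (Set.Ioi 0)) (nhds 0) := by
      have : Continuous fun s : ℝ => C * (Real.pi * s) := by fun_prop
      have := (this.tendsto 0).mono_left (nhdsWithin_le_nhds (s := Set.Ioi 0))
      simpa using this
    refine squeeze_zero' (Eventually.of_forall fun _ => norm_nonneg _) ?_ hz
    filter_upwards [self_mem_nhdsWithin] with s hs
    exact kL_bound h hs
  have h2 : Tendsto (fun s : ℝ => Real.sinc (Real.pi * s / 2) ^ 2) (nhdsWithin 0 (Set.Ioi 0)) (nhds 1) := by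
    have : Continuous fun s : ℝ => Real.sinc (Real.pi * s / 2) ^ 2 := by
      have := Real.continuous_sinc
      fun_prop
    have := (this.tendsto 0).mono_left (nhdsWithin_le_nhds (s := Set.Ioi 0))
    simpa using this
  have h3 := h2.mul h1
  rw [one_mul] at h3
  refine h3.congr' ?_
  filter_upwards [self_mem_nhdsWithin] with s hs
  have hs : 0 < s := hs
  have hne : Real.pi * s / 2 ≠ 0 := by have := Real.pi_pos; positivity
  rw [Real.sinc_of_ne_zero hne]
  have e1 : Real.cos (Real.pi * s) = 1 - 2 * Real.sin (Real.pi * s / 2) ^ 2 := by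
    have := Real.cos_two_mul (Real.pi * s / 2)
    rw [Real.cos_sq', mul_div_cancel₀ _ two_ne_zero] at this
    linarith
  rw [e1]
  field_simp
  ring

lemma kL_contAt {κ : ℝ → ℝ} {lam C : ℝ} (h : Ker κ lam C) {s : ℝ} (hs : 0 < s) : ContinuousAt (kL κ) s := by
  unfold kL
  refine continuousAt_of_dominated (bound := fun t => κ t * Real.exp (-(Real.pi * (s / 2) * t))) ?_ ?_ (h.intexpR (half_pos hs)) ?_
  · exact Eventually.of_forall fun u => h.meas.mul (by fun_prop : Measurable fun t : ℝ => Real.exp (-(Real.pi * u * t))).aestronglyMeasurable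
  · filter_upwards [lt_mem_nhds (half_lt_self hs)] with u hu
    filter_upwards [ae_restrict_mem measurableSet_Ioi] with t ht
    have ht : 0 < t := ht
    have h0 := h.nonneg t ht
    rw [Real.norm_of_nonneg (by positivity)]
    have := Real.pi_pos
    gcongr
  · exact Eventually.of_forall fun t => by fun_prop

lemma kF_cont {κ : ℝ → ℝ} {lam C : ℝ} (h : Ker κ lam C) : Continuous (kF κ lam) := by
  rw [continuous_iff_continuousAt]
  intro ξ
  by_cases hξ : ξ = 0
  · subst hξ
    rw [continuousAt_iff_punctured_nhds]
    have h1 : Tendsto (fun ξ : V8 => ‖ξ‖ ^ 2) (nhdsWithin 0 {0}ᶜ) (nhdsWithin 0 (Set.Ioi 0)) := by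
      refine tendsto_nhdsWithin_iff.2 ⟨?_, ?_⟩
      · have : Continuous fun ξ : V8 => ‖ξ‖ ^ 2 := by fun_prop
        have := (this.tendsto 0).mono_left (nhdsWithin_le_nhds (s := {0}ᶜ))
        simpa using this
      · filter_upwards [self_mem_nhdsWithin] with ξ hξ
        have : 0 < ‖ξ‖ := norm_pos_iff.2 hξ
        exact pow_pos this 2
    have h2 := (kL_lim h).comp h1
    have e : kF κ lam 0 = lam := by simp [kF]
    rw [e]
    refine h2.congr' ?_
    filter_upwards [self_mem_nhdsWithin] with ξ hξ
    have hξ : ξ ≠ 0 := hξ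
    rw [kF, if_neg hξ]; rfl
  · have hp : 0 < ‖ξ‖ ^ 2 := pow_pos (norm_pos_iff.2 hξ) 2
    have h1 : ContinuousAt (fun ξ : V8 => kL κ (‖ξ‖ ^ 2)) ξ :=
      ContinuousAt.comp (f := fun ξ : V8 => ‖ξ‖ ^ 2) (kL_contAt h hp) (by fun_prop)
    have h2 : ContinuousAt (fun ξ : V8 => 2 - 2 * Real.cos (Real.pi * ‖ξ‖ ^ 2)) ξ := by fun_prop
    refine (h2.mul h1).congr ?_
    filter_upwards [isOpen_ne.mem_nhds hξ] with η hη
    rw [kF, if_neg hη]; rfl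

lemma kF_zero (κ : ℝ → ℝ) (lam : ℝ) : kF κ lam 0 = lam := by simp [kF]

lemma kF_nonneg {κ : ℝ → ℝ} {lam C : ℝ} (h : Ker κ lam C) (ξ : V8) : 0 ≤ kF κ lam ξ := by
  have hp : ∀ s, 0 ≤ (2 - 2 * Real.cos (Real.pi * s)) * kL κ s := fun s =>
    mul_nonneg (by linarith [Real.cos_le_one (Real.pi * s)])
      (setIntegral_nonneg measurableSet_Ioi fun t ht => mul_nonneg (h.nonneg t ht) (Real.exp_pos _).le)
  rw [kF]
  split_ifs with h0
  · exact ge_of_tendsto (kL_lim h) (Eventually.of_forall hp)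
  · exact hp _

lemma chX_int (x : V8) {F : V8 → ℝ} (hF : Integrable F) : Integrable fun ξ => chX x ξ * (F ξ : ℂ) := by
  refine hF.ofReal.bdd_mul (c := 1) (chX_cont x).aestronglyMeasurable (Eventually.of_forall fun ξ => (chX_norm x ξ).le)

lemma cos_of {F : V8 → ℝ} (hF : Integrable F) (x : V8) :
    ∫ ξ, F ξ * Real.cos (2 * Real.pi * inner ℝ x ξ) = (∫ ξ, chX x ξ * (F ξ : ℂ)).re := by
  have : ∫ ξ, (chX x ξ * (F ξ : ℂ)).re = (∫ ξ, chX x ξ * (F ξ : ℂ)).re := integral_re (chX_int x hF)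
  rw [← this]
  congr 1; ext ξ
  rw [re_mul_ofReal, chX_re, mul_comm]

lemma kf_cont {κ : ℝ → ℝ} {lam C : ℝ} (h : Ker κ lam C) : Continuous (kf κ) := by
  have e : kf κ = fun x => (∫ ξ : V8, chX x ξ * (kF κ lam ξ : ℂ)).re := by
    ext x; rw [kF_four h, ofReal_re]
  rw [e]
  refine Complex.continuous_re.comp ?_
  have hi := kF_integrable h
  refine continuous_of_dominated (bound := fun ξ => ‖kF κ lam ξ‖) (fun x => (chX_int x hi).aestronglyMeasurable) ?_ hi.norm ?_
  · refine fun x => Eventually.of_forall fun ξ => ?_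
    rw [norm_mul, chX_norm, one_mul, norm_real]
  · refine Eventually.of_forall fun ξ => ?_
    unfold chX
    fun_prop

lemma four_inv {κ : ℝ → ℝ} {lam C : ℝ} (h : Ker κ lam C) (hi : Integrable (kf κ)) (x : V8) :
    ∫ ξ, kf κ ξ * Real.cos (2 * Real.pi * inner ℝ x ξ) = kF κ lam x := by
  have e1 : FourierTransform.fourier (fun ξ : V8 => (kF κ lam ξ : ℂ)) = fun x => (kf κ x : ℂ) := by
    ext y
    rw [Real.fourier_eq', ← kF_four h]
    congr 1; ext ξ
    rw [smul_eq_mul, chX, real_inner_comm]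
    congr 2; push_cast; ring
  have h2 := (kF_integrable h).ofReal (𝕜 := ℂ)
  have h3 := h2.fourierInv_fourier_eq (v := x) (by
    change Integrable (FourierTransform.fourier (fun ξ : V8 => (kF κ lam ξ : ℂ)))
    rw [e1]; exact hi.ofReal) (Complex.continuous_ofReal.comp (kF_cont h)).continuousAt
  change FourierTransformInv.fourierInv (FourierTransform.fourier (fun ξ : V8 => (kF κ lam ξ : ℂ))) x = (kF κ lam x : ℂ) at h3
  rw [e1, Real.fourierInv_eq'] at h3
  have h4 : ∫ ξ : V8, chX (-x) ξ * (kf κ ξ : ℂ) = (kF κ lam x : ℂ) := by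
    rw [← h3]
    congr 1; ext ξ
    rw [smul_eq_mul, chX, inner_neg_left, real_inner_comm]
    congr 2; push_cast; ring
  have h5 := cos_of hi (-x)
  rw [h4, ofReal_re] at h5
  rw [← h5]
  congr 1; ext ξ
  rw [inner_neg_left, mul_neg, Real.cos_neg]

/-! real Gaussians -/

def gR (a : ℝ) (ξ : V8) : ℝ := Real.exp (-(Real.pi * a) * ‖ξ‖ ^ 2)

lemma gR_cast (a : ℝ) (ξ : V8) : (gR a ξ : ℂ) = gsG a ξ := by
  rw [gR, gsG, ofReal_exp]; push_cast; rfl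

lemma gR_int {a : ℝ} (ha : 0 < a) : Integrable (gR a) := by
  have h := (gs_int (a := a) (by simpa using ha) 0).re
  refine h.congr (Eventually.of_forall fun ξ => ?_)
  show (chX 0 ξ * gsG a ξ).re = _
  rw [← gR_cast]; simp [chX]

lemma gR_cos {a : ℝ} (ha : 0 < a) (x : V8) :
    ∫ ξ, gR a ξ * Real.cos (2 * Real.pi * inner ℝ x ξ) = (a ^ 4)⁻¹ * gR (1 / a) x := by
  rw [cos_of (gR_int ha)]
  simp only [gR_cast]
  rw [gs_four (by simpa using ha)]
  have : ((a : ℂ) ^ 4)⁻¹ * cexp (-(Real.pi * ‖x‖ ^ 2) / a) = (((a ^ 4)⁻¹ * gR (1 / a) x : ℝ) : ℂ) := by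
    rw [gR]; push_cast; congr 2; ring
  rw [this, ofReal_re]

lemma kf_eq {b C C' : ℝ} (hb : 1 < b) {lamT lamK : ℝ} (hT : Ker (xT b) lamT C) (hK : Ker (xK b) lamK C') (x : V8) :
    kf (xT b) x = gR b x - kF (xK b) lamK x := by
  have hg : Continuous (gR b) := by unfold gR; fun_prop
  have := Continuous.ext_on (dense_compl_singleton (0 : V8)) (kf_cont hT) (hg.sub (kF_cont hK)) (by
    intro x hx
    have hx : x ≠ 0 := hx
    have hp : 0 < ‖x‖ ^ 2 := pow_pos (norm_pos_iff.2 hx) 2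
    show kf (xT b) x = gR b x - kF (xK b) lamK x
    rw [kf, (kf_int hT hp.le).2, main_identity hb hp, kF, if_neg hx, kL, gR]
    have : -(Real.pi * b) * ‖x‖ ^ 2 = -(Real.pi * ‖x‖ ^ 2 * b) := by ring
    rw [this]
    ring)
  exact congrFun this x

lemma cos_zero (F : V8 → ℝ) : ∫ ξ, F ξ * Real.cos (2 * Real.pi * inner ℝ (0 : V8) ξ) = ∫ ξ, F ξ := by simp

theorem bound_big {b : ℝ} (hb : 1 < b) (C : Set V8) (hC_fin : ∀ R : ℝ, 0 < R → (C ∩ Metric.closedBall 0 R).Finite)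
    (hC_dens : Tendsto (fun R => (Nat.card ↥(C ∩ Metric.closedBall 0 R) : ℝ) / volB R) atTop (nhds 1)) :
    ENNReal.ofReal (xQ b - 1) ≤ lowE C (fun r => ENNReal.ofReal (Real.exp (-(Real.pi * b) * r))) := by
  obtain ⟨_, hK⟩ := xK_ker hb
  obtain ⟨_, hT⟩ := xT_ker hb
  have h0 := zero_lt_one.trans hb
  have hi : Integrable (kf (xT b)) := by
    have := (gR_int h0).sub (kF_integrable hK)
    exact this.congr (Eventually.of_forall fun x => (kf_eq hb hT hK x).symm)
  have key := lp_bound hi (kF_integrable hT) (kF_nonneg hT) (fun x => by rw [cos_of (kF_integrable hT), kF_four hT, ofReal_re])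
    (G := fun r => Real.exp (-(Real.pi * b) * r)) (fun r _ => (Real.exp_pos _).le)
    (fun x _ => by rw [kf_eq hb hT hK]; have := kF_nonneg hK x; rw [gR]; linarith) C hC_fin hC_dens
  rw [← cos_zero, four_inv hT hi, kF_zero, kf_eq hb hT hK, kF_zero] at key
  refine le_trans (le_of_eq ?_) key
  congr 1
  simp [gR]; ring

theorem bound_small {b : ℝ} (hb : 1 < b) (C : Set V8) (hC_fin : ∀ R : ℝ, 0 < R → (C ∩ Metric.closedBall 0 R).Finite)
    (hC_dens : Tendsto (fun R => (Nat.card ↥(C ∩ Metric.closedBall 0 R) : ℝ) / volB R) atTop (nhds 1)) :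
    ENNReal.ofReal (xQ (1 / b) - 1) ≤ lowE C (fun r => ENNReal.ofReal (Real.exp (-(Real.pi * (1 / b)) * r))) := by
  obtain ⟨_, hK⟩ := xK_ker hb
  obtain ⟨_, hT⟩ := xT_ker hb
  have h0 := zero_lt_one.trans hb
  have h1 : 0 < 1 / b := by positivity
  have hi : Integrable (kf (xT b)) := by
    have := (gR_int h0).sub (kF_integrable hK)
    exact this.congr (Eventually.of_forall fun x => (kf_eq hb hT hK x).symm)
  have iT := kF_integrable hT
  have iK := kF_integrable hK
  have bc : ∀ (F : V8 → ℝ), Integrable F → ∀ x, Integrable fun ξ => F ξ * Real.cos (2 * Real.pi * inner ℝ x ξ) := by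
    intro F hF x
    refine (chX_int x hF).re.congr (Eventually.of_forall fun ξ => ?_)
    show (chX x ξ * (F ξ : ℂ)).re = _
    rw [re_mul_ofReal, chX_re, mul_comm]
  have key := lp_bound (f := fun x => gR (1 / b) x - b ^ 4 * kF (xT b) _ x) (F := fun ξ => b ^ 4 * kF (xK b) _ ξ)
    ((gR_int h1).sub (iT.const_mul _)) (iK.const_mul _) (fun ξ => mul_nonneg (by positivity) (kF_nonneg hK ξ))
    (fun x => by
      have e : ∀ ξ, b ^ 4 * kF (xK b) ((xQ b + sP b) / 2) ξ * Real.cos (2 * Real.pi * inner ℝ x ξ) =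
          b ^ 4 * (gR b ξ * Real.cos (2 * Real.pi * inner ℝ x ξ) - kf (xT b) ξ * Real.cos (2 * Real.pi * inner ℝ x ξ)) := by
        intro ξ; rw [kf_eq hb hT hK]; ring
      simp only [e]
      rw [integral_const_mul, integral_sub (bc _ (gR_int h0) x) (bc _ hi x), gR_cos h0, four_inv hT hi]
      field_simp)
    (G := fun r => Real.exp (-(Real.pi * (1 / b)) * r)) (fun r _ => (Real.exp_pos _).le)
    (fun x _ => by
      have := mul_nonneg (by positivity : 0 ≤ b ^ 4) (kF_nonneg hT x)
      simp only [gR]; linarith) C hC_fin hC_dens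
  have e1 : ∫ x, gR (1 / b) x = b ^ 4 := by
    have h := gR_cos h1 0
    rw [cos_zero] at h
    rw [h]; simp [gR]
  have e2 : ∫ x, kF (xT b) ((xQ b - sP b) / 2) x = 1 - (xQ b + sP b) / 2 := by
    have h := cos_of iT 0
    rw [cos_zero, kF_four hT, ofReal_re, kf_eq hb hT hK, kF_zero] at h
    rw [h]; simp [gR]
  rw [integral_sub (gR_int h1) (iT.const_mul _), integral_const_mul, e1, e2, kF_zero] at key
  refine le_trans (le_of_eq ?_) key
  congr 1
  rw [xQ_S h0]
  simp [gR]; ring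

theorem final (g : ℝ → ℝ) (hg : CM g) (C : Set V8) (hC_fin : ∀ R : ℝ, 0 < R → (C ∩ Metric.closedBall 0 R).Finite)
    (hC_dens : Tendsto (fun R => (Nat.card ↥(C ∩ Metric.closedBall 0 R) : ℝ) / volB R) atTop (nhds 1)) :
    ∑' x : ↥(E8 \ {0}), ENNReal.ofReal (g (‖(x : V8)‖ ^ 2)) ≤ lowE C (fun r => ENNReal.ofReal (g r)) := by
  refine bernstein_reduction hg (by simp) hC_fin fun c hc hcp => ?_
  have hpi := Real.pi_pos
  obtain ⟨a, rfl⟩ : ∃ a, c = Real.pi * a := ⟨c / Real.pi, by field_simp⟩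
  have ha : 0 < a := by
    by_contra h
    have := mul_nonpos_of_nonneg_of_nonpos hpi.le (not_lt.1 h)
    linarith
  have ha1 : a ≠ 1 := by rintro rfl; exact hcp (mul_one _)
  refine (E8_sum_le ha).trans ?_
  rw [xQ_eq, ofReal_re]
  rcases lt_or_gt_of_ne ha1 with h | h
  · have := bound_small (b := 1 / a) (by rw [lt_div_iff₀ ha]; linarith) C hC_fin hC_dens
    rw [one_div_one_div] at this
    exact this
  · exact bound_big h C hC_fin hC_dens

end UO

/-- Universal optimality of `E₈`: for every completely monotonic `g` on `(0,∞)`, every point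
configuration `C ⊆ ℝ⁸` of density 1 has lower energy, for the potential `r ↦ g(r²)`, at least
the `E₈` lattice sum `Σ_{x ∈ E₈, x ≠ 0} g(|x|²)` (all energies computed in `[0,∞]`). -/
theorem E8_universally_optimal (g : ℝ → ℝ)
    (hg_smooth : ContDiffOn ℝ (⊤ : ℕ∞) g (Set.Ioi 0))
    (hg_cm : ∀ (k : ℕ) (x : ℝ), 0 < x →
      0 ≤ (-1 : ℝ) ^ k * iteratedDerivWithin k g (Set.Ioi 0) x)
    (C : Set (EuclideanSpace ℝ (Fin 8)))
    (hC_fin : ∀ R : ℝ, 0 < R → (C ∩ Metric.closedBall 0 R).Finite)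
    (hC_dens : Tendsto (fun R : ℝ =>
        (Nat.card ↥(C ∩ Metric.closedBall 0 R) : ℝ) /
          (volume (Metric.closedBall (0 : EuclideanSpace ℝ (Fin 8)) R)).toReal)
      atTop (nhds 1)) :
    (∑' x : ↥(E8 \ {0}), ENNReal.ofReal (g (‖(x : EuclideanSpace ℝ (Fin 8))‖ ^ 2)))
      ≤ liminf (fun R : ℝ =>
          (Nat.card ↥(C ∩ Metric.closedBall 0 R) : ℝ≥0∞)⁻¹ *
            ∑' q : ↥(C ∩ Metric.closedBall 0 R) × ↥(C ∩ Metric.closedBall 0 R),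
              if (q.1 : EuclideanSpace ℝ (Fin 8)) ≠ (q.2 : EuclideanSpace ℝ (Fin 8)) then
                ENNReal.ofReal
                  (g (‖(q.1 : EuclideanSpace ℝ (Fin 8)) - (q.2 : EuclideanSpace ℝ (Fin 8))‖ ^ 2))
              else 0)
        atTop := by
  exact UO.final g (UO.CM.of_within hg_smooth hg_cm) C hC_fin hC_dens

end
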